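/- Persistence of spatial analyticity for the Majda–Biello system: Let a₂ be a real number with a₂ < 0, a₂ = 1, or a₂ > 4. Let σ₀ > 0 and s ∈ ℝ, and let (u, v) be a pair of real-valued smooth functions on ℝ × ℝ solving pointwise the Majda–Biello system u_t + u_{xxx} = −v v_x, v_t + a₂ v_{xxx} = −(u v)_x, such that u(t,·), v(t,·) are Schwartz for each t ∈ ℝ and ‖u(0)‖_{G^{σ₀,s}}, ‖v(0)‖_{G^{σ₀,s}} are finite. Then for every ε > 0 there exists a constant c > 0, depending on ε, σ₀ and the norms ‖u(0)‖_{G^{σ₀,s}}, ‖v(0)‖_{G^{σ₀,s}}, such that for every t ∈ ℝ the norms ‖u(t)‖_{G^{σ(t),s}} and ‖v(t)‖_{G^{σ(t),s}} are finite, where σ(t) = c (1+|t|)^{−4/3−ε}. -/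

import Mathlib

open MeasureTheory Set Filter
open scoped ENNReal

/-- One-dimensional (spatial) Fourier transform `f̂(ξ) = ∫ e^{-i x ξ} f(x) dx`. -/
noncomputable def FT1 (g : ℝ → ℂ) (ξ : ℝ) : ℂ :=
  ∫ x : ℝ, Complex.exp (-Complex.I * (x * ξ)) * g x

/-- Gevrey norm `‖g‖_{G^{σ,s}}`, valued in `ℝ≥0∞` (so that infinite norms are
meaningful). -/
noncomputable def gevreyNorm (σ s : ℝ) (g : ℝ → ℂ) : ℝ≥0∞ :=
  (∫⁻ ξ : ℝ, ENNReal.ofReal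
      (Real.exp (2 * σ * |ξ|) * (1 + |ξ|) ^ (2 * s) * ‖FT1 g ξ‖ ^ 2)) ^ (1/2 : ℝ)



namespace MB

/-- Japanese bracket weight. -/
noncomputable def J (r x : ℝ) : ℝ≥0∞ := ENNReal.ofReal ((1 + |x|) ^ (-r))

noncomputable def n2 {X : Type*} [MeasureSpace X] (f : X → ℝ≥0∞) : ℝ≥0∞ :=
  (∫⁻ x, f x ^ 2) ^ (1/2 : ℝ)

lemma n2_sq {X : Type*} [MeasureSpace X] (f : X → ℝ≥0∞) : n2 f ^ 2 = ∫⁻ x, f x ^ 2 := by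
  unfold n2
  rw [← ENNReal.rpow_natCast, ← ENNReal.rpow_mul]; norm_num

lemma cs {X : Type*} [MeasureSpace X] {f g : X → ℝ≥0∞} (hf : Measurable f) (hg : Measurable g) :
    ∫⁻ x, f x * g x ≤ n2 f * n2 g := by
  have h := ENNReal.lintegral_mul_le_Lp_mul_Lq (μ := (volume : Measure X))
    (p := 2) (q := 2) (by constructor <;> norm_num) hf.aemeasurable hg.aemeasurable
  simpa [n2] using h

lemma J_pos (r x : ℝ) : 0 < (1 + |x|) ^ (-r) := by positivity

lemma J_neg (r x : ℝ) : J r (-x) = J r x := by simp [J]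

@[fun_prop] lemma J_meas (r : ℝ) : Measurable (J r) := by
  unfold J; fun_prop

lemma J_mul (r s x : ℝ) : J r x * J s x = J (r + s) x := by
  unfold J
  rw [← ENNReal.ofReal_mul (J_pos r x).le, ← Real.rpow_add (by positivity)]
  congr 2; ring

lemma J_sq (r x : ℝ) : J r x ^ 2 = J (2 * r) x := by
  rw [sq, J_mul]; congr 1; ring

lemma J_fin {r : ℝ} (hr : 1 < r) : ∫⁻ x, J r x < ∞ := by
  have := finite_integral_one_add_norm (E := ℝ) (μ := volume) (r := r) (by simpa using hr)
  simpa [J] using this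

/-- the constant -/
noncomputable def cJ (r : ℝ) : ℝ≥0∞ := ∫⁻ x, J r x

lemma J_add_left (r y : ℝ) : ∫⁻ x, J r (y + x) = cJ r := lintegral_add_left_eq_self (J r) y
lemma J_add_right (r y : ℝ) : ∫⁻ x, J r (x + y) = cJ r := lintegral_add_right_eq_self (J r) y

lemma n2_add_left {A : ℝ → ℝ≥0∞} (y : ℝ) : n2 (fun x => A (y + x)) = n2 A := by
  unfold n2; rw [lintegral_add_left_eq_self (fun x => A x ^ 2) y]
lemma n2_add_right {A : ℝ → ℝ≥0∞} (y : ℝ) : n2 (fun x => A (x + y)) = n2 A := by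
  unfold n2; rw [lintegral_add_right_eq_self (fun x => A x ^ 2) y]
lemma n2_sub_left {A : ℝ → ℝ≥0∞} (y : ℝ) : n2 (fun x => A (y - x)) = n2 A := by
  unfold n2; rw [lintegral_sub_left_eq_self (fun x => A x ^ 2) y]

lemma AJ {A : ℝ → ℝ≥0∞} (hA : Measurable A) (r : ℝ) :
    ∫⁻ x, A x * J r x ≤ cJ (2 * r) ^ (1/2 : ℝ) * n2 A := by
  refine (cs hA (J_meas r)).trans ?_
  rw [mul_comm]
  gcongr
  unfold n2 cJ
  simp only [J_sq]
  exact le_rfl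

lemma E3 {A : ℝ → ℝ≥0∞} (hA : Measurable A) :
    ∫⁻ x, ∫⁻ y, A x * J 1 x * (A y * A (x + y)) ≤ cJ 2 ^ (1/2 : ℝ) * n2 A ^ 3 := by
  calc ∫⁻ x, ∫⁻ y, A x * J 1 x * (A y * A (x + y))
      ≤ ∫⁻ x, A x * J 1 x * n2 A ^ 2 := by
        refine lintegral_mono fun x => ?_
        rw [lintegral_const_mul _ (by fun_prop)]
        gcongr
        refine (cs hA (by fun_prop)).trans ?_
        rw [n2_add_left, sq]
    _ ≤ _ := by
        rw [lintegral_mul_const _ (by fun_prop)]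
        have := AJ hA 1
        calc _ ≤ cJ (2 * 1) ^ (1/2 : ℝ) * n2 A * n2 A ^ 2 := by gcongr
          _ = _ := by rw [mul_one]; ring

/-- triple integrals -/
lemma swap12 {f : ℝ → ℝ → ℝ → ℝ≥0∞} (hf : Measurable fun q : ℝ × ℝ × ℝ => f q.1 q.2.1 q.2.2) :
    ∫⁻ x, ∫⁻ y, ∫⁻ z, f x y z = ∫⁻ y, ∫⁻ x, ∫⁻ z, f x y z := by
  refine lintegral_lintegral_swap (Measurable.aemeasurable ?_)
  have : Measurable fun q : (ℝ × ℝ) × ℝ => f q.1.1 q.1.2 q.2 :=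
    hf.comp (by fun_prop : Measurable fun q : (ℝ × ℝ) × ℝ => (q.1.1, q.1.2, q.2))
  exact this.lintegral_prod_right'

lemma swap23 {f : ℝ → ℝ → ℝ → ℝ≥0∞} (hf : Measurable fun q : ℝ × ℝ × ℝ => f q.1 q.2.1 q.2.2) :
    ∫⁻ x, ∫⁻ y, ∫⁻ z, f x y z = ∫⁻ x, ∫⁻ z, ∫⁻ y, f x y z := by
  refine lintegral_congr fun x => ?_
  refine lintegral_lintegral_swap (Measurable.aemeasurable ?_)
  exact hf.comp (by fun_prop : Measurable fun q : ℝ × ℝ => (x, q.1, q.2))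

lemma E4 {A : ℝ → ℝ≥0∞} (hA : Measurable A) :
    ∫⁻ x, ∫⁻ y, ∫⁻ z, A x * A y * A z * A (x + y + z) * J 2 (x + z) ≤ cJ 2 * n2 A ^ 4 := by
  have h1 : ∫⁻ x, ∫⁻ y, ∫⁻ z, A x * A y * A z * A (x + y + z) * J 2 (x + z)
      = ∫⁻ x, ∫⁻ y, ∫⁻ z, A x * A y * A (z - x) * A (y + z) * J 2 z := by
    refine lintegral_congr fun x => lintegral_congr fun y => ?_
    rw [← lintegral_sub_right_eq_self _ x]
    refine lintegral_congr fun z => ?_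
    rw [show x + y + (z - x) = y + z by ring, show x + (z - x) = z by ring]
  rw [h1, swap23 (by fun_prop), swap12 (by fun_prop)]
  calc ∫⁻ z, ∫⁻ x, ∫⁻ y, A x * A y * A (z - x) * A (y + z) * J 2 z
      = ∫⁻ z, ∫⁻ x, (A x * A (z - x)) * (J 2 z * ∫⁻ y, A y * A (y + z)) := by
        refine lintegral_congr fun z => lintegral_congr fun x => ?_
        rw [← mul_assoc, ← lintegral_const_mul _ (by fun_prop)]
        refine lintegral_congr fun y => ?_
        ring
    _ ≤ ∫⁻ z, ∫⁻ x, (A x * A (z - x)) * (J 2 z * (n2 A * n2 A)) := by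
        gcongr with z x
        refine (cs hA (by fun_prop)).trans ?_
        rw [n2_add_right]
    _ = ∫⁻ z, (∫⁻ x, (A x * A (z - x))) * (J 2 z * (n2 A * n2 A)) := by
        refine lintegral_congr fun z => ?_
        rw [lintegral_mul_const _ (by fun_prop)]
    _ ≤ ∫⁻ z, (n2 A * n2 A) * (J 2 z * (n2 A * n2 A)) := by
        gcongr with z
        refine (cs hA (by fun_prop)).trans ?_
        rw [n2_sub_left]
    _ = _ := by
        rw [lintegral_const_mul _ (by fun_prop), lintegral_mul_const _ (by fun_prop)]
        change _ * (cJ 2 * _) = _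
        ring

lemma E4' {A : ℝ → ℝ≥0∞} (hA : Measurable A) :
    ∫⁻ x, ∫⁻ y, ∫⁻ z, A x * A y * A z * A (x + y + z) * J 2 (y + z) ≤ cJ 2 * n2 A ^ 4 := by
  rw [swap12 (by fun_prop)]
  refine le_trans (le_of_eq ?_) (E4 hA)
  refine lintegral_congr fun x => lintegral_congr fun y => lintegral_congr fun z => ?_
  rw [mul_comm (A y), add_comm y x]

lemma JJ (d e : ℝ) : ∫⁻ c, J (3/4) (c + d) * J (3/4) (c + e) ≤ cJ (3/2) := by
  refine (cs (by fun_prop) (by fun_prop)).trans ?_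
  rw [n2_add_right, n2_add_right, ← sq, n2_sq]
  simp only [J_sq]
  norm_num [cJ]

noncomputable def c5 : ℝ≥0∞ := cJ (3/2) ^ (1/2 : ℝ) * cJ (5/4)

/-- path estimate, centre first. -/
lemma P5 {A : ℝ → ℝ≥0∞} (hA : Measurable A) :
    ∫⁻ c, ∫⁻ d, ∫⁻ e, A c * A d * A e * (J 1 (c + d) * J 1 (c + e)) ≤ c5 * n2 A ^ 3 := by
  let P : ℝ × ℝ × ℝ → ℝ≥0∞ := fun q =>
    A q.2.1 * A q.2.2 * (J (3/8) (q.1 + q.2.1) * J (3/8) (q.1 + q.2.2))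
  let Q : ℝ × ℝ × ℝ → ℝ≥0∞ := fun q =>
    A q.1 * (J (5/8) (q.1 + q.2.1) * J (5/8) (q.1 + q.2.2))
  have hP : Measurable P := by fun_prop
  have hQ : Measurable Q := by fun_prop
  have h1 : ∫⁻ c, ∫⁻ d, ∫⁻ e, A c * A d * A e * (J 1 (c + d) * J 1 (c + e))
      = ∫⁻ q, P q * Q q := by
    rw [Measure.volume_eq_prod, lintegral_prod _ (by fun_prop)]
    refine lintegral_congr fun c => ?_
    rw [Measure.volume_eq_prod, lintegral_prod _ (by fun_prop)]
    refine lintegral_congr fun d => lintegral_congr fun e => ?_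
    simp only [P, Q]
    have e1 : ∀ x, J 1 x = J (3/8) x * J (5/8) x := fun x => by rw [J_mul]; norm_num
    rw [e1, e1]; ring
  rw [h1]
  refine (cs hP hQ).trans ?_
  have hP2 : ∫⁻ q, P q ^ 2 ≤ cJ (3/2) * n2 A ^ 4 := by
    rw [Measure.volume_eq_prod, lintegral_prod _ (by fun_prop)]
    have : ∀ c, ∫⁻ de : ℝ × ℝ, P (c, de) ^ 2 = ∫⁻ d, ∫⁻ e,
        A d ^ 2 * A e ^ 2 * (J (3/4) (c + d) * J (3/4) (c + e)) := by
      intro c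
      rw [Measure.volume_eq_prod, lintegral_prod _ (by fun_prop)]
      refine lintegral_congr fun d => lintegral_congr fun e => ?_
      simp only [P, mul_pow, J_sq]; norm_num
    simp only [this]
    rw [swap12 (by fun_prop), swap23 (by fun_prop)]
    calc ∫⁻ d, ∫⁻ e, ∫⁻ c, A d ^ 2 * A e ^ 2 * (J (3/4) (c + d) * J (3/4) (c + e))
        ≤ ∫⁻ d, ∫⁻ e, A d ^ 2 * (A e ^ 2 * cJ (3/2)) := by
          gcongr with d e
          rw [lintegral_const_mul _ (by fun_prop), mul_assoc]
          gcongr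
          exact JJ d e
      _ = _ := by
          simp_rw [lintegral_const_mul _ (show Measurable fun e => A e ^ 2 * cJ (3/2) by fun_prop)]
          rw [lintegral_mul_const _ (by fun_prop), lintegral_mul_const _ (by fun_prop), ← n2_sq]
          ring
  have hQ2 : ∫⁻ q, Q q ^ 2 ≤ cJ (5/4) ^ 2 * n2 A ^ 2 := by
    rw [Measure.volume_eq_prod, lintegral_prod _ (by fun_prop)]
    have : ∀ c, ∫⁻ de : ℝ × ℝ, Q (c, de) ^ 2 = A c ^ 2 * cJ (5/4) ^ 2 := by
      intro c
      rw [Measure.volume_eq_prod, lintegral_prod _ (by fun_prop)]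
      simp only [Q, mul_pow, J_sq]
      norm_num
      simp_rw [← mul_assoc]
      simp_rw [lintegral_const_mul _ (show Measurable fun e => J (5/4) (c + e) by fun_prop), J_add_left]
      rw [lintegral_mul_const _ (by fun_prop), lintegral_const_mul _ (by fun_prop), J_add_left]
      ring
    simp only [this]
    rw [lintegral_mul_const _ (by fun_prop), ← n2_sq, mul_comm]
  have hP3 : n2 P ≤ cJ (3/2) ^ (1/2 : ℝ) * n2 A ^ 2 := by
    have := ENNReal.rpow_le_rpow hP2 (show (0:ℝ) ≤ 1/2 by norm_num)
    rw [ENNReal.mul_rpow_of_nonneg _ _ (by norm_num), show n2 A ^ 4 = (n2 A ^ 2) ^ (2:ℝ) by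
      rw [ENNReal.rpow_two]; ring, ← ENNReal.rpow_mul] at this
    simpa [n2] using this
  have hQ3 : n2 Q ≤ cJ (5/4) * n2 A := by
    have := ENNReal.rpow_le_rpow hQ2 (show (0:ℝ) ≤ 1/2 by norm_num)
    rw [← mul_pow, ← ENNReal.rpow_two, ← ENNReal.rpow_mul] at this
    simpa [n2] using this
  calc n2 P * n2 Q ≤ (cJ (3/2) ^ (1/2 : ℝ) * n2 A ^ 2) * (cJ (5/4) * n2 A) := by gcongr
    _ = _ := by unfold c5; ring


lemma P5_4 {A : ℝ → ℝ≥0∞} (hA : Measurable A) : ∫⁻ x, ∫⁻ y, ∫⁻ z, A x * A y * A z * (J 1 (x + z) * J 1 (y + z)) ≤ c5 * n2 A ^ 3 := by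
  rw [swap23 (by fun_prop), swap12 (by fun_prop)]
  refine le_trans (le_of_eq ?_) (P5 hA)
  refine lintegral_congr fun x => lintegral_congr fun y => lintegral_congr fun z => ?_
  rw [add_comm y x, add_comm z x]; ring


lemma P5_3 {A : ℝ → ℝ≥0∞} (hA : Measurable A) (hev : ∀ x, A (-x) = A x) : ∫⁻ x, ∫⁻ y, ∫⁻ z, A x * A y * A (x + y + z) * (J 1 (x + z) * J 1 (y + z))
    ≤ c5 * n2 A ^ 3 := by
  refine le_trans (le_of_eq ?_) (P5_4 hA)
  refine lintegral_congr fun x => lintegral_congr fun y => ?_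
  rw [← lintegral_sub_left_eq_self _ (-(x + y))]
  refine lintegral_congr fun z => ?_
  rw [show x + y + (-(x + y) - z) = -z by ring, show x + (-(x+y) - z) = -(y + z) by ring,
    show y + (-(x+y) - z) = -(x + z) by ring, hev, J_neg, J_neg]
  ring

lemma P5_1 {A : ℝ → ℝ≥0∞} (hA : Measurable A) (hev : ∀ x, A (-x) = A x) : ∫⁻ x, ∫⁻ y, ∫⁻ z, A y * A z * A (x + y + z) * (J 1 (x + z) * J 1 (y + z))
    ≤ c5 * n2 A ^ 3 := by
  refine le_trans (le_of_eq ?_) (P5 hA)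
  rw [swap12 (by fun_prop), swap23 (by fun_prop)]
  refine lintegral_congr fun y => lintegral_congr fun z => ?_
  rw [← lintegral_sub_left_eq_self _ (-(y + z))]
  refine lintegral_congr fun x => ?_
  rw [show (-(y + z) - x) + y + z = -x by ring, show (-(y+z) - x) + z = -(y + x) by ring,
    hev, J_neg]
  ring

lemma P5_2 {A : ℝ → ℝ≥0∞} (hA : Measurable A) (hev : ∀ x, A (-x) = A x) : ∫⁻ x, ∫⁻ y, ∫⁻ z, A x * A z * A (x + y + z) * (J 1 (x + z) * J 1 (y + z))
    ≤ c5 * n2 A ^ 3 := by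
  rw [swap12 (by fun_prop)]
  refine le_trans (le_of_eq ?_) (P5_1 hA hev)
  refine lintegral_congr fun x => lintegral_congr fun y => lintegral_congr fun z => ?_
  rw [add_comm y x]; ring

noncomputable def c6 : ℝ≥0∞ := (cJ (4/3) ^ (1/2 : ℝ)) ^ 3

lemma Q5_4 {A : ℝ → ℝ≥0∞} (hA : Measurable A) :
    ∫⁻ x, ∫⁻ y, ∫⁻ z, A x * J (2/3) x * (A y * J (2/3) y) * (A z * J (2/3) z)
      ≤ c6 * n2 A ^ 3 := by
  have hm : Measurable fun z => A z * J (2/3) z := by fun_prop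
  have e : ∫⁻ x, ∫⁻ y, ∫⁻ z, A x * J (2/3) x * (A y * J (2/3) y) * (A z * J (2/3) z)
      = (∫⁻ x, A x * J (2/3) x) * (∫⁻ x, A x * J (2/3) x) * (∫⁻ x, A x * J (2/3) x) := by
    rw [← lintegral_mul_const _ hm, ← lintegral_mul_const _ (hm.mul_const _)]
    refine lintegral_congr fun x => ?_
    rw [← lintegral_const_mul _ hm]
    refine lintegral_congr fun y => ?_
    rw [lintegral_const_mul _ hm]
    ring
  rw [e]
  have := AJ hA (2/3)
  rw [show (2 * (2/3) : ℝ) = 4/3 by norm_num] at this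
  calc _ ≤ (cJ (4/3) ^ (1/2 : ℝ) * n2 A) * (cJ (4/3) ^ (1/2 : ℝ) * n2 A) *
        (cJ (4/3) ^ (1/2 : ℝ) * n2 A) := by gcongr
    _ = _ := by unfold c6; ring

lemma Q5_3 {A : ℝ → ℝ≥0∞} (hA : Measurable A) :
    ∫⁻ x, ∫⁻ y, ∫⁻ z, A x * J (2/3) x * (A y * J (2/3) y) * (A (x + y + z) * J (2/3) (x + y + z))
      ≤ c6 * n2 A ^ 3 := by
  refine le_trans (le_of_eq ?_) (Q5_4 hA)
  refine lintegral_congr fun x => lintegral_congr fun y => ?_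
  rw [← lintegral_add_left_eq_self (fun z => A x * J (2/3) x * (A y * J (2/3) y) * (A z * J (2/3) z)) (x + y)]

lemma cJ_ne {r : ℝ} (hr : 1 < r) : cJ r ≠ ∞ := (J_fin hr).ne
lemma c5_ne : c5 ≠ ∞ :=
  ENNReal.mul_ne_top (ENNReal.rpow_ne_top_of_nonneg (by norm_num) (cJ_ne (by norm_num)))
    (cJ_ne (by norm_num))
lemma c6_ne : c6 ≠ ∞ :=
  ENNReal.pow_ne_top (ENNReal.rpow_ne_top_of_nonneg (by norm_num) (cJ_ne (by norm_num)))
end MB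


namespace MB

/-- admissible weights. -/
structure Wt (κ : ℝ) (w : ℝ → ℝ) : Prop where
  k0 : 0 ≤ κ
  meas : Measurable w
  one : ∀ x, 1 ≤ w x
  bdd : ∃ B, ∀ x, w x ≤ B
  mono : ∀ x y, |x| ≤ |y| → w x ≤ w y
  sub : ∀ x y, w (x + y) ≤ w x * w y
  lip : ∀ x y, |x| ≤ |y| → w y - w x ≤ κ * (|y| - |x|) * w y

namespace Wt
variable {κ : ℝ} {w : ℝ → ℝ}

lemma even (h : Wt κ w) (x : ℝ) : w (-x) = w x :=
  le_antisymm (h.mono _ _ (by simp)) (h.mono _ _ (by simp))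

lemma pos (h : Wt κ w) (x : ℝ) : 0 < w x := lt_of_lt_of_le one_pos (h.one x)

lemma mul {κ₁ κ₂ : ℝ} {w₁ w₂ : ℝ → ℝ} (h₁ : Wt κ₁ w₁) (h₂ : Wt κ₂ w₂) :
    Wt (κ₁ + κ₂) (fun x => w₁ x * w₂ x) where
  k0 := add_nonneg h₁.k0 h₂.k0
  meas := h₁.meas.mul h₂.meas
  one x := by nlinarith [h₁.one x, h₂.one x]
  bdd := by
    obtain ⟨B, hB⟩ := h₁.bdd
    obtain ⟨D, hD⟩ := h₂.bdd
    exact ⟨B * D, fun x => mul_le_mul (hB x) (hD x) (h₂.pos x).le ((h₁.pos x).le.trans (hB x))⟩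
  mono x y h := mul_le_mul (h₁.mono _ _ h) (h₂.mono _ _ h) (h₂.pos x).le (h₁.pos y).le
  sub x y := by
    calc _ ≤ (w₁ x * w₁ y) * (w₂ x * w₂ y) :=
          mul_le_mul (h₁.sub _ _) (h₂.sub _ _) (h₂.pos _).le (mul_pos (h₁.pos _) (h₁.pos _)).le
      _ = _ := by ring
  lip x y h := by
    have a := h₁.lip x y h
    have b := h₂.lip x y h
    have := h₁.mono x y h
    have := h₂.mono x y h
    have := h₁.pos x
    have := h₂.pos y
    have e : w₁ y * w₂ y - w₁ x * w₂ x = (w₁ y - w₁ x) * w₂ y + w₁ x * (w₂ y - w₂ x) := by ring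
    rw [e]
    have c1 : (w₁ y - w₁ x) * w₂ y ≤ (κ₁ * (|y| - |x|) * w₁ y) * w₂ y := by gcongr
    have c2 : w₁ x * (w₂ y - w₂ x) ≤ w₁ y * (κ₂ * (|y| - |x|) * w₂ y) := by
      apply mul_le_mul <;> linarith
    linarith

lemma lip2 (h : Wt κ w) {x y : ℝ} (hx : |x| ≤ |y|) :
    w y ^ 2 - w x ^ 2 ≤ 2 * κ * (|y| - |x|) * w y ^ 2 := by
  have a := h.lip x y hx
  have b := h.mono x y hx
  have := h.pos x
  have e : w y ^ 2 - w x ^ 2 = (w y - w x) * (w y + w x) := by ring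
  rw [e]
  calc _ ≤ (κ * (|y| - |x|) * w y) * (w y + w y) := by
        apply mul_le_mul a (by linarith) (by linarith) (by linarith)
    _ = _ := by ring
end Wt

lemma wt_const : Wt 0 (fun _ => 1) where
  k0 := le_rfl
  meas := measurable_const
  one _ := le_rfl
  bdd := ⟨1, fun _ => le_rfl⟩
  mono _ _ _ := le_rfl
  sub _ _ := by norm_num
  lip _ _ _ := by norm_num

lemma min_sub {R a b : ℝ} (hab : a ≤ b) : min b R - min a R ≤ b - a := by
  rcases le_total b R with h | h
  · rw [min_eq_left h, min_eq_left (hab.trans h)]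
  · rw [min_eq_right h]
    rcases le_total a R with h' | h'
    · rw [min_eq_left h']; linarith
    · rw [min_eq_right h']; linarith

lemma min_add_le {R a b : ℝ} (hR : 0 ≤ R) (ha : 0 ≤ a) (hb : 0 ≤ b) :
    min (a + b) R ≤ min a R + min b R := by
  rcases le_total a R with h | h
  · rcases le_total b R with h' | h'
    · rw [min_eq_left h, min_eq_left h']; exact min_le_left _ _
    · rw [min_eq_right h']; exact (min_le_right _ _).trans (by linarith [le_min ha hR])
  · rw [min_eq_right h]; exact (min_le_right _ _).trans (by linarith [le_min hb hR])

lemma wt_exp {κ R : ℝ} (hk : 0 ≤ κ) (hR : 0 ≤ R) : Wt κ (fun x => Real.exp (κ * min |x| R)) where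
  k0 := hk
  meas := by fun_prop
  one x := Real.one_le_exp (mul_nonneg hk (le_min (abs_nonneg _) hR))
  bdd := ⟨Real.exp (κ * R), fun x => by
    apply Real.exp_le_exp.2; gcongr; exact min_le_right _ _⟩
  mono x y h := by apply Real.exp_le_exp.2; gcongr
  sub x y := by
    rw [← Real.exp_add, ← mul_add]
    apply Real.exp_le_exp.2; gcongr
    exact (min_le_min_right _ (abs_add_le x y)).trans (min_add_le hR (abs_nonneg _) (abs_nonneg _))
  lip x y h := by
    have e := Real.add_one_le_exp (κ * min |x| R - κ * min |y| R)
    have e2 : Real.exp (κ * min |x| R) =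
      Real.exp (κ * min |x| R - κ * min |y| R) * Real.exp (κ * min |y| R) := by
      rw [← Real.exp_add]; congr 1; ring
    have := min_sub (R := R) h
    have p := Real.exp_pos (κ * min |y| R)
    have : κ * (min |y| R - min |x| R) ≤ κ * (|y| - |x|) := by gcongr
    rw [e2]
    nlinarith

lemma wt_lin {κ R : ℝ} (hk : 0 ≤ κ) (hR : 0 ≤ R) : Wt κ (fun x => 1 + κ * min |x| R) where
  k0 := hk
  meas := by fun_prop
  one x := by have := mul_nonneg hk (le_min (abs_nonneg x) hR); linarith
  bdd := ⟨1 + κ * R, fun x => by gcongr; exact min_le_right _ _⟩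
  mono x y h := by gcongr
  sub x y := by
    have h1 : κ * min |x + y| R ≤ κ * (min |x| R + min |y| R) := by
      gcongr
      exact (min_le_min_right _ (abs_add_le x y)).trans (min_add_le hR (abs_nonneg _) (abs_nonneg _))
    have := mul_nonneg (mul_nonneg hk (le_min (abs_nonneg x) hR)) (mul_nonneg hk (le_min (abs_nonneg y) hR))
    nlinarith
  lip x y h := by
    have := min_sub (R := R) h
    have h1 : κ * (min |y| R - min |x| R) ≤ κ * (|y| - |x|) := by gcongr
    have h2 := mul_nonneg hk (le_min (abs_nonneg y) hR)
    have h3 : 0 ≤ κ * (|y| - |x|) := mul_nonneg hk (by linarith)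
    nlinarith

lemma wt_pow {κ : ℝ} {w : ℝ → ℝ} (h : Wt κ w) (n : ℕ) : Wt (n * κ) (fun x => w x ^ n) := by
  induction n with
  | zero => simpa using wt_const
  | succ n ih =>
    have := ih.mul h
    simpa [pow_succ, add_mul] using this

lemma tri_ind {P : ℝ → ℝ → Prop} (h0 : ∀ a b, 0 ≤ a → 0 ≤ b → P a b)
    (hneg : ∀ x y, P x y → P (-x) (-y)) (hswap : ∀ x y, P x y → P y x)
    (hrot : ∀ x y, P x y → P (x + y) (-y)) : ∀ x y, P x y := by
  have h1 : ∀ x y, 0 ≤ x → y ≤ 0 → 0 ≤ x + y → P x y := by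
    intro x y hx hy hxy
    have := hrot (x + y) (-y) (h0 _ _ hxy (by linarith))
    simpa using this
  have h2 : ∀ x y, 0 ≤ x → y ≤ 0 → P x y := by
    intro x y hx hy
    rcases le_total 0 (x + y) with h | h
    · exact h1 x y hx hy h
    · have := hneg _ _ (hswap _ _ (h1 (-y) (-x) (by linarith) (by linarith) (by linarith)))
      simpa using this
  intro x y
  rcases le_total 0 x with hx | hx <;> rcases le_total 0 y with hy | hy
  · exact h0 x y hx hy
  · exact h2 x y hx hy
  · exact hswap _ _ (h2 y x hy hx)
  · have := hneg _ _ (h0 (-x) (-y) (by linarith) (by linarith))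
    simpa using this

/-- the trilinear symbol. -/
def ms (θ : ℝ → ℝ) (x y : ℝ) : ℝ := x * θ x + y * θ y - (x + y) * θ (x + y)

/-- max of three frequencies. -/
def mm (x y : ℝ) : ℝ := max (max |x| |y|) |x + y|

lemma mm_x (x y : ℝ) : |x| ≤ mm x y := (le_max_left _ _).trans (le_max_left _ _)
lemma mm_y (x y : ℝ) : |y| ≤ mm x y := (le_max_right _ _).trans (le_max_left _ _)
lemma mm_xy (x y : ℝ) : |x + y| ≤ mm x y := le_max_right _ _
lemma mm_nonneg (x y : ℝ) : 0 ≤ mm x y := (abs_nonneg x).trans (mm_x x y)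
lemma mm_swap (x y : ℝ) : mm x y = mm y x := by
  unfold mm; rw [max_comm |x|, add_comm x]
lemma mm_neg (x y : ℝ) : mm (-x) (-y) = mm x y := by
  unfold mm; rw [abs_neg, abs_neg, show -x + -y = -(x + y) by ring, abs_neg]
lemma mm_rot (x y : ℝ) : mm (x + y) (-y) = mm x y := by
  unfold mm
  rw [show x + y + -y = x by ring, abs_neg, max_assoc, max_comm, max_comm |y|]
lemma mm_pos {a b : ℝ} (ha : 0 ≤ a) (hb : 0 ≤ b) : mm a b = a + b := by
  unfold mm
  rw [abs_of_nonneg ha, abs_of_nonneg hb, abs_of_nonneg (add_nonneg ha hb)]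
  apply max_eq_right; apply max_le <;> linarith
@[fun_prop] lemma mm_meas : Measurable fun q : ℝ × ℝ => mm q.1 q.2 := by unfold mm; fun_prop

lemma ms_neg {θ : ℝ → ℝ} (h : ∀ x, θ (-x) = θ x) (x y : ℝ) : ms θ (-x) (-y) = - ms θ x y := by
  unfold ms; rw [show -x + -y = -(x + y) by ring, h, h, h]; ring
lemma ms_swap (θ : ℝ → ℝ) (x y : ℝ) : ms θ x y = ms θ y x := by
  unfold ms; rw [add_comm x y]; ring
lemma ms_rot {θ : ℝ → ℝ} (h : ∀ x, θ (-x) = θ x) (x y : ℝ) : ms θ (x + y) (-y) = - ms θ x y := by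
  unfold ms; rw [show x + y + -y = x by ring, h]; ring

lemma ms_bound {κ : ℝ} {w : ℝ → ℝ} (h : Wt κ w) (x y : ℝ) :
    |ms (fun z => w z ^ 2) x y| * mm x y ≤ 4 * κ * |x * y * (x + y)| * (w x * w y * w (x + y)) := by
  have hev : ∀ x, (fun z => w z ^ 2) (-x) = (fun z => w z ^ 2) x := fun x => by simp [h.even]
  revert x y
  refine tri_ind ?_ ?_ ?_ ?_
  · intro a b ha hb
    rw [mm_pos ha hb]
    have A := h.lip2 (x := a) (y := a + b) (by rw [abs_of_nonneg ha, abs_of_nonneg (add_nonneg ha hb)]; linarith)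
    have B := h.lip2 (x := b) (y := a + b) (by rw [abs_of_nonneg hb, abs_of_nonneg (add_nonneg ha hb)]; linarith)
    have A' := h.mono a (a + b) (by rw [abs_of_nonneg ha, abs_of_nonneg (add_nonneg ha hb)]; linarith)
    have B' := h.mono b (a + b) (by rw [abs_of_nonneg hb, abs_of_nonneg (add_nonneg ha hb)]; linarith)
    rw [abs_of_nonneg ha, abs_of_nonneg (add_nonneg ha hb)] at A
    rw [abs_of_nonneg hb, abs_of_nonneg (add_nonneg ha hb)] at B
    have pa := h.pos a
    have pb := h.pos b
    have hm : ms (fun z => w z ^ 2) a b = -(a * (w (a+b) ^ 2 - w a ^ 2) + b * (w (a+b) ^ 2 - w b ^ 2)) := by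
      simp only [ms]; ring
    have n1 : 0 ≤ w (a+b) ^ 2 - w a ^ 2 := by nlinarith
    have n2 : 0 ≤ w (a+b) ^ 2 - w b ^ 2 := by nlinarith
    rw [hm, abs_neg, abs_of_nonneg (by positivity), abs_of_nonneg (by positivity)]
    have hc : w (a+b) ^ 2 ≤ w a * w b * w (a + b) := by
      have := h.sub a b; have := h.pos (a + b); nlinarith
    have : a * (w (a+b) ^ 2 - w a ^ 2) + b * (w (a+b) ^ 2 - w b ^ 2) ≤ 4 * κ * (a * b) * w (a+b) ^ 2 := by
      have := mul_le_mul_of_nonneg_left A ha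
      have := mul_le_mul_of_nonneg_left B hb
      linarith
    calc _ ≤ 4 * κ * (a * b) * (w a * w b * w (a + b)) * (a + b) := by
          have := h.k0
          gcongr
          exact (by assumption : _ ≤ 4 * κ * (a * b) * w (a+b) ^ 2).trans (by gcongr)
      _ = _ := by ring
  · intro x y hxy
    rw [ms_neg hev, mm_neg, abs_neg, show -x * -y * (-x + -y) = -(x*y*(x+y)) by ring, abs_neg,
      show -x + -y = -(x + y) by ring, h.even, h.even, h.even]
    exact hxy
  · intro x y hxy
    rw [ms_swap, mm_swap, add_comm y x, mul_comm y x, mul_comm (w y)]; exact hxy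
  · intro x y hxy
    rw [ms_rot hev, mm_rot, abs_neg, show (x + y) * -y * (x + y + -y) = -(x*y*(x+y)) by ring, abs_neg,
      show x + y + -y = x by ring, h.even]
    calc _ ≤ _ := hxy
      _ = _ := by ring

/-- three-wave resonance function. -/
def H3 (a x y : ℝ) : ℝ := a * x ^ 3 + a * y ^ 3 - (x + y) ^ 3

lemma H3_bound {a : ℝ} (ha : a < 0 ∨ a = 1 ∨ 4 < a) :
    ∃ c > 0, ∀ x y, c * |x * y * (x + y)| ≤ |H3 a x y| := by
  have key : ∀ c, (∀ x y, c * |x * y| ≤ |(a - 1) * (x^2 + y^2) - (a + 2) * (x * y)|) →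
      ∀ x y, c * |x * y * (x + y)| ≤ |H3 a x y| := by
    intro c hc x y
    have : H3 a x y = ((a - 1) * (x^2 + y^2) - (a + 2) * (x * y)) * (x + y) := by unfold H3; ring
    rw [this, abs_mul (x * y), abs_mul _ (x + y), ← mul_assoc]
    gcongr
    exact hc x y
  have xy : ∀ x y : ℝ, 2 * |x * y| ≤ x^2 + y^2 := by
    intro x y
    rw [abs_mul]
    nlinarith [sq_nonneg (|x| - |y|), sq_abs x, sq_abs y]
  rcases ha with ha | ha | ha
  · refine ⟨min (-3 * a) (4 - a), by apply lt_min <;> linarith, key _ fun x y => ?_⟩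
    rw [le_abs]; right
    have := xy x y
    have h1 := mul_le_mul_of_nonneg_left this (show 0 ≤ 1 - a by linarith)
    have h2 : min (-3 * a) (4 - a) * |x*y| ≤ (2 * (1 - a) - |a + 2|) * |x * y| := by
      gcongr
      rcases le_total 0 (a + 2) with h | h
      · rw [abs_of_nonneg h]; exact (min_le_left _ _).trans (by linarith)
      · rw [abs_of_nonpos h]; exact (min_le_right _ _).trans (by linarith)
    have h3 := neg_abs_le ((a + 2) * (x * y))
    rw [abs_mul] at h3
    linarith
  · subst ha
    refine ⟨3, by norm_num, key _ fun x y => ?_⟩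
    norm_num [abs_mul]
  · refine ⟨a - 4, by linarith, key _ fun x y => ?_⟩
    rw [le_abs]; left
    have := xy x y
    have h1 := mul_le_mul_of_nonneg_left this (show 0 ≤ a - 1 by linarith)
    have h3 := le_abs_self ((a + 2) * (x * y))
    rw [abs_mul, abs_of_pos (show 0 < a + 2 by linarith)] at h3
    linarith

/-- four-wave resonance function. -/
def H4 (a1 a2 a3 a4 x y z : ℝ) : ℝ := a1 * x ^ 3 + a2 * y ^ 3 + a3 * z ^ 3 + a4 * (-(x + y + z)) ^ 3

lemma H4A {a : ℝ} (ha : a < 0) : ∃ c > 0, ∀ x y z,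
    c * (|x + y| * |x + z| * |y + z|) ≤ |H4 a a a a x y z| := by
  refine ⟨-3 * a, by linarith, fun x y z => ?_⟩
  have : H4 a a a a x y z = (-3 * a) * ((x + y) * (x + z) * (y + z)) := by unfold H4; ring
  rw [this, abs_mul (-3 * a), abs_mul _ (y + z), abs_mul (x + y), abs_of_pos (show 0 < -3 * a by linarith)]

lemma H4B {a : ℝ} (ha : a < 0) : ∃ c > 0, ∀ x y z,
    c * (|x + y| * |x + z| * |y + z|) ≤ |H4 1 a 1 a x y z| := by
  refine ⟨min 1 (-a), lt_min one_pos (by linarith), fun x y z => ?_⟩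
  set u := -(x + y + z) with hu
  have : H4 1 a 1 a x y z = (x + z) * ((x^2 - x*z + z^2) + (-a) * (y^2 - y * u + u^2)) := by
    unfold H4; rw [hu]; ring
  rw [this, abs_mul]
  have e1 : |x + y| * |y + z| ≤ |x * z| + |y * u| := by
    rw [← abs_mul, show (x + y) * (y + z) = x * z - y * u by rw [hu]; ring]
    exact abs_sub _ _
  have q : ∀ x y : ℝ, |x * y| ≤ x^2 - x*y + y^2 := by
    intro x y
    rw [abs_le]; constructor <;> nlinarith [sq_nonneg (x - y), sq_nonneg x, sq_nonneg y, sq_nonneg (x+y)]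
  have q1 := q x z
  have q2 := q y u
  have hm1 : min 1 (-a) ≤ 1 := min_le_left _ _
  have hm2 : min 1 (-a) ≤ -a := min_le_right _ _
  have hm0 : 0 < min 1 (-a) := lt_min one_pos (by linarith)
  have : min 1 (-a) * (|x + y| * |y + z|) ≤ |x^2 - x*z + z^2 + (-a) * (y^2 - y * u + u^2)| := by
    refine le_trans ?_ (le_abs_self _)
    have f1 : min 1 (-a) * |x * z| ≤ 1 * (x^2 - x*z + z^2) :=
      mul_le_mul hm1 q1 (abs_nonneg _) (by norm_num)
    have f2 : min 1 (-a) * |y * u| ≤ (-a) * (y^2 - y*u + u^2) :=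
      mul_le_mul hm2 q2 (abs_nonneg _) (by linarith)
    nlinarith
  calc _ = |x + z| * (min 1 (-a) * (|x + y| * |y + z|)) := by ring
    _ ≤ _ := by gcongr

/-- first normal form symbol, cut off. -/
noncomputable def M3 (a : ℝ) (θ : ℝ → ℝ) (x y : ℝ) : ℝ :=
  if 1 ≤ mm x y then ms θ x y / H3 a x y else 0

noncomputable def mlow (θ : ℝ → ℝ) (x y : ℝ) : ℝ :=
  if 1 ≤ mm x y then 0 else ms θ x y

lemma M3_swap (a : ℝ) (θ : ℝ → ℝ) (x y : ℝ) : M3 a θ x y = M3 a θ y x := by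
  unfold M3; rw [mm_swap, ms_swap, show H3 a x y = H3 a y x by unfold H3; ring]

lemma M3_bound {a : ℝ} (ha : a < 0 ∨ a = 1 ∨ 4 < a) : ∃ C > 0, ∀ κ w, Wt κ w → ∀ x y,
    |M3 a (fun z => w z ^ 2) x y| ≤ C * κ * (w x * w y * w (x + y)) / (1 + mm x y) := by
  obtain ⟨c, hc, H⟩ := H3_bound ha
  refine ⟨8 / c, by positivity, fun κ w h x y => ?_⟩
  have hw : 0 < w x * w y * w (x + y) := mul_pos (mul_pos (h.pos _) (h.pos _)) (h.pos _)
  have hk := h.k0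
  have hmm := mm_nonneg x y
  unfold M3
  split_ifs with h1
  · rw [abs_div]
    rcases eq_or_ne (H3 a x y) 0 with h0 | h0
    · rw [h0]; simp; positivity
    have b := ms_bound h x y
    have hH : 0 < |H3 a x y| := abs_pos.2 h0
    rw [div_le_div_iff₀ hH (by linarith)]
    calc _ ≤ |ms (fun z => w z ^ 2) x y| * (2 * mm x y) := by gcongr; linarith
      _ ≤ 2 * (4 * κ * |x * y * (x + y)| * (w x * w y * w (x + y))) := by linarith
      _ = 8 / c * κ * (w x * w y * w (x + y)) * (c * |x * y * (x + y)|) := by field_simp; ring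
      _ ≤ _ := by gcongr; exact H x y
  · simp; positivity

lemma mlow_bound {κ : ℝ} {w : ℝ → ℝ} (h : Wt κ w) (x y : ℝ) :
    |mlow (fun z => w z ^ 2) x y| ≤ 8 * κ * (w x * w y * w (x + y)) / (1 + mm x y) := by
  have hw : 0 < w x * w y * w (x + y) := mul_pos (mul_pos (h.pos _) (h.pos _)) (h.pos _)
  have hk := h.k0
  have hmm := mm_nonneg x y
  unfold mlow
  split_ifs with h1
  · simp; positivity
  · push Not at h1
    have b := ms_bound h x y
    rw [le_div_iff₀ (by linarith)]
    rcases hmm.eq_or_lt with h0 | h0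
    · have hx : x = 0 := by have := mm_x x y; rw [← h0] at this; simpa using this
      have hy : y = 0 := by have := mm_y x y; rw [← h0] at this; simpa using this
      subst hx hy
      have h5 : 0 ≤ 8 * κ * (w 0 * w 0 * w (0 + 0)) := by positivity
      simpa [ms] using h5
    · have e : |x * y * (x + y)| ≤ mm x y := by
        rw [abs_mul, abs_mul]
        have a1 := mm_x x y; have a2 := mm_y x y; have a3 := mm_xy x y
        calc |x| * |y| * |x + y| ≤ 1 * 1 * mm x y := by gcongr <;> linarith
          _ = _ := by ring
      have : |ms (fun z => w z ^ 2) x y| ≤ 4 * κ * (w x * w y * w (x + y)) := by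
        refine le_of_mul_le_mul_right ?_ h0
        calc _ ≤ _ := b
          _ ≤ 4 * κ * mm x y * (w x * w y * w (x + y)) := by gcongr
          _ = _ := by ring
      calc _ ≤ (4 * κ * (w x * w y * w (x + y))) * 2 := by gcongr; linarith
        _ = _ := by ring

lemma ms_eq {a : ℝ} (ha : a < 0 ∨ a = 1 ∨ 4 < a) {κ : ℝ} {w : ℝ → ℝ} (h : Wt κ w) (x y : ℝ) :
    ms (fun z => w z ^ 2) x y =
      H3 a x y * M3 a (fun z => w z ^ 2) x y + mlow (fun z => w z ^ 2) x y := by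
  unfold M3 mlow
  split_ifs with h1
  · rcases eq_or_ne (H3 a x y) 0 with h0 | h0
    · rw [h0]; simp
      obtain ⟨c, hc, H⟩ := H3_bound ha
      have h2 := H x y
      rw [h0, abs_zero] at h2
      have h3 : |x * y * (x + y)| = 0 := le_antisymm (by nlinarith) (abs_nonneg _)
      have := ms_bound h x y
      rw [h3] at this
      simp at this
      have h5 : |ms (fun z => w z ^ 2) x y| ≤ 0 := by nlinarith [abs_nonneg (ms (fun z => w z ^ 2) x y)]
      simpa using h5
    · field_simp; simp
  · simp
end MB


namespace MB

/-- time-dependent factor on a measure space. -/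
structure Fac {X : Type*} [MeasurableSpace X] (α β : ℝ) (d : X → ℝ) (F F' : ℝ → X → ℂ) : Prop where
  meas : ∀ t ∈ Icc α β, Measurable (F t)
  meas' : ∀ t ∈ Icc α β, Measurable (F' t)
  bd : ∀ t ∈ Icc α β, ∀ x, ‖F t x‖ ≤ d x
  bd' : ∀ t ∈ Icc α β, ∀ x, ‖F' t x‖ ≤ d x
  ct : ∀ x, ContinuousOn (fun t => F t x) (Icc α β)
  der : ∀ x, ∀ t ∈ Ioo α β, HasDerivAt (fun t => F t x) (F' t x) t

lemma Fac.mul {X : Type*} [MeasurableSpace X] {α β : ℝ} {d e : X → ℝ} {F F' G G' : ℝ → X → ℂ}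
    (hF : Fac α β d F F') (hG : Fac α β e G G') :
    Fac α β (fun x => 2 * (d x * e x)) (fun t x => F t x * G t x)
      (fun t x => F' t x * G t x + F t x * G' t x) where
  meas t ht := (hF.meas t ht).mul (hG.meas t ht)
  meas' t ht := ((hF.meas' t ht).mul (hG.meas t ht)).add ((hF.meas t ht).mul (hG.meas' t ht))
  bd t ht x := by
    rw [norm_mul]
    have a := hF.bd t ht x; have b := hG.bd t ht x
    have := norm_nonneg (F t x); have := norm_nonneg (G t x)
    have : ‖F t x‖ * ‖G t x‖ ≤ d x * e x := mul_le_mul a b (by positivity) (by linarith)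
    nlinarith [norm_nonneg (F t x), norm_nonneg (G t x)]
  bd' t ht x := by
    have a := hF.bd t ht x; have b := hG.bd t ht x
    have a' := hF.bd' t ht x; have b' := hG.bd' t ht x
    have n1 := norm_nonneg (F t x); have n2 := norm_nonneg (G t x)
    calc _ ≤ ‖F' t x‖ * ‖G t x‖ + ‖F t x‖ * ‖G' t x‖ := by
          refine (norm_add_le _ _).trans ?_
          rw [norm_mul, norm_mul]
      _ ≤ d x * e x + d x * e x :=
          add_le_add (mul_le_mul a' b n2 (by linarith)) (mul_le_mul a b' (norm_nonneg _) (by linarith))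
      _ = _ := by ring
  ct x := (hF.ct x).mul (hG.ct x)
  der x t ht := (hF.der x t ht).mul (hG.der x t ht)

lemma Fac.const {X : Type*} [MeasurableSpace X] (α β : ℝ) {M : X → ℂ} (hM : Measurable M) :
    Fac α β (fun x => ‖M x‖) (fun _ x => M x) (fun _ _ => 0) where
  meas _ _ := hM
  meas' _ _ := measurable_const
  bd _ _ _ := le_rfl
  bd' _ _ _ := by simp
  ct _ := continuousOn_const
  der _ _ _ := hasDerivAt_const _ _

lemma Fac.cOn {X : Type*} [MeasureSpace X] {α β : ℝ} {d : X → ℝ} {F F' : ℝ → X → ℂ}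
    (h : Fac α β d F F') (hd : Integrable d) :
    ContinuousOn (fun t => ∫ x, F t x) (Icc α β) :=
  continuousOn_of_dominated (fun t ht => (h.meas t ht).aestronglyMeasurable)
    (fun t ht => Eventually.of_forall (h.bd t ht)) hd (Eventually.of_forall h.ct)

lemma Fac.int {X : Type*} [MeasureSpace X] {α β : ℝ} {d : X → ℝ} {F F' : ℝ → X → ℂ}
    (h : Fac α β d F F') (hd : Integrable d) {t : ℝ} (ht : t ∈ Icc α β) : Integrable (F t) :=
  hd.mono' (h.meas t ht).aestronglyMeasurable (Eventually.of_forall (h.bd t ht))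

lemma Fac.hasDeriv {X : Type*} [MeasureSpace X] {α β : ℝ} {d : X → ℝ} {F F' : ℝ → X → ℂ}
    (h : Fac α β d F F') (hd : Integrable d) {t : ℝ} (ht : t ∈ Ioo α β) :
    HasDerivAt (fun t => ∫ x, F t x) (∫ x, F' t x) t := by
  have ht' := Ioo_subset_Icc_self ht
  refine (hasDerivAt_integral_of_dominated_loc_of_deriv_le (bound := d) (s := Ioo α β)
    (Ioo_mem_nhds ht.1 ht.2) ?_ (h.int hd ht') ?_ ?_ hd ?_).2
  · filter_upwards [Ioo_mem_nhds ht.1 ht.2] with s hs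
    exact (h.meas s (Ioo_subset_Icc_self hs)).aestronglyMeasurable
  · exact (h.meas' t ht').aestronglyMeasurable
  · exact Eventually.of_forall fun x s hs => h.bd' s (Ioo_subset_Icc_self hs) x
  · exact Eventually.of_forall fun x s hs => h.der x s hs

/-- decay class -/
def Dec (C : ℝ) (g : ℝ → ℂ) : Prop := Measurable g ∧ ∀ ξ, ‖g ξ‖ ≤ C / (1 + |ξ|) ^ 3

/-- component of a solution on `[α,β]` -/
structure Comp (α β ph : ℝ) (f n : ℝ → ℝ → ℂ) : Prop where
  dec : ∃ C, 0 ≤ C ∧ ∀ t ∈ Icc α β, Dec C (f t) ∧ Dec C (n t) ∧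
    Dec C (fun ξ => Complex.I * ph * ξ ^ 3 * f t ξ + n t ξ)
  ct : ∀ ξ, ContinuousOn (fun t => f t ξ) (Icc α β)
  der : ∀ ξ, ∀ t ∈ Ioo α β,
    HasDerivAt (fun t => f t ξ) (Complex.I * ph * ξ ^ 3 * f t ξ + n t ξ) t

/-- total derivative -/
noncomputable def dd (ph : ℝ) (f n : ℝ → ℝ → ℂ) (t ξ : ℝ) : ℂ :=
  Complex.I * ph * ξ ^ 3 * f t ξ + n t ξ

lemma Comp.fac {X : Type*} [MeasurableSpace X] {α β ph : ℝ} {f n : ℝ → ℝ → ℂ} (h : Comp α β ph f n) :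
    ∃ C, 0 ≤ C ∧ ∀ l : X → ℝ, Measurable l →
      Fac α β (fun x => C / (1 + |l x|) ^ 3) (fun t x => f t (l x)) (fun t x => dd ph f n t (l x)) := by
  obtain ⟨C, hC, H⟩ := h.dec
  refine ⟨C, hC, fun l hl => ⟨?_, ?_, ?_, ?_, ?_, ?_⟩⟩
  · exact fun t ht => (H t ht).1.1.comp hl
  · exact fun t ht => (H t ht).2.2.1.comp hl
  · exact fun t ht x => (H t ht).1.2 _
  · exact fun t ht x => (H t ht).2.2.2 _
  · exact fun x => h.ct _
  · exact fun x => h.der _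

lemma int1 : Integrable fun x : ℝ => 1 / (1 + |x|) ^ 2 := by
  have := integrable_one_add_norm (E := ℝ) (μ := volume) (r := 2) (by norm_num)
  refine this.congr (Eventually.of_forall fun x => ?_)
  simp only [Real.norm_eq_abs]
  rw [Real.rpow_neg (by positivity)]; norm_num

lemma int2 : Integrable fun q : ℝ × ℝ => 1 / (1 + |q.1|) ^ 2 * (1 / (1 + |q.2|) ^ 2) :=
  int1.mul_prod int1

lemma int3 : Integrable fun q : (ℝ × ℝ) × ℝ =>
    1 / (1 + |q.1.1|) ^ 2 * (1 / (1 + |q.1.2|) ^ 2) * (1 / (1 + |q.2|) ^ 2) :=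
  int2.mul_prod int1

lemma br_le (x : ℝ) : 1 / (1 + |x|) ^ 3 ≤ 1 / (1 + |x|) ^ 2 := by
  apply one_div_le_one_div_of_le (by positivity)
  exact pow_le_pow_right₀ (by linarith [abs_nonneg x]) (by norm_num)

lemma br_le1 (x : ℝ) : 1 / (1 + |x|) ^ 3 ≤ 1 := by
  rw [div_le_one (by positivity)]
  exact one_le_pow₀ (by linarith [abs_nonneg x])

lemma br_mul (x : ℝ) : (1 + |x|) * (1 / (1 + |x|) ^ 3) = 1 / (1 + |x|) ^ 2 := by
  field_simp

/-- domination for trilinear forms -/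
lemma dom2 {B C1 C2 C3 : ℝ} (hB : 0 ≤ B) (h1 : 0 ≤ C1) (h2 : 0 ≤ C2) (h3 : 0 ≤ C3)
    {M : ℝ × ℝ → ℂ} (hM : Measurable M) (hb : ∀ q, ‖M q‖ ≤ B * (1 + |q.1|) * (1 + |q.2|)) :
    Integrable fun q : ℝ × ℝ => ‖M q‖ * (C1 / (1 + |-q.1 - q.2|) ^ 3) * (C2 / (1 + |q.1|) ^ 3)
      * (C3 / (1 + |q.2|) ^ 3) := by
  refine (int2.const_mul (B * C1 * C2 * C3)).mono' (Measurable.aestronglyMeasurable (by fun_prop)) ?_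
  refine Eventually.of_forall fun q => ?_
  rw [Real.norm_of_nonneg (by positivity)]
  rw [div_eq_mul_one_div C1, div_eq_mul_one_div C2, div_eq_mul_one_div C3]
  calc _ ≤ (B * (1 + |q.1|) * (1 + |q.2|)) * (C1 * 1) * (C2 * (1 / (1 + |q.1|) ^ 3)) *
        (C3 * (1 / (1 + |q.2|) ^ 3)) := by
        gcongr
        · exact hb q
        · exact br_le1 _
    _ = B * C1 * C2 * C3 * (((1 + |q.1|) * (1 / (1 + |q.1|) ^ 3)) *
        ((1 + |q.2|) * (1 / (1 + |q.2|) ^ 3))) := by ring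
    _ = _ := by rw [br_mul, br_mul]

lemma dom3 {B C1 C2 C3 C4 : ℝ} (hB : 0 ≤ B) (h1 : 0 ≤ C1) (h2 : 0 ≤ C2) (h3 : 0 ≤ C3) (h4 : 0 ≤ C4)
    {M : (ℝ × ℝ) × ℝ → ℂ} (hM : Measurable M) (hb : ∀ q, ‖M q‖ ≤ B) :
    Integrable fun q : (ℝ × ℝ) × ℝ => ‖M q‖ * (C1 / (1 + |q.1.1|) ^ 3) * (C2 / (1 + |q.1.2|) ^ 3)
      * (C3 / (1 + |q.2|) ^ 3) * (C4 / (1 + |-(q.1.1 + q.1.2 + q.2)|) ^ 3) := by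
  refine (int3.const_mul (B * C1 * C2 * C3 * C4)).mono' (Measurable.aestronglyMeasurable (by fun_prop)) ?_
  refine Eventually.of_forall fun q => ?_
  rw [Real.norm_of_nonneg (by positivity)]
  rw [div_eq_mul_one_div C1, div_eq_mul_one_div C2, div_eq_mul_one_div C3, div_eq_mul_one_div C4]
  calc _ ≤ B * (C1 * (1 / (1 + |q.1.1|) ^ 2)) * (C2 * (1 / (1 + |q.1.2|) ^ 2)) *
        (C3 * (1 / (1 + |q.2|) ^ 2)) * (C4 * 1) := by
        have b1 := br_le q.1.1; have b2 := br_le q.1.2; have b3 := br_le q.2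
        have b4 := br_le1 (-(q.1.1 + q.1.2 + q.2))
        refine mul_le_mul (mul_le_mul (mul_le_mul (mul_le_mul (hb q) ?_ ?_ ?_) ?_ ?_ ?_) ?_ ?_ ?_) ?_ ?_ ?_
        all_goals first | positivity | exact mul_le_mul_of_nonneg_left (by assumption) (by assumption)
    _ = _ := by ring

lemma Dec.int2 {B C1 C2 C3 : ℝ} {f g k : ℝ → ℂ} (hf : Dec C1 f) (hg : Dec C2 g) (hk : Dec C3 k)
    {M : ℝ × ℝ → ℂ} (hM : Measurable M) (hb : ∀ q, ‖M q‖ ≤ B * (1 + |q.1|) * (1 + |q.2|)) :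
    Integrable fun q : ℝ × ℝ => M q * f (-q.1 - q.2) * g q.1 * k q.2 := by
  have pos : ∀ {C : ℝ} {f : ℝ → ℂ}, Dec C f → 0 ≤ C := fun {C f} h => by
    have := (norm_nonneg _).trans (h.2 0); simpa using this
  have hB : 0 ≤ B := by have := (norm_nonneg _).trans (hb (0,0)); simpa using this
  have m1 := hf.1; have m2 := hg.1; have m3 := hk.1
  refine (dom2 hB (pos hf) (pos hg) (pos hk) hM hb).mono' (Measurable.aestronglyMeasurable (by fun_prop)) ?_
  refine Eventually.of_forall fun q => ?_
  rw [norm_mul, norm_mul, norm_mul]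
  gcongr
  · have := pos hf; have := pos hg; positivity
  · have := pos hf; positivity
  · exact hf.2 _
  · exact hg.2 _
  · exact hk.2 _

lemma Dec.int3 {B C1 C2 C3 C4 : ℝ} {f1 f2 f3 f4 : ℝ → ℂ} (h1 : Dec C1 f1) (h2 : Dec C2 f2)
    (h3 : Dec C3 f3) (h4 : Dec C4 f4)
    {M : (ℝ × ℝ) × ℝ → ℂ} (hM : Measurable M) (hb : ∀ q, ‖M q‖ ≤ B) :
    Integrable fun q : (ℝ × ℝ) × ℝ => M q * f1 q.1.1 * f2 q.1.2 * f3 q.2 *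
      f4 (-(q.1.1 + q.1.2 + q.2)) := by
  have pos : ∀ {C : ℝ} {f : ℝ → ℂ}, Dec C f → 0 ≤ C := fun {C f} h => by
    have := (norm_nonneg _).trans (h.2 0); simpa using this
  have hB : 0 ≤ B := (norm_nonneg _).trans (hb ((0,0),0))
  have m1 := h1.1; have m2 := h2.1; have m3 := h3.1; have m4 := h4.1
  have p1 := pos h1; have p2 := pos h2; have p3 := pos h3; have p4 := pos h4
  refine (dom3 hB p1 p2 p3 p4 hM hb).mono' (Measurable.aestronglyMeasurable (by fun_prop)) ?_
  refine Eventually.of_forall fun q => ?_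
  rw [norm_mul, norm_mul, norm_mul, norm_mul]
  gcongr
  · exact h1.2 _
  · exact h2.2 _
  · exact h3.2 _
  · exact h4.2 _

/-- trilinear form -/
noncomputable def L3 (M : ℝ × ℝ → ℂ) (f g k : ℝ → ℂ) : ℂ :=
  ∫ q : ℝ × ℝ, M q * f (-q.1 - q.2) * g q.1 * k q.2

/-- quadrilinear form -/
noncomputable def L4 (M : (ℝ × ℝ) × ℝ → ℂ) (f1 f2 f3 f4 : ℝ → ℂ) : ℂ :=
  ∫ q : (ℝ × ℝ) × ℝ, M q * f1 q.1.1 * f2 q.1.2 * f3 q.2 * f4 (-(q.1.1 + q.1.2 + q.2))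

lemma L3_deriv {α β : ℝ} {a1 a2 a3 : ℝ} {f1 n1 f2 n2 f3 n3 : ℝ → ℝ → ℂ}
    (h1 : Comp α β a1 f1 n1) (h2 : Comp α β a2 f2 n2) (h3 : Comp α β a3 f3 n3)
    {B : ℝ} {M : ℝ × ℝ → ℂ} (hM : Measurable M) (hb : ∀ q, ‖M q‖ ≤ B * (1 + |q.1|) * (1 + |q.2|)) :
    ContinuousOn (fun t => L3 M (f1 t) (f2 t) (f3 t)) (Icc α β) ∧
    ∀ t ∈ Ioo α β, HasDerivAt (fun t => L3 M (f1 t) (f2 t) (f3 t))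
      ((∫ q : ℝ × ℝ, Complex.I * ((a1 * (-q.1 - q.2) ^ 3 + a2 * q.1 ^ 3 + a3 * q.2 ^ 3 : ℝ) : ℂ) * M q *
          f1 t (-q.1 - q.2) * f2 t q.1 * f3 t q.2)
        + L3 M (n1 t) (f2 t) (f3 t) + L3 M (f1 t) (n2 t) (f3 t) + L3 M (f1 t) (f2 t) (n3 t)) t := by
  obtain ⟨C1, p1, H1⟩ := h1.fac (X := ℝ × ℝ)
  obtain ⟨C2, p2, H2⟩ := h2.fac (X := ℝ × ℝ)
  obtain ⟨C3, p3, H3⟩ := h3.fac (X := ℝ × ℝ)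
  have F := (((Fac.const α β hM).mul (H1 (fun q => -q.1 - q.2) (by fun_prop))).mul
    (H2 (fun q => q.1) (by fun_prop))).mul (H3 (fun q => q.2) (by fun_prop))
  have hB : 0 ≤ B := by have := (norm_nonneg _).trans (hb (0,0)); simpa using this
  have I : Integrable fun x : ℝ × ℝ => 2 * (2 * (2 * (‖M x‖ * (C1 / (1 + |-x.1 - x.2|) ^ 3)) *
      (C2 / (1 + |x.1|) ^ 3)) * (C3 / (1 + |x.2|) ^ 3)) := by
    refine ((dom2 hB p1 p2 p3 hM hb).const_mul 8).congr (Eventually.of_forall fun x => ?_)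
    ring
  refine ⟨F.cOn I, fun t ht => ?_⟩
  have D := F.hasDeriv I ht
  refine D.congr_deriv ?_
  have ht' := Ioo_subset_Icc_self ht
  obtain ⟨E1, -, K1⟩ := h1.dec
  obtain ⟨E2, -, K2⟩ := h2.dec
  obtain ⟨E3, -, K3⟩ := h3.dec
  obtain ⟨a, b, c⟩ := K1 t ht'
  obtain ⟨a', b', c'⟩ := K2 t ht'
  obtain ⟨a'', b'', c''⟩ := K3 t ht'
  have i1 := Dec.int2 b a' a'' hM hb
  have i2 := Dec.int2 a b' a'' hM hb
  have i3 := Dec.int2 a a' b'' hM hb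
  have j1 := Dec.int2 c a' a'' hM hb
  have j2 := Dec.int2 a c' a'' hM hb
  have j3 := Dec.int2 a a' c'' hM hb
  have j : Integrable fun q : ℝ × ℝ => Complex.I * ((a1 * (-q.1 - q.2) ^ 3 + a2 * q.1 ^ 3 + a3 * q.2 ^ 3 : ℝ) : ℂ) * M q *
          f1 t (-q.1 - q.2) * f2 t q.1 * f3 t q.2 := by
    refine (((((j1.sub i1).add (j2.sub i2))).add (j3.sub i3))).congr (Eventually.of_forall fun q => ?_)
    simp only [Pi.add_apply, Pi.sub_apply]
    push_cast
    ring
  unfold L3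
  rw [← integral_add' j i1, ← integral_add' (j.add i1) i2, ← integral_add' ((j.add i1).add i2) i3]
  refine integral_congr_ae (Eventually.of_forall fun q => ?_)
  simp only [dd, Pi.add_apply]
  push_cast
  ring

lemma L4_deriv {α β : ℝ} {a1 a2 a3 a4 : ℝ} {f1 n1 f2 n2 f3 n3 f4 n4 : ℝ → ℝ → ℂ}
    (h1 : Comp α β a1 f1 n1) (h2 : Comp α β a2 f2 n2) (h3 : Comp α β a3 f3 n3)
    (h4 : Comp α β a4 f4 n4)
    {B : ℝ} {M : (ℝ × ℝ) × ℝ → ℂ} (hM : Measurable M) (hb : ∀ q, ‖M q‖ ≤ B) :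
    ContinuousOn (fun t => L4 M (f1 t) (f2 t) (f3 t) (f4 t)) (Icc α β) ∧
    ∀ t ∈ Ioo α β, HasDerivAt (fun t => L4 M (f1 t) (f2 t) (f3 t) (f4 t))
      (L4 (fun q => Complex.I * ((H4 a1 a2 a3 a4 q.1.1 q.1.2 q.2 : ℝ) : ℂ) * M q)
          (f1 t) (f2 t) (f3 t) (f4 t)
        + L4 M (n1 t) (f2 t) (f3 t) (f4 t) + L4 M (f1 t) (n2 t) (f3 t) (f4 t)
        + L4 M (f1 t) (f2 t) (n3 t) (f4 t) + L4 M (f1 t) (f2 t) (f3 t) (n4 t)) t := by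
  obtain ⟨C1, p1, H1⟩ := h1.fac (X := (ℝ × ℝ) × ℝ)
  obtain ⟨C2, p2, H2⟩ := h2.fac (X := (ℝ × ℝ) × ℝ)
  obtain ⟨C3, p3, H3⟩ := h3.fac (X := (ℝ × ℝ) × ℝ)
  obtain ⟨C4, p4, H4'⟩ := h4.fac (X := (ℝ × ℝ) × ℝ)
  have F := ((((Fac.const α β hM).mul (H1 (fun q => q.1.1) (by fun_prop))).mul
    (H2 (fun q => q.1.2) (by fun_prop))).mul (H3 (fun q => q.2) (by fun_prop))).mul
    (H4' (fun q => -(q.1.1 + q.1.2 + q.2)) (by fun_prop))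
  have hB : 0 ≤ B := (norm_nonneg _).trans (hb ((0,0),0))
  have I : Integrable fun x : (ℝ × ℝ) × ℝ => 2 * (2 * (2 * (2 * (‖M x‖ * (C1 / (1 + |x.1.1|) ^ 3)) *
      (C2 / (1 + |x.1.2|) ^ 3)) * (C3 / (1 + |x.2|) ^ 3)) * (C4 / (1 + |-(x.1.1 + x.1.2 + x.2)|) ^ 3)) := by
    refine ((dom3 hB p1 p2 p3 p4 hM hb).const_mul 16).congr (Eventually.of_forall fun x => ?_)
    ring
  refine ⟨F.cOn I, fun t ht => ?_⟩
  have D := F.hasDeriv I ht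
  refine D.congr_deriv ?_
  have ht' := Ioo_subset_Icc_self ht
  obtain ⟨E1, -, K1⟩ := h1.dec
  obtain ⟨E2, -, K2⟩ := h2.dec
  obtain ⟨E3, -, K3⟩ := h3.dec
  obtain ⟨E4, -, K4⟩ := h4.dec
  obtain ⟨a, b, c⟩ := K1 t ht'
  obtain ⟨a', b', c'⟩ := K2 t ht'
  obtain ⟨a'', b'', c''⟩ := K3 t ht'
  obtain ⟨u, v, w⟩ := K4 t ht'
  have i1 := Dec.int3 b a' a'' u hM hb
  have i2 := Dec.int3 a b' a'' u hM hb
  have i3 := Dec.int3 a a' b'' u hM hb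
  have i4 := Dec.int3 a a' a'' v hM hb
  have j1 := Dec.int3 c a' a'' u hM hb
  have j2 := Dec.int3 a c' a'' u hM hb
  have j3 := Dec.int3 a a' c'' u hM hb
  have j4 := Dec.int3 a a' a'' w hM hb
  have j : Integrable fun q : (ℝ × ℝ) × ℝ => Complex.I * ((H4 a1 a2 a3 a4 q.1.1 q.1.2 q.2 : ℝ) : ℂ) * M q *
          f1 t q.1.1 * f2 t q.1.2 * f3 t q.2 * f4 t (-(q.1.1 + q.1.2 + q.2)) := by
    refine ((((((j1.sub i1).add (j2.sub i2))).add (j3.sub i3))).add (j4.sub i4)).congr (Eventually.of_forall fun q => ?_)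
    simp only [Pi.add_apply, Pi.sub_apply, H4]
    push_cast
    ring
  unfold L4
  rw [← integral_add' j i1, ← integral_add' (j.add i1) i2, ← integral_add' ((j.add i1).add i2) i3,
    ← integral_add' (((j.add i1).add i2).add i3) i4]
  refine integral_congr_ae (Eventually.of_forall fun q => ?_)
  simp only [dd, H4, Pi.add_apply]
  push_cast
  ring
end MB


namespace MB

/-- `f` is dominated by `a` in the weight `w`. -/
def Wd (w : ℝ → ℝ) (f : ℝ → ℂ) (a : ℝ → ℝ≥0∞) : Prop :=
  ∀ ξ, ENNReal.ofReal (w ξ) * ‖f ξ‖ₑ ≤ a ξ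

lemma L4_bound {w : ℝ → ℝ} (hw : ∀ x, 1 ≤ w x) (hev : ∀ x, w (-x) = w x) {f1 f2 f3 f4 : ℝ → ℂ}
    {a1 a2 a3 a4 : ℝ → ℝ≥0∞} (m1 : Measurable f1) (m2 : Measurable f2) (m3 : Measurable f3)
    (m4 : Measurable f4) (h1 : Wd w f1 a1) (h2 : Wd w f2 a2) (h3 : Wd w f3 a3) (h4 : Wd w f4 a4)
    {M : (ℝ × ℝ) × ℝ → ℂ} (hM : Measurable M) {G : ℝ → ℝ → ℝ → ℝ}
    (hG : ∀ x y z, 0 ≤ G x y z)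
    (hb : ∀ x y z, ‖M ((x, y), z)‖ ≤ G x y z * (w x * w y * w z * w (x + y + z))) :
    ‖L4 M f1 f2 f3 f4‖ₑ ≤ ∫⁻ x, ∫⁻ y, ∫⁻ z, ENNReal.ofReal (G x y z) *
      (a1 x * a2 y * a3 z * a4 (-(x + y + z))) := by
  unfold L4
  refine (enorm_integral_le_lintegral_enorm _).trans ?_
  rw [Measure.volume_eq_prod, lintegral_prod _ (by fun_prop), Measure.volume_eq_prod, lintegral_prod]
  swap
  · refine Measurable.aemeasurable ?_
    refine Measurable.lintegral_prod_right' (f := fun q : (ℝ × ℝ) × ℝ => ‖M q * f1 q.1.1 * f2 q.1.2 * f3 q.2 *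
      f4 (-(q.1.1 + q.1.2 + q.2))‖ₑ) ?_
    fun_prop
  refine lintegral_mono fun x => lintegral_mono fun y => lintegral_mono fun z => ?_
  simp only [enorm_mul]
  have w0 : ∀ x, 0 ≤ w x := fun x => zero_le_one.trans (hw x)
  have hb' : ‖M ((x, y), z)‖ₑ ≤ ENNReal.ofReal (G x y z) * (ENNReal.ofReal (w x) *
      ENNReal.ofReal (w y) * ENNReal.ofReal (w z) * ENNReal.ofReal (w (-(x + y + z)))) := by
    rw [hev, ← ENNReal.ofReal_mul (w0 _), ← ENNReal.ofReal_mul (mul_nonneg (w0 _) (w0 _)),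
      ← ENNReal.ofReal_mul (mul_nonneg (mul_nonneg (w0 _) (w0 _)) (w0 _)), ← ENNReal.ofReal_mul (hG _ _ _),
      ← ofReal_norm]
    exact ENNReal.ofReal_le_ofReal (hb x y z)
  calc _ ≤ (ENNReal.ofReal (G x y z) * (ENNReal.ofReal (w x) *
      ENNReal.ofReal (w y) * ENNReal.ofReal (w z) * ENNReal.ofReal (w (-(x + y + z))))) *
        ‖f1 x‖ₑ * ‖f2 y‖ₑ * ‖f3 z‖ₑ * ‖f4 (-(x + y + z))‖ₑ := by gcongr
    _ = ENNReal.ofReal (G x y z) * ((ENNReal.ofReal (w x) * ‖f1 x‖ₑ) * (ENNReal.ofReal (w y) * ‖f2 y‖ₑ) *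
        (ENNReal.ofReal (w z) * ‖f3 z‖ₑ) * (ENNReal.ofReal (w (-(x + y + z))) * ‖f4 (-(x + y + z))‖ₑ)) := by
          ring
    _ ≤ _ := by
        gcongr
        · exact h1 x
        · exact h2 y
        · exact h3 z
        · exact h4 _

lemma L3_bound {w : ℝ → ℝ} (hw : ∀ x, 1 ≤ w x) (hev : ∀ x, w (-x) = w x) {f1 f2 f3 : ℝ → ℂ}
    {a1 a2 a3 : ℝ → ℝ≥0∞} (m1 : Measurable f1) (m2 : Measurable f2) (m3 : Measurable f3)
    (h1 : Wd w f1 a1) (h2 : Wd w f2 a2) (h3 : Wd w f3 a3)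
    {M : ℝ × ℝ → ℂ} (hM : Measurable M) {G : ℝ → ℝ → ℝ}
    (hG : ∀ x y, 0 ≤ G x y)
    (hb : ∀ x y, ‖M (x, y)‖ ≤ G x y * (w x * w y * w (x + y))) :
    ‖L3 M f1 f2 f3‖ₑ ≤ ∫⁻ x, ∫⁻ y, ENNReal.ofReal (G x y) *
      (a1 (-x - y) * a2 x * a3 y) := by
  unfold L3
  refine (enorm_integral_le_lintegral_enorm _).trans ?_
  rw [Measure.volume_eq_prod, lintegral_prod _ (by fun_prop)]
  refine lintegral_mono fun x => lintegral_mono fun y => ?_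
  simp only [enorm_mul]
  have w0 : ∀ x, 0 ≤ w x := fun x => zero_le_one.trans (hw x)
  have hb' : ‖M (x, y)‖ₑ ≤ ENNReal.ofReal (G x y) * (ENNReal.ofReal (w x) *
      ENNReal.ofReal (w y) * ENNReal.ofReal (w (-x - y))) := by
    rw [show -x - y = -(x + y) by ring, hev, ← ENNReal.ofReal_mul (w0 _), ← ENNReal.ofReal_mul (mul_nonneg (w0 _) (w0 _)),
      ← ENNReal.ofReal_mul (hG _ _), ← ofReal_norm]
    exact ENNReal.ofReal_le_ofReal (hb x y)
  calc _ ≤ (ENNReal.ofReal (G x y) * (ENNReal.ofReal (w x) *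
      ENNReal.ofReal (w y) * ENNReal.ofReal (w (-x - y)))) *
        ‖f1 (-x - y)‖ₑ * ‖f2 x‖ₑ * ‖f3 y‖ₑ := by gcongr
    _ = ENNReal.ofReal (G x y) * ((ENNReal.ofReal (w (-x - y)) * ‖f1 (-x - y)‖ₑ) * (ENNReal.ofReal (w x) * ‖f2 x‖ₑ) *
        (ENNReal.ofReal (w y) * ‖f3 y‖ₑ)) := by ring
    _ ≤ _ := by
        gcongr
        · exact h1 _
        · exact h2 x
        · exact h3 y

lemma J1_eq (x : ℝ) : J 1 x = ENNReal.ofReal (1 / (1 + |x|)) := by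
  unfold J; rw [Real.rpow_neg_one, one_div]
lemma J2_eq (x : ℝ) : J 2 x = ENNReal.ofReal (1 / (1 + |x|) ^ 2) := by
  unfold J; rw [Real.rpow_neg (by positivity), one_div]; norm_num

lemma const_out {f : ℝ → ℝ → ℝ → ℝ≥0∞} {c : ℝ≥0∞} (hc : c ≠ ∞) :
    ∫⁻ x, ∫⁻ y, ∫⁻ z, c * f x y z = c * ∫⁻ x, ∫⁻ y, ∫⁻ z, f x y z := by
  simp_rw [lintegral_const_mul' _ _ hc]

/-- resonant and boundary quartic terms -/
lemma L4_quart {w : ℝ → ℝ} (hw : ∀ x, 1 ≤ w x) (hev : ∀ x, w (-x) = w x) {f1 f2 f3 f4 : ℝ → ℂ}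
    {A : ℝ → ℝ≥0∞} (hA : Measurable A) (hAe : ∀ x, A (-x) = A x)
    (m1 : Measurable f1) (m2 : Measurable f2) (m3 : Measurable f3)
    (m4 : Measurable f4) (h1 : Wd w f1 A) (h2 : Wd w f2 A) (h3 : Wd w f3 A) (h4 : Wd w f4 A)
    {M : (ℝ × ℝ) × ℝ → ℂ} (hM : Measurable M) {B : ℝ} (hB : 0 ≤ B)
    (hb : ∀ x y z, ‖M ((x, y), z)‖ ≤ B * (1 / (1 + |x + z|) ^ 2 + 1 / (1 + |y + z|) ^ 2) *
      (w x * w y * w z * w (x + y + z))) :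
    ‖L4 M f1 f2 f3 f4‖ₑ ≤ ENNReal.ofReal B * (2 * cJ 2) * n2 A ^ 4 := by
  refine (L4_bound hw hev m1 m2 m3 m4 h1 h2 h3 h4 hM (fun x y z => by positivity) hb).trans ?_
  have e : ∀ x y z, ENNReal.ofReal (B * (1 / (1 + |x + z|) ^ 2 + 1 / (1 + |y + z|) ^ 2)) *
      (A x * A y * A z * A (-(x + y + z))) = ENNReal.ofReal B * (A x * A y * A z * A (x + y + z) * J 2 (x + z)
      + A x * A y * A z * A (x + y + z) * J 2 (y + z)) := by
    intro x y z
    rw [ENNReal.ofReal_mul hB, ENNReal.ofReal_add (by positivity) (by positivity), ← J2_eq, ← J2_eq, hAe]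
    ring
  simp_rw [e]
  rw [const_out ENNReal.ofReal_ne_top, mul_assoc]
  gcongr
  have : ∫⁻ x, ∫⁻ y, ∫⁻ z, (A x * A y * A z * A (x + y + z) * J 2 (x + z)
      + A x * A y * A z * A (x + y + z) * J 2 (y + z)) =
      (∫⁻ x, ∫⁻ y, ∫⁻ z, A x * A y * A z * A (x + y + z) * J 2 (x + z)) +
      ∫⁻ x, ∫⁻ y, ∫⁻ z, A x * A y * A z * A (x + y + z) * J 2 (y + z) := by
    rw [← lintegral_add_left]
    · refine lintegral_congr fun x => ?_
      rw [← lintegral_add_left]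
      · refine lintegral_congr fun y => ?_
        rw [← lintegral_add_left]
        fun_prop
      · exact Measurable.lintegral_prod_right' (f := fun q : ℝ × ℝ => A x * A q.1 * A q.2 * A (x + q.1 + q.2) * J 2 (x + q.2)) (by fun_prop)
    · have m : Measurable fun q : (ℝ × ℝ) × ℝ => A q.1.1 * A q.1.2 * A q.2 * A (q.1.1 + q.1.2 + q.2) * J 2 (q.1.1 + q.2) := by fun_prop
      exact Measurable.lintegral_prod_right' (f := fun q : ℝ × ℝ => ∫⁻ z, A q.1 * A q.2 * A z * A (q.1 + q.2 + z) * J 2 (q.1 + z)) m.lintegral_prod_right'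
  rw [this]
  calc _ ≤ _ := add_le_add (E4 hA) (E4' hA)
    _ = _ := by ring

lemma triple_add {f g : ℝ → ℝ → ℝ → ℝ≥0∞} (hf : Measurable fun q : (ℝ × ℝ) × ℝ => f q.1.1 q.1.2 q.2) :
    ∫⁻ x, ∫⁻ y, ∫⁻ z, (f x y z + g x y z) =
      (∫⁻ x, ∫⁻ y, ∫⁻ z, f x y z) + ∫⁻ x, ∫⁻ y, ∫⁻ z, g x y z := by
  rw [← lintegral_add_left]
  · refine lintegral_congr fun x => ?_
    rw [← lintegral_add_left]
    · refine lintegral_congr fun y => ?_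
      rw [← lintegral_add_left]
      exact hf.comp (by fun_prop : Measurable fun z : ℝ => ((x, y), z))
    · exact Measurable.lintegral_prod_right' (f := fun q : ℝ × ℝ => f x q.1 q.2)
        (hf.comp (by fun_prop : Measurable fun q : ℝ × ℝ => ((x, q.1), q.2)))
  · exact Measurable.lintegral_prod_right' (f := fun q : ℝ × ℝ => ∫⁻ z, f q.1 q.2 z) hf.lintegral_prod_right'

lemma slot34 {m s o x y X Y : ℝ} (hs : 0 ≤ s) (ho : 0 ≤ o) (hx : |x| ≤ m) (hy : |y| ≤ m)
    (hX0 : 0 ≤ X) (hY0 : 0 ≤ Y) (hX : s - m ≤ X) (hY : s - m ≤ Y) (hos : o ≤ s + 2 * m) :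
    s / ((1 + X) * (1 + Y) * (1 + m)) ≤ 4 * (1 / (1 + X) * (1 / (1 + Y))) +
      4 * ((1 + |x|) ^ (-(2/3) : ℝ) * (1 + |y|) ^ (-(2/3) : ℝ) * (1 + o) ^ (-(2/3) : ℝ)) := by
  have hm : 0 ≤ m := (abs_nonneg x).trans hx
  rcases le_total s (4 * (1 + m)) with h | h
  · have : s / ((1 + X) * (1 + Y) * (1 + m)) ≤ 4 * (1 / (1 + X) * (1 / (1 + Y))) := by
      rw [div_le_iff₀ (by positivity)]
      have : 4 * (1 / (1 + X) * (1 / (1 + Y))) * ((1 + X) * (1 + Y) * (1 + m)) = 4 * (1 + m) := by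
        field_simp
      rw [this]; exact h
    have p : 0 ≤ 4 * ((1 + |x|) ^ (-(2/3) : ℝ) * (1 + |y|) ^ (-(2/3) : ℝ) * (1 + o) ^ (-(2/3) : ℝ)) := by positivity
    linarith
  · have k1 : s / ((1 + X) * (1 + Y) * (1 + m)) ≤ 2 * (1 / ((1 + s) * (1 + m))) := by
      rw [div_le_iff₀ (by positivity)]
      have e : 2 * (1 / ((1 + s) * (1 + m))) * ((1 + X) * (1 + Y) * (1 + m)) = 2 * ((1 + X) * (1 + Y)) / (1 + s) := by
        field_simp
      rw [e, le_div_iff₀ (by positivity)]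
      have a : 3/4 * (1 + s) ≤ 1 + X := by linarith
      have b : 3/4 * (1 + s) ≤ 1 + Y := by linarith
      have : (3/4 * (1 + s)) * (3/4 * (1 + s)) ≤ (1 + X) * (1 + Y) := by gcongr
      nlinarith
    have k2 : 1 / ((1 + s) * (1 + m)) ≤
        2 * ((1 + |x|) ^ (-(2/3) : ℝ) * (1 + |y|) ^ (-(2/3) : ℝ) * (1 + o) ^ (-(2/3) : ℝ)) := by
      rw [Real.rpow_neg (by positivity), Real.rpow_neg (by positivity), Real.rpow_neg (by positivity),
        ← mul_inv, ← mul_inv, ← div_eq_mul_inv, div_le_div_iff₀ (by positivity) (by positivity), one_mul]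
      have a1 : (1 + |x|) ^ (2/3 : ℝ) ≤ (1 + m) ^ (2/3 : ℝ) := by gcongr
      have a2 : (1 + |y|) ^ (2/3 : ℝ) ≤ (1 + m) ^ (2/3 : ℝ) := by gcongr
      have a3 : (1 + o) ^ (2/3 : ℝ) ≤ 2 * (1 + s) ^ (2/3 : ℝ) := by
        calc (1 + o) ^ (2/3 : ℝ) ≤ (2 * (1 + s)) ^ (2/3 : ℝ) := by gcongr; linarith
          _ = 2 ^ (2/3 : ℝ) * (1 + s) ^ (2/3 : ℝ) := Real.mul_rpow (by norm_num) (by positivity)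
          _ ≤ _ := by
            gcongr
            calc (2:ℝ) ^ (2/3 : ℝ) ≤ 2 ^ (1 : ℝ) := by
                  apply Real.rpow_le_rpow_of_exponent_le <;> norm_num
              _ = 2 := by norm_num
      have a4 : (1 + m) ^ (1/3 : ℝ) ≤ (1 + s) ^ (1/3 : ℝ) := by gcongr; linarith
      calc _ ≤ (1 + m) ^ (2/3 : ℝ) * (1 + m) ^ (2/3 : ℝ) * (2 * (1 + s) ^ (2/3 : ℝ)) := by gcongr
        _ = 2 * ((1 + m) * ((1 + m) ^ (1/3 : ℝ) * (1 + s) ^ (2/3 : ℝ))) := by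
          have : (1 + m) * (1 + m) ^ (1/3 : ℝ) = (1 + m) ^ (2/3 : ℝ) * (1 + m) ^ (2/3 : ℝ) := by
            rw [← Real.rpow_add (by positivity)]
            nth_rewrite 1 [← Real.rpow_one (1 + m)]
            rw [← Real.rpow_add (by positivity)]; norm_num
          rw [← this]; ring
        _ ≤ 2 * ((1 + m) * ((1 + s) ^ (1/3 : ℝ) * (1 + s) ^ (2/3 : ℝ))) := by gcongr
        _ = _ := by
          rw [← Real.rpow_add (by positivity)]; norm_num; ring
    have p : 0 ≤ 4 * (1 / (1 + X) * (1 / (1 + Y))) := by positivity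
    linarith

/-- quintic bounds: hypothesis bundle -/
structure QB (w : ℝ → ℝ) (M : (ℝ × ℝ) × ℝ → ℂ) (B : ℝ) : Prop where
  meas : Measurable M
  b0 : 0 ≤ B
  bd : ∀ x y z, ‖M ((x, y), z)‖ ≤ B * (1 / ((1 + |x + z|) * (1 + |y + z|) * (1 + max |x| |y|))) *
      (w x * w y * w z * w (x + y + z))

lemma L4_s1 {w : ℝ → ℝ} (hw : ∀ x, 1 ≤ w x) (hev : ∀ x, w (-x) = w x) {f1 f2 f3 f4 : ℝ → ℂ}
    {A : ℝ → ℝ≥0∞} (hA : Measurable A) (hAe : ∀ x, A (-x) = A x)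
    (m1 : Measurable f1) (m2 : Measurable f2) (m3 : Measurable f3)
    (m4 : Measurable f4) {S : ℝ≥0∞} (hS : S ≠ ∞)
    {M : (ℝ × ℝ) × ℝ → ℂ} {B : ℝ} (hM : QB w M B)
    (h1 : Wd w f1 (fun ξ => ENNReal.ofReal |ξ| * S)) (h2 : Wd w f2 A) (h3 : Wd w f3 A) (h4 : Wd w f4 A) :
    ‖L4 M f1 f2 f3 f4‖ₑ ≤ ENNReal.ofReal B * S * (c5 * n2 A ^ 3) := by
  have b0 := hM.b0
  refine (L4_bound hw hev m1 m2 m3 m4 h1 h2 h3 h4 hM.meas (fun x y z => by positivity) hM.bd).trans ?_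
  refine le_trans ?_ (mul_le_mul_right (P5_1 hA hAe) _)
  rw [← const_out (ENNReal.mul_ne_top ENNReal.ofReal_ne_top hS)]
  refine lintegral_mono fun x => lintegral_mono fun y => lintegral_mono fun z => ?_
  have key : ENNReal.ofReal (B * (1 / ((1 + |x + z|) * (1 + |y + z|) * (1 + max |x| |y|)))) * ENNReal.ofReal |x|
      ≤ ENNReal.ofReal B * (J 1 (x + z) * J 1 (y + z)) := by
    rw [J1_eq, J1_eq, ← ENNReal.ofReal_mul (by positivity), ← ENNReal.ofReal_mul (by positivity),
      ← ENNReal.ofReal_mul (by positivity)]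
    apply ENNReal.ofReal_le_ofReal
    rw [mul_assoc]
    refine mul_le_mul_of_nonneg_left ?_ b0
    have : |x| / (1 + max |x| |y|) ≤ 1 := by
      rw [div_le_one (by positivity)]; linarith [le_max_left |x| |y|]
    calc _ = 1 / (1 + |x + z|) * (1 / (1 + |y + z|)) * (|x| / (1 + max |x| |y|)) := by field_simp
      _ ≤ _ := mul_le_of_le_one_right (by positivity) this
  rw [hAe]
  calc _ = (ENNReal.ofReal (B * (1 / ((1 + |x + z|) * (1 + |y + z|) * (1 + max |x| |y|)))) * ENNReal.ofReal |x|) *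
      (S * (A y * A z * A (x + y + z))) := by ring
    _ ≤ (ENNReal.ofReal B * (J 1 (x + z) * J 1 (y + z))) * (S * (A y * A z * A (x + y + z))) := by gcongr
    _ = _ := by ring

lemma L4_s2 {w : ℝ → ℝ} (hw : ∀ x, 1 ≤ w x) (hev : ∀ x, w (-x) = w x) {f1 f2 f3 f4 : ℝ → ℂ}
    {A : ℝ → ℝ≥0∞} (hA : Measurable A) (hAe : ∀ x, A (-x) = A x)
    (m1 : Measurable f1) (m2 : Measurable f2) (m3 : Measurable f3)
    (m4 : Measurable f4) {S : ℝ≥0∞} (hS : S ≠ ∞)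
    {M : (ℝ × ℝ) × ℝ → ℂ} {B : ℝ} (hM : QB w M B)
    (h1 : Wd w f1 A) (h2 : Wd w f2 (fun ξ => ENNReal.ofReal |ξ| * S)) (h3 : Wd w f3 A) (h4 : Wd w f4 A) :
    ‖L4 M f1 f2 f3 f4‖ₑ ≤ ENNReal.ofReal B * S * (c5 * n2 A ^ 3) := by
  have b0 := hM.b0
  refine (L4_bound hw hev m1 m2 m3 m4 h1 h2 h3 h4 hM.meas (fun x y z => by positivity) hM.bd).trans ?_
  refine le_trans ?_ (mul_le_mul_right (P5_2 hA hAe) _)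
  rw [← const_out (ENNReal.mul_ne_top ENNReal.ofReal_ne_top hS)]
  refine lintegral_mono fun x => lintegral_mono fun y => lintegral_mono fun z => ?_
  have key : ENNReal.ofReal (B * (1 / ((1 + |x + z|) * (1 + |y + z|) * (1 + max |x| |y|)))) * ENNReal.ofReal |y|
      ≤ ENNReal.ofReal B * (J 1 (x + z) * J 1 (y + z)) := by
    rw [J1_eq, J1_eq, ← ENNReal.ofReal_mul (by positivity), ← ENNReal.ofReal_mul (by positivity),
      ← ENNReal.ofReal_mul (by positivity)]
    apply ENNReal.ofReal_le_ofReal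
    rw [mul_assoc]
    refine mul_le_mul_of_nonneg_left ?_ b0
    have : |y| / (1 + max |x| |y|) ≤ 1 := by
      rw [div_le_one (by positivity)]; linarith [le_max_right |x| |y|]
    calc _ = 1 / (1 + |x + z|) * (1 / (1 + |y + z|)) * (|y| / (1 + max |x| |y|)) := by field_simp
      _ ≤ _ := mul_le_of_le_one_right (by positivity) this
  rw [hAe]
  calc _ = (ENNReal.ofReal (B * (1 / ((1 + |x + z|) * (1 + |y + z|) * (1 + max |x| |y|)))) * ENNReal.ofReal |y|) *
      (S * (A x * A z * A (x + y + z))) := by ring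
    _ ≤ (ENNReal.ofReal B * (J 1 (x + z) * J 1 (y + z))) * (S * (A x * A z * A (x + y + z))) := by gcongr
    _ = _ := by ring

lemma slotE {B m s o x y X Y : ℝ} (hB : 0 ≤ B) (hs : 0 ≤ s) (hx : |x| ≤ m) (hy : |y| ≤ m)
    (hX : s - m ≤ |X|) (hY : s - m ≤ |Y|) (hos : |o| ≤ s + 2 * m) :
    ENNReal.ofReal (B * (1 / ((1 + |X|) * (1 + |Y|) * (1 + m)))) * ENNReal.ofReal s ≤
      ENNReal.ofReal B * 4 * (J 1 X * J 1 Y + J (2/3) x * J (2/3) y * J (2/3) o) := by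
  have hm : 0 ≤ m := (abs_nonneg x).trans hx
  have h := slot34 hs (abs_nonneg o) hx hy (abs_nonneg X) (abs_nonneg Y) hX hY hos
  rw [J1_eq, J1_eq]
  unfold J
  rw [show (4 : ℝ≥0∞) = ENNReal.ofReal 4 by norm_num, ← ENNReal.ofReal_mul (by positivity), ← ENNReal.ofReal_mul (by positivity),
    ← ENNReal.ofReal_mul (by positivity), ← ENNReal.ofReal_mul (by positivity), ← ENNReal.ofReal_mul (by positivity),
    ← ENNReal.ofReal_add (by positivity) (by positivity), ← ENNReal.ofReal_mul (by positivity)]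
  apply ENNReal.ofReal_le_ofReal
  calc _ = B * (s / ((1 + |X|) * (1 + |Y|) * (1 + m))) := by ring
    _ ≤ _ := mul_le_mul_of_nonneg_left h hB
    _ = _ := by ring

lemma L4_s3 {w : ℝ → ℝ} (hw : ∀ x, 1 ≤ w x) (hev : ∀ x, w (-x) = w x) {f1 f2 f3 f4 : ℝ → ℂ}
    {A : ℝ → ℝ≥0∞} (hA : Measurable A) (hAe : ∀ x, A (-x) = A x)
    (m1 : Measurable f1) (m2 : Measurable f2) (m3 : Measurable f3)
    (m4 : Measurable f4) {S : ℝ≥0∞} (hS : S ≠ ∞)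
    {M : (ℝ × ℝ) × ℝ → ℂ} {B : ℝ} (hM : QB w M B)
    (h1 : Wd w f1 A) (h2 : Wd w f2 A) (h3 : Wd w f3 (fun ξ => ENNReal.ofReal |ξ| * S)) (h4 : Wd w f4 A) :
    ‖L4 M f1 f2 f3 f4‖ₑ ≤ ENNReal.ofReal B * S * 4 * ((c5 + c6) * n2 A ^ 3) := by
  have b0 := hM.b0
  refine (L4_bound hw hev m1 m2 m3 m4 h1 h2 h3 h4 hM.meas (fun x y z => by positivity) hM.bd).trans ?_
  rw [add_mul]
  refine le_trans ?_ (mul_le_mul_right (add_le_add (P5_3 hA hAe) (Q5_3 hA)) _)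
  rw [← triple_add (by fun_prop), ← const_out (ENNReal.mul_ne_top (ENNReal.mul_ne_top ENNReal.ofReal_ne_top hS) (by simp))]
  refine lintegral_mono fun x => lintegral_mono fun y => lintegral_mono fun z => ?_
  have key := slotE (B := B) (m := max |x| |y|) (s := |z|) (o := x + y + z) (x := x) (y := y) (X := x + z) (Y := y + z)
    b0 (abs_nonneg z) (le_max_left _ _) (le_max_right _ _)
    (by have := abs_sub_abs_le_abs_sub z (-x); rw [abs_neg, sub_neg_eq_add, add_comm z x] at this
        linarith [le_max_left |x| |y|])
    (by have := abs_sub_abs_le_abs_sub z (-y); rw [abs_neg, sub_neg_eq_add, add_comm z y] at this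
        linarith [le_max_right |x| |y|])
    (by have := abs_add_three x y z; linarith [le_max_right |x| |y|, le_max_left |x| |y|])
  rw [hAe]
  calc _ = (ENNReal.ofReal (B * (1 / ((1 + |x + z|) * (1 + |y + z|) * (1 + max |x| |y|)))) * ENNReal.ofReal |z|) *
      (S * (A x * A y * A (x + y + z))) := by ring
    _ ≤ _ := mul_le_mul_left key _
    _ = _ := by ring

lemma L4_s4 {w : ℝ → ℝ} (hw : ∀ x, 1 ≤ w x) (hev : ∀ x, w (-x) = w x) {f1 f2 f3 f4 : ℝ → ℂ}
    {A : ℝ → ℝ≥0∞} (hA : Measurable A)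
    (m1 : Measurable f1) (m2 : Measurable f2) (m3 : Measurable f3)
    (m4 : Measurable f4) {S : ℝ≥0∞} (hS : S ≠ ∞)
    {M : (ℝ × ℝ) × ℝ → ℂ} {B : ℝ} (hM : QB w M B)
    (h1 : Wd w f1 A) (h2 : Wd w f2 A) (h3 : Wd w f3 A) (h4 : Wd w f4 (fun ξ => ENNReal.ofReal |ξ| * S)) :
    ‖L4 M f1 f2 f3 f4‖ₑ ≤ ENNReal.ofReal B * S * 4 * ((c5 + c6) * n2 A ^ 3) := by
  have b0 := hM.b0
  refine (L4_bound hw hev m1 m2 m3 m4 h1 h2 h3 h4 hM.meas (fun x y z => by positivity) hM.bd).trans ?_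
  rw [add_mul]
  refine le_trans ?_ (mul_le_mul_right (add_le_add (P5_4 hA) (Q5_4 hA)) _)
  rw [← triple_add (by fun_prop), ← const_out (ENNReal.mul_ne_top (ENNReal.mul_ne_top ENNReal.ofReal_ne_top hS) (by simp))]
  refine lintegral_mono fun x => lintegral_mono fun y => lintegral_mono fun z => ?_
  have key := slotE (B := B) (m := max |x| |y|) (s := |-(x + y + z)|) (o := z) (x := x) (y := y) (X := x + z) (Y := y + z)
    b0 (abs_nonneg _) (le_max_left _ _) (le_max_right _ _)
    (by have := abs_sub_abs_le_abs_sub (x + y + z) y; rw [show x + y + z - y = x + z by ring] at this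
        rw [abs_neg]
        linarith [le_max_right |x| |y|])
    (by have := abs_sub_abs_le_abs_sub (x + y + z) x; rw [show x + y + z - x = y + z by ring] at this
        rw [abs_neg]
        linarith [le_max_left |x| |y|])
    (by have := abs_add_three (x + y + z) (-x) (-y)
        rw [show x + y + z + -x + -y = z by ring, abs_neg, abs_neg] at this
        rw [abs_neg]
        linarith [le_max_right |x| |y|, le_max_left |x| |y|])
  calc _ = (ENNReal.ofReal (B * (1 / ((1 + |x + z|) * (1 + |y + z|) * (1 + max |x| |y|)))) * ENNReal.ofReal |-(x + y + z)|) *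
      (S * (A x * A y * A z)) := by ring
    _ ≤ _ := mul_le_mul_left key _
    _ = _ := by ring
end MB


namespace MB

lemma norm_le_of_enorm {E : Type*} [NormedAddCommGroup E] {z : E} {r : ℝ} (hr : 0 ≤ r)
    (h : ‖z‖ₑ ≤ ENNReal.ofReal r) : ‖z‖ ≤ r := by
  rw [← ofReal_norm] at h
  exact (ENNReal.ofReal_le_ofReal_iff hr).1 h

lemma L4_sub {B C1 C2 C3 C4 B' : ℝ} {f1 f2 f3 f4 : ℝ → ℂ} (h1 : Dec C1 f1) (h2 : Dec C2 f2)
    (h3 : Dec C3 f3) (h4 : Dec C4 f4)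
    {M M' : (ℝ × ℝ) × ℝ → ℂ} (hM : Measurable M) (hb : ∀ q, ‖M q‖ ≤ B)
    (hM' : Measurable M') (hb' : ∀ q, ‖M' q‖ ≤ B') :
    L4 M f1 f2 f3 f4 - L4 M' f1 f2 f3 f4 = L4 (fun q => M q - M' q) f1 f2 f3 f4 := by
  unfold L4
  rw [← integral_sub (Dec.int3 h1 h2 h3 h4 hM hb) (Dec.int3 h1 h2 h3 h4 hM' hb')]
  refine integral_congr_ae (Eventually.of_forall fun q => ?_)
  simp only
  ring

/-- second normal form multiplier -/
noncomputable def M4 (a1 a2 a3 a4 : ℝ) (K : ℝ × ℝ → ℂ) (q : (ℝ × ℝ) × ℝ) : ℂ :=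
  if 1 ≤ |q.1.1 + q.2| ∧ 1 ≤ |q.1.2 + q.2| then
    K q.1 / (Complex.I * ((H4 a1 a2 a3 a4 q.1.1 q.1.2 q.2 : ℝ) : ℂ)) else 0

lemma M4_meas {a1 a2 a3 a4 : ℝ} {K : ℝ × ℝ → ℂ} (hK : Measurable K) :
    Measurable (M4 a1 a2 a3 a4 K) := by
  unfold M4 H4
  refine Measurable.ite ?_ (by fun_prop) measurable_const
  have m1 : Measurable fun q : (ℝ × ℝ) × ℝ => |q.1.1 + q.2| := by fun_prop
  have m2 : Measurable fun q : (ℝ × ℝ) × ℝ => |q.1.2 + q.2| := by fun_prop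
  exact (measurableSet_le measurable_const m1).inter (measurableSet_le measurable_const m2)

section
variable {a1 a2 a3 a4 c D κ : ℝ} {w : ℝ → ℝ} {K : ℝ × ℝ → ℂ}

lemma M4_bound (hc : 0 < c)
    (hH : ∀ x y z, c * (|x + y| * |x + z| * |y + z|) ≤ |H4 a1 a2 a3 a4 x y z|)
    (hw : Wt κ w) (hD : 0 ≤ D)
    (hK : ∀ x y, ‖K (x, y)‖ ≤ D * (w x * w y * w (x + y)) * (|x + y| / (1 + max |x| |y|))) (x y z : ℝ) :
    ‖M4 a1 a2 a3 a4 K ((x, y), z)‖ ≤ 4 * D / c * (1 / ((1 + |x + z|) * (1 + |y + z|) * (1 + max |x| |y|))) *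
      (w x * w y * w z * w (x + y + z)) := by
  have w0 : ∀ x, 0 < w x := hw.pos
  have p1 := w0 x
  have p2 := w0 y
  have p3 := w0 z
  have p4 := w0 (x + y + z)
  have p5 := w0 (x + y)
  have hsub : w (x + y) ≤ w z * w (x + y + z) := by
    have := hw.sub (x + y + z) (-z)
    rw [hw.even, show x + y + z + -z = x + y by ring] at this
    linarith
  unfold M4
  simp only
  split_ifs with h
  · obtain ⟨hX, hY⟩ := h
    rw [norm_div, norm_mul, Complex.norm_I, one_mul, Complex.norm_real, Real.norm_eq_abs]
    rcases eq_or_ne (x + y) 0 with h0 | h0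
    · have := hK x y
      rw [h0] at this
      have : ‖K (x, y)‖ = 0 := by
        apply le_antisymm _ (norm_nonneg _)
        simpa using this
      rw [this]
      simp only [zero_div]
      positivity
    · have hs : 0 < |x + y| := abs_pos.2 h0
      have hm : 0 ≤ max |x| |y| := (abs_nonneg x).trans (le_max_left _ _)
      have hden : 0 < c * (|x + y| * |x + z| * |y + z|) := by positivity
      calc ‖K (x, y)‖ / |H4 a1 a2 a3 a4 x y z|
          ≤ (D * (w x * w y * w (x + y)) * (|x + y| / (1 + max |x| |y|))) /
            (c * (|x + y| * |x + z| * |y + z|)) := by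
            gcongr
            · exact hK x y
            · exact hH x y z
        _ = D / c * (w x * w y * w (x + y)) * (1 / (|x + z| * |y + z| * (1 + max |x| |y|))) := by
            field_simp
        _ ≤ D / c * (w x * w y * (w z * w (x + y + z))) *
            (4 * (1 / ((1 + |x + z|) * (1 + |y + z|) * (1 + max |x| |y|)))) := by
            refine mul_le_mul ?_ ?_ (by positivity) (by positivity)
            · refine mul_le_mul_of_nonneg_left ?_ (by positivity)
              exact mul_le_mul_of_nonneg_left hsub (by positivity)
            · rw [← mul_div_assoc, mul_one, div_le_div_iff₀ (by positivity) (by positivity), one_mul]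
              have : (1 + |x + z|) * (1 + |y + z|) ≤ (2 * |x + z|) * (2 * |y + z|) := by
                gcongr <;> linarith
              nlinarith
        _ = _ := by ring
  · rw [norm_zero]; positivity

lemma amgm {X Y m : ℝ} (hX : 0 ≤ X) (hY : 0 ≤ Y) (hm : 0 ≤ m) :
    1 / ((1 + X) * (1 + Y) * (1 + m)) ≤ 1 / (1 + X) ^ 2 + 1 / (1 + Y) ^ 2 := by
  have h1 : 1 / ((1 + X) * (1 + Y) * (1 + m)) ≤ 1 / ((1 + X) * (1 + Y)) := by
    apply one_div_le_one_div_of_le (by positivity)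
    exact le_mul_of_one_le_right (by positivity) (by linarith)
  have e : 1 / ((1 + X) * (1 + Y)) = (1 / (1 + X)) * (1 / (1 + Y)) := by field_simp
  have e1 : 1 / (1 + X) ^ 2 = (1 / (1 + X)) ^ 2 := by field_simp
  have e2 : 1 / (1 + Y) ^ 2 = (1 / (1 + Y)) ^ 2 := by field_simp
  rw [e1, e2]
  have p1 : 0 ≤ 1 / (1 + X) := by positivity
  have p2 : 0 ≤ 1 / (1 + Y) := by positivity
  nlinarith [sq_nonneg (1 / (1 + X) - 1 / (1 + Y))]

lemma Kres_bound (hc : 0 < c)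
    (hH : ∀ x y z, c * (|x + y| * |x + z| * |y + z|) ≤ |H4 a1 a2 a3 a4 x y z|)
    (hw : Wt κ w) (hD : 0 ≤ D)
    (hK : ∀ x y, ‖K (x, y)‖ ≤ D * (w x * w y * w (x + y)) * (|x + y| / (1 + max |x| |y|))) (x y z : ℝ) :
    ‖K (x, y) - Complex.I * ((H4 a1 a2 a3 a4 x y z : ℝ) : ℂ) * M4 a1 a2 a3 a4 K ((x, y), z)‖ ≤
      8 * D * (1 / (1 + |x + z|) ^ 2 + 1 / (1 + |y + z|) ^ 2) *
      (w x * w y * w z * w (x + y + z)) := by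
  have w0 : ∀ x, 0 < w x := hw.pos
  have p1 := w0 x
  have p2 := w0 y
  have p3 := w0 z
  have p4 := w0 (x + y + z)
  have p5 := w0 (x + y)
  have hsub : w (x + y) ≤ w z * w (x + y + z) := by
    have := hw.sub (x + y + z) (-z)
    rw [hw.even, show x + y + z + -z = x + y by ring] at this
    linarith
  unfold M4
  simp only
  split_ifs with h
  · have : K (x, y) - Complex.I * ((H4 a1 a2 a3 a4 x y z : ℝ) : ℂ) * (K (x, y) /
        (Complex.I * ((H4 a1 a2 a3 a4 x y z : ℝ) : ℂ))) = 0 := by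
      rcases eq_or_ne (x + y) 0 with h0 | h0
      · have := hK x y
        rw [h0] at this
        have : K (x, y) = 0 := by
          rw [← norm_le_zero_iff]
          simpa using this
        rw [this]; simp
      · have hs : 0 < |x + y| := abs_pos.2 h0
        obtain ⟨hX, hY⟩ := h
        have : H4 a1 a2 a3 a4 x y z ≠ 0 := by
          intro h1
          have := hH x y z
          rw [h1, abs_zero] at this
          have : 0 < c * (|x + y| * |x + z| * |y + z|) := by positivity
          linarith
        rw [mul_div_cancel₀, sub_self]
        exact mul_ne_zero Complex.I_ne_zero (by exact_mod_cast this)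
    rw [this, norm_zero]
    positivity
  · rw [mul_zero, sub_zero]
    have hm : 0 ≤ max |x| |y| := (abs_nonneg x).trans (le_max_left _ _)
    have h2 : |x + y| / (1 + max |x| |y|) ≤ 2 := by
      rw [div_le_iff₀ (by positivity)]
      linarith [abs_add_le x y, le_max_left |x| |y|, le_max_right |x| |y|]
    have h3 : 1/4 ≤ 1 / (1 + |x + z|) ^ 2 + 1 / (1 + |y + z|) ^ 2 := by
      have g : ∀ t : ℝ, 0 ≤ t → t < 1 → 1/4 ≤ 1 / (1 + t) ^ 2 := by
        intro t h0 h1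
        apply one_div_le_one_div_of_le (by positivity)
        nlinarith
      rcases not_and_or.1 h with h | h
      · have := g _ (abs_nonneg _) (not_le.1 h)
        have : 0 ≤ 1 / (1 + |y + z|) ^ 2 := by positivity
        linarith
      · have := g _ (abs_nonneg _) (not_le.1 h)
        have : 0 ≤ 1 / (1 + |x + z|) ^ 2 := by positivity
        linarith
    calc ‖K (x, y)‖ ≤ _ := hK x y
      _ ≤ D * (w x * w y * (w z * w (x + y + z))) * 2 := by
        refine mul_le_mul ?_ h2 (by positivity) (by positivity)
        refine mul_le_mul_of_nonneg_left ?_ hD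
        exact mul_le_mul_of_nonneg_left hsub (by positivity)
      _ = 8 * D * (1 / 4) * (w x * w y * w z * w (x + y + z)) := by ring
      _ ≤ _ := by
        refine mul_le_mul_of_nonneg_right ?_ (by positivity)
        exact mul_le_mul_of_nonneg_left h3 (by positivity)
end

/-- real constants -/
noncomputable def k2 : ℝ := (cJ 2).toReal
noncomputable def k5 : ℝ := c5.toReal
noncomputable def k6 : ℝ := c6.toReal
lemma k2_nn : 0 ≤ k2 := ENNReal.toReal_nonneg
lemma k5_nn : 0 ≤ k5 := ENNReal.toReal_nonneg
lemma k6_nn : 0 ≤ k6 := ENNReal.toReal_nonneg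
lemma k2_eq : cJ 2 = ENNReal.ofReal k2 := (ENNReal.ofReal_toReal (cJ_ne (by norm_num))).symm
lemma k5_eq : c5 = ENNReal.ofReal k5 := (ENNReal.ofReal_toReal c5_ne).symm
lemma k6_eq : c6 = ENNReal.ofReal k6 := (ENNReal.ofReal_toReal c6_ne).symm

/-- the abstract quartic lemma -/
lemma quartic {a1 a2 a3 a4 c : ℝ} (hc : 0 < c)
    (hH : ∀ x y z, c * (|x + y| * |x + z| * |y + z|) ≤ |H4 a1 a2 a3 a4 x y z|) :
    ∃ C > 0, ∀ (α β κ D N : ℝ) (w : ℝ → ℝ) (K : ℝ × ℝ → ℂ) (A : ℝ → ℝ → ℝ≥0∞)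
      (f1 n1 f2 n2' f3 n3 f4 n4 : ℝ → ℝ → ℂ), Wt κ w → 0 ≤ D → 0 ≤ N → Measurable K →
      (∀ x y, ‖K (x, y)‖ ≤ D * (w x * w y * w (x + y)) * (|x + y| / (1 + max |x| |y|))) →
      Comp α β a1 f1 n1 → Comp α β a2 f2 n2' → Comp α β a3 f3 n3 → Comp α β a4 f4 n4 →
      (∀ t ∈ Icc α β, Measurable (A t) ∧ (∀ x, A t (-x) = A t x) ∧ n2 (A t) ≤ ENNReal.ofReal N ∧
        (Wd w (f1 t) (A t) ∧ Wd w (f2 t) (A t) ∧ Wd w (f3 t) (A t) ∧ Wd w (f4 t) (A t)) ∧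
        (Wd w (n1 t) (fun ξ => ENNReal.ofReal |ξ| * n2 (A t) ^ 2) ∧
         Wd w (n2' t) (fun ξ => ENNReal.ofReal |ξ| * n2 (A t) ^ 2) ∧
         Wd w (n3 t) (fun ξ => ENNReal.ofReal |ξ| * n2 (A t) ^ 2) ∧
         Wd w (n4 t) (fun ξ => ENNReal.ofReal |ξ| * n2 (A t) ^ 2))) →
      ∃ R R' : ℝ → ℂ, ContinuousOn R (Icc α β) ∧ (∀ t ∈ Ioo α β, HasDerivAt R (R' t) t) ∧
        (∀ t ∈ Icc α β, ‖R t‖ ≤ C * D * N ^ 4) ∧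
        ∀ t ∈ Ioo α β, ‖L4 (fun q => K q.1) (f1 t) (f2 t) (f3 t) (f4 t) - R' t‖ ≤
          C * D * (N ^ 4 + N ^ 5) := by
  have hk2 := k2_nn
  have hk5 := k5_nn
  have hk6 := k6_nn
  refine ⟨1 + 4 / c * (2 * k2) + 8 * (2 * k2) + 4 / c * (k5 + k5 + 8 * (k5 + k6)), by positivity, ?_⟩
  intro α β κ D N w K A f1 n1 f2 n2' f3 n3 f4 n4 hw hD hN hKm hK h1 h2 h3 h4 hA
  obtain ⟨Bw, hBw⟩ := hw.bdd
  have w0 : ∀ x, 0 < w x := hw.pos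
  have hBw0 : 0 < Bw := (w0 0).trans_le (hBw 0)
  set M := M4 a1 a2 a3 a4 K with hMdef
  have hMm : Measurable M := M4_meas hKm
  have hMb := M4_bound hc hH hw hD hK
  have hQB : QB w M (4 * D / c) := ⟨hMm, by positivity, hMb⟩
  have hprod : ∀ x y z, w x * w y * w z * w (x + y + z) ≤ Bw ^ 4 := by
    intro x y z
    have := w0 x; have := w0 y; have := w0 z; have := w0 (x + y + z)
    calc _ ≤ Bw * Bw * Bw * Bw := by
          gcongr <;> apply hBw
      _ = _ := by ring
  have hMbd : ∀ q, ‖M q‖ ≤ 4 * D / c * 1 * Bw ^ 4 := by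
    rintro ⟨⟨x, y⟩, z⟩
    refine (hMb x y z).trans ?_
    have hm : 0 ≤ max |x| |y| := (abs_nonneg x).trans (le_max_left _ _)
    have := w0 x; have := w0 y; have := w0 z; have := w0 (x + y + z)
    refine mul_le_mul (mul_le_mul_of_nonneg_left ?_ (by positivity)) (hprod x y z) (by positivity) (by positivity)
    rw [div_le_one (by positivity)]
    exact one_le_mul_of_one_le_of_one_le (one_le_mul_of_one_le_of_one_le (by linarith [abs_nonneg (x+z)])
      (by linarith [abs_nonneg (y+z)])) (by linarith)
  obtain ⟨hct, hder⟩ := L4_deriv h1 h2 h3 h4 hMm hMbd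
  refine ⟨_, _, hct, hder, ?_, ?_⟩
  · intro t ht
    obtain ⟨Am, Ae, AN, ⟨d1, d2, d3, d4⟩, -⟩ := hA t ht
    obtain ⟨C1, -, k1⟩ := h1.dec
    obtain ⟨C2, -, k2'⟩ := h2.dec
    obtain ⟨C3, -, k3⟩ := h3.dec
    obtain ⟨C4, -, k4⟩ := h4.dec
    have q := L4_quart hw.one hw.even Am Ae (k1 t ht).1.1 (k2' t ht).1.1 (k3 t ht).1.1 (k4 t ht).1.1
      d1 d2 d3 d4 hMm (B := 4 * D / c) (by positivity) (fun x y z => (hMb x y z).trans (by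
        have := w0 x; have := w0 y; have := w0 z; have := w0 (x + y + z)
        refine mul_le_mul_of_nonneg_right ?_ (by positivity)
        refine mul_le_mul_of_nonneg_left ?_ (by positivity)
        exact amgm (abs_nonneg _) (abs_nonneg _) ((abs_nonneg x).trans (le_max_left _ _))))
    have q' : ‖L4 M (f1 t) (f2 t) (f3 t) (f4 t)‖ₑ ≤ ENNReal.ofReal (4 * D / c * (2 * k2) * N ^ 4) := by
      refine q.trans ?_
      rw [ENNReal.ofReal_mul (by positivity), ENNReal.ofReal_mul (by positivity), ENNReal.ofReal_mul (by positivity),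
        ENNReal.ofReal_pow hN, ← k2_eq, show ENNReal.ofReal 2 = 2 by norm_num]
      gcongr
    refine (norm_le_of_enorm (by positivity) q').trans ?_
    have e : 4 * D / c * (2 * k2) * N ^ 4 = (4 / c * (2 * k2)) * D * N ^ 4 := by ring
    rw [e]
    refine mul_le_mul_of_nonneg_right ?_ (by positivity)
    refine mul_le_mul_of_nonneg_right ?_ hD
    have : 0 ≤ 4 / c * (k5 + k5 + 8 * (k5 + k6)) := by positivity
    linarith
  · intro t ht'
    have ht := Ioo_subset_Icc_self ht'
    obtain ⟨Am, Ae, AN, ⟨d1, d2, d3, d4⟩, ⟨e1, e2, e3, e4⟩⟩ := hA t ht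
    obtain ⟨C1, -, kk1⟩ := h1.dec
    obtain ⟨C2, -, kk2⟩ := h2.dec
    obtain ⟨C3, -, kk3⟩ := h3.dec
    obtain ⟨C4, -, kk4⟩ := h4.dec
    obtain ⟨u1, v1, -⟩ := kk1 t ht
    obtain ⟨u2, v2, -⟩ := kk2 t ht
    obtain ⟨u3, v3, -⟩ := kk3 t ht
    obtain ⟨u4, v4, -⟩ := kk4 t ht
    have hS : n2 (A t) ^ 2 ≠ ∞ := ENNReal.pow_ne_top (ne_top_of_le_ne_top ENNReal.ofReal_ne_top AN)
    have hKb : ∀ q : (ℝ × ℝ) × ℝ, ‖K q.1‖ ≤ D * (Bw * Bw * Bw) * 2 := by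
      rintro ⟨⟨x, y⟩, z⟩
      refine (hK x y).trans ?_
      have hm : 0 ≤ max |x| |y| := (abs_nonneg x).trans (le_max_left _ _)
      have := w0 x; have := w0 y; have := w0 (x + y)
      refine mul_le_mul (mul_le_mul_of_nonneg_left ?_ hD) ?_ (by positivity) (by positivity)
      · gcongr <;> apply hBw
      · rw [div_le_iff₀ (by positivity)]
        linarith [abs_add_le x y, le_max_left |x| |y|, le_max_right |x| |y|]
    have hres := Kres_bound hc hH hw hD hK
    have hHm : Measurable fun q : (ℝ × ℝ) × ℝ => Complex.I * ((H4 a1 a2 a3 a4 q.1.1 q.1.2 q.2 : ℝ) : ℂ) * M q := by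
      refine Measurable.mul ?_ hMm
      unfold H4; fun_prop
    have hresb : ∀ q : (ℝ × ℝ) × ℝ, ‖K q.1 - Complex.I * ((H4 a1 a2 a3 a4 q.1.1 q.1.2 q.2 : ℝ) : ℂ) * M q‖ ≤
        8 * D * 2 * Bw ^ 4 := by
      rintro ⟨⟨x, y⟩, z⟩
      refine (hres x y z).trans ?_
      have := w0 x; have := w0 y; have := w0 z; have := w0 (x + y + z)
      refine mul_le_mul (mul_le_mul_of_nonneg_left ?_ (by positivity)) (hprod x y z) (by positivity) (by positivity)
      have g : ∀ t : ℝ, 0 ≤ t → 1 / (1 + t) ^ 2 ≤ 1 := by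
        intro t h0
        rw [div_le_one (by positivity)]
        nlinarith
      linarith [g _ (abs_nonneg (x + z)), g _ (abs_nonneg (y + z))]
    have hHb : ∀ q : (ℝ × ℝ) × ℝ, ‖Complex.I * ((H4 a1 a2 a3 a4 q.1.1 q.1.2 q.2 : ℝ) : ℂ) * M q‖ ≤
        D * (Bw * Bw * Bw) * 2 + 8 * D * 2 * Bw ^ 4 := by
      intro q
      have := norm_sub_le (K q.1) (K q.1 - Complex.I * ((H4 a1 a2 a3 a4 q.1.1 q.1.2 q.2 : ℝ) : ℂ) * M q)
      rw [sub_sub_cancel] at this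
      linarith [hKb q, hresb q]
    have split : L4 (fun q => K q.1) (f1 t) (f2 t) (f3 t) (f4 t) -
        L4 (fun q => Complex.I * ((H4 a1 a2 a3 a4 q.1.1 q.1.2 q.2 : ℝ) : ℂ) * M q) (f1 t) (f2 t) (f3 t) (f4 t) =
        L4 (fun q => K q.1 - Complex.I * ((H4 a1 a2 a3 a4 q.1.1 q.1.2 q.2 : ℝ) : ℂ) * M q) (f1 t) (f2 t) (f3 t) (f4 t) :=
      L4_sub u1 u2 u3 u4 (hKm.comp measurable_fst) hKb hHm hHb
    have q0 := L4_quart hw.one hw.even Am Ae u1.1 u2.1 u3.1 u4.1 d1 d2 d3 d4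
      ((hKm.comp measurable_fst).sub hHm) (B := 8 * D) (by positivity) hres
    have s1 := L4_s1 hw.one hw.even Am Ae v1.1 u2.1 u3.1 u4.1 hS hQB e1 d2 d3 d4
    have s2 := L4_s2 hw.one hw.even Am Ae u1.1 v2.1 u3.1 u4.1 hS hQB d1 e2 d3 d4
    have s3 := L4_s3 hw.one hw.even Am Ae u1.1 u2.1 v3.1 u4.1 hS hQB d1 d2 e3 d4
    have s4 := L4_s4 hw.one hw.even Am u1.1 u2.1 u3.1 v4.1 hS hQB d1 d2 d3 e4
    have q0' : ‖L4 (fun q => K q.1 - Complex.I * ((H4 a1 a2 a3 a4 q.1.1 q.1.2 q.2 : ℝ) : ℂ) * M q) (f1 t) (f2 t) (f3 t) (f4 t)‖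
        ≤ 8 * D * (2 * k2) * N ^ 4 := by
      refine norm_le_of_enorm (by positivity) (q0.trans ?_)
      rw [ENNReal.ofReal_mul (p := 8 * D * (2 * k2)) (by positivity), ENNReal.ofReal_mul (p := 8 * D) (by positivity), ENNReal.ofReal_mul (p := 2) (by positivity),
        ENNReal.ofReal_pow hN, ← k2_eq, show ENNReal.ofReal 2 = 2 by norm_num]
      gcongr
    have b5 : ENNReal.ofReal (4 * D / c) * n2 (A t) ^ 2 * (c5 * n2 (A t) ^ 3) ≤
        ENNReal.ofReal (4 * D / c * N ^ 2 * (k5 * N ^ 3)) := by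
      rw [ENNReal.ofReal_mul (by positivity), ENNReal.ofReal_mul (by positivity), ENNReal.ofReal_mul (p := k5) (by positivity),
        ENNReal.ofReal_pow hN, ENNReal.ofReal_pow hN, ← k5_eq]
      gcongr
    have b6 : ENNReal.ofReal (4 * D / c) * n2 (A t) ^ 2 * 4 * ((c5 + c6) * n2 (A t) ^ 3) ≤
        ENNReal.ofReal (4 * D / c * N ^ 2 * 4 * ((k5 + k6) * N ^ 3)) := by
      rw [ENNReal.ofReal_mul (by positivity), ENNReal.ofReal_mul (by positivity), ENNReal.ofReal_mul (by positivity),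
        ENNReal.ofReal_mul (p := k5 + k6) (by positivity), ENNReal.ofReal_add hk5 hk6,
        ENNReal.ofReal_pow hN, ENNReal.ofReal_pow hN, ← k5_eq, ← k6_eq, show ENNReal.ofReal 4 = 4 by norm_num]
      gcongr
    have s1' := norm_le_of_enorm (by positivity) (s1.trans b5)
    have s2' := norm_le_of_enorm (by positivity) (s2.trans b5)
    have s3' := norm_le_of_enorm (by positivity) (s3.trans b6)
    have s4' := norm_le_of_enorm (by positivity) (s4.trans b6)
    set P := L4 (fun q => Complex.I * ((H4 a1 a2 a3 a4 q.1.1 q.1.2 q.2 : ℝ) : ℂ) * M q) (f1 t) (f2 t) (f3 t) (f4 t)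
    have e : ∀ k P z1 z2 z3 z4 : ℂ, k - (P + z1 + z2 + z3 + z4) = (k - P) - z1 - z2 - z3 - z4 := by
      intros; ring
    rw [e, split]
    refine (norm_sub_le _ _).trans ?_
    have t1 := norm_sub_le (L4 (fun q => K q.1 - Complex.I * ((H4 a1 a2 a3 a4 q.1.1 q.1.2 q.2 : ℝ) : ℂ) * M q) (f1 t) (f2 t) (f3 t) (f4 t) - L4 M (n1 t) (f2 t) (f3 t) (f4 t) - L4 M (f1 t) (n2' t) (f3 t) (f4 t)) (L4 M (f1 t) (f2 t) (n3 t) (f4 t))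
    have t2 := norm_sub_le (L4 (fun q => K q.1 - Complex.I * ((H4 a1 a2 a3 a4 q.1.1 q.1.2 q.2 : ℝ) : ℂ) * M q) (f1 t) (f2 t) (f3 t) (f4 t) - L4 M (n1 t) (f2 t) (f3 t) (f4 t)) (L4 M (f1 t) (n2' t) (f3 t) (f4 t))
    have t3 := norm_sub_le (L4 (fun q => K q.1 - Complex.I * ((H4 a1 a2 a3 a4 q.1.1 q.1.2 q.2 : ℝ) : ℂ) * M q) (f1 t) (f2 t) (f3 t) (f4 t)) (L4 M (n1 t) (f2 t) (f3 t) (f4 t))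
    have tot : 8 * D * (2 * k2) * N ^ 4 + (4 * D / c * N ^ 2 * (k5 * N ^ 3) + 4 * D / c * N ^ 2 * (k5 * N ^ 3) +
        4 * D / c * N ^ 2 * 4 * ((k5 + k6) * N ^ 3) + 4 * D / c * N ^ 2 * 4 * ((k5 + k6) * N ^ 3)) ≤
        (1 + 4 / c * (2 * k2) + 8 * (2 * k2) + 4 / c * (k5 + k5 + 8 * (k5 + k6))) * D * (N ^ 4 + N ^ 5) := by
      have r1 : 0 ≤ D * N ^ 4 * (1 + 4 / c * (2 * k2) + 4 / c * (k5 + k5 + 8 * (k5 + k6))) := by positivity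
      have r2 : 0 ≤ D * N ^ 5 * (1 + 4 / c * (2 * k2) + 8 * (2 * k2)) := by positivity
      have : (1 + 4 / c * (2 * k2) + 8 * (2 * k2) + 4 / c * (k5 + k5 + 8 * (k5 + k6))) * D * (N ^ 4 + N ^ 5) =
        8 * D * (2 * k2) * N ^ 4 + (4 * D / c * N ^ 2 * (k5 * N ^ 3) + 4 * D / c * N ^ 2 * (k5 * N ^ 3) +
        4 * D / c * N ^ 2 * 4 * ((k5 + k6) * N ^ 3) + 4 * D / c * N ^ 2 * 4 * ((k5 + k6) * N ^ 3)) +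
        D * N ^ 4 * (1 + 4 / c * (2 * k2) + 4 / c * (k5 + k5 + 8 * (k5 + k6))) +
        D * N ^ 5 * (1 + 4 / c * (2 * k2) + 8 * (2 * k2)) := by ring
      linarith
    linarith
end MB


namespace MB

noncomputable def cv (f g : ℝ → ℂ) (ξ : ℝ) : ℂ := ∫ η, f η * g (ξ - η)
noncomputable def nP (q : ℝ → ℂ) (ξ : ℝ) : ℂ := -(Complex.I * ξ / 2) * cv q q ξ
noncomputable def nQ (p q : ℝ → ℂ) (ξ : ℝ) : ℂ := -(Complex.I * ξ) * cv p q ξ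

/-- Fourier-side solution on a time interval -/
structure FS (a α β : ℝ) (p q : ℝ → ℝ → ℂ) : Prop where
  mp : ∀ t ∈ Icc α β, Measurable (p t)
  mq : ∀ t ∈ Icc α β, Measurable (q t)
  cp : ∀ t ∈ Icc α β, ∀ ξ, p t (-ξ) = (starRingEnd ℂ) (p t ξ)
  cq : ∀ t ∈ Icc α β, ∀ ξ, q t (-ξ) = (starRingEnd ℂ) (q t ξ)
  dec : ∃ C, 0 ≤ C ∧ ∀ t ∈ Icc α β, ∀ ξ, ‖p t ξ‖ ≤ C / (1 + |ξ|) ^ 6 ∧ ‖q t ξ‖ ≤ C / (1 + |ξ|) ^ 6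
  ctp : ∀ ξ, ContinuousOn (fun t => p t ξ) (Icc α β)
  ctq : ∀ ξ, ContinuousOn (fun t => q t ξ) (Icc α β)
  dep : ∀ ξ, ∀ t ∈ Ioo α β,
    HasDerivAt (fun t => p t ξ) (Complex.I * (1 : ℝ) * ξ ^ 3 * p t ξ + nP (q t) ξ) t
  deq : ∀ ξ, ∀ t ∈ Ioo α β,
    HasDerivAt (fun t => q t ξ) (Complex.I * a * ξ ^ 3 * q t ξ + nQ (p t) (q t) ξ) t

lemma FS.mono {a α β α' β' : ℝ} {p q : ℝ → ℝ → ℂ} (h : FS a α β p q) (h1 : α ≤ α') (h2 : β' ≤ β) :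
    FS a α' β' p q := by
  have s1 : Icc α' β' ⊆ Icc α β := Icc_subset_Icc h1 h2
  have s2 : Ioo α' β' ⊆ Ioo α β := Ioo_subset_Ioo h1 h2
  obtain ⟨C, hC, hd⟩ := h.dec
  exact ⟨fun t ht => h.mp t (s1 ht), fun t ht => h.mq t (s1 ht), fun t ht => h.cp t (s1 ht),
    fun t ht => h.cq t (s1 ht), ⟨C, hC, fun t ht => hd t (s1 ht)⟩, fun ξ => (h.ctp ξ).mono s1,
    fun ξ => (h.ctq ξ).mono s1, fun ξ t ht => h.dep ξ t (s2 ht), fun ξ t ht => h.deq ξ t (s2 ht)⟩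

lemma br_tri (x y : ℝ) : 1 + |x| ≤ (1 + |y|) * (1 + |x - y|) := by
  have := abs_add_le y (x - y)
  rw [add_sub_cancel] at this
  nlinarith [abs_nonneg y, abs_nonneg (x - y)]

lemma cv_meas {f g : ℝ → ℂ} (hf : Measurable f) (hg : Measurable g) : Measurable (cv f g) := by
  unfold cv
  have : StronglyMeasurable (Function.uncurry fun ξ η => f η * g (ξ - η)) :=
    (by unfold Function.uncurry; fun_prop : Measurable (Function.uncurry fun ξ η => f η * g (ξ - η))).stronglyMeasurable
  exact this.integral_prod_right.measurable

/-- integral constant -/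
noncomputable def i2 : ℝ := ∫ x : ℝ, 1 / (1 + |x|) ^ 2
lemma i2_nn : 0 ≤ i2 := integral_nonneg fun x => by positivity

lemma cv_dec {f g : ℝ → ℂ} {C : ℝ} (hC : 0 ≤ C) (hf : ∀ ξ, ‖f ξ‖ ≤ C / (1 + |ξ|) ^ 6)
    (hg : ∀ ξ, ‖g ξ‖ ≤ C / (1 + |ξ|) ^ 6) (ξ : ℝ) : ‖cv f g ξ‖ ≤ C ^ 2 * i2 / (1 + |ξ|) ^ 4 := by
  unfold cv
  have key : ∀ η, ‖f η * g (ξ - η)‖ ≤ C ^ 2 / (1 + |ξ|) ^ 4 * (1 / (1 + |η|) ^ 2) := by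
    intro η
    rw [norm_mul]
    calc _ ≤ (C / (1 + |η|) ^ 6) * (C / (1 + |ξ - η|) ^ 6) :=
          mul_le_mul (hf _) (hg _) (norm_nonneg _) (by positivity)
      _ = C ^ 2 * (1 / ((1 + |η|) ^ 2 * ((1 + |ξ - η|) ^ 2 * ((1 + |η|) * (1 + |ξ - η|)) ^ 4))) := by
          field_simp
      _ ≤ C ^ 2 * (1 / ((1 + |η|) ^ 2 * (1 * (1 + |ξ|) ^ 4))) := by
          refine mul_le_mul_of_nonneg_left ?_ (by positivity)
          apply one_div_le_one_div_of_le (by positivity)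
          have h1 : (1 + |ξ|) ^ 4 ≤ ((1 + |η|) * (1 + |ξ - η|)) ^ 4 :=
            pow_le_pow_left₀ (by positivity) (br_tri ξ η) 4
          have h2 : 1 ≤ (1 + |ξ - η|) ^ 2 := one_le_pow₀ (by linarith [abs_nonneg (ξ - η)])
          refine mul_le_mul_of_nonneg_left ?_ (by positivity)
          exact mul_le_mul h2 h1 (by positivity) (by positivity)
      _ = _ := by field_simp
  refine (norm_integral_le_of_norm_le (int1.const_mul _) (Eventually.of_forall key)).trans ?_
  rw [integral_const_mul]
  unfold i2
  apply le_of_eq; ring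

lemma dec_of {f : ℝ → ℂ} {C : ℝ} (hm : Measurable f) (hC : 0 ≤ C) (h : ∀ ξ, ‖f ξ‖ ≤ C / (1 + |ξ|) ^ 6) :
    Dec C f := by
  refine ⟨hm, fun ξ => (h ξ).trans ?_⟩
  refine div_le_div_of_nonneg_left hC (by positivity) ?_
  exact pow_le_pow_right₀ (by linarith [abs_nonneg ξ]) (by norm_num)

lemma n_dec {f g : ℝ → ℂ} {C : ℝ} (hC : 0 ≤ C) (mf : Measurable f) (mg : Measurable g)
    (hf : ∀ ξ, ‖f ξ‖ ≤ C / (1 + |ξ|) ^ 6) (hg : ∀ ξ, ‖g ξ‖ ≤ C / (1 + |ξ|) ^ 6)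
    {k : ℂ} (hk : ‖k‖ ≤ 1) : Dec (C ^ 2 * i2) (fun ξ => k * ξ * cv f g ξ) := by
  refine ⟨by have := cv_meas mf mg; fun_prop, fun ξ => ?_⟩
  rw [norm_mul, norm_mul, Complex.norm_real, Real.norm_eq_abs]
  have := i2_nn
  calc ‖k‖ * |ξ| * ‖cv f g ξ‖ ≤ 1 * (1 + |ξ|) * (C ^ 2 * i2 / (1 + |ξ|) ^ 4) := by
        refine mul_le_mul (mul_le_mul hk (by linarith) (abs_nonneg _) zero_le_one) (cv_dec hC hf hg ξ)
          (norm_nonneg _) (by positivity)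
    _ = _ := by field_simp

lemma ph_dec {f n : ℝ → ℂ} {C C' a : ℝ} (hC : 0 ≤ C) (mf : Measurable f)
    (hf : ∀ ξ, ‖f ξ‖ ≤ C / (1 + |ξ|) ^ 6) (hn : Dec C' n) :
    Dec (|a| * C + C') (fun ξ => Complex.I * a * ξ ^ 3 * f ξ + n ξ) := by
  refine ⟨by have := hn.1; fun_prop, fun ξ => ?_⟩
  refine (norm_add_le _ _).trans ?_
  rw [add_div]
  refine add_le_add ?_ (hn.2 ξ)
  rw [norm_mul, norm_mul, norm_mul, Complex.norm_I, one_mul, Complex.norm_real, Real.norm_eq_abs, norm_pow,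
    Complex.norm_real, Real.norm_eq_abs]
  calc |a| * |ξ| ^ 3 * ‖f ξ‖ ≤ |a| * (1 + |ξ|) ^ 3 * (C / (1 + |ξ|) ^ 6) := by
        refine mul_le_mul (mul_le_mul_of_nonneg_left ?_ (abs_nonneg _)) (hf ξ) (norm_nonneg _) (by positivity)
        exact pow_le_pow_left₀ (abs_nonneg _) (by linarith) 3
    _ = _ := by field_simp

lemma Dec.mono {C C' : ℝ} {f : ℝ → ℂ} (h : Dec C f) (hc : C ≤ C') : Dec C' f :=
  ⟨h.1, fun ξ => (h.2 ξ).trans (div_le_div_of_nonneg_right hc (by positivity))⟩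

lemma nP_eq (q : ℝ → ℂ) : nP q = fun ξ : ℝ => (-(Complex.I / 2)) * ξ * cv q q ξ := by
  funext ξ; unfold nP; ring
lemma nQ_eq (p q : ℝ → ℂ) : nQ p q = fun ξ : ℝ => (-Complex.I) * ξ * cv p q ξ := by
  funext ξ; unfold nQ; ring
lemma nI : ‖(-(Complex.I / 2))‖ ≤ 1 := by
  rw [norm_neg, norm_div, Complex.norm_I]; norm_num
lemma nI' : ‖(-Complex.I)‖ ≤ 1 := by
  rw [norm_neg, Complex.norm_I]

lemma FS.compP {a α β : ℝ} {p q : ℝ → ℝ → ℂ} (h : FS a α β p q) :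
    Comp α β 1 p (fun t => nP (q t)) := by
  obtain ⟨C, hC, hd⟩ := h.dec
  have := i2_nn
  refine ⟨⟨C + C ^ 2 * i2, by positivity, fun t ht => ?_⟩, h.ctp, h.dep⟩
  have n := n_dec (k := -(Complex.I / 2)) hC (h.mq t ht) (h.mq t ht) (fun ξ => (hd t ht ξ).2) (fun ξ => (hd t ht ξ).2) nI
  rw [← nP_eq] at n
  have m := ph_dec (a := 1) hC (h.mp t ht) (fun ξ => (hd t ht ξ).1) n
  rw [abs_one, one_mul] at m
  have p1 : 0 ≤ C ^ 2 * i2 := by positivity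
  exact ⟨(dec_of (h.mp t ht) hC (fun ξ => (hd t ht ξ).1)).mono (by linarith), n.mono (by linarith), m⟩

lemma FS.compQ {a α β : ℝ} {p q : ℝ → ℝ → ℂ} (h : FS a α β p q) :
    Comp α β a q (fun t => nQ (p t) (q t)) := by
  obtain ⟨C, hC, hd⟩ := h.dec
  have := i2_nn
  refine ⟨⟨|a| * C + C + C ^ 2 * i2, by positivity, fun t ht => ?_⟩, h.ctq, h.deq⟩
  have n := n_dec (k := -Complex.I) hC (h.mp t ht) (h.mq t ht) (fun ξ => (hd t ht ξ).1) (fun ξ => (hd t ht ξ).2) nI'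
  rw [← nQ_eq] at n
  have m := ph_dec (a := a) hC (h.mq t ht) (fun ξ => (hd t ht ξ).2) n
  have p1 : 0 ≤ C ^ 2 * i2 := by positivity
  have p2 : 0 ≤ |a| * C := by positivity
  exact ⟨(dec_of (h.mq t ht) hC (fun ξ => (hd t ht ξ).2)).mono (by linarith), n.mono (by linarith), m.mono (by linarith)⟩

/-- weighted amplitude -/
noncomputable def Am (w : ℝ → ℝ) (p q : ℝ → ℂ) (ξ : ℝ) : ℝ≥0∞ :=
  ENNReal.ofReal (w ξ) * (‖p ξ‖ₑ + ‖q ξ‖ₑ)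

lemma Am_meas {w : ℝ → ℝ} {p q : ℝ → ℂ} (hw : Measurable w) (hp : Measurable p) (hq : Measurable q) :
    Measurable (Am w p q) := by unfold Am; fun_prop

lemma Am_p (w : ℝ → ℝ) (p q : ℝ → ℂ) : Wd w p (Am w p q) := fun ξ => by
  unfold Am; exact mul_le_mul_right (le_self_add) _
lemma Am_q (w : ℝ → ℝ) (p q : ℝ → ℂ) : Wd w q (Am w p q) := fun ξ => by
  unfold Am; exact mul_le_mul_right (le_add_self) _

lemma Am_even {w : ℝ → ℝ} (hw : ∀ x, w (-x) = w x) {p q : ℝ → ℂ}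
    (hp : ∀ ξ, p (-ξ) = (starRingEnd ℂ) (p ξ)) (hq : ∀ ξ, q (-ξ) = (starRingEnd ℂ) (q ξ)) (ξ : ℝ) :
    Am w p q (-ξ) = Am w p q ξ := by
  unfold Am
  rw [hw, hp, hq]
  have e : ∀ z : ℂ, ‖(starRingEnd ℂ) z‖ₑ = ‖z‖ₑ := fun z => by
    rw [← ofReal_norm, ← ofReal_norm, Complex.norm_conj]
  rw [e, e]

lemma Wd_cv {κ : ℝ} {w : ℝ → ℝ} (hw : Wt κ w) {f g : ℝ → ℂ} {A : ℝ → ℝ≥0∞} (hA : Measurable A)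
    (hf : Wd w f A) (hg : Wd w g A) (ξ : ℝ) :
    ENNReal.ofReal (w ξ) * ‖cv f g ξ‖ₑ ≤ ∫⁻ η, A η * A (ξ - η) := by
  unfold cv
  calc _ ≤ ENNReal.ofReal (w ξ) * ∫⁻ η, ‖f η * g (ξ - η)‖ₑ :=
        mul_le_mul_right (enorm_integral_le_lintegral_enorm _) _
    _ = ∫⁻ η, ENNReal.ofReal (w ξ) * ‖f η * g (ξ - η)‖ₑ :=
        (lintegral_const_mul' _ _ ENNReal.ofReal_ne_top).symm
    _ ≤ _ := by
      refine lintegral_mono fun η => ?_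
      have h1 : w ξ ≤ w η * w (ξ - η) := by
        have := hw.sub η (ξ - η); rwa [add_sub_cancel] at this
      have h2 : ENNReal.ofReal (w ξ) ≤ ENNReal.ofReal (w η) * ENNReal.ofReal (w (ξ - η)) := by
        rw [← ENNReal.ofReal_mul (hw.pos _).le]
        exact ENNReal.ofReal_le_ofReal h1
      rw [enorm_mul]
      calc _ ≤ (ENNReal.ofReal (w η) * ENNReal.ofReal (w (ξ - η))) * (‖f η‖ₑ * ‖g (ξ - η)‖ₑ) :=
            mul_le_mul_left h2 _
        _ = (ENNReal.ofReal (w η) * ‖f η‖ₑ) * (ENNReal.ofReal (w (ξ - η)) * ‖g (ξ - η)‖ₑ) := by ring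
        _ ≤ _ := mul_le_mul' (hf _) (hg _)

lemma Wd_n {κ : ℝ} {w : ℝ → ℝ} (hw : Wt κ w) {f g : ℝ → ℂ} {A : ℝ → ℝ≥0∞} (hA : Measurable A)
    (hf : Wd w f A) (hg : Wd w g A) {k : ℂ} (hk : ‖k‖ ≤ 1) :
    Wd w (fun ξ => k * ξ * cv f g ξ) (fun ξ => ENNReal.ofReal |ξ| * n2 A ^ 2) := by
  intro ξ
  have h := Wd_cv hw hA hf hg ξ
  have h' : ∫⁻ η, A η * A (ξ - η) ≤ n2 A ^ 2 := by
    refine (cs hA (by fun_prop)).trans ?_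
    rw [n2_sub_left, sq]
  have hk' : ‖k‖ₑ ≤ 1 := by
    rw [← ofReal_norm]; exact ENNReal.ofReal_le_one.2 hk
  rw [enorm_mul, enorm_mul, show ‖(ξ : ℂ)‖ₑ = ENNReal.ofReal |ξ| by
    rw [← ofReal_norm, Complex.norm_real, Real.norm_eq_abs]]
  calc _ = ‖k‖ₑ * (ENNReal.ofReal |ξ| * (ENNReal.ofReal (w ξ) * ‖cv f g ξ‖ₑ)) := by ring
    _ ≤ 1 * (ENNReal.ofReal |ξ| * n2 A ^ 2) := by
      refine mul_le_mul' hk' (mul_le_mul_right (h.trans h') _)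
    _ = _ := one_mul _

lemma Wd_nP {κ : ℝ} {w : ℝ → ℝ} (hw : Wt κ w) {q : ℝ → ℂ} {A : ℝ → ℝ≥0∞} (hA : Measurable A)
    (hg : Wd w q A) : Wd w (nP q) (fun ξ => ENNReal.ofReal |ξ| * n2 A ^ 2) := by
  rw [nP_eq]; exact Wd_n hw hA hg hg nI
lemma Wd_nQ {κ : ℝ} {w : ℝ → ℝ} (hw : Wt κ w) {p q : ℝ → ℂ} {A : ℝ → ℝ≥0∞} (hA : Measurable A)
    (hf : Wd w p A) (hg : Wd w q A) : Wd w (nQ p q) (fun ξ => ENNReal.ofReal |ξ| * n2 A ^ 2) := by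
  rw [nQ_eq]; exact Wd_n hw hA hf hg nI'
end MB


namespace MB

/-- strong decay -/
def D6 (C : ℝ) (f : ℝ → ℂ) : Prop := Measurable f ∧ ∀ ξ, ‖f ξ‖ ≤ C / (1 + |ξ|) ^ 6

lemma FS.d6 {a α β : ℝ} {p q : ℝ → ℝ → ℂ} (h : FS a α β p q) :
    ∃ C, 0 ≤ C ∧ ∀ t ∈ Icc α β, D6 C (p t) ∧ D6 C (q t) := by
  obtain ⟨C, hC, hd⟩ := h.dec
  exact ⟨C, hC, fun t ht => ⟨⟨h.mp t ht, fun ξ => (hd t ht ξ).1⟩, ⟨h.mq t ht, fun ξ => (hd t ht ξ).2⟩⟩⟩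

lemma D6.dec {C : ℝ} {f : ℝ → ℂ} (hC : 0 ≤ C) (h : D6 C f) : Dec C f := dec_of h.1 hC h.2

lemma D6.int2 {B C : ℝ} {f g k : ℝ → ℂ} (hC : 0 ≤ C) (hB : 0 ≤ B) (hf : D6 C f) (hg : D6 C g) (hk : D6 C k)
    {M : ℝ × ℝ → ℂ} (hM : Measurable M) (hb : ∀ q, ‖M q‖ ≤ B * (1 + |q.1|) ^ 4 * (1 + |q.2|) ^ 4) :
    Integrable fun q : ℝ × ℝ => M q * f (-q.1 - q.2) * g q.1 * k q.2 := by
  have m1 := hf.1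
  have m2 := hg.1
  have m3 := hk.1
  refine (MB.int2.const_mul (B * C ^ 3)).mono' (by fun_prop) (Eventually.of_forall fun q => ?_)
  rw [norm_mul, norm_mul, norm_mul]
  have h1 : ‖f (-q.1 - q.2)‖ ≤ C := by
    refine (hf.2 _).trans (div_le_self hC (one_le_pow₀ (by linarith [abs_nonneg (-q.1 - q.2)])))
  calc _ ≤ (B * (1 + |q.1|) ^ 4 * (1 + |q.2|) ^ 4) * C * (C / (1 + |q.1|) ^ 6) * (C / (1 + |q.2|) ^ 6) := by
        refine mul_le_mul (mul_le_mul (mul_le_mul (hb q) h1 (norm_nonneg _) (by positivity)) (hg.2 _)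
          (norm_nonneg _) (by positivity)) (hk.2 _) (norm_nonneg _) (by positivity)
    _ = _ := by field_simp

/-- quadratic energy -/
noncomputable def E2 (θ : ℝ → ℝ) (f : ℝ → ℂ) : ℂ := ∫ ξ, (θ ξ : ℂ) * f ξ * f (-ξ)

lemma E2_deriv {α β ph B : ℝ} {f n : ℝ → ℝ → ℂ} (h : Comp α β ph f n) {θ : ℝ → ℝ} (hθ : Measurable θ)
    (he : ∀ x, θ (-x) = θ x) (hB : 0 ≤ B) (hb : ∀ x, |θ x| ≤ B * (1 + |x|) ^ 2) :
    ContinuousOn (fun t => E2 θ (f t)) (Icc α β) ∧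
    ∀ t ∈ Ioo α β, HasDerivAt (fun t => E2 θ (f t)) (2 * ∫ ξ, (θ ξ : ℂ) * f t (-ξ) * n t ξ) t := by
  obtain ⟨C, p, H⟩ := h.fac (X := ℝ)
  have hM : Measurable fun x : ℝ => (θ x : ℂ) := by fun_prop
  have F := ((Fac.const α β hM).mul (H (fun q => q) (by fun_prop))).mul (H (fun q => -q) (by fun_prop))
  have I : Integrable fun x : ℝ => 2 * (2 * (‖(θ x : ℂ)‖ * (C / (1 + |x|) ^ 3)) * (C / (1 + |-x|) ^ 3)) := by
    refine (int1.const_mul (4 * B * C ^ 2)).mono' (by fun_prop) (Eventually.of_forall fun x => ?_)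
    rw [Real.norm_of_nonneg (by positivity), abs_neg, Complex.norm_real, Real.norm_eq_abs]
    calc _ ≤ 2 * (2 * ((B * (1 + |x|) ^ 2) * (C / (1 + |x|) ^ 3)) * (C / (1 + |x|) ^ 3)) := by
          gcongr; exact hb x
      _ = 4 * B * C ^ 2 * (1 / (1 + |x|) ^ 4) := by field_simp; ring
      _ ≤ _ := by
        refine mul_le_mul_of_nonneg_left ?_ (by positivity)
        apply one_div_le_one_div_of_le (by positivity)
        exact pow_le_pow_right₀ (by linarith [abs_nonneg x]) (by norm_num)
  refine ⟨F.cOn I, fun t ht => (F.hasDeriv I ht).congr_deriv ?_⟩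
  have ht' := Ioo_subset_Icc_self ht
  obtain ⟨E, hE, K⟩ := h.dec
  obtain ⟨u, v, -⟩ := K t ht'
  have mf := u.1
  have mn := v.1
  have j : Integrable fun ξ => (θ ξ : ℂ) * f t (-ξ) * n t ξ := by
    refine (int1.const_mul (B * E ^ 2)).mono' (by fun_prop) (Eventually.of_forall fun x => ?_)
    rw [norm_mul, norm_mul, Complex.norm_real, Real.norm_eq_abs]
    have := u.2 (-x)
    rw [abs_neg] at this
    calc _ ≤ (B * (1 + |x|) ^ 2) * (E / (1 + |x|) ^ 3) * (E / (1 + |x|) ^ 3) :=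
          mul_le_mul (mul_le_mul (hb x) this (norm_nonneg _) (by positivity)) (v.2 x) (norm_nonneg _) (by positivity)
      _ = B * E ^ 2 * (1 / (1 + |x|) ^ 4) := by field_simp
      _ ≤ _ := by
        refine mul_le_mul_of_nonneg_left ?_ (by positivity)
        apply one_div_le_one_div_of_le (by positivity)
        exact pow_le_pow_right₀ (by linarith [abs_nonneg x]) (by norm_num)
  have j' := j.comp_neg
  have e := integral_neg_eq_self (fun ξ => (θ ξ : ℂ) * f t (-ξ) * n t ξ) volume
  rw [two_mul]
  nth_rewrite 2 [← e]
  rw [← integral_add j j']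
  refine integral_congr_ae (Eventually.of_forall fun x => ?_)
  simp only [dd, neg_neg, he]
  push_cast
  ring

lemma L3_swap (M : ℝ × ℝ → ℂ) (f g k : ℝ → ℂ) :
    L3 M f g k = L3 (fun q => M (q.2, q.1)) f k g := by
  unfold L3
  rw [Measure.volume_eq_prod, ← integral_prod_swap]
  refine integral_congr_ae (Eventually.of_forall fun x => ?_)
  simp only [Prod.fst_swap, Prod.snd_swap]
  rw [show -x.2 - x.1 = -x.1 - x.2 by ring]
  show _ = M (x.2, x.1) * _ * _ * _
  simp only [Prod.swap]
  ring

lemma L3_add {f g k : ℝ → ℂ} {M M' : ℝ × ℝ → ℂ}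
    (h : Integrable fun q : ℝ × ℝ => M q * f (-q.1 - q.2) * g q.1 * k q.2)
    (h' : Integrable fun q : ℝ × ℝ => M' q * f (-q.1 - q.2) * g q.1 * k q.2) :
    L3 (fun q => M q + M' q) f g k = L3 M f g k + L3 M' f g k := by
  unfold L3
  rw [← integral_add h h']
  refine integral_congr_ae (Eventually.of_forall fun x => ?_)
  simp only
  ring

lemma th_bd {θ : ℝ → ℝ} {B : ℝ} (hB : 0 ≤ B) (hb : ∀ x, |θ x| ≤ B * (1 + |x|) ^ 2) (x : ℝ) :
    |x * θ x| ≤ B * (1 + |x|) ^ 4 := by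
  rw [abs_mul]
  calc |x| * |θ x| ≤ (1 + |x|) * (B * (1 + |x|) ^ 2) :=
        mul_le_mul (by linarith) (hb x) (abs_nonneg _) (by positivity)
    _ = B * (1 + |x|) ^ 3 := by ring
    _ ≤ _ := by
      refine mul_le_mul_of_nonneg_left ?_ hB
      exact pow_le_pow_right₀ (by linarith [abs_nonneg x]) (by norm_num)

lemma IdQ {B C : ℝ} {p q : ℝ → ℂ} (hC : 0 ≤ C) (hp : D6 C p) (hq : D6 C q) {θ : ℝ → ℝ} (hθ : Measurable θ)
    (he : ∀ x, θ (-x) = θ x) (hB : 0 ≤ B) (hb : ∀ x, |θ x| ≤ B * (1 + |x|) ^ 2) :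
    Integrable (fun z : ℝ × ℝ => (Complex.I * ((z.1 * θ z.1 : ℝ) : ℂ)) * p (-z.1 - z.2) * q z.1 * q z.2) ∧
    ∫ ξ, (θ ξ : ℂ) * q (-ξ) * nQ p q ξ = L3 (fun z => Complex.I * ((z.1 * θ z.1 : ℝ) : ℂ)) p q q := by
  have hIntg : Integrable (fun z : ℝ × ℝ => (Complex.I * ((z.1 * θ z.1 : ℝ) : ℂ)) * p (-z.1 - z.2) * q z.1 * q z.2) := by
    refine D6.int2 (B := B) hC hB hp hq hq (by fun_prop) (fun z => ?_)
    rw [norm_mul, Complex.norm_I, one_mul, Complex.norm_real, Real.norm_eq_abs]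
    refine (th_bd hB hb z.1).trans ?_
    refine le_mul_of_one_le_right (by positivity) (one_le_pow₀ (by linarith [abs_nonneg z.2]))
  refine ⟨hIntg, ?_⟩
  unfold L3
  rw [Measure.volume_eq_prod] at hIntg ⊢
  rw [integral_prod _ hIntg, ← integral_neg_eq_self]
  refine integral_congr_ae (Eventually.of_forall fun x => ?_)
  simp only [neg_neg, he]
  have e : cv p q (-x) = ∫ y, p (-x - y) * q y := by
    unfold cv
    rw [← integral_sub_left_eq_self _ _ (-x)]
    simp
  have e2 : ∀ y, Complex.I * ((x * θ x : ℝ) : ℂ) * p (-x - y) * q x * q y =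
      (Complex.I * ((x * θ x : ℝ) : ℂ) * q x) * (p (-x - y) * q y) := fun y => by ring
  simp_rw [e2]
  rw [integral_const_mul, ← e]
  unfold nQ
  push_cast
  ring

lemma IdP {B C : ℝ} {p q : ℝ → ℂ} (hC : 0 ≤ C) (hp : D6 C p) (hq : D6 C q) {θ : ℝ → ℝ} (hθ : Measurable θ)
    (hB : 0 ≤ B) (hb : ∀ x, |θ x| ≤ B * (1 + |x|) ^ 2) :
    Integrable (fun z : ℝ × ℝ => (-Complex.I * (((z.1 + z.2) * θ (z.1 + z.2) : ℝ) : ℂ)) * p (-z.1 - z.2) * q z.1 * q z.2) ∧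
    2 * ∫ ξ, (θ ξ : ℂ) * p (-ξ) * nP q ξ =
      L3 (fun z => -Complex.I * (((z.1 + z.2) * θ (z.1 + z.2) : ℝ) : ℂ)) p q q := by
  have hIntg : Integrable (fun z : ℝ × ℝ => (-Complex.I * (((z.1 + z.2) * θ (z.1 + z.2) : ℝ) : ℂ)) * p (-z.1 - z.2) * q z.1 * q z.2) := by
    refine D6.int2 (B := B) hC hB hp hq hq (by fun_prop) (fun z => ?_)
    rw [norm_mul, norm_neg, Complex.norm_I, one_mul, Complex.norm_real, Real.norm_eq_abs]
    refine (th_bd hB hb _).trans ?_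
    rw [mul_assoc, ← mul_pow]
    refine mul_le_mul_of_nonneg_left (pow_le_pow_left₀ (by positivity) ?_ 4) hB
    have := abs_add_le z.1 z.2
    nlinarith [abs_nonneg z.1, abs_nonneg z.2]
  refine ⟨hIntg, ?_⟩
  unfold L3
  have mp := measurePreserving_prod_add (volume : Measure ℝ) (volume : Measure ℝ)
  have em : MeasurableEmbedding (fun z : ℝ × ℝ => (z.1, z.1 + z.2)) :=
    (MeasurableEquiv.shearAddRight ℝ).measurableEmbedding
  set G : ℝ × ℝ → ℂ := fun z => (-Complex.I * ((z.2 * θ z.2 : ℝ) : ℂ)) * p (-z.2) * q z.1 * q (z.2 - z.1) with hG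
  have hcomp : (fun z : ℝ × ℝ => (-Complex.I * (((z.1 + z.2) * θ (z.1 + z.2) : ℝ) : ℂ)) * p (-z.1 - z.2) * q z.1 * q z.2)
      = G ∘ (fun z : ℝ × ℝ => (z.1, z.1 + z.2)) := by
    funext z
    simp only [hG, Function.comp, neg_add, sub_eq_add_neg]
    rw [show z.1 + z.2 + -z.1 = z.2 by ring]
  rw [Measure.volume_eq_prod] at hIntg ⊢
  rw [hcomp] at hIntg ⊢
  have hGi : Integrable G (volume.prod volume) := (mp.integrable_comp_emb em).1 hIntg
  have : ∫ z, (G ∘ fun z : ℝ × ℝ => (z.1, z.1 + z.2)) z ∂(volume.prod volume) = ∫ z, G z ∂(volume.prod volume) :=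
    mp.integral_comp em G
  rw [this, integral_prod_symm _ hGi, ← integral_const_mul]
  refine integral_congr_ae (Eventually.of_forall fun ξ => ?_)
  simp only [hG]
  have e2 : ∀ x, -Complex.I * ((ξ * θ ξ : ℝ) : ℂ) * p (-ξ) * q x * q (ξ - x) =
      (-Complex.I * ((ξ * θ ξ : ℝ) : ℂ) * p (-ξ)) * (q x * q (ξ - x)) := fun y => by ring
  simp_rw [e2]
  rw [integral_const_mul]
  unfold nP cv
  push_cast
  ring

/-- the energy symbol -/
noncomputable def mg (θu θv : ℝ → ℝ) (x y : ℝ) : ℝ := x * θv x + y * θv y - (x + y) * θu (x + y)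

lemma E_deriv {a α β B : ℝ} {p q : ℝ → ℝ → ℂ} (h : FS a α β p q) {θu θv : ℝ → ℝ} (hu : Measurable θu)
    (hv : Measurable θv) (eu : ∀ x, θu (-x) = θu x) (ev : ∀ x, θv (-x) = θv x) (hB : 0 ≤ B)
    (bu : ∀ x, |θu x| ≤ B * (1 + |x|) ^ 2) (bv : ∀ x, |θv x| ≤ B * (1 + |x|) ^ 2) :
    ContinuousOn (fun t => E2 θu (p t) + E2 θv (q t)) (Icc α β) ∧
    ∀ t ∈ Ioo α β, HasDerivAt (fun t => E2 θu (p t) + E2 θv (q t))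
      (L3 (fun z => Complex.I * ((mg θu θv z.1 z.2 : ℝ) : ℂ)) (p t) (q t) (q t)) t := by
  obtain ⟨c1, d1⟩ := E2_deriv h.compP hu eu hB bu
  obtain ⟨c2, d2⟩ := E2_deriv h.compQ hv ev hB bv
  refine ⟨c1.add c2, fun t ht => ((d1 t ht).add (d2 t ht)).congr_deriv ?_⟩
  have ht' := Ioo_subset_Icc_self ht
  obtain ⟨C, hC, hd⟩ := h.d6
  obtain ⟨i1, e1⟩ := IdP hC (hd t ht').1 (hd t ht').2 hu hB bu
  obtain ⟨i2, e2⟩ := IdQ hC (hd t ht').1 (hd t ht').2 hv ev hB bv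
  rw [e1, e2, two_mul]
  nth_rewrite 3 [L3_swap]
  have i3 : Integrable (fun z : ℝ × ℝ => (Complex.I * ((z.2 * θv z.2 : ℝ) : ℂ)) * p t (-z.1 - z.2) * q t z.1 * q t z.2) := by
    have := i2.swap
    refine this.congr (Eventually.of_forall fun x => ?_)
    simp only [Function.comp, Prod.fst_swap, Prod.snd_swap]
    rw [show -x.2 - x.1 = -x.1 - x.2 by ring]
    ring
  rw [← L3_add i2 i3, ← L3_add i1]
  · congr 1
    funext z
    unfold mg
    push_cast
    ring
  · refine (i2.add i3).congr (Eventually.of_forall fun x => ?_)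
    simp only [Pi.add_apply]
    ring

/-- the involution (x,y) -> (-(x+y), y) -/
def invo : (ℝ × ℝ) ≃ᵐ (ℝ × ℝ) where
  toFun z := (-(z.1 + z.2), z.2)
  invFun z := (-(z.1 + z.2), z.2)
  left_inv z := by ext <;> simp
  right_inv z := by ext <;> simp
  measurable_toFun := by
    show Measurable fun z : ℝ × ℝ => (-(z.1 + z.2), z.2)
    fun_prop
  measurable_invFun := by
    show Measurable fun z : ℝ × ℝ => (-(z.1 + z.2), z.2)
    fun_prop

lemma invo_mp : MeasurePreserving invo (volume.prod volume) (volume.prod volume) := by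
  have h : MeasurePreserving (fun z : ℝ × ℝ => (z.1, -z.1 - z.2)) (volume.prod volume) (volume.prod volume) :=
    MeasurePreserving.skew_product (g := fun x y => -x - y) (MeasurePreserving.id volume) (by
      show Measurable fun z : ℝ × ℝ => -z.1 - z.2
      fun_prop) (Eventually.of_forall fun x => ((volume : Measure ℝ).measurePreserving_sub_left (-x)).map_eq)
  have := (Measure.measurePreserving_swap (μ := (volume : Measure ℝ)) (ν := (volume : Measure ℝ))).comp
    (h.comp (Measure.measurePreserving_swap (μ := (volume : Measure ℝ)) (ν := (volume : Measure ℝ))))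
  convert this using 1
  funext z
  simp [invo, Function.comp]
  ring

lemma expA {B C : ℝ} {q : ℝ → ℂ} (hC : 0 ≤ C) (hq : D6 C q) {M : ℝ × ℝ → ℂ} (hM : Measurable M)
    (hb : ∀ z : ℝ × ℝ, ‖Complex.I / 2 * ((z.1 + z.2 : ℝ) : ℂ) * M z‖ ≤ B) :
    L3 M (nP q) q q = L4 (fun z => Complex.I / 2 * ((z.1.1 + z.1.2 : ℝ) : ℂ) * M z.1) q q q q := by
  have hd := hq.dec hC
  have hIntg := Dec.int3 hd hd hd hd (M := fun z => Complex.I / 2 * ((z.1.1 + z.1.2 : ℝ) : ℂ) * M z.1)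
    (by fun_prop) (fun z => hb z.1)
  unfold L4 L3
  rw [Measure.volume_eq_prod] at hIntg
  nth_rewrite 2 [Measure.volume_eq_prod]
  rw [integral_prod _ hIntg]
  refine integral_congr_ae (Eventually.of_forall fun z => ?_)
  simp only
  have e2 : ∀ x, Complex.I / 2 * ((z.1 + z.2 : ℝ) : ℂ) * M z * q z.1 * q z.2 * q x * q (-(z.1 + z.2 + x)) =
      (Complex.I / 2 * ((z.1 + z.2 : ℝ) : ℂ) * M z * q z.1 * q z.2) * (q x * q (-z.1 - z.2 - x)) := fun y => by
    rw [show -(z.1 + z.2 + y) = -z.1 - z.2 - y by ring]; ring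
  simp_rw [e2]
  rw [integral_const_mul]
  unfold nP cv
  push_cast
  ring

lemma expB {B C : ℝ} {p q : ℝ → ℂ} (hC : 0 ≤ C) (hp : D6 C p) (hq : D6 C q) {M : ℝ × ℝ → ℂ} (hM : Measurable M)
    (hb : ∀ z : ℝ × ℝ, ‖Complex.I * ((z.1 + z.2 : ℝ) : ℂ) * M (-(z.1 + z.2), z.2)‖ ≤ B) :
    L3 M p (nQ p q) q =
      L4 (fun z => Complex.I * ((z.1.1 + z.1.2 : ℝ) : ℂ) * M (-(z.1.1 + z.1.2), z.1.2)) p q p q := by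
  have hd := hq.dec hC
  have hd' := hp.dec hC
  have hIntg := Dec.int3 hd' hd hd' hd (M := fun z => Complex.I * ((z.1.1 + z.1.2 : ℝ) : ℂ) * M (-(z.1.1 + z.1.2), z.1.2))
    (by fun_prop) (fun z => hb z.1)
  unfold L4 L3
  rw [Measure.volume_eq_prod] at hIntg
  nth_rewrite 2 [Measure.volume_eq_prod]
  rw [integral_prod _ hIntg, Measure.volume_eq_prod, ← invo_mp.integral_comp invo.measurableEmbedding]
  refine integral_congr_ae (Eventually.of_forall fun z => ?_)
  simp only
  have e2 : ∀ x, Complex.I * ((z.1 + z.2 : ℝ) : ℂ) * M (-(z.1 + z.2), z.2) * p z.1 * q z.2 * p x * q (-(z.1 + z.2 + x)) =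
      (Complex.I * ((z.1 + z.2 : ℝ) : ℂ) * M (-(z.1 + z.2), z.2) * p z.1 * q z.2) * (p x * q (-(z.1 + z.2) - x)) := fun y => by
    rw [show -(z.1 + z.2 + y) = -(z.1 + z.2) - y by ring]; ring
  simp_rw [e2]
  rw [integral_const_mul]
  show M (-(z.1 + z.2), z.2) * p (-(-(z.1 + z.2)) - z.2) * nQ p q (-(z.1 + z.2)) * q z.2 = _
  rw [show -(-(z.1 + z.2)) - z.2 = z.1 by ring]
  unfold nQ cv
  push_cast
  ring
end MB


namespace MB

lemma lip_ext {α β K : ℝ} {G G' : ℝ → ℂ} (hc : ContinuousOn G (Icc α β))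
    (hd : ∀ t ∈ Ioo α β, HasDerivAt G (G' t) t) (hb : ∀ t ∈ Ioo α β, ‖G' t‖ ≤ K) :
    ∀ s ∈ Icc α β, ∀ t ∈ Icc α β, ‖G t - G s‖ ≤ K * |t - s| := by
  intro s hs t ht
  rcases lt_or_ge α β with h | h
  · have hK : 0 ≤ K := (norm_nonneg _).trans (hb ((α + β) / 2) ⟨by linarith, by linarith⟩)
    have hl : LipschitzOnWith K.toNNReal G (Ioo α β) := by
      refine (convex_Ioo α β).lipschitzOnWith_of_nnnorm_hasDerivWithin_le
        (fun x hx => (hd x hx).hasDerivWithinAt) (fun x hx => ?_)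
      rw [← NNReal.coe_le_coe, coe_nnnorm, Real.coe_toNNReal _ hK]
      exact hb x hx
    have hl2 := hl.closure (by rwa [closure_Ioo h.ne])
    rw [closure_Ioo h.ne] at hl2
    have := hl2.norm_sub_le ht hs
    rwa [Real.coe_toNNReal _ hK, Real.norm_eq_abs] at this
  · have : s = t := by
      have := hs.1; have := hs.2; have := ht.1; have := ht.2; linarith
    subst this; simp

lemma ms_meas {θ : ℝ → ℝ} (hθ : Measurable θ) : Measurable fun z : ℝ × ℝ => ms θ z.1 z.2 := by
  unfold ms; fun_prop

lemma M3_meas (a : ℝ) {θ : ℝ → ℝ} (hθ : Measurable θ) : Measurable fun z : ℝ × ℝ => M3 a θ z.1 z.2 := by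
  unfold M3
  refine Measurable.ite (measurableSet_le measurable_const mm_meas) ?_ measurable_const
  refine (ms_meas hθ).div ?_
  unfold H3; fun_prop

lemma mlow_meas {θ : ℝ → ℝ} (hθ : Measurable θ) : Measurable fun z : ℝ × ℝ => mlow θ z.1 z.2 := by
  unfold mlow
  exact Measurable.ite (measurableSet_le measurable_const mm_meas) measurable_const (ms_meas hθ)

lemma L3_tri {κ D N : ℝ} {w : ℝ → ℝ} (hw : Wt κ w) (hD : 0 ≤ D) (hN : 0 ≤ N) {f g k : ℝ → ℂ} {A : ℝ → ℝ≥0∞}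
    (m1 : Measurable f) (m2 : Measurable g) (m3 : Measurable k) (hA : Measurable A) (he : ∀ x, A (-x) = A x)
    (h1 : Wd w f A) (h2 : Wd w g A) (h3 : Wd w k A) (hn : n2 A ≤ ENNReal.ofReal N)
    {M : ℝ × ℝ → ℂ} (hM : Measurable M)
    (hb : ∀ x y, ‖M (x, y)‖ ≤ D * (w x * w y * w (x + y)) / (1 + mm x y)) :
    ‖L3 M f g k‖ ≤ k2 ^ (1/2 : ℝ) * D * N ^ 3 := by
  have hk := k2_nn
  refine norm_le_of_enorm (by positivity) ?_
  refine (L3_bound hw.one hw.even m1 m2 m3 h1 h2 h3 hM (G := fun x y => D / (1 + mm x y))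
    (fun x y => div_nonneg hD (by linarith [mm_nonneg x y])) (fun x y => (hb x y).trans (le_of_eq (by ring)))).trans ?_
  calc ∫⁻ x, ∫⁻ y, ENNReal.ofReal (D / (1 + mm x y)) * (A (-x - y) * A x * A y)
      ≤ ∫⁻ x, ∫⁻ y, ENNReal.ofReal D * (A x * J 1 x * (A y * A (x + y))) := by
        refine lintegral_mono fun x => lintegral_mono fun y => ?_
        have e : A (-x - y) = A (x + y) := by rw [← he (x + y)]; congr 1; ring
        rw [e, J1_eq]
        have : ENNReal.ofReal (D / (1 + mm x y)) ≤ ENNReal.ofReal D * ENNReal.ofReal (1 / (1 + |x|)) := by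
          rw [← ENNReal.ofReal_mul hD]
          refine ENNReal.ofReal_le_ofReal ?_
          rw [mul_one_div]
          exact div_le_div_of_nonneg_left hD (by positivity) (by linarith [mm_x x y])
        calc _ ≤ ENNReal.ofReal D * ENNReal.ofReal (1 / (1 + |x|)) * (A (x + y) * A x * A y) := mul_le_mul_left this _
          _ = _ := by ring
    _ = ENNReal.ofReal D * ∫⁻ x, ∫⁻ y, A x * J 1 x * (A y * A (x + y)) := by
        simp_rw [lintegral_const_mul' _ _ ENNReal.ofReal_ne_top]
    _ ≤ ENNReal.ofReal D * (cJ 2 ^ (1/2 : ℝ) * n2 A ^ 3) := mul_le_mul_right (E3 hA) _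
    _ ≤ ENNReal.ofReal D * (ENNReal.ofReal (k2 ^ (1/2 : ℝ)) * ENNReal.ofReal N ^ 3) := by
        rw [k2_eq, ENNReal.ofReal_rpow_of_nonneg hk (by norm_num)]
        gcongr
    _ = _ := by
        rw [← ENNReal.ofReal_pow hN, ← ENNReal.ofReal_mul (by positivity), ← ENNReal.ofReal_mul hD]
        congr 1; ring

/-- energy -/
noncomputable def Ew (w : ℝ → ℝ) (p q : ℝ → ℂ) : ℂ := E2 (fun x => w x ^ 2) p + E2 (fun x => w x ^ 2) q

lemma mg_self (θ : ℝ → ℝ) (x y : ℝ) : mg θ θ x y = ms θ x y := rfl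

lemma H3_phase (a x y : ℝ) : 1 * (-x - y) ^ 3 + a * x ^ 3 + a * y ^ 3 = H3 a x y := by
  unfold H3; ring

theorem caseI {a : ℝ} (ha : a < 0) : ∃ C > 0, ∀ (α β κ N : ℝ) (w : ℝ → ℝ) (p q : ℝ → ℝ → ℂ),
    FS a α β p q → Wt κ w → 0 ≤ N → (∀ t ∈ Icc α β, n2 (Am w (p t) (q t)) ≤ ENNReal.ofReal N) →
    ∀ s ∈ Icc α β, ∀ t ∈ Icc α β, ‖Ew w (p t) (q t) - Ew w (p s) (q s)‖ ≤
      C * κ * (N ^ 3 + N ^ 4 + |t - s| * (N ^ 3 + N ^ 4 + N ^ 5)) := by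
  obtain ⟨C3, hC3, hM3⟩ := M3_bound (a := a) (Or.inl ha)
  obtain ⟨cA, hcA, hHA⟩ := H4A ha
  obtain ⟨cB, hcB, hHB⟩ := H4B ha
  obtain ⟨CA, hCA, QA⟩ := quartic hcA hHA
  obtain ⟨CB, hCB, QBB⟩ := quartic hcB hHB
  have hk2 := k2_nn
  set k := k2 ^ (1/2 : ℝ) with hk
  have hk0 : 0 ≤ k := by positivity
  refine ⟨1 + 2 * (k * C3 + CA * C3 + 2 * (CB * C3)) + 8 * k, by positivity, ?_⟩
  intro α β κ N w p q hF hw hN hn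
  have hκ := hw.k0
  obtain ⟨C, hC, hd⟩ := hF.d6
  obtain ⟨Bw, hBw⟩ := hw.bdd
  have w0 := hw.pos
  have hBw0 : 0 < Bw := (w0 0).trans_le (hBw 0)
  have hwm := hw.meas
  set θ : ℝ → ℝ := fun z => w z ^ 2 with hθ
  have θm : Measurable θ := by fun_prop
  set M : ℝ × ℝ → ℂ := fun z => ((M3 a θ z.1 z.2 : ℝ) : ℂ) with hM
  have Mm : Measurable M := Complex.measurable_ofReal.comp (M3_meas a θm)
  have Mb : ∀ x y, ‖M (x, y)‖ ≤ (C3 * κ) * (w x * w y * w (x + y)) / (1 + mm x y) := by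
    intro x y
    simp only [hM, Complex.norm_real, Real.norm_eq_abs]
    exact hM3 κ w hw x y
  have www : ∀ x y, w x * w y * w (x + y) ≤ Bw ^ 3 := by
    intro x y
    have := w0 x; have := w0 y; have := w0 (x + y)
    calc w x * w y * w (x + y) ≤ Bw * Bw * Bw :=
          mul_le_mul (mul_le_mul (hBw x) (hBw y) (w0 y).le hBw0.le) (hBw _) (w0 _).le (by positivity)
      _ = _ := by ring
  have Mb' : ∀ z : ℝ × ℝ, ‖M z‖ ≤ (C3 * κ * Bw ^ 3) * (1 + |z.1|) * (1 + |z.2|) := by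
    intro z
    refine (Mb z.1 z.2).trans ?_
    calc _ ≤ (C3 * κ) * (w z.1 * w z.2 * w (z.1 + z.2)) := by
          refine div_le_self ?_ (by linarith [mm_nonneg z.1 z.2])
          have := w0 z.1; have := w0 z.2; have := w0 (z.1 + z.2)
          positivity
      _ ≤ (C3 * κ) * Bw ^ 3 := mul_le_mul_of_nonneg_left (www _ _) (by positivity)
      _ ≤ _ := by
          rw [mul_assoc (C3 * κ * Bw ^ 3)]
          refine le_mul_of_one_le_right (by positivity) ?_
          nlinarith [abs_nonneg z.1, abs_nonneg z.2, mul_nonneg (abs_nonneg z.1) (abs_nonneg z.2)]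
  have θe : ∀ x, θ (-x) = θ x := fun x => by simp only [hθ, hw.even]
  have θb : ∀ x, |θ x| ≤ Bw ^ 2 * (1 + |x|) ^ 2 := by
    intro x
    simp only [hθ]
    rw [abs_of_nonneg (by positivity)]
    calc w x ^ 2 ≤ Bw ^ 2 := pow_le_pow_left₀ (w0 x).le (hBw x) 2
      _ ≤ _ := le_mul_of_one_le_right (by positivity) (one_le_pow₀ (by linarith [abs_nonneg x]))
  obtain ⟨cE, dE⟩ := E_deriv hF θm θm θe θe (by positivity : 0 ≤ Bw ^ 2) θb θb
  obtain ⟨c3, d3⟩ := L3_deriv hF.compP hF.compQ hF.compQ Mm Mb'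
  -- quartic kernels
  set KA : ℝ × ℝ → ℂ := fun z => Complex.I / 2 * ((z.1 + z.2 : ℝ) : ℂ) * M z with hKA
  set KB : ℝ × ℝ → ℂ := fun z => Complex.I * ((z.1 + z.2 : ℝ) : ℂ) * M (-(z.1 + z.2), z.2) with hKB
  have KAm : Measurable KA := by fun_prop
  have KBm : Measurable KB := by fun_prop
  have kgen : ∀ x y : ℝ, |x + y| * ((C3 * κ) * (w x * w y * w (x + y)) / (1 + mm x y)) ≤
      C3 * κ * (w x * w y * w (x + y)) * (|x + y| / (1 + max |x| |y|)) := by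
    intro x y
    have := w0 x; have := w0 y; have := w0 (x + y)
    have h1 : (0:ℝ) < 1 + max |x| |y| := by linarith [abs_nonneg x, le_max_left |x| |y|]
    have h2 : 1 + max |x| |y| ≤ 1 + mm x y := by
      have : max |x| |y| ≤ mm x y := le_max_left _ _
      linarith
    calc _ = C3 * κ * (w x * w y * w (x + y)) * (|x + y| / (1 + mm x y)) := by ring
      _ ≤ _ := mul_le_mul_of_nonneg_left (div_le_div_of_nonneg_left (abs_nonneg _) h1 h2) (by positivity)
  have KAb : ∀ x y, ‖KA (x, y)‖ ≤ C3 * κ * (w x * w y * w (x + y)) * (|x + y| / (1 + max |x| |y|)) := by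
    intro x y
    refine le_trans ?_ (kgen x y)
    simp only [hKA]
    rw [norm_mul, norm_mul, norm_div, Complex.norm_I, Complex.norm_real, Real.norm_eq_abs]
    have h2 : ‖(2:ℂ)‖ = 2 := by norm_num
    rw [h2]
    refine mul_le_mul ?_ (Mb x y) (norm_nonneg _) (abs_nonneg _)
    linarith [abs_nonneg (x + y)]
  have KBb : ∀ x y, ‖KB (x, y)‖ ≤ C3 * κ * (w x * w y * w (x + y)) * (|x + y| / (1 + max |x| |y|)) := by
    intro x y
    refine le_trans ?_ (kgen x y)
    simp only [hKB]
    rw [norm_mul, norm_mul, Complex.norm_I, Complex.norm_real, Real.norm_eq_abs, one_mul]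
    refine mul_le_mul_of_nonneg_left ?_ (abs_nonneg _)
    refine (Mb _ _).trans (le_of_eq ?_)
    have e1 : -(x + y) + y = -x := by ring
    have e2 : mm (-(x + y)) y = mm x y := by
      rw [← mm_rot x y, ← mm_neg (x + y) (-y), neg_neg]
    rw [e1, e2, hw.even, hw.even]
    ring
  have bdK : ∀ K : ℝ × ℝ → ℂ, (∀ x y, ‖K (x, y)‖ ≤ C3 * κ * (w x * w y * w (x + y)) * (|x + y| / (1 + max |x| |y|))) →
      ∀ z, ‖K z‖ ≤ C3 * κ * Bw ^ 3 * 2 := by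
    intro K hK z
    refine (hK z.1 z.2).trans ?_
    have h1 : (0:ℝ) < 1 + max |z.1| |z.2| := by linarith [abs_nonneg z.1, le_max_left |z.1| |z.2|]
    have := w0 z.1; have := w0 z.2; have := w0 (z.1 + z.2)
    refine mul_le_mul (mul_le_mul_of_nonneg_left (www _ _) (by positivity)) ?_ (by positivity) (by positivity)
    rw [div_le_iff₀ h1]
    linarith [abs_add_le z.1 z.2, le_max_left |z.1| |z.2|, le_max_right |z.1| |z.2|]
  have Am1 : ∀ t ∈ Icc α β, Measurable (Am w (p t) (q t)) := fun t ht => Am_meas hwm (hF.mp t ht) (hF.mq t ht)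
  have Am2 : ∀ t ∈ Icc α β, ∀ x, Am w (p t) (q t) (-x) = Am w (p t) (q t) x := fun t ht =>
    Am_even hw.even (hF.cp t ht) (hF.cq t ht)
  obtain ⟨RA, RA', cRA, dRA, bRA, eRA⟩ := QA α β κ (C3 * κ) N w KA (fun t => Am w (p t) (q t)) q _ q _ q _ q _ hw
    (by positivity) hN KAm KAb hF.compQ hF.compQ hF.compQ hF.compQ (fun t ht => by
      have hq := Am_q w (p t) (q t)
      have hnq := Wd_nQ hw (Am1 t ht) (Am_p w (p t) (q t)) hq
      exact ⟨Am1 t ht, Am2 t ht, hn t ht, ⟨hq, hq, hq, hq⟩, ⟨hnq, hnq, hnq, hnq⟩⟩)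
  obtain ⟨RB, RB', cRB, dRB, bRB, eRB⟩ := QBB α β κ (C3 * κ) N w KB (fun t => Am w (p t) (q t)) p _ q _ p _ q _ hw
    (by positivity) hN KBm KBb hF.compP hF.compQ hF.compP hF.compQ (fun t ht => by
      have hq := Am_q w (p t) (q t)
      have hp := Am_p w (p t) (q t)
      have hnq := Wd_nQ hw (Am1 t ht) hp hq
      have hnp := Wd_nP hw (Am1 t ht) hq
      exact ⟨Am1 t ht, Am2 t ht, hn t ht, ⟨hp, hq, hp, hq⟩, ⟨hnp, hnq, hnp, hnq⟩⟩)
  set R3 : ℝ → ℂ := fun t => L3 M (p t) (q t) (q t) with hR3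
  set E : ℝ → ℂ := fun t => E2 θ (p t) + E2 θ (q t) with hE
  have b3 : ∀ t ∈ Icc α β, ‖R3 t‖ ≤ k * (C3 * κ) * N ^ 3 := fun t ht =>
    L3_tri hw (by positivity) hN (hF.mp t ht) (hF.mq t ht) (hF.mq t ht) (Am1 t ht) (Am2 t ht)
      (Am_p w (p t) (q t)) (Am_q w (p t) (q t)) (Am_q w (p t) (q t)) (hn t ht) Mm Mb
  have mlm : Measurable fun z : ℝ × ℝ => Complex.I * ((mlow θ z.1 z.2 : ℝ) : ℂ) :=
    (Complex.measurable_ofReal.comp (mlow_meas θm)).const_mul _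
  have mlb : ∀ x y : ℝ, ‖Complex.I * ((mlow θ x y : ℝ) : ℂ)‖ ≤ (8 * κ) * (w x * w y * w (x + y)) / (1 + mm x y) := by
    intro x y
    rw [norm_mul, Complex.norm_I, one_mul, Complex.norm_real, Real.norm_eq_abs]
    exact mlow_bound hw x y
  have bl : ∀ t ∈ Icc α β, ‖L3 (fun z => Complex.I * ((mlow θ z.1 z.2 : ℝ) : ℂ)) (p t) (q t) (q t)‖ ≤ k * (8 * κ) * N ^ 3 :=
    fun t ht => L3_tri hw (by positivity) hN (hF.mp t ht) (hF.mq t ht) (hF.mq t ht) (Am1 t ht) (Am2 t ht)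
      (Am_p w (p t) (q t)) (Am_q w (p t) (q t)) (Am_q w (p t) (q t)) (hn t ht) mlm mlb
  set G : ℝ → ℂ := fun t => E t - R3 t + RA t + 2 * RB t with hG
  have cG : ContinuousOn G (Icc α β) := ((cE.sub c3).add cRA).add (cRB.const_smul (2:ℂ))
  have dG : ∀ t ∈ Ioo α β, ∃ g, HasDerivAt G g t ∧ ‖g‖ ≤ κ * (8 * k + CA * C3 + 2 * (CB * C3)) * (N ^ 3 + N ^ 4 + N ^ 5) := by
    intro t ht
    have ht' := Ioo_subset_Icc_self ht
    obtain ⟨hdp, hdq⟩ := hd t ht'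
    refine ⟨_, (((dE t ht).sub (d3 t ht)).add (dRA t ht)).add ((dRB t ht).const_mul 2), ?_⟩
    have eA := expA hC hdq Mm (bdK KA KAb)
    have eB := expB hC hdp hdq Mm (bdK KB KBb)
    have hsw : L3 M (p t) (q t) (nQ (p t) (q t)) = L3 M (p t) (nQ (p t) (q t)) (q t) := by
      rw [L3_swap]
      congr 1
      funext z
      simp only [hM]
      rw [M3_swap]
    have hm : L3 (fun z => Complex.I * ((mg θ θ z.1 z.2 : ℝ) : ℂ)) (p t) (q t) (q t) =
        (∫ z : ℝ × ℝ, Complex.I * ((1 * (-z.1 - z.2) ^ 3 + a * z.1 ^ 3 + a * z.2 ^ 3 : ℝ) : ℂ) * M z *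
          p t (-z.1 - z.2) * q t z.1 * q t z.2) +
        L3 (fun z => Complex.I * ((mlow θ z.1 z.2 : ℝ) : ℂ)) (p t) (q t) (q t) := by
      have i1 : Integrable fun z : ℝ × ℝ => (Complex.I * ((H3 a z.1 z.2 : ℝ) : ℂ) * M z) *
          p t (-z.1 - z.2) * q t z.1 * q t z.2 := by
        refine D6.int2 (B := (2 * |a| + 8) * (C3 * κ * Bw ^ 3)) hC (by positivity) hdp hdq hdq (by unfold H3; fun_prop) (fun z => ?_)
        rw [norm_mul, norm_mul, Complex.norm_I, one_mul, Complex.norm_real, Real.norm_eq_abs]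
        have hh : |H3 a z.1 z.2| ≤ (2 * |a| + 8) * ((1 + |z.1|) ^ 3 * (1 + |z.2|) ^ 3) := by
          have e1 : |z.1| ^ 3 ≤ (1 + |z.1|) ^ 3 * (1 + |z.2|) ^ 3 := by
            rw [← mul_pow]
            refine pow_le_pow_left₀ (abs_nonneg _) ?_ 3
            nlinarith [abs_nonneg z.1, abs_nonneg z.2, mul_nonneg (abs_nonneg z.1) (abs_nonneg z.2)]
          have e2 : |z.2| ^ 3 ≤ (1 + |z.1|) ^ 3 * (1 + |z.2|) ^ 3 := by
            rw [← mul_pow]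
            refine pow_le_pow_left₀ (abs_nonneg _) ?_ 3
            nlinarith [abs_nonneg z.1, abs_nonneg z.2, mul_nonneg (abs_nonneg z.1) (abs_nonneg z.2)]
          have e3 : |z.1 + z.2| ^ 3 ≤ (1 + |z.1|) ^ 3 * (1 + |z.2|) ^ 3 := by
            rw [← mul_pow]
            refine pow_le_pow_left₀ (abs_nonneg _) ((abs_add_le _ _).trans ?_) 3
            nlinarith [abs_nonneg z.1, abs_nonneg z.2, mul_nonneg (abs_nonneg z.1) (abs_nonneg z.2)]
          have t1 : |H3 a z.1 z.2| ≤ |a| * |z.1| ^ 3 + |a| * |z.2| ^ 3 + |z.1 + z.2| ^ 3 := by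
            unfold H3
            refine (abs_sub _ _).trans (add_le_add ((abs_add_le _ _).trans (le_of_eq ?_)) (le_of_eq (abs_pow _ _)))
            rw [abs_mul, abs_mul, abs_pow, abs_pow]
          nlinarith [mul_le_mul_of_nonneg_left e1 (abs_nonneg a), mul_le_mul_of_nonneg_left e2 (abs_nonneg a), abs_nonneg a, pow_nonneg (abs_nonneg z.1) 3]
        calc _ ≤ ((2 * |a| + 8) * ((1 + |z.1|) ^ 3 * (1 + |z.2|) ^ 3)) * ((C3 * κ * Bw ^ 3) * (1 + |z.1|) * (1 + |z.2|)) :=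
              mul_le_mul hh (Mb' z) (norm_nonneg _) (by positivity)
          _ = _ := by ring
      have i2 : Integrable fun z : ℝ × ℝ => (Complex.I * ((mlow θ z.1 z.2 : ℝ) : ℂ)) *
          p t (-z.1 - z.2) * q t z.1 * q t z.2 := by
        refine D6.int2 (B := 8 * κ * Bw ^ 3) hC (by positivity) hdp hdq hdq mlm (fun z => ?_)
        refine (mlb z.1 z.2).trans ?_
        calc _ ≤ (8 * κ) * (w z.1 * w z.2 * w (z.1 + z.2)) := by
              refine div_le_self ?_ (by linarith [mm_nonneg z.1 z.2])
              have := w0 z.1; have := w0 z.2; have := w0 (z.1 + z.2)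
              positivity
          _ ≤ (8 * κ) * Bw ^ 3 := mul_le_mul_of_nonneg_left (www _ _) (by positivity)
          _ ≤ _ := by
              rw [mul_assoc (8 * κ * Bw ^ 3)]
              refine le_mul_of_one_le_right (by positivity) ?_
              rw [← mul_pow]
              refine one_le_pow₀ ?_
              nlinarith [abs_nonneg z.1, abs_nonneg z.2, mul_nonneg (abs_nonneg z.1) (abs_nonneg z.2)]
      have := L3_add i1 i2
      unfold L3 at this ⊢
      simp_rw [H3_phase]
      rw [← this]
      refine integral_congr_ae (Eventually.of_forall fun z => ?_)
      simp only [hM]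
      rw [mg_self, ms_eq (a := a) (Or.inl ha) hw]
      push_cast
      ring
    rw [hm, eA, hsw, eB]
    have r1 := eRA t ht
    have r2 := eRB t ht
    have r3 := bl t ht'
    set l := L3 (fun z => Complex.I * ((mlow θ z.1 z.2 : ℝ) : ℂ)) (p t) (q t) (q t)
    set lA := L4 (fun z => KA z.1) (q t) (q t) (q t) (q t) with hlA
    set lB := L4 (fun z => KB z.1) (p t) (q t) (p t) (q t) with hlB
    set i3 := (∫ z : ℝ × ℝ, Complex.I * ((1 * (-z.1 - z.2) ^ 3 + a * z.1 ^ 3 + a * z.2 ^ 3 : ℝ) : ℂ) * M z *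
          p t (-z.1 - z.2) * q t z.1 * q t z.2)
    have : ‖l - (lA - RA' t) - 2 * (lB - RB' t)‖ ≤ κ * (8 * k + CA * C3 + 2 * (CB * C3)) * (N ^ 3 + N ^ 4 + N ^ 5) := by
      have n1 : ‖l - (lA - RA' t) - 2 * (lB - RB' t)‖ ≤ ‖l‖ + ‖lA - RA' t‖ + 2 * ‖lB - RB' t‖ := by
        refine (norm_sub_le _ _).trans (add_le_add (norm_sub_le _ _) (le_of_eq ?_))
        rw [norm_mul]; norm_num
      have p3 : 0 ≤ N ^ 3 := by positivity
      have p4 : 0 ≤ N ^ 4 := by positivity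
      have p5 : 0 ≤ N ^ 5 := by positivity
      have q1 : k * (8 * κ) * N ^ 3 ≤ κ * (8 * k) * (N ^ 3 + N ^ 4 + N ^ 5) := by
        calc _ = κ * (8 * k) * N ^ 3 := by ring
          _ ≤ _ := mul_le_mul_of_nonneg_left (by linarith) (by positivity)
      have q2 : CA * (C3 * κ) * (N ^ 4 + N ^ 5) ≤ κ * (CA * C3) * (N ^ 3 + N ^ 4 + N ^ 5) := by
        calc _ = κ * (CA * C3) * (N ^ 4 + N ^ 5) := by ring
          _ ≤ _ := mul_le_mul_of_nonneg_left (by linarith) (by positivity)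
      have q3 : CB * (C3 * κ) * (N ^ 4 + N ^ 5) ≤ κ * (CB * C3) * (N ^ 3 + N ^ 4 + N ^ 5) := by
        calc _ = κ * (CB * C3) * (N ^ 4 + N ^ 5) := by ring
          _ ≤ _ := mul_le_mul_of_nonneg_left (by linarith) (by positivity)
      have : κ * (8 * k + CA * C3 + 2 * (CB * C3)) * (N ^ 3 + N ^ 4 + N ^ 5) =
        κ * (8 * k) * (N ^ 3 + N ^ 4 + N ^ 5) + κ * (CA * C3) * (N ^ 3 + N ^ 4 + N ^ 5) + 2 * (κ * (CB * C3) * (N ^ 3 + N ^ 4 + N ^ 5)) := by ring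
      rw [this]
      linarith
    refine le_trans (le_of_eq ?_) this
    congr 1
    ring
  choose! g hg hgb using dG
  intro s hs t ht
  have key := lip_ext cG hg hgb s hs t ht
  have bR : ∀ t ∈ Icc α β, ‖R3 t - RA t - 2 * RB t‖ ≤ κ * (k * C3 + CA * C3 + 2 * (CB * C3)) * (N ^ 3 + N ^ 4) := by
    intro t ht
    have n1 : ‖R3 t - RA t - 2 * RB t‖ ≤ ‖R3 t‖ + ‖RA t‖ + 2 * ‖RB t‖ := by
      refine (norm_sub_le _ _).trans (add_le_add (norm_sub_le _ _) (le_of_eq ?_))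
      rw [norm_mul]; norm_num
    have r1 := bRA t ht
    have r2 := bRB t ht
    have r3 := b3 t ht
    have p3 : 0 ≤ κ * (k * C3 * N ^ 4 + CA * C3 * N ^ 3 + 2 * (CB * C3) * N ^ 3) := by positivity
    nlinarith
  have e : Ew w (p t) (q t) - Ew w (p s) (q s) = (G t - G s) + (R3 t - RA t - 2 * RB t) - (R3 s - RA s - 2 * RB s) := by
    have : ∀ r, Ew w (p r) (q r) = E r := fun r => rfl
    rw [this, this]
    simp only [hG]
    ring
  rw [e]
  refine (norm_sub_le _ _).trans ((add_le_add (norm_add_le _ _) le_rfl).trans ?_)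
  have b1 := bR t ht
  have b2 := bR s hs
  have p3 : 0 ≤ N ^ 3 := by positivity
  have p4 : 0 ≤ N ^ 4 := by positivity
  have p5 : 0 ≤ N ^ 5 := by positivity
  set S := N ^ 3 + N ^ 4
  have hS : 0 ≤ S := by positivity
  have hT : 0 ≤ S + N ^ 5 := by positivity
  have x1 : 0 ≤ κ * (1 + 8 * k) * S := by positivity
  have x2 : 0 ≤ κ * (1 + 2 * (k * C3) + CA * C3 + 2 * (CB * C3)) * ((S + N ^ 5) * |t - s|) := by positivity
  nlinarith
end MB


namespace MB

lemma n2_mono {f g : ℝ → ℝ≥0∞} (h : ∀ x, f x ≤ g x) : n2 f ≤ n2 g := by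
  unfold n2
  exact ENNReal.rpow_le_rpow (lintegral_mono fun x => pow_le_pow_left₀ (zero_le) (h x) 2) (by norm_num)

lemma n2_le {f : ℝ → ℝ≥0∞} {c : ℝ≥0∞} (h : ∫⁻ x, f x ^ 2 ≤ c ^ 2) : n2 f ≤ c := by
  rw [← n2_sq] at h
  exact (ENNReal.pow_le_pow_left_iff (by norm_num)).1 h

lemma n2_add {f g : ℝ → ℝ≥0∞} (hf : Measurable f) (hg : Measurable g) :
    n2 (fun x => f x + g x) ≤ n2 f + n2 g := by
  have := ENNReal.lintegral_Lp_add_le (μ := volume) hf.aemeasurable hg.aemeasurable (p := 2) (by norm_num)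
  simpa [n2] using this

lemma n2_smul {f : ℝ → ℝ≥0∞} (c : ℝ≥0∞) (hf : Measurable f) :
    n2 (fun x => c * f x) = c * n2 f := by
  unfold n2
  simp_rw [mul_pow]
  rw [lintegral_const_mul _ (hf.pow_const 2), ENNReal.mul_rpow_of_nonneg _ _ (by norm_num)]
  congr 1
  rw [← ENNReal.rpow_natCast, ← ENNReal.rpow_mul]
  norm_num

/-- convolution of nonnegative functions -/
noncomputable def lc (f g : ℝ → ℝ≥0∞) (ξ : ℝ) : ℝ≥0∞ := ∫⁻ η, f η * g (ξ - η)

lemma lc_meas {f g : ℝ → ℝ≥0∞} (hf : Measurable f) (hg : Measurable g) : Measurable (lc f g) := by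
  unfold lc
  exact Measurable.lintegral_prod_right' (f := fun z : ℝ × ℝ => f z.2 * g (z.1 - z.2)) (by fun_prop)

lemma lc_comm (f g : ℝ → ℝ≥0∞) (ξ : ℝ) : lc f g ξ = lc g f ξ := by
  unfold lc
  rw [← lintegral_sub_left_eq_self _ ξ]
  simp_rw [sub_sub_cancel, mul_comm]

noncomputable def n1 (f : ℝ → ℝ≥0∞) : ℝ≥0∞ := ∫⁻ x, f x

lemma lc_int {f g : ℝ → ℝ≥0∞} (hf : Measurable f) (hg : Measurable g) : ∫⁻ x, lc f g x = n1 f * n1 g := by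
  unfold lc n1
  rw [lintegral_lintegral_swap (by fun_prop)]
  have : ∀ y, ∫⁻ x, f y * g (x - y) = f y * ∫⁻ x, g x := by
    intro y
    rw [lintegral_const_mul _ (by fun_prop), lintegral_sub_right_eq_self]
  simp_rw [this]
  rw [lintegral_mul_const _ hf]

lemma lc_sup {f g : ℝ → ℝ≥0∞} (hf : Measurable f) (hg : Measurable g) (x : ℝ) : lc f g x ≤ n2 f * n2 g := by
  unfold lc
  refine (cs hf (g := fun y => g (x - y)) (by fun_prop)).trans ?_
  rw [n2_sub_left]

lemma young {f g : ℝ → ℝ≥0∞} (hf : Measurable f) (hg : Measurable g) : n2 (lc f g) ≤ n2 f * n1 g := by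
  refine n2_le ?_
  have e : ∀ z : ℝ≥0∞, z ^ (1/2:ℝ) * z ^ (1/2:ℝ) = z := by
    intro z
    rw [← ENNReal.rpow_add_of_nonneg _ _ (by norm_num) (by norm_num)]; norm_num
  have h1 : ∀ x, lc f g x ^ 2 ≤ lc (fun y => f y ^ 2) g x * n1 g := by
    intro x
    have h := cs (f := fun y => f y * g (x - y) ^ (1/2:ℝ)) (g := fun y => g (x - y) ^ (1/2:ℝ)) (by fun_prop) (by fun_prop)
    have h2 : lc f g x ≤ n2 (fun y => f y * g (x - y) ^ (1/2:ℝ)) * n2 (fun y => g (x - y) ^ (1/2:ℝ)) := by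
      refine le_trans (le_of_eq ?_) h
      unfold lc
      congr 1; funext y
      rw [mul_assoc, e]
    refine (pow_le_pow_left₀ (zero_le) h2 2).trans (le_of_eq ?_)
    rw [mul_pow, n2_sq, n2_sq]
    simp_rw [mul_pow, pow_two (_ ^ (1/2:ℝ)), e]
    unfold lc n1
    rw [lintegral_sub_left_eq_self]
  calc ∫⁻ x, lc f g x ^ 2 ≤ ∫⁻ x, lc (fun y => f y ^ 2) g x * n1 g := lintegral_mono h1
    _ = (∫⁻ x, lc (fun y => f y ^ 2) g x) * n1 g := lintegral_mul_const _ (lc_meas (by fun_prop) hg)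
    _ = n1 (fun y => f y ^ 2) * n1 g * n1 g := by rw [lc_int (by fun_prop) hg]
    _ = _ := by rw [mul_pow, n2_sq, n1]; ring

noncomputable def ab (x : ℝ) : ℝ≥0∞ := ENNReal.ofReal |x|

@[fun_prop] lemma ab_meas : Measurable ab := by unfold ab; fun_prop

lemma ab_tri (x y : ℝ) : ab (x + y) ≤ ab x + ab y := by
  unfold ab
  rw [← ENNReal.ofReal_add (abs_nonneg _) (abs_nonneg _)]
  exact ENNReal.ofReal_le_ofReal (abs_add_le _ _)

lemma ab_lc {A : ℝ → ℝ≥0∞} (hA : Measurable A) (ξ : ℝ) :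
    ab ξ * lc A A ξ ≤ 2 * lc (fun x => ab x * A x) A ξ := by
  have : ab ξ * lc A A ξ ≤ lc (fun x => ab x * A x) A ξ + lc A (fun x => ab x * A x) ξ := by
    unfold lc
    rw [← lintegral_const_mul _ (by fun_prop), ← lintegral_add_left (by fun_prop)]
    refine lintegral_mono fun y => ?_
    have := ab_tri y (ξ - y)
    rw [add_sub_cancel] at this
    calc _ ≤ (ab y + ab (ξ - y)) * (A y * A (ξ - y)) := mul_le_mul_left this _
      _ = _ := by ring
  rw [lc_comm A (fun x => ab x * A x)] at this
  rw [two_mul]; exact this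

/-- low part of the derivative -/
noncomputable def lo (κ : ℝ) (A : ℝ → ℝ≥0∞) (x : ℝ) : ℝ≥0∞ := if 2 * κ * |x| ≤ 1 then ab x * A x else 0

lemma lo_meas (κ : ℝ) {A : ℝ → ℝ≥0∞} (hA : Measurable A) : Measurable (lo κ A) := by
  unfold lo
  exact Measurable.ite (measurableSet_le (by fun_prop) measurable_const) (by fun_prop) measurable_const

lemma lc_split {κ : ℝ} (hκ : 0 ≤ κ) {A : ℝ → ℝ≥0∞} (hA : Measurable A) (ξ : ℝ) :
    lc (fun x => ab x * A x) A ξ ≤ lc (lo κ A) A ξ + ENNReal.ofReal (2 * κ) *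
      (lc (fun x => ab x * A x) (fun x => ab x * A x) ξ + ab ξ * lc (fun x => ab x * A x) A ξ) := by
  have hl := lo_meas κ hA
  unfold lc
  rw [← lintegral_const_mul _ (by fun_prop), ← lintegral_add_left (by fun_prop), ← lintegral_const_mul _ (by fun_prop),
    ← lintegral_add_left (by fun_prop)]
  refine lintegral_mono fun y => ?_
  simp only [lo]
  split_ifs with h
  · exact le_self_add
  · rw [zero_mul, zero_add]
    push Not at h
    have h1 : (1:ℝ≥0∞) ≤ ENNReal.ofReal (2 * κ) * ab y := by
      unfold ab
      rw [← ENNReal.ofReal_mul (by positivity)]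
      exact ENNReal.one_le_ofReal.2 h.le
    have h2 : ab y ≤ ab (ξ - y) + ab ξ := by
      have := ab_tri (-(ξ - y)) ξ
      rw [show -(ξ - y) + ξ = y by ring] at this
      simpa [ab, abs_sub_comm] using this
    calc ab y * A y * A (ξ - y) ≤ (ENNReal.ofReal (2 * κ) * ab y) * (ab y * A y * A (ξ - y)) := le_mul_of_one_le_left (zero_le) h1
      _ ≤ (ENNReal.ofReal (2 * κ) * (ab (ξ - y) + ab ξ)) * (ab y * A y * A (ξ - y)) := by gcongr
      _ = _ := by ring

lemma T_bound {κ : ℝ} (hκ : 0 ≤ κ) {A : ℝ → ℝ≥0∞} (hA : Measurable A) :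
    (∫⁻ x, ab x * lc A A x * lc A A x) + ENNReal.ofReal (2 * κ) * ∫⁻ x, ab x * lc A A x * lc (fun x => ab x * A x) A x ≤
      2 * (n2 (lo κ A) * n2 A * n1 A ^ 2) + ENNReal.ofReal (16 * κ) * (n2 (fun x => ab x * A x) * n1 A) ^ 2 := by
  set B : ℝ → ℝ≥0∞ := fun x => ab x * A x with hB
  have hBm : Measurable B := by fun_prop
  have hl := lo_meas κ hA
  have mg := lc_meas hA hA
  have mG := lc_meas hBm hA
  have mL := lc_meas hl hA
  have mBB := lc_meas hBm hBm
  have y1 := young hBm hA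
  have GG : ∫⁻ x, lc B A x * lc B A x ≤ (n2 B * n1 A) ^ 2 := by
    calc _ ≤ n2 (lc B A) * n2 (lc B A) := cs mG mG
      _ ≤ _ := by rw [pow_two]; gcongr
  have h2 : ∫⁻ x, ab x * lc A A x * lc B A x ≤ 2 * (n2 B * n1 A) ^ 2 := by
    calc _ ≤ ∫⁻ x, 2 * (lc B A x * lc B A x) := by
          refine lintegral_mono fun x => ?_
          rw [← mul_assoc]
          exact mul_le_mul_left (ab_lc hA x) _
      _ = 2 * ∫⁻ x, lc B A x * lc B A x := lintegral_const_mul _ (by fun_prop)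
      _ ≤ _ := by gcongr
  have h1 : ∫⁻ x, ab x * lc A A x * lc A A x ≤
      2 * (n2 (lo κ A) * n2 A * n1 A ^ 2) + ENNReal.ofReal (2 * κ) * (6 * (n2 B * n1 A) ^ 2) := by
    calc _ ≤ ∫⁻ x, 2 * (lc (lo κ A) A x * lc A A x) + 2 * (ENNReal.ofReal (2 * κ) *
              (lc B B x * lc A A x + ab x * lc A A x * lc B A x)) := by
          refine lintegral_mono fun x => ?_
          calc _ ≤ 2 * lc B A x * lc A A x := mul_le_mul_left (ab_lc hA x) _
            _ ≤ 2 * (lc (lo κ A) A x + ENNReal.ofReal (2 * κ) * (lc B B x + ab x * lc B A x)) * lc A A x := by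
                gcongr
                exact lc_split hκ hA x
            _ = _ := by ring
      _ = 2 * (∫⁻ x, lc (lo κ A) A x * lc A A x) + 2 * (ENNReal.ofReal (2 * κ) *
              ((∫⁻ x, lc B B x * lc A A x) + ∫⁻ x, ab x * lc A A x * lc B A x)) := by
          rw [lintegral_add_left (by fun_prop), lintegral_const_mul _ (by fun_prop), lintegral_const_mul _ (by fun_prop),
            lintegral_const_mul _ (by fun_prop), lintegral_add_left (by fun_prop)]
      _ ≤ 2 * ((n2 (lo κ A) * n1 A) * (n2 A * n1 A)) + 2 * (ENNReal.ofReal (2 * κ) *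
              ((n2 B * n2 B) * (n1 A * n1 A) + 2 * (n2 B * n1 A) ^ 2)) := by
          gcongr
          · exact (cs mL mg).trans (mul_le_mul' (young hl hA) (young hA hA))
          · calc _ ≤ ∫⁻ x, (n2 B * n2 B) * lc A A x := lintegral_mono fun x => mul_le_mul_left (lc_sup hBm hBm x) _
              _ = _ := by rw [lintegral_const_mul _ mg, lc_int hA hA]
      _ = _ := by ring
  calc _ ≤ 2 * (n2 (lo κ A) * n2 A * n1 A ^ 2) + ENNReal.ofReal (2 * κ) * (6 * (n2 B * n1 A) ^ 2) +
        ENNReal.ofReal (2 * κ) * (2 * (n2 B * n1 A) ^ 2) := by gcongr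
    _ = 2 * (n2 (lo κ A) * n2 A * n1 A ^ 2) + (8 * ENNReal.ofReal (2 * κ)) * (n2 B * n1 A) ^ 2 := by ring
    _ = _ := by
      congr 2
      rw [show (8:ℝ≥0∞) = ENNReal.ofReal 8 by norm_num, ← ENNReal.ofReal_mul (by norm_num)]
      congr 1; ring

lemma tri3 {f g h : ℝ → ℝ≥0∞} (hf : Measurable f) (hg : Measurable g) (hh : Measurable h) :
    ∫⁻ x, ∫⁻ y, f x * g y * h (x + y) = ∫⁻ x, h x * lc f g x := by
  unfold lc
  have : ∀ x, h x * ∫⁻ y, f y * g (x - y) = ∫⁻ y, f y * g (x - y) * h x := by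
    intro x
    rw [← lintegral_const_mul _ (by fun_prop)]
    congr 1; funext y; ring
  simp_rw [this]
  symm
  rw [lintegral_lintegral_swap (by fun_prop)]
  congr 1; funext x
  symm
  rw [← lintegral_sub_right_eq_self _ x]
  congr 1; funext y
  simp

lemma high_J {κ : ℝ} (hκ : 0 < κ) : n2 (fun x => ENNReal.ofReal (4 * κ) * J 1 (2 * κ * x)) ≤
    ENNReal.ofReal ((8 * κ * k2) ^ (1/2:ℝ)) := by
  refine n2_le ?_
  simp_rw [mul_pow, J_sq]
  have hm : Measurable fun x => J (2 * 1) x := J_meas _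
  rw [lintegral_const_mul' _ _ (ENNReal.pow_ne_top ENNReal.ofReal_ne_top)]
  have e : ∫⁻ x, J (2 * 1) (2 * κ * x) = ENNReal.ofReal (1 / (2 * κ)) * cJ 2 := by
    have h1 : ∫⁻ x, J (2 * 1) (2 * κ * x) = ∫⁻ x, J (2 * 1) x ∂(Measure.map (fun x => 2 * κ * x) volume) := by
      rw [lintegral_map hm (by fun_prop)]
    rw [h1, Real.map_volume_mul_left (by positivity), lintegral_smul_measure, cJ]
    norm_num
    rw [abs_of_pos hκ, ENNReal.ofReal_mul (by positivity)]
  have hk := k2_nn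
  rw [e, k2_eq, ← ENNReal.ofReal_mul (by positivity), ← ENNReal.ofReal_pow (by positivity),
    ← ENNReal.ofReal_mul (by positivity), ← ENNReal.ofReal_pow (by positivity)]
  refine ENNReal.ofReal_le_ofReal (le_of_eq ?_)
  rw [← Real.rpow_natCast ((8 * κ * k2) ^ (1/2:ℝ)), ← Real.rpow_mul (by positivity)]
  norm_num
  field_simp
  ring
end MB


namespace MB

noncomputable def kh : ℝ := k2 ^ (1/2 : ℝ)
lemma kh_nn : 0 ≤ kh := by have := k2_nn; unfold kh; positivity

lemma n1_le {A : ℝ → ℝ≥0∞} (hA : Measurable A) : n1 A ≤ ENNReal.ofReal kh * (n2 A + n2 (fun x => ab x * A x)) := by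
  have h := AJ (A := fun x => A x + ab x * A x) (by fun_prop) 1
  have e : ∀ x, (A x + ab x * A x) * J 1 x = A x := by
    intro x
    rw [J1_eq]
    have : A x + ab x * A x = A x * ENNReal.ofReal (1 + |x|) := by
      rw [ENNReal.ofReal_add (by norm_num) (abs_nonneg x), ENNReal.ofReal_one]; unfold ab; ring
    rw [this, mul_assoc, ← ENNReal.ofReal_mul (by positivity)]
    rw [mul_one_div_cancel (by positivity), ENNReal.ofReal_one, mul_one]
  simp_rw [e] at h
  have hk := k2_nn
  have hc : cJ (2 * 1) ^ (1/2:ℝ) = ENNReal.ofReal kh := by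
    rw [mul_one, k2_eq, ENNReal.ofReal_rpow_of_nonneg hk (by norm_num), kh]
  rw [hc] at h
  exact h.trans (mul_le_mul_right (n2_add hA (by fun_prop)) _)

lemma w_low {κ : ℝ} {w : ℝ → ℝ} (hw : Wt κ w) (h0 : w 0 = 1) {x : ℝ} (hx : 2 * κ * |x| ≤ 1) : w x ≤ 2 := by
  have := hw.lip 0 x (by simp)
  have p := hw.pos x
  rw [h0, abs_zero, sub_zero] at this
  nlinarith

lemma sizes {κ N0 Φ : ℝ} {w : ℝ → ℝ} (hw : Wt κ w) (h0 : w 0 = 1) (hκ : 0 < κ) (hκ1 : κ ≤ 1) (hN0 : 0 ≤ N0) (hΦ : 0 ≤ Φ)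
    (hκΦ : κ * Φ ^ 2 ≤ 2) {p q : ℝ → ℂ} (hp : Measurable p) (hq : Measurable q)
    (a0 : n2 (Am (fun _ => 1) p q) ≤ ENNReal.ofReal N0)
    (b0 : n2 (fun x => ab x * Am (fun _ => 1) p q x) ≤ ENNReal.ofReal N0)
    (b1 : n2 (fun x => ab x * Am w p q x) ≤ ENNReal.ofReal Φ) :
    n2 (Am w p q) ≤ ENNReal.ofReal ((4 * kh + 4) * (1 + N0)) ∧
    n1 (Am w p q) ≤ ENNReal.ofReal ((4 * kh + 4) * (1 + N0)) ∧
    n2 (lo κ (Am w p q)) ≤ ENNReal.ofReal ((4 * kh + 4) * (1 + N0)) := by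
  have hk := kh_nn
  have hk2 := k2_nn
  set A := Am w p q with hAd
  set A0 := Am (fun _ => 1) p q with hA0d
  have mA : Measurable A := Am_meas hw.meas hp hq
  have mA0 : Measurable A0 := Am_meas measurable_const hp hq
  have low : ∀ x, 2 * κ * |x| ≤ 1 → A x ≤ 2 * A0 x := by
    intro x hx
    simp only [hAd, hA0d, Am, ENNReal.ofReal_one, one_mul]
    refine mul_le_mul_left ?_ _
    rw [show (2:ℝ≥0∞) = ENNReal.ofReal 2 by norm_num]
    exact ENNReal.ofReal_le_ofReal (w_low hw h0 hx)
  have kΦ : κ * Φ ≤ 2 := by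
    by_contra h; push Not at h
    have : Φ > 2 := by nlinarith
    nlinarith
  refine ⟨?_, ?_, ?_⟩
  · have h1 : ∀ x, A x ≤ 2 * A0 x + ENNReal.ofReal (2 * κ) * (ab x * A x) := by
      intro x
      by_cases hx : 2 * κ * |x| ≤ 1
      · exact (low x hx).trans le_self_add
      · push Not at hx
        refine le_trans ?_ le_add_self
        rw [← mul_assoc]
        refine le_mul_of_one_le_left (zero_le) ?_
        unfold ab
        rw [← ENNReal.ofReal_mul (by positivity)]
        exact ENNReal.one_le_ofReal.2 hx.le
    calc n2 A ≤ n2 (fun x => 2 * A0 x + ENNReal.ofReal (2 * κ) * (ab x * A x)) := n2_mono h1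
      _ ≤ 2 * n2 A0 + ENNReal.ofReal (2 * κ) * n2 (fun x => ab x * A x) := by
          refine (n2_add (by fun_prop) (by fun_prop)).trans (le_of_eq ?_)
          rw [n2_smul _ mA0, n2_smul _ (by fun_prop)]
      _ ≤ ENNReal.ofReal 2 * ENNReal.ofReal N0 + ENNReal.ofReal (2 * κ) * ENNReal.ofReal Φ := by
          rw [show (2:ℝ≥0∞) = ENNReal.ofReal 2 by norm_num]
          gcongr
      _ = ENNReal.ofReal (2 * N0 + 2 * κ * Φ) := by
          rw [← ENNReal.ofReal_mul (by norm_num), ← ENNReal.ofReal_mul (by positivity), ← ENNReal.ofReal_add (by positivity) (by positivity)]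
      _ ≤ _ := ENNReal.ofReal_le_ofReal (by nlinarith [mul_nonneg hk hN0])
  · have h1 : ∀ x, A x ≤ 2 * A0 x + (ab x * A x) * (ENNReal.ofReal (4 * κ) * J 1 (2 * κ * x)) := by
      intro x
      by_cases hx : 2 * κ * |x| ≤ 1
      · exact (low x hx).trans le_self_add
      · push Not at hx
        refine le_trans ?_ le_add_self
        rw [J1_eq]
        unfold ab
        calc A x ≤ (ENNReal.ofReal |x| * (ENNReal.ofReal (4 * κ) * ENNReal.ofReal (1 / (1 + |2 * κ * x|)))) * A x := by
              refine le_mul_of_one_le_left (zero_le) ?_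
              rw [← ENNReal.ofReal_mul (by positivity), ← ENNReal.ofReal_mul (by positivity)]
              refine ENNReal.one_le_ofReal.2 ?_
              rw [abs_mul, abs_of_pos (by positivity : (0:ℝ) < 2 * κ), mul_one_div, mul_div_assoc', le_div_iff₀ (by positivity)]
              linarith
          _ = _ := by ring
    calc n1 A ≤ ∫⁻ x, 2 * A0 x + (ab x * A x) * (ENNReal.ofReal (4 * κ) * J 1 (2 * κ * x)) := lintegral_mono h1
      _ = 2 * n1 A0 + ∫⁻ x, (ab x * A x) * (ENNReal.ofReal (4 * κ) * J 1 (2 * κ * x)) := by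
          rw [lintegral_add_left (by fun_prop), lintegral_const_mul _ mA0]; rfl
      _ ≤ 2 * (ENNReal.ofReal kh * (n2 A0 + n2 (fun x => ab x * A0 x))) +
          n2 (fun x => ab x * A x) * ENNReal.ofReal ((8 * κ * k2) ^ (1/2:ℝ)) := by
          gcongr
          · exact n1_le mA0
          · exact (cs (by fun_prop) (((J_meas 1).comp (by fun_prop)).const_mul _)).trans (mul_le_mul_right (high_J hκ) _)
      _ ≤ ENNReal.ofReal 2 * (ENNReal.ofReal kh * (ENNReal.ofReal N0 + ENNReal.ofReal N0)) +
          ENNReal.ofReal Φ * ENNReal.ofReal ((8 * κ * k2) ^ (1/2:ℝ)) := by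
          rw [show (2:ℝ≥0∞) = ENNReal.ofReal 2 by norm_num]
          gcongr
      _ = ENNReal.ofReal (2 * (kh * (N0 + N0)) + Φ * (8 * κ * k2) ^ (1/2:ℝ)) := by
          rw [← ENNReal.ofReal_add hN0 hN0, ← ENNReal.ofReal_mul hk, ← ENNReal.ofReal_mul (by norm_num),
            ← ENNReal.ofReal_mul hΦ, ← ENNReal.ofReal_add (by positivity) (by positivity)]
      _ ≤ _ := by
          refine ENNReal.ofReal_le_ofReal ?_
          have : Φ * (8 * κ * k2) ^ (1/2:ℝ) ≤ 4 * kh := by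
            unfold kh
            rw [← Real.sqrt_eq_rpow, ← Real.sqrt_eq_rpow]
            refine abs_le_of_sq_le_sq' ?_ (by positivity) |>.2
            rw [mul_pow, mul_pow, Real.sq_sqrt (by positivity), Real.sq_sqrt hk2]
            nlinarith
          nlinarith [mul_nonneg hk hN0]
  · have h1 : ∀ x, lo κ A x ≤ 2 * (ab x * A0 x) := by
      intro x
      unfold lo
      split_ifs with hx
      · calc ab x * A x ≤ ab x * (2 * A0 x) := mul_le_mul_right (low x hx) _
          _ = _ := by ring
      · exact zero_le
    calc _ ≤ n2 (fun x => 2 * (ab x * A0 x)) := n2_mono h1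
      _ = 2 * n2 (fun x => ab x * A0 x) := n2_smul _ (by fun_prop)
      _ ≤ ENNReal.ofReal 2 * ENNReal.ofReal N0 := by
          rw [show (2:ℝ≥0∞) = ENNReal.ofReal 2 by norm_num]
          gcongr
      _ = ENNReal.ofReal (2 * N0) := by rw [← ENNReal.ofReal_mul (by norm_num)]
      _ ≤ _ := ENNReal.ofReal_le_ofReal (by nlinarith [mul_nonneg hk hN0])

/-! multiplier -/
lemma ms2_bound {κ : ℝ} {w : ℝ → ℝ} (h : Wt κ w) : ∀ x y : ℝ,
    |ms (fun z => z ^ 2 * w z ^ 2) x y| ≤ |x * y * (x + y)| * (3 + 2 * κ * mm x y) * (w x * w y * w (x + y)) := by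
  have he : ∀ x : ℝ, (fun z => z ^ 2 * w z ^ 2) (-x) = (fun z => z ^ 2 * w z ^ 2) x := by
    intro x; simp only [h.even]; ring
  refine tri_ind ?_ ?_ ?_ ?_
  · intro a b ha hb
    have hs : 0 ≤ a + b := add_nonneg ha hb
    rw [mm_pos ha hb, abs_of_nonneg (by positivity : (0:ℝ) ≤ a * b * (a + b))]
    have la := h.lip2 (x := a) (y := a + b) (by rw [abs_of_nonneg ha, abs_of_nonneg hs]; linarith)
    have lb := h.lip2 (x := b) (y := a + b) (by rw [abs_of_nonneg hb, abs_of_nonneg hs]; linarith)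
    have ma := h.mono a (a + b) (by rw [abs_of_nonneg ha, abs_of_nonneg hs]; linarith)
    have mb := h.mono b (a + b) (by rw [abs_of_nonneg hb, abs_of_nonneg hs]; linarith)
    rw [abs_of_nonneg ha, abs_of_nonneg hs] at la
    rw [abs_of_nonneg hb, abs_of_nonneg hs] at lb
    have pa := h.pos a
    have pb := h.pos b
    have ps := h.pos (a + b)
    have hκ := h.k0
    have sub := h.sub a b
    have e : ms (fun z => z ^ 2 * w z ^ 2) a b = -(a ^ 3 * (w (a + b) ^ 2 - w a ^ 2) + b ^ 3 * (w (a + b) ^ 2 - w b ^ 2)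
        + 3 * (a * b * (a + b)) * w (a + b) ^ 2) := by
      unfold ms; ring
    have qa : 0 ≤ w (a + b) ^ 2 - w a ^ 2 := by nlinarith
    have qb : 0 ≤ w (a + b) ^ 2 - w b ^ 2 := by nlinarith
    rw [e, abs_neg, abs_of_nonneg (by positivity)]
    have s1 : a ^ 3 * (w (a + b) ^ 2 - w a ^ 2) ≤ a ^ 3 * (2 * κ * (a + b - a) * w (a + b) ^ 2) :=
      mul_le_mul_of_nonneg_left la (by positivity)
    have s2 : b ^ 3 * (w (a + b) ^ 2 - w b ^ 2) ≤ b ^ 3 * (2 * κ * (a + b - b) * w (a + b) ^ 2) :=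
      mul_le_mul_of_nonneg_left lb (by positivity)
    have s3 : w (a + b) ^ 2 ≤ w a * w b * w (a + b) := by nlinarith
    calc _ ≤ (a * b * (a + b) * (3 + 2 * κ * (a + b))) * w (a + b) ^ 2 := by
          have : 0 ≤ κ * (a * b) * (a * b) * w (a + b) ^ 2 := by positivity
          nlinarith
      _ ≤ (a * b * (a + b) * (3 + 2 * κ * (a + b))) * (w a * w b * w (a + b)) := mul_le_mul_of_nonneg_left s3 (by positivity)
  · intro x y hxy
    rw [ms_neg he, abs_neg, mm_neg, h.even, h.even, show -x + -y = -(x + y) by ring, h.even,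
      show -x * -y * -(x + y) = -(x * y * (x + y)) by ring, abs_neg]
    exact hxy
  · intro x y hxy
    rw [ms_swap, mm_swap, show y * x * (y + x) = x * y * (x + y) by ring, show w y * w x * w (y + x) = w x * w y * w (x + y) by
      rw [add_comm y x]; ring]
    exact hxy
  · intro x y hxy
    rw [ms_rot he, abs_neg, mm_rot, h.even, show x + y + -y = x by ring,
      show (x + y) * -y * x = -(x * y * (x + y)) by ring, abs_neg, show w (x + y) * w y * w x = w x * w y * w (x + y) by ring]
    exact hxy

noncomputable def N3 (a : ℝ) (w : ℝ → ℝ) (x y : ℝ) : ℝ := ms (fun z => z ^ 2 * w z ^ 2) x y / H3 a x y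

lemma N3_swap (a : ℝ) (w : ℝ → ℝ) (x y : ℝ) : N3 a w x y = N3 a w y x := by
  unfold N3; rw [ms_swap, show H3 a x y = H3 a y x by unfold H3; ring]

lemma N3_meas (a : ℝ) {w : ℝ → ℝ} (hw : Measurable w) : Measurable fun z : ℝ × ℝ => N3 a w z.1 z.2 := by
  unfold N3
  refine (ms_meas (by fun_prop)).div ?_
  unfold H3; fun_prop

lemma N3_bound {a : ℝ} (ha : a < 0 ∨ a = 1 ∨ 4 < a) : ∃ C > 0, ∀ κ w, Wt κ w → ∀ x y,
    |N3 a w x y| ≤ C * (1 + κ * mm x y) * (w x * w y * w (x + y)) ∧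
    ms (fun z => z ^ 2 * w z ^ 2) x y = H3 a x y * N3 a w x y := by
  obtain ⟨c, hc, hH⟩ := H3_bound ha
  refine ⟨3 / c, by positivity, fun κ w hw x y => ?_⟩
  have hb := ms2_bound hw x y
  have hh := hH x y
  have := hw.pos x; have := hw.pos y; have := hw.pos (x + y); have hκ := hw.k0
  have hm := mm_nonneg x y
  by_cases h0 : H3 a x y = 0
  · have z : |x * y * (x + y)| = 0 := by
      rw [h0, abs_zero] at hh
      have := abs_nonneg (x * y * (x + y))
      nlinarith
    rw [z, zero_mul, zero_mul] at hb
    have z2 : ms (fun z => z ^ 2 * w z ^ 2) x y = 0 := abs_nonpos_iff.1 hb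
    unfold N3
    rw [z2, h0]
    simp only [div_zero, abs_zero, mul_zero, and_true]
    positivity
  · refine ⟨?_, ?_⟩
    · unfold N3
      rw [abs_div, div_le_iff₀ (abs_pos.2 h0)]
      refine hb.trans ?_
      calc |x * y * (x + y)| * (3 + 2 * κ * mm x y) * (w x * w y * w (x + y))
          = (c * |x * y * (x + y)|) * ((1 / c) * ((3 + 2 * κ * mm x y) * (w x * w y * w (x + y)))) := by field_simp
        _ ≤ |H3 a x y| * ((1 / c) * ((3 + 2 * κ * mm x y) * (w x * w y * w (x + y)))) :=
            mul_le_mul_of_nonneg_right hh (by positivity)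
        _ ≤ |H3 a x y| * ((1 / c) * ((3 * (1 + κ * mm x y)) * (w x * w y * w (x + y)))) := by
            refine mul_le_mul_of_nonneg_left (mul_le_mul_of_nonneg_left (mul_le_mul_of_nonneg_right ?_ (by positivity)) (by positivity)) (abs_nonneg _)
            nlinarith [mul_nonneg hκ hm]
        _ = _ := by ring
    · unfold N3
      field_simp
end MB


namespace MB

/-! Case II trilinear bounds -/
noncomputable def TT (κ : ℝ) (Z A : ℝ → ℝ≥0∞) : ℝ≥0∞ :=
  (∫⁻ x, Z x * lc A A x) + ENNReal.ofReal (2 * κ) * ∫⁻ x, Z x * lc (fun x => ab x * A x) A x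

lemma G_ofReal {C κ m u v : ℝ} (hC : 0 ≤ C) (hκ : 0 ≤ κ) (hm : m ≤ |u| + |v|) :
    ENNReal.ofReal (C * (1 + κ * m)) ≤ ENNReal.ofReal C * (1 + ENNReal.ofReal κ * (ab u + ab v)) := by
  unfold ab
  rw [← ENNReal.ofReal_add (abs_nonneg _) (abs_nonneg _), ← ENNReal.ofReal_mul hκ, ← ENNReal.ofReal_one,
    ← ENNReal.ofReal_add zero_le_one (by positivity), ← ENNReal.ofReal_mul hC]
  refine ENNReal.ofReal_le_ofReal (mul_le_mul_of_nonneg_left ?_ hC)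
  linarith [mul_le_mul_of_nonneg_left hm hκ]

lemma tqa {C κ : ℝ} (hC : 0 ≤ C) (hκ : 0 ≤ κ) {Z A : ℝ → ℝ≥0∞} (hZ : Measurable Z) (hA : Measurable A)
    (eZ : ∀ x, Z (-x) = Z x) :
    ∫⁻ x, ∫⁻ y, ENNReal.ofReal (C * (1 + κ * mm x y)) * (Z (-x - y) * A x * A y) ≤
      ENNReal.ofReal C * TT κ Z A := by
  have mB : Measurable fun x => ab x * A x := by fun_prop
  have hmm : ∀ x y : ℝ, mm x y ≤ |x| + |y| := fun x y =>
    max_le (max_le (by linarith [abs_nonneg y]) (by linarith [abs_nonneg x])) (abs_add_le _ _)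
  have e1 := tri3 hA hA hZ
  have e2 := tri3 mB hA hZ
  have e3 := tri3 hA mB hZ
  calc _ ≤ ∫⁻ x, ∫⁻ y, ENNReal.ofReal C * (A x * A y * Z (x + y) + ENNReal.ofReal κ * ((ab x * A x) * A y * Z (x + y)
          + A x * (ab y * A y) * Z (x + y))) := by
        refine lintegral_mono fun x => lintegral_mono fun y => ?_
        calc _ ≤ (ENNReal.ofReal C * (1 + ENNReal.ofReal κ * (ab x + ab y))) * (Z (-x - y) * A x * A y) :=
              mul_le_mul_left (G_ofReal hC hκ (hmm x y)) _
          _ = _ := by rw [show -x - y = -(x + y) by ring, eZ]; ring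
    _ = ENNReal.ofReal C * ((∫⁻ x, ∫⁻ y, A x * A y * Z (x + y)) + ENNReal.ofReal κ *
          ((∫⁻ x, ∫⁻ y, (ab x * A x) * A y * Z (x + y)) + ∫⁻ x, ∫⁻ y, A x * (ab y * A y) * Z (x + y))) := by
        simp_rw [lintegral_const_mul' _ _ ENNReal.ofReal_ne_top]
        congr 1
        rw [← lintegral_add_left (by fun_prop), ← lintegral_const_mul' _ _ ENNReal.ofReal_ne_top,
          ← lintegral_add_left (by fun_prop)]
        refine lintegral_congr fun x => ?_
        rw [← lintegral_add_left (by fun_prop), ← lintegral_const_mul' _ _ ENNReal.ofReal_ne_top,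
          ← lintegral_add_left (by fun_prop)]
    _ = _ := by
        rw [e1, e2, e3]
        unfold TT
        simp_rw [lc_comm A (fun x => ab x * A x)]
        rw [ENNReal.ofReal_mul (p := 2) (by norm_num)]
        norm_num
        ring

lemma inner_lc {f g : ℝ → ℝ≥0∞} (eg : ∀ x, g (-x) = g x) (x : ℝ) :
    ∫⁻ y, f (x + y) * g y = lc g f x := by
  unfold lc
  rw [← lintegral_neg_eq_self]
  refine lintegral_congr fun y => ?_
  rw [eg, mul_comm, sub_eq_add_neg]

lemma tqb {C κ : ℝ} (hC : 0 ≤ C) (hκ : 0 ≤ κ) {Z A : ℝ → ℝ≥0∞} (hZ : Measurable Z) (hA : Measurable A)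
    (eA : ∀ x, A (-x) = A x) :
    ∫⁻ x, ∫⁻ y, ENNReal.ofReal (C * (1 + κ * mm x y)) * (A (-x - y) * Z x * A y) ≤
      ENNReal.ofReal C * TT κ Z A := by
  have mB : Measurable fun x => ab x * A x := by fun_prop
  have eab : ∀ x, ab (-x) = ab x := fun x => by unfold ab; rw [abs_neg]
  have hmm : ∀ x y : ℝ, mm x y ≤ |x + y| + |y| := fun x y => by
    have : |x| ≤ |x + y| + |y| := by
      calc |x| = |(x + y) - y| := by ring_nf
        _ ≤ _ := abs_sub _ _
    exact max_le (max_le this (by linarith [abs_nonneg (x + y)])) (by linarith [abs_nonneg y])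
  have mlc := lc_meas hA hA
  have mlc2 := lc_meas mB hA
  calc _ ≤ ∫⁻ x, ∫⁻ y, (ENNReal.ofReal C * Z x) * (A (x + y) * A y + ENNReal.ofReal κ * ((ab (x + y) * A (x + y)) * A y
          + A (x + y) * (ab y * A y))) := by
        refine lintegral_mono fun x => lintegral_mono fun y => ?_
        calc _ ≤ (ENNReal.ofReal C * (1 + ENNReal.ofReal κ * (ab (x + y) + ab y))) * (A (-x - y) * Z x * A y) :=
              mul_le_mul_left (G_ofReal hC hκ (hmm x y)) _
          _ = _ := by rw [show -x - y = -(x + y) by ring, eA]; ring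
    _ = ∫⁻ x, ENNReal.ofReal C * (Z x * lc A A x + ENNReal.ofReal (2 * κ) * (Z x * lc (fun x => ab x * A x) A x)) := by
        refine lintegral_congr fun x => ?_
        rw [lintegral_const_mul _ (by fun_prop), lintegral_add_left (by fun_prop), lintegral_const_mul _ (by fun_prop),
          lintegral_add_left (by fun_prop), inner_lc eA]
        have i1 := inner_lc (f := fun x => ab x * A x) eA x
        have i2 := inner_lc (f := A) (g := fun x => ab x * A x) (fun x => by simp only [eA, eab]) x
        rw [i1, i2, lc_comm A (fun x => ab x * A x), ENNReal.ofReal_mul (p := 2) (by norm_num)]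
        norm_num
        ring
    _ = _ := by
        unfold TT
        rw [lintegral_const_mul _ (by fun_prop), lintegral_add_left (by fun_prop), lintegral_const_mul _ (by fun_prop)]

lemma Wd_n' {κ : ℝ} {w : ℝ → ℝ} (hw : Wt κ w) {f g : ℝ → ℂ} {A : ℝ → ℝ≥0∞} (hA : Measurable A)
    (hf : Wd w f A) (hg : Wd w g A) {k : ℂ} (hk : ‖k‖ ≤ 1) :
    Wd w (fun ξ => k * ξ * cv f g ξ) (fun ξ => ab ξ * lc A A ξ) := by
  intro ξ
  have h := Wd_cv hw hA hf hg ξ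
  have e1 : ‖k * ξ * cv f g ξ‖ₑ ≤ ab ξ * ‖cv f g ξ‖ₑ := by
    rw [enorm_mul, enorm_mul]
    refine mul_le_mul_left ?_ _
    have hk' : ‖k‖ₑ ≤ 1 := by
      rw [← ofReal_norm, ← ENNReal.ofReal_one]; exact ENNReal.ofReal_le_ofReal hk
    calc _ ≤ 1 * ‖(ξ:ℂ)‖ₑ := mul_le_mul_left hk' _
      _ = _ := by rw [one_mul, ← ofReal_norm, Complex.norm_real, Real.norm_eq_abs]; rfl
  calc _ ≤ ENNReal.ofReal (w ξ) * (ab ξ * ‖cv f g ξ‖ₑ) := mul_le_mul_right e1 _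
    _ = ab ξ * (ENNReal.ofReal (w ξ) * ‖cv f g ξ‖ₑ) := by ring
    _ ≤ _ := mul_le_mul_right h _

lemma nP_meas {q : ℝ → ℂ} (hq : Measurable q) : Measurable (nP q) := by
  have := cv_meas hq hq
  unfold nP; fun_prop
lemma nQ_meas {p q : ℝ → ℂ} (hp : Measurable p) (hq : Measurable q) : Measurable (nQ p q) := by
  have := cv_meas hp hq
  unfold nQ; fun_prop

lemma ab_even (x : ℝ) : ab (-x) = ab x := by unfold ab; rw [abs_neg]

lemma lc_even {A : ℝ → ℝ≥0∞} (eA : ∀ x, A (-x) = A x) (x : ℝ) : lc A A (-x) = lc A A x := by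
  unfold lc
  rw [← lintegral_neg_eq_self]
  refine lintegral_congr fun y => ?_
  rw [eA, show -x - -y = -(x - y) by ring, eA]

lemma TT_g {κ S Φ : ℝ} (hκ : 0 ≤ κ) (hS : 0 ≤ S) (hΦ : 0 ≤ Φ) (hκΦ : κ * Φ ^ 2 ≤ 2) {A : ℝ → ℝ≥0∞} (hA : Measurable A)
    (s1 : n2 A ≤ ENNReal.ofReal S) (s2 : n1 A ≤ ENNReal.ofReal S) (s3 : n2 (lo κ A) ≤ ENNReal.ofReal S)
    (b1 : n2 (fun x => ab x * A x) ≤ ENNReal.ofReal Φ) :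
    TT κ (fun x => ab x * lc A A x) A ≤ ENNReal.ofReal (34 * (1 + S) ^ 4) := by
  refine (T_bound hκ hA).trans ?_
  calc _ ≤ 2 * (ENNReal.ofReal S * ENNReal.ofReal S * ENNReal.ofReal S ^ 2) + ENNReal.ofReal (16 * κ) * (ENNReal.ofReal Φ * ENNReal.ofReal S) ^ 2 := by
        gcongr
    _ = ENNReal.ofReal (2 * (S * S * S ^ 2) + 16 * κ * (Φ * S) ^ 2) := by
        rw [show (2:ℝ≥0∞) = ENNReal.ofReal 2 by norm_num, ← ENNReal.ofReal_pow hS, ← ENNReal.ofReal_mul hS,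
          ← ENNReal.ofReal_mul (by positivity), ← ENNReal.ofReal_mul (by positivity), ← ENNReal.ofReal_mul (by positivity),
          ← ENNReal.ofReal_pow (by positivity), ← ENNReal.ofReal_mul (by positivity), ← ENNReal.ofReal_add (by positivity) (by positivity)]
    _ ≤ _ := by
        refine ENNReal.ofReal_le_ofReal ?_
        have h1 : 16 * κ * (Φ * S) ^ 2 ≤ 32 * S ^ 2 := by nlinarith [sq_nonneg S]
        have h2 : S * S * S ^ 2 ≤ (1 + S) ^ 4 := by
          calc S * S * S ^ 2 = S ^ 4 := by ring
            _ ≤ _ := pow_le_pow_left₀ hS (by linarith) 4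
        have h3 : S ^ 2 ≤ (1 + S) ^ 4 := by
          calc S ^ 2 ≤ (1 + S) ^ 2 := pow_le_pow_left₀ hS (by linarith) 2
            _ ≤ _ := pow_le_pow_right₀ (by linarith) (by norm_num)
        linarith

lemma TT_A {κ S Φ : ℝ} (hκ : 0 ≤ κ) (hκ1 : κ ≤ 1) (hS : 0 ≤ S) (hΦ : 0 ≤ Φ) (hκΦ : κ * Φ ^ 2 ≤ 2) {A : ℝ → ℝ≥0∞} (hA : Measurable A)
    (s1 : n2 A ≤ ENNReal.ofReal S) (s2 : n1 A ≤ ENNReal.ofReal S)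
    (b1 : n2 (fun x => ab x * A x) ≤ ENNReal.ofReal Φ) :
    TT κ A A ≤ ENNReal.ofReal (34 * (1 + S) ^ 4) := by
  have mB : Measurable fun x => ab x * A x := by fun_prop
  have t1 : ∫⁻ x, A x * lc A A x ≤ n2 A * (n2 A * n1 A) :=
    (cs hA (lc_meas hA hA)).trans (mul_le_mul_right (young hA hA) _)
  have t2 : ∫⁻ x, A x * lc (fun x => ab x * A x) A x ≤ n2 A * (n2 (fun x => ab x * A x) * n1 A) :=
    (cs hA (lc_meas mB hA)).trans (mul_le_mul_right (young mB hA) _)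
  unfold TT
  calc _ ≤ ENNReal.ofReal S * (ENNReal.ofReal S * ENNReal.ofReal S) + ENNReal.ofReal (2 * κ) * (ENNReal.ofReal S * (ENNReal.ofReal Φ * ENNReal.ofReal S)) := by
        refine add_le_add (t1.trans ?_) (mul_le_mul_right (t2.trans ?_) _)
        · gcongr
        · gcongr
    _ = ENNReal.ofReal (S * (S * S) + 2 * κ * (S * (Φ * S))) := by
        rw [← ENNReal.ofReal_mul hS, ← ENNReal.ofReal_mul hS, ← ENNReal.ofReal_mul hΦ,
          ← ENNReal.ofReal_mul hS, ← ENNReal.ofReal_mul (by positivity), ← ENNReal.ofReal_add (by positivity) (by positivity)]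
    _ ≤ _ := by
        refine ENNReal.ofReal_le_ofReal ?_
        have h0 : κ * Φ ≤ 2 := by
          have : (κ * Φ) ^ 2 ≤ 2 ^ 2 := by
            calc (κ * Φ) ^ 2 = κ * (κ * Φ ^ 2) := by ring
              _ ≤ 1 * 2 := mul_le_mul hκ1 hκΦ (by positivity) (by norm_num)
              _ ≤ _ := by norm_num
          exact (abs_le_of_sq_le_sq' this (by norm_num)).2
        have h1 : 2 * κ * (S * (Φ * S)) ≤ 4 * S ^ 2 := by nlinarith [sq_nonneg S]
        have h2 : S * (S * S) ≤ (1 + S) ^ 4 := by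
          calc S * (S * S) = S ^ 3 := by ring
            _ ≤ (1 + S) ^ 3 := pow_le_pow_left₀ hS (by linarith) 3
            _ ≤ _ := pow_le_pow_right₀ (by linarith) (by norm_num)
        have h3 : S ^ 2 ≤ (1 + S) ^ 4 := by
          calc S ^ 2 ≤ (1 + S) ^ 2 := pow_le_pow_left₀ hS (by linarith) 2
            _ ≤ _ := pow_le_pow_right₀ (by linarith) (by norm_num)
        nlinarith [sq_nonneg S]
end MB


namespace MB

lemma H3_poly (a x y : ℝ) : |H3 a x y| ≤ (2 * |a| + 8) * ((1 + |x|) ^ 3 * (1 + |y|) ^ 3) := by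
  have e1 : |x| ^ 3 ≤ (1 + |x|) ^ 3 * (1 + |y|) ^ 3 := by
    rw [← mul_pow]
    refine pow_le_pow_left₀ (abs_nonneg _) ?_ 3
    nlinarith [abs_nonneg x, abs_nonneg y, mul_nonneg (abs_nonneg x) (abs_nonneg y)]
  have e2 : |y| ^ 3 ≤ (1 + |x|) ^ 3 * (1 + |y|) ^ 3 := by
    rw [← mul_pow]
    refine pow_le_pow_left₀ (abs_nonneg _) ?_ 3
    nlinarith [abs_nonneg x, abs_nonneg y, mul_nonneg (abs_nonneg x) (abs_nonneg y)]
  have e3 : |x + y| ^ 3 ≤ (1 + |x|) ^ 3 * (1 + |y|) ^ 3 := by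
    rw [← mul_pow]
    refine pow_le_pow_left₀ (abs_nonneg _) ((abs_add_le _ _).trans ?_) 3
    nlinarith [abs_nonneg x, abs_nonneg y, mul_nonneg (abs_nonneg x) (abs_nonneg y)]
  have t1 : |H3 a x y| ≤ |a| * |x| ^ 3 + |a| * |y| ^ 3 + |x + y| ^ 3 := by
    unfold H3
    refine (abs_sub _ _).trans (add_le_add ((abs_add_le _ _).trans (le_of_eq ?_)) (le_of_eq (abs_pow _ _)))
    rw [abs_mul, abs_mul, abs_pow, abs_pow]
  nlinarith [mul_le_mul_of_nonneg_left e1 (abs_nonneg a), mul_le_mul_of_nonneg_left e2 (abs_nonneg a), abs_nonneg a, pow_nonneg (abs_nonneg x) 3]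

noncomputable def Ex (w : ℝ → ℝ) (p q : ℝ → ℂ) : ℂ :=
  E2 (fun x => x ^ 2 * w x ^ 2) p + E2 (fun x => x ^ 2 * w x ^ 2) q

theorem caseII {a : ℝ} (ha : a < 0 ∨ a = 1 ∨ 4 < a) : ∃ C > 0, ∀ (α β κ N0 Φ : ℝ) (w : ℝ → ℝ) (p q : ℝ → ℝ → ℂ),
    FS a α β p q → Wt κ w → w 0 = 1 → 0 < κ → κ ≤ 1 → 0 ≤ N0 → 0 ≤ Φ → κ * Φ ^ 2 ≤ 2 →
    (∀ t ∈ Icc α β, n2 (Am (fun _ => 1) (p t) (q t)) ≤ ENNReal.ofReal N0 ∧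
      n2 (fun x => ab x * Am (fun _ => 1) (p t) (q t) x) ≤ ENNReal.ofReal N0 ∧
      n2 (fun x => ab x * Am w (p t) (q t) x) ≤ ENNReal.ofReal Φ) →
    ∀ s ∈ Icc α β, ∀ t ∈ Icc α β, ‖Ex w (p t) (q t) - Ex w (p s) (q s)‖ ≤
      C * (1 + N0) ^ 4 * (1 + |t - s|) := by
  obtain ⟨C3, hC3, hN3⟩ := N3_bound ha
  have hkh := kh_nn
  refine ⟨C3 * 34 * (4 * kh + 5) ^ 4 * 3, by positivity, ?_⟩
  intro α β κ N0 Φ w p q hF hw hw0 hκ hκ1 hN0 hΦ hκΦ hn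
  obtain ⟨C, hC, hd⟩ := hF.d6
  obtain ⟨Bw, hBw⟩ := hw.bdd
  have w0 := hw.pos
  have hBw0 : 0 < Bw := (w0 0).trans_le (hBw 0)
  have hwm := hw.meas
  set θ : ℝ → ℝ := fun z => z ^ 2 * w z ^ 2 with hθ
  have θm : Measurable θ := by fun_prop
  set M : ℝ × ℝ → ℂ := fun z => ((N3 a w z.1 z.2 : ℝ) : ℂ) with hM
  have Mm : Measurable M := Complex.measurable_ofReal.comp (N3_meas a hwm)
  have Mb : ∀ x y, ‖M (x, y)‖ ≤ (C3 * (1 + κ * mm x y)) * (w x * w y * w (x + y)) := by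
    intro x y
    simp only [hM, Complex.norm_real, Real.norm_eq_abs]
    exact (hN3 κ w hw x y).1
  have www : ∀ x y, w x * w y * w (x + y) ≤ Bw ^ 3 := by
    intro x y
    have := w0 x; have := w0 y; have := w0 (x + y)
    calc w x * w y * w (x + y) ≤ Bw * Bw * Bw :=
          mul_le_mul (mul_le_mul (hBw x) (hBw y) (w0 y).le hBw0.le) (hBw _) (w0 _).le (by positivity)
      _ = _ := by ring
  have hG : ∀ x y, 0 ≤ C3 * (1 + κ * mm x y) := fun x y => by have := mm_nonneg x y; positivity
  have Mb' : ∀ z : ℝ × ℝ, ‖M z‖ ≤ (C3 * Bw ^ 3) * (1 + |z.1|) * (1 + |z.2|) := by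
    intro z
    refine (Mb z.1 z.2).trans ?_
    have hmm : mm z.1 z.2 ≤ |z.1| + |z.2| :=
      max_le (max_le (by linarith [abs_nonneg z.2]) (by linarith [abs_nonneg z.1])) (abs_add_le _ _)
    have h1 : 1 + κ * mm z.1 z.2 ≤ (1 + |z.1|) * (1 + |z.2|) := by
      have := mul_le_mul hκ1 hmm (mm_nonneg _ _) zero_le_one
      nlinarith [abs_nonneg z.1, abs_nonneg z.2, mul_nonneg (abs_nonneg z.1) (abs_nonneg z.2)]
    calc _ ≤ (C3 * ((1 + |z.1|) * (1 + |z.2|))) * Bw ^ 3 := by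
          have := w0 z.1; have := w0 z.2; have := w0 (z.1 + z.2)
          exact mul_le_mul (mul_le_mul_of_nonneg_left h1 hC3.le) (www _ _) (by positivity) (by positivity)
      _ = _ := by ring
  have θe : ∀ x, θ (-x) = θ x := fun x => by simp only [hθ, hw.even]; ring
  have θb : ∀ x, |θ x| ≤ Bw ^ 2 * (1 + |x|) ^ 2 := by
    intro x
    simp only [hθ]
    rw [abs_of_nonneg (by positivity), mul_comm]
    refine mul_le_mul (pow_le_pow_left₀ (w0 x).le (hBw x) 2) ?_ (by positivity) (by positivity)
    rw [← sq_abs]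
    exact pow_le_pow_left₀ (abs_nonneg _) (by linarith) 2
  obtain ⟨cE, dE⟩ := E_deriv hF θm θm θe θe (by positivity : 0 ≤ Bw ^ 2) θb θb
  obtain ⟨c3, d3⟩ := L3_deriv hF.compP hF.compQ hF.compQ Mm Mb'
  have Am1 : ∀ t ∈ Icc α β, Measurable (Am w (p t) (q t)) := fun t ht => Am_meas hwm (hF.mp t ht) (hF.mq t ht)
  have Am2 : ∀ t ∈ Icc α β, ∀ x, Am w (p t) (q t) (-x) = Am w (p t) (q t) x := fun t ht =>
    Am_even hw.even (hF.cp t ht) (hF.cq t ht)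
  set S := (4 * kh + 4) * (1 + N0) with hS
  have hS0 : 0 ≤ S := by positivity
  set K := C3 * (34 * (1 + S) ^ 4) with hK
  have hK0 : 0 ≤ K := by positivity
  have conv : ∀ z : ℂ, ∀ T : ℝ≥0∞, ‖z‖ₑ ≤ ENNReal.ofReal C3 * T → T ≤ ENNReal.ofReal (34 * (1 + S) ^ 4) → ‖z‖ ≤ K := by
    intro z T h1 h2
    refine norm_le_of_enorm hK0 (h1.trans ?_)
    rw [hK, ENNReal.ofReal_mul hC3.le]
    exact mul_le_mul_right h2 _
  have sz := fun t ht => sizes hw hw0 hκ hκ1 hN0 hΦ hκΦ (hF.mp t ht) (hF.mq t ht) (hn t ht).1 (hn t ht).2.1 (hn t ht).2.2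
  set R3 : ℝ → ℂ := fun t => L3 M (p t) (q t) (q t) with hR3
  have b3 : ∀ t ∈ Icc α β, ‖R3 t‖ ≤ K := fun t ht => by
    obtain ⟨s1, s2, s3⟩ := sz t ht
    refine conv _ _ ((L3_bound hw.one hw.even (hF.mp t ht) (hF.mq t ht) (hF.mq t ht) (Am_p w (p t) (q t))
      (Am_q w (p t) (q t)) (Am_q w (p t) (q t)) Mm hG Mb).trans (tqa hC3.le hκ.le (Am1 t ht) (Am1 t ht) (Am2 t ht)))
      (TT_A hκ.le hκ1 hS0 hΦ hκΦ (Am1 t ht) s1 s2 (hn t ht).2.2)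
  have bP : ∀ t ∈ Icc α β, ‖L3 M (nP (q t)) (q t) (q t)‖ ≤ K := fun t ht => by
    obtain ⟨s1, s2, s3⟩ := sz t ht
    have wn : Wd w (nP (q t)) (fun ξ => ab ξ * lc (Am w (p t) (q t)) (Am w (p t) (q t)) ξ) := by
      rw [nP_eq]
      exact Wd_n' hw (Am1 t ht) (Am_q w (p t) (q t)) (Am_q w (p t) (q t)) nI
    have := lc_meas (Am1 t ht) (Am1 t ht)
    refine conv _ _ ((L3_bound hw.one hw.even (nP_meas (hF.mq t ht)) (hF.mq t ht) (hF.mq t ht) wn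
      (Am_q w (p t) (q t)) (Am_q w (p t) (q t)) Mm hG Mb).trans (tqa hC3.le hκ.le (by fun_prop) (Am1 t ht)
        (fun x => by simp only [ab_even, lc_even (Am2 t ht)])))
      (TT_g hκ.le hS0 hΦ hκΦ (Am1 t ht) s1 s2 s3 (hn t ht).2.2)
  have bQ : ∀ t ∈ Icc α β, ‖L3 M (p t) (nQ (p t) (q t)) (q t)‖ ≤ K := fun t ht => by
    obtain ⟨s1, s2, s3⟩ := sz t ht
    have wn : Wd w (nQ (p t) (q t)) (fun ξ => ab ξ * lc (Am w (p t) (q t)) (Am w (p t) (q t)) ξ) := by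
      rw [nQ_eq]
      exact Wd_n' hw (Am1 t ht) (Am_p w (p t) (q t)) (Am_q w (p t) (q t)) nI'
    have := lc_meas (Am1 t ht) (Am1 t ht)
    refine conv _ _ ((L3_bound hw.one hw.even (hF.mp t ht) (nQ_meas (hF.mp t ht) (hF.mq t ht)) (hF.mq t ht)
      (Am_p w (p t) (q t)) wn (Am_q w (p t) (q t)) Mm hG Mb).trans (tqb hC3.le hκ.le (by fun_prop) (Am1 t ht) (Am2 t ht)))
      (TT_g hκ.le hS0 hΦ hκΦ (Am1 t ht) s1 s2 s3 (hn t ht).2.2)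
  set E : ℝ → ℂ := fun t => E2 θ (p t) + E2 θ (q t) with hE
  set G : ℝ → ℂ := fun t => E t - R3 t with hGd
  have cG : ContinuousOn G (Icc α β) := cE.sub c3
  have dG : ∀ t ∈ Ioo α β, ∃ g, HasDerivAt G g t ∧ ‖g‖ ≤ 3 * K := by
    intro t ht
    have ht' := Ioo_subset_Icc_self ht
    obtain ⟨hdp, hdq⟩ := hd t ht'
    refine ⟨_, (dE t ht).sub (d3 t ht), ?_⟩
    have hsw : L3 M (p t) (q t) (nQ (p t) (q t)) = L3 M (p t) (nQ (p t) (q t)) (q t) := by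
      rw [L3_swap]
      congr 1
      funext z
      simp only [hM]
      rw [N3_swap]
    have hm : L3 (fun z => Complex.I * ((mg θ θ z.1 z.2 : ℝ) : ℂ)) (p t) (q t) (q t) =
        (∫ z : ℝ × ℝ, Complex.I * ((1 * (-z.1 - z.2) ^ 3 + a * z.1 ^ 3 + a * z.2 ^ 3 : ℝ) : ℂ) * M z *
          p t (-z.1 - z.2) * q t z.1 * q t z.2) := by
      unfold L3
      simp_rw [H3_phase]
      refine integral_congr_ae (Eventually.of_forall fun z => ?_)
      simp only [hM]
      rw [mg_self, (hN3 κ w hw z.1 z.2).2]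
      push_cast
      ring
    rw [hm, hsw]
    have r1 := bP t ht'
    have r2 := bQ t ht'
    set i3 := (∫ z : ℝ × ℝ, Complex.I * ((1 * (-z.1 - z.2) ^ 3 + a * z.1 ^ 3 + a * z.2 ^ 3 : ℝ) : ℂ) * M z *
          p t (-z.1 - z.2) * q t z.1 * q t z.2)
    set lA := L3 M (nP (q t)) (q t) (q t)
    set lB := L3 M (p t) (nQ (p t) (q t)) (q t)
    rw [show i3 - (i3 + lA + lB + lB) = -(lA + lB + lB) by ring, norm_neg]
    exact (norm_add₃_le).trans (by linarith)
  choose! g hg hgb using dG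
  intro s hs t ht
  have key := lip_ext cG hg hgb s hs t ht
  have e : Ex w (p t) (q t) - Ex w (p s) (q s) = (G t - G s) + R3 t - R3 s := by
    have : ∀ r, Ex w (p r) (q r) = E r := fun r => rfl
    rw [this, this]
    simp only [hGd]
    ring
  rw [e]
  have b1 := b3 t ht
  have b2 := b3 s hs
  have hKb : K ≤ C3 * 34 * (4 * kh + 5) ^ 4 * (1 + N0) ^ 4 := by
    rw [hK, mul_assoc (C3 * 34), ← mul_pow, ← mul_assoc]
    refine mul_le_mul_of_nonneg_left (pow_le_pow_left₀ (by positivity) ?_ 4) (by positivity)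
    rw [hS]; nlinarith
  calc _ ≤ ‖G t - G s‖ + ‖R3 t‖ + ‖R3 s‖ := (norm_sub_le _ _).trans (add_le_add (norm_add_le _ _) le_rfl)
    _ ≤ K * (3 * (1 + |t - s|)) := by nlinarith
    _ ≤ (C3 * 34 * (4 * kh + 5) ^ 4 * (1 + N0) ^ 4) * (3 * (1 + |t - s|)) :=
        mul_le_mul_of_nonneg_right hKb (by positivity)
    _ = _ := by ring
end MB


namespace MB

lemma one_bd (z : ℝ × ℝ) : ‖(1:ℂ)‖ ≤ 1 * (1 + |z.1|) * (1 + |z.2|) := by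
  rw [norm_one]
  nlinarith [abs_nonneg z.1, abs_nonneg z.2, mul_nonneg (abs_nonneg z.1) (abs_nonneg z.2)]

lemma L3_cvA {C1 C2 C3 : ℝ} {f g k : ℝ → ℂ} (hf : Dec C1 f) (hg : Dec C2 g) (hk : Dec C3 k) :
    L3 (fun _ => 1) f g k = ∫ ξ, f (-ξ) * cv g k ξ := by
  have hIntg := Dec.int2 hf hg hk (M := fun _ => 1) measurable_const one_bd
  unfold L3
  have mp := measurePreserving_prod_add (volume : Measure ℝ) (volume : Measure ℝ)
  have em : MeasurableEmbedding (fun z : ℝ × ℝ => (z.1, z.1 + z.2)) :=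
    (MeasurableEquiv.shearAddRight ℝ).measurableEmbedding
  set G : ℝ × ℝ → ℂ := fun z => 1 * f (-z.2) * g z.1 * k (z.2 - z.1) with hG
  have hcomp : (fun z : ℝ × ℝ => 1 * f (-z.1 - z.2) * g z.1 * k z.2)
      = G ∘ (fun z : ℝ × ℝ => (z.1, z.1 + z.2)) := by
    funext z
    simp only [hG, Function.comp, neg_add, sub_eq_add_neg]
    rw [show z.1 + z.2 + -z.1 = z.2 by ring]
  rw [Measure.volume_eq_prod] at hIntg ⊢
  rw [hcomp] at hIntg ⊢
  have hGi : Integrable G (volume.prod volume) := (mp.integrable_comp_emb em).1 hIntg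
  have : ∫ z, (G ∘ fun z : ℝ × ℝ => (z.1, z.1 + z.2)) z ∂(volume.prod volume) = ∫ z, G z ∂(volume.prod volume) :=
    mp.integral_comp em G
  rw [this, integral_prod_symm _ hGi]
  refine integral_congr_ae (Eventually.of_forall fun ξ => ?_)
  simp only [hG]
  have e2 : ∀ x, 1 * f (-ξ) * g x * k (ξ - x) = f (-ξ) * (g x * k (ξ - x)) := fun y => by ring
  simp_rw [e2]
  rw [integral_const_mul]
  rfl

lemma L3_cvB {C1 C2 C3 : ℝ} {f g k : ℝ → ℂ} (hf : Dec C1 f) (hg : Dec C2 g) (hk : Dec C3 k) :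
    L3 (fun _ => 1) f g k = ∫ ξ, g ξ * cv f k (-ξ) := by
  have hIntg := Dec.int2 hf hg hk (M := fun _ => 1) measurable_const one_bd
  unfold L3
  rw [Measure.volume_eq_prod] at hIntg ⊢
  rw [integral_prod _ hIntg]
  refine integral_congr_ae (Eventually.of_forall fun x => ?_)
  have e : cv f k (-x) = ∫ y, f (-x - y) * k y := by
    unfold cv
    rw [← integral_sub_left_eq_self _ _ (-x)]
    simp
  have e2 : ∀ y, 1 * f (-x - y) * g x * k y = g x * (f (-x - y) * k y) := fun y => by ring
  simp only
  simp_rw [e2]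
  rw [integral_const_mul, ← e]

lemma odd_int {h : ℝ → ℂ} (ho : ∀ x, h (-x) = -h x) : ∫ x, h x = 0 := by
  have := integral_neg_eq_self h volume
  simp_rw [ho] at this
  rw [integral_neg] at this
  exact CharZero.neg_eq_self_iff.1 this

lemma FS.nDec {a α β : ℝ} {p q : ℝ → ℝ → ℂ} (h : FS a α β p q) {t : ℝ} (ht : t ∈ Icc α β) :
    ∃ C, Dec C (p t) ∧ Dec C (q t) ∧ Dec C (nP (q t)) ∧ Dec C (nQ (p t) (q t)) := by
  obtain ⟨C1, _, h1⟩ := h.compP.dec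
  obtain ⟨C2, _, h2⟩ := h.compQ.dec
  exact ⟨max C1 C2, (h1 t ht).1.mono (le_max_left _ _), (h2 t ht).1.mono (le_max_right _ _),
    (h1 t ht).2.1.mono (le_max_left _ _), (h2 t ht).2.1.mono (le_max_right _ _)⟩

/-- conservation of the Hamiltonian -/
lemma ham_cons {a α β : ℝ} {p q : ℝ → ℝ → ℂ} (h : FS a α β p q) : ∀ s ∈ Icc α β, ∀ t ∈ Icc α β,
    (E2 (fun x => x ^ 2) (p t) + E2 (fun x => a * x ^ 2) (q t)) - L3 (fun _ => 1) (p t) (q t) (q t) =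
    (E2 (fun x => x ^ 2) (p s) + E2 (fun x => a * x ^ 2) (q s)) - L3 (fun _ => 1) (p s) (q s) (q s) := by
  have sqb : ∀ x : ℝ, x ^ 2 ≤ (1 + |x|) ^ 2 := fun x => by
    rw [← sq_abs]; exact pow_le_pow_left₀ (abs_nonneg _) (by linarith) 2
  obtain ⟨cE, dE⟩ := E_deriv h (θu := fun x => x ^ 2) (θv := fun x => a * x ^ 2) (B := 1 + |a|) (by fun_prop) (by fun_prop)
    (fun x => by ring) (fun x => by ring) (by positivity)
    (fun x => by
      rw [abs_of_nonneg (by positivity)]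
      calc x ^ 2 ≤ 1 * (1 + |x|) ^ 2 := by rw [one_mul]; exact sqb x
        _ ≤ _ := mul_le_mul_of_nonneg_right (by linarith [abs_nonneg a]) (by positivity))
    (fun x => by
      rw [abs_mul, abs_of_nonneg (by positivity : (0:ℝ) ≤ x ^ 2)]
      exact mul_le_mul (by linarith) (sqb x) (by positivity) (by positivity))
  obtain ⟨c3, d3⟩ := L3_deriv h.compP h.compQ h.compQ (M := fun _ => 1) measurable_const one_bd
  intro s hs t ht
  have key := lip_ext (K := 0) (cE.sub c3) (fun t ht => (dE t ht).sub (d3 t ht)) (fun t ht => by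
    obtain ⟨C, dp, dq, dnp, dnq⟩ := h.nDec (Ioo_subset_Icc_self ht)
    have e1 : L3 (fun _ => 1) (nP (q t)) (q t) (q t) = 0 := by
      rw [L3_cvA dnp dq dq]
      refine odd_int fun x => ?_
      unfold nP
      push_cast
      rw [neg_neg]
      ring
    have e2 : L3 (fun _ => 1) (p t) (nQ (p t) (q t)) (q t) = 0 := by
      rw [L3_cvB dp dnq dq]
      refine odd_int fun x => ?_
      unfold nQ
      push_cast
      rw [neg_neg]
      ring
    have e3 : L3 (fun _ => 1) (p t) (q t) (nQ (p t) (q t)) = 0 := by rw [L3_swap, e2]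
    rw [e1, e2, e3]
    simp only [add_zero]
    refine le_of_eq ?_
    rw [norm_eq_zero, sub_eq_zero]
    unfold L3
    refine integral_congr_ae (Eventually.of_forall fun z => ?_)
    simp only
    rw [H3_phase]
    unfold mg H3
    push_cast
    ring) s hs t ht
  rw [zero_mul] at key
  exact sub_eq_zero.1 (norm_eq_zero.1 (le_antisymm key (norm_nonneg _)))

lemma l2_cons {a α β : ℝ} {p q : ℝ → ℝ → ℂ} (h : FS a α β p q) : ∀ s ∈ Icc α β, ∀ t ∈ Icc α β,
    E2 (fun _ => 1) (p t) + E2 (fun _ => 1) (q t) = E2 (fun _ => 1) (p s) + E2 (fun _ => 1) (q s) := by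
  obtain ⟨cE, dE⟩ := E_deriv h (θu := fun _ => 1) (θv := fun _ => 1) (B := 1) (by fun_prop) (by fun_prop)
    (fun x => rfl) (fun x => rfl) (by positivity)
    (fun x => by rw [abs_one, one_mul]; exact one_le_pow₀ (by linarith [abs_nonneg x]))
    (fun x => by rw [abs_one, one_mul]; exact one_le_pow₀ (by linarith [abs_nonneg x]))
  intro s hs t ht
  have key := lip_ext (K := 0) cE dE (fun t ht => by
    have : (fun z : ℝ × ℝ => Complex.I * ((mg (fun _ => 1) (fun _ => 1) z.1 z.2 : ℝ) : ℂ)) = fun _ => 0 := by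
      funext z; unfold mg; push_cast; ring
    rw [this]
    unfold L3
    simp) s hs t ht
  rw [zero_mul] at key
  exact sub_eq_zero.1 (norm_eq_zero.1 (le_antisymm key (norm_nonneg _)))

/-! real quadratic functionals -/
noncomputable def V2 (θ θ' : ℝ → ℝ) (p q : ℝ → ℂ) : ℝ≥0∞ :=
  ∫⁻ ξ, (ENNReal.ofReal (θ ξ) * ‖p ξ‖ₑ ^ 2 + ENNReal.ofReal (θ' ξ) * ‖q ξ‖ₑ ^ 2)

noncomputable def V (θ : ℝ → ℝ) (p q : ℝ → ℂ) : ℝ≥0∞ := V2 θ θ p q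

lemma E2_real {B C : ℝ} {θ : ℝ → ℝ} {f : ℝ → ℂ} (hC : 0 ≤ C) (hf : D6 C f) (cf : ∀ ξ, f (-ξ) = (starRingEnd ℂ) (f ξ))
    (hθ : Measurable θ) (h0 : ∀ x, 0 ≤ θ x) (hb : ∀ x, |θ x| ≤ B * (1 + |x|) ^ 2) :
    ∃ X : ℝ, 0 ≤ X ∧ E2 θ f = X ∧ ∫⁻ ξ, ENNReal.ofReal (θ ξ) * ‖f ξ‖ₑ ^ 2 = ENNReal.ofReal X := by
  have hB : 0 ≤ B := by simpa using (abs_nonneg _).trans (hb 0)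
  have fm := hf.1
  have hi : Integrable fun ξ => θ ξ * ‖f ξ‖ ^ 2 := by
    refine ((int1.const_mul (B * C ^ 2))).mono' (by fun_prop) (Eventually.of_forall fun x => ?_)
    have hx := h0 x
    rw [Real.norm_eq_abs, abs_of_nonneg (by positivity)]
    have h1 := hb x
    rw [abs_of_nonneg hx] at h1
    have h2 : ‖f x‖ ^ 2 ≤ (C / (1 + |x|) ^ 6) ^ 2 := pow_le_pow_left₀ (norm_nonneg _) (hf.2 x) 2
    have hp : (1:ℝ) ≤ 1 + |x| := by linarith [abs_nonneg x]
    have hp0 : (0:ℝ) < 1 + |x| := by linarith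
    calc _ ≤ (B * (1 + |x|) ^ 2) * (C / (1 + |x|) ^ 6) ^ 2 := mul_le_mul h1 h2 (by positivity) (by positivity)
      _ = B * C ^ 2 * (1 / (1 + |x|) ^ 10) := by field_simp
      _ ≤ _ := by
          refine mul_le_mul_of_nonneg_left ?_ (by positivity)
          exact one_div_le_one_div_of_le (by positivity) (pow_le_pow_right₀ hp (by norm_num))
  refine ⟨∫ ξ, θ ξ * ‖f ξ‖ ^ 2, integral_nonneg fun x => mul_nonneg (h0 x) (by positivity), ?_, ?_⟩
  · unfold E2
    rw [← integral_complex_ofReal]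
    refine integral_congr_ae (Eventually.of_forall fun x => ?_)
    simp only
    rw [cf, mul_assoc, Complex.mul_conj, Complex.normSq_eq_norm_sq]
    push_cast
    ring
  · rw [ofReal_integral_eq_lintegral_ofReal hi (Eventually.of_forall fun x => mul_nonneg (h0 x) (by positivity))]
    refine lintegral_congr fun x => ?_
    rw [ENNReal.ofReal_mul (h0 x), ENNReal.ofReal_pow (norm_nonneg _), ofReal_norm]

lemma V2_E {B B' C : ℝ} {θ θ' : ℝ → ℝ} {p q : ℝ → ℂ} (hC : 0 ≤ C) (hp : D6 C p) (hq : D6 C q)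
    (cp : ∀ ξ, p (-ξ) = (starRingEnd ℂ) (p ξ)) (cq : ∀ ξ, q (-ξ) = (starRingEnd ℂ) (q ξ))
    (hθ : Measurable θ) (h0 : ∀ x, 0 ≤ θ x) (hb : ∀ x, |θ x| ≤ B * (1 + |x|) ^ 2)
    (hθ' : Measurable θ') (h0' : ∀ x, 0 ≤ θ' x) (hb' : ∀ x, |θ' x| ≤ B' * (1 + |x|) ^ 2) :
    V2 θ θ' p q = ENNReal.ofReal ‖E2 θ p + E2 θ' q‖ := by
  obtain ⟨X, hX, e1, e2⟩ := E2_real hC hp cp hθ h0 hb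
  obtain ⟨Y, hY, e3, e4⟩ := E2_real hC hq cq hθ' h0' hb'
  have pm := hp.1
  unfold V2
  rw [lintegral_add_left (by fun_prop), e2, e4, e1, e3, ← ENNReal.ofReal_add hX hY, ← Complex.ofReal_add,
    Complex.norm_real, Real.norm_eq_abs, abs_of_nonneg (by positivity)]

lemma n2_V {φ : ℝ → ℝ} {p q : ℝ → ℂ} (h0 : ∀ x, 0 ≤ φ x) {X : ℝ} (hX : 0 ≤ X)
    (h : V (fun x => φ x ^ 2) p q ≤ ENNReal.ofReal X) :
    n2 (fun ξ => ENNReal.ofReal (φ ξ) * (‖p ξ‖ₑ + ‖q ξ‖ₑ)) ≤ ENNReal.ofReal (Real.sqrt (2 * X)) := by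
  refine n2_le ?_
  rw [← ENNReal.ofReal_pow (Real.sqrt_nonneg _), Real.sq_sqrt (by positivity), ENNReal.ofReal_mul (by norm_num)]
  refine le_trans ?_ (mul_le_mul_right h _)
  unfold V V2
  rw [← lintegral_const_mul' _ _ ENNReal.ofReal_ne_top]
  refine lintegral_mono fun x => ?_
  simp only
  rw [← ofReal_norm, ← ofReal_norm, ← ENNReal.ofReal_add (norm_nonneg _) (norm_nonneg _), ← ENNReal.ofReal_mul (h0 x),
    ← ENNReal.ofReal_pow (mul_nonneg (h0 x) (by positivity)), ← ENNReal.ofReal_pow (norm_nonneg _), ← ENNReal.ofReal_pow (norm_nonneg _),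
    ← ENNReal.ofReal_mul (by positivity), ← ENNReal.ofReal_mul (by positivity), ← ENNReal.ofReal_add (by positivity) (by positivity),
    ← ENNReal.ofReal_mul (by norm_num)]
  refine ENNReal.ofReal_le_ofReal ?_
  nlinarith [mul_nonneg (sq_nonneg (φ x)) (sq_nonneg (‖p x‖ - ‖q x‖))]

lemma V_mono {θ θ' : ℝ → ℝ} {p q : ℝ → ℂ} (h : ∀ x, θ x ≤ θ' x) : V θ p q ≤ V θ' p q := by
  unfold V V2
  refine lintegral_mono fun x => ?_
  have := ENNReal.ofReal_le_ofReal (h x)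
  gcongr

lemma sq_th (x : ℝ) : x ^ 2 ≤ (1 + |x|) ^ 2 := by
  rw [← sq_abs]; exact pow_le_pow_left₀ (abs_nonneg _) (by linarith) 2

lemma Am_as (w : ℝ → ℝ) (p q : ℝ → ℂ) : Am w p q = fun ξ => ENNReal.ofReal (w ξ) * (‖p ξ‖ₑ + ‖q ξ‖ₑ) := rfl
lemma abAm_as {w : ℝ → ℝ} (p q : ℝ → ℂ) : (fun x => ab x * Am w p q x) =
    fun ξ => ENNReal.ofReal (|ξ| * w ξ) * (‖p ξ‖ₑ + ‖q ξ‖ₑ) := by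
  funext x
  unfold Am ab
  rw [ENNReal.ofReal_mul (abs_nonneg _), mul_assoc]

lemma Am_V {w : ℝ → ℝ} {p q : ℝ → ℂ} (h0 : ∀ x, 0 ≤ w x) {X : ℝ} (hX : 0 ≤ X)
    (h : V (fun x => w x ^ 2) p q ≤ ENNReal.ofReal X) : n2 (Am w p q) ≤ ENNReal.ofReal (Real.sqrt (2 * X)) := n2_V h0 hX h

lemma abAm_V {w : ℝ → ℝ} {p q : ℝ → ℂ} (h0 : ∀ x, 0 ≤ w x) {X : ℝ} (hX : 0 ≤ X)
    (h : V (fun x => x ^ 2 * w x ^ 2) p q ≤ ENNReal.ofReal X) :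
    n2 (fun x => ab x * Am w p q x) ≤ ENNReal.ofReal (Real.sqrt (2 * X)) := by
  rw [abAm_as]
  refine n2_V (fun x => mul_nonneg (abs_nonneg _) (h0 x)) hX ?_
  simp_rw [mul_pow, sq_abs]
  exact h

lemma L31_bound {p q : ℝ → ℂ} (hp : Measurable p) (hq : Measurable q)
    (cp : ∀ ξ, p (-ξ) = (starRingEnd ℂ) (p ξ)) (cq : ∀ ξ, q (-ξ) = (starRingEnd ℂ) (q ξ)) {m h : ℝ} (hm : 0 ≤ m) (hh : 0 ≤ h)
    (h1 : n2 (Am (fun _ => 1) p q) ≤ ENNReal.ofReal m) (h2 : n2 (fun x => ab x * Am (fun _ => 1) p q x) ≤ ENNReal.ofReal h) :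
    ‖L3 (fun _ => 1) p q q‖ ≤ m ^ 2 * (kh * (m + h)) := by
  have hk := kh_nn
  have mA : Measurable (Am (fun _ => 1) p q) := Am_meas (by fun_prop) hp hq
  have ev : ∀ x, Am (fun _ => 1) p q (-x) = Am (fun _ => 1) p q x := Am_even (fun _ => rfl) cp cq
  refine norm_le_of_enorm (by positivity) ?_
  have b := L3_bound (w := fun _ => 1) (fun _ => le_rfl) (fun _ => rfl) hp hq hq (Am_p _ p q) (Am_q _ p q) (Am_q _ p q)
    (M := fun _ => 1) measurable_const (G := fun _ _ => 1) (fun _ _ => zero_le_one) (fun _ _ => by simp)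
  refine b.trans ?_
  set A := Am (fun _ => 1) p q
  have t := tri3 mA mA mA
  have t1 : ∫⁻ x, A x * lc A A x ≤ n2 A * (n2 A * n1 A) :=
    (cs mA (lc_meas mA mA)).trans (mul_le_mul_right (young mA mA) _)
  calc _ = ∫⁻ x, ∫⁻ y, A x * A y * A (x + y) := by
        refine lintegral_congr fun x => lintegral_congr fun y => ?_
        rw [ENNReal.ofReal_one, one_mul, show -x - y = -(x + y) by ring, ev]
        ring
    _ ≤ n2 A * (n2 A * n1 A) := t.le.trans t1
    _ ≤ ENNReal.ofReal m * (ENNReal.ofReal m * (ENNReal.ofReal kh * (ENNReal.ofReal m + ENNReal.ofReal h))) := by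
        have := n1_le mA
        gcongr
        exact this.trans (by gcongr)
    _ = _ := by
        rw [← ENNReal.ofReal_add hm hh, ← ENNReal.ofReal_mul hk, ← ENNReal.ofReal_mul hm, ← ENNReal.ofReal_mul hm]
        congr 1
        ring
end MB


namespace MB

lemma V_of_E {B C : ℝ} {θ : ℝ → ℝ} {p q : ℝ → ℂ} (hC : 0 ≤ C) (hp : D6 C p) (hq : D6 C q)
    (cp : ∀ ξ, p (-ξ) = (starRingEnd ℂ) (p ξ)) (cq : ∀ ξ, q (-ξ) = (starRingEnd ℂ) (q ξ))
    (hθ : Measurable θ) (h0 : ∀ x, 0 ≤ θ x) (hb : ∀ x, |θ x| ≤ B * (1 + |x|) ^ 2) :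
    V θ p q = ENNReal.ofReal ‖E2 θ p + E2 θ q‖ := V2_E hC hp hq cp cq hθ h0 hb hθ h0 hb

lemma H1_bound {a : ℝ} (ha : 1 ≤ a) {M : ℝ} (hM : 0 ≤ M) : ∃ B ≥ 0, ∀ (α β : ℝ) (p q : ℝ → ℝ → ℂ), FS a α β p q →
    ∀ s ∈ Icc α β, V (fun x => 1 + x ^ 2) (p s) (q s) ≤ ENNReal.ofReal M → ∀ t ∈ Icc α β,
    V (fun _ => 1) (p t) (q t) ≤ ENNReal.ofReal B ∧ V (fun x => x ^ 2) (p t) (q t) ≤ ENNReal.ofReal B := by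
  have hk := kh_nn
  set m := Real.sqrt (2 * M) with hm
  have hm0 : 0 ≤ m := Real.sqrt_nonneg _
  set P := a * M + m ^ 2 * (kh * (m + m)) + m ^ 2 * (kh * m) with hP
  have hP0 : 0 ≤ P := by positivity
  set Q := m ^ 2 * kh with hQ
  have hQ0 : 0 ≤ Q := by positivity
  refine ⟨M + (2 * P + 2 * Q ^ 2), by positivity, ?_⟩
  intro α β p q hF s hs hV t ht
  obtain ⟨C, hC, hd⟩ := hF.d6
  have b1 : ∀ x : ℝ, |(1:ℝ)| ≤ 1 * (1 + |x|) ^ 2 := fun x => by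
    rw [abs_one, one_mul]; exact one_le_pow₀ (by linarith [abs_nonneg x])
  have b2 : ∀ x : ℝ, |x ^ 2| ≤ 1 * (1 + |x|) ^ 2 := fun x => by
    rw [abs_of_nonneg (by positivity), one_mul]; exact sq_th x
  have b3 : ∀ x : ℝ, |a * x ^ 2| ≤ a * (1 + |x|) ^ 2 := fun x => by
    rw [abs_of_nonneg (by positivity)]; exact mul_le_mul_of_nonneg_left (sq_th x) (by positivity)
  have V1 : ∀ r ∈ Icc α β, V (fun _ => 1) (p r) (q r) = ENNReal.ofReal ‖E2 (fun _ => 1) (p r) + E2 (fun _ => 1) (q r)‖ :=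
    fun r hr => V_of_E hC (hd r hr).1 (hd r hr).2 (hF.cp r hr) (hF.cq r hr) measurable_const (fun _ => zero_le_one) b1
  have Vx : ∀ r ∈ Icc α β, V (fun x => x ^ 2) (p r) (q r) =
      ENNReal.ofReal ‖E2 (fun x => x ^ 2) (p r) + E2 (fun x => x ^ 2) (q r)‖ :=
    fun r hr => V_of_E hC (hd r hr).1 (hd r hr).2 (hF.cp r hr) (hF.cq r hr) (by fun_prop) (fun _ => by positivity) b2
  have Vh : ∀ r ∈ Icc α β, V2 (fun x => x ^ 2) (fun x => a * x ^ 2) (p r) (q r) =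
      ENNReal.ofReal ‖E2 (fun x => x ^ 2) (p r) + E2 (fun x => a * x ^ 2) (q r)‖ :=
    fun r hr => V2_E hC (hd r hr).1 (hd r hr).2 (hF.cp r hr) (hF.cq r hr) (by fun_prop) (fun _ => by positivity) b2
      (by fun_prop) (fun _ => by positivity) b3
  have v1s : V (fun _ => 1) (p s) (q s) ≤ ENNReal.ofReal M := (V_mono fun x => by nlinarith [sq_nonneg x]).trans hV
  have vxs : V (fun x => x ^ 2) (p s) (q s) ≤ ENNReal.ofReal M := (V_mono fun x => by linarith).trans hV
  have v1t : V (fun _ => 1) (p t) (q t) ≤ ENNReal.ofReal M := by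
    rw [V1 t ht, l2_cons hF s hs t ht, ← V1 s hs]; exact v1s
  refine ⟨v1t.trans (ENNReal.ofReal_le_ofReal (by nlinarith [sq_nonneg Q])), ?_⟩
  have A0 : ∀ r, V (fun _ => 1) (p r) (q r) ≤ ENNReal.ofReal M → n2 (Am (fun _ => 1) (p r) (q r)) ≤ ENNReal.ofReal m := by
    intro r hr
    refine Am_V (fun _ => zero_le_one) hM ?_
    simpa using hr
  have A1 : ∀ r X, 0 ≤ X → V (fun x => x ^ 2) (p r) (q r) ≤ ENNReal.ofReal X →
      n2 (fun x => ab x * Am (fun _ => 1) (p r) (q r) x) ≤ ENNReal.ofReal (Real.sqrt (2 * X)) := by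
    intro r X hX hr
    refine abAm_V (fun _ => zero_le_one) hX ?_
    simpa using hr
  set X := ‖E2 (fun x => x ^ 2) (p t) + E2 (fun x => x ^ 2) (q t)‖ with hX
  have hX0 : 0 ≤ X := norm_nonneg _
  have l3s := L31_bound (hF.mp s hs) (hF.mq s hs) (hF.cp s hs) (hF.cq s hs) hm0 hm0 (A0 s v1s) (A1 s M hM vxs)
  have l3t := L31_bound (hF.mp t ht) (hF.mq t ht) (hF.cp t ht) (hF.cq t ht) hm0 (Real.sqrt_nonneg (2 * X)) (A0 t v1t)
    (A1 t X hX0 (Vx t ht).le)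
  have ham := ham_cons hF s hs t ht
  have us : ‖E2 (fun x => x ^ 2) (p s) + E2 (fun x => a * x ^ 2) (q s)‖ ≤ a * M := by
    have : V2 (fun x => x ^ 2) (fun x => a * x ^ 2) (p s) (q s) ≤ ENNReal.ofReal (a * M) := by
      rw [ENNReal.ofReal_mul (by positivity)]
      refine le_trans ?_ (mul_le_mul_right vxs _)
      unfold V V2
      rw [← lintegral_const_mul' _ _ ENNReal.ofReal_ne_top]
      refine lintegral_mono fun x => ?_
      simp only
      rw [mul_add, ← mul_assoc, ← mul_assoc, ← ENNReal.ofReal_mul (by positivity)]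
      refine add_le_add (mul_le_mul_left (ENNReal.ofReal_le_ofReal ?_) _) le_rfl
      nlinarith [sq_nonneg x]
    rw [Vh s hs] at this
    exact (ENNReal.ofReal_le_ofReal_iff (by positivity)).1 this
  have ut : X ≤ ‖E2 (fun x => x ^ 2) (p t) + E2 (fun x => a * x ^ 2) (q t)‖ := by
    have : V (fun x => x ^ 2) (p t) (q t) ≤ V2 (fun x => x ^ 2) (fun x => a * x ^ 2) (p t) (q t) := by
      unfold V V2
      refine lintegral_mono fun x => ?_
      simp only
      refine add_le_add le_rfl (mul_le_mul_left (ENNReal.ofReal_le_ofReal ?_) _)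
      nlinarith [sq_nonneg x]
    rw [Vh t ht, Vx t ht] at this
    exact (ENNReal.ofReal_le_ofReal_iff (norm_nonneg _)).1 this
  have tri : X ≤ a * M + m ^ 2 * (kh * (m + m)) + m ^ 2 * (kh * (m + Real.sqrt (2 * X))) := by
    set et := E2 (fun x => x ^ 2) (p t) + E2 (fun x => a * x ^ 2) (q t)
    set es := E2 (fun x => x ^ 2) (p s) + E2 (fun x => a * x ^ 2) (q s)
    set lt := L3 (fun _ => 1) (p t) (q t) (q t)
    set ls := L3 (fun _ => 1) (p s) (q s) (q s)
    have e : et = es - ls + lt := by rw [← ham]; ring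
    have : ‖et‖ ≤ ‖es‖ + ‖ls‖ + ‖lt‖ := by
      rw [e]; exact (norm_add_le _ _).trans (add_le_add (norm_sub_le _ _) le_rfl)
    linarith
  rw [Vx t ht]
  refine ENNReal.ofReal_le_ofReal ?_
  have hsq := Real.sq_sqrt (by positivity : (0:ℝ) ≤ 2 * X)
  have hy0 := Real.sqrt_nonneg (2 * X)
  set y := Real.sqrt (2 * X)
  have : X ≤ P + Q * y := by
    rw [hP, hQ]; linarith
  nlinarith [sq_nonneg (y - 2 * Q)]

lemma cont_boot {f : ℝ → ℝ} {α β s M : ℝ} (hc : ContinuousOn f (Icc α β)) (hs : s ∈ Icc α β) (hM : 0 < M) (h0 : f s ≤ M)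
    (c : ℝ) (step : ∀ t ∈ Icc α β, |t - s| ≤ c → (∀ r ∈ uIcc s t, f r ≤ 4 * M) → f t ≤ 2 * M) :
    ∀ t ∈ Icc α β, |t - s| ≤ c → f t ≤ 4 * M := by
  intro t ht htc
  by_contra hcon
  push Not at hcon
  set l : ℝ → ℝ := fun x => s + x * (t - s) with hl
  have lm : ∀ x ∈ Icc (0:ℝ) 1, l x ∈ Icc α β := by
    intro x hx
    have : l x = (1 - x) • s + x • t := by simp only [hl, smul_eq_mul]; ring
    rw [this]
    exact convex_Icc α β hs ht (by linarith [hx.2]) hx.1 (by ring)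
  have lc : Continuous l := by fun_prop
  set g : ℝ → ℝ := f ∘ l
  have gc : ContinuousOn g (Icc 0 1) := hc.comp lc.continuousOn lm
  have g0 : g 0 ≤ M := by simpa [g, hl] using h0
  have g1 : 4 * M < g 1 := by simpa [g, hl] using hcon
  set S : Set ℝ := Icc 0 1 ∩ g ⁻¹' {3 * M} with hS
  have Sc : IsClosed S := gc.preimage_isClosed_of_isClosed isClosed_Icc isClosed_singleton
  have Sn : S.Nonempty := by
    obtain ⟨x, hx, e⟩ := intermediate_value_Icc (zero_le_one) gc (⟨by linarith, by linarith⟩ : 3 * M ∈ Icc (g 0) (g 1))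
    exact ⟨x, hx, e⟩
  have Sb : BddBelow S := ⟨0, fun x hx => hx.1.1⟩
  have hx0 := Sc.csInf_mem Sn Sb
  set x0 := sInf S
  obtain ⟨x01, x02⟩ := hx0
  have x02 : g x0 = 3 * M := x02
  have low : ∀ r ∈ Icc 0 x0, g r ≤ 4 * M := by
    intro r hr
    by_contra hh
    push Not at hh
    obtain ⟨x, hx, e⟩ := intermediate_value_Icc hr.1 (gc.mono (Icc_subset_Icc le_rfl (hr.2.trans x01.2)))
      (⟨by linarith, by linarith⟩ : 3 * M ∈ Icc (g 0) (g r))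
    have hxS : x ∈ S := ⟨⟨hx.1, hx.2.trans (hr.2.trans x01.2)⟩, e⟩
    have h1 := csInf_le Sb hxS
    have : r = x0 := le_antisymm hr.2 (h1.trans hx.2)
    rw [this, x02] at hh
    linarith
  have labs : |l x0 - s| ≤ c := by
    have : l x0 - s = x0 * (t - s) := by simp only [hl]; ring
    rw [this, abs_mul, abs_of_nonneg x01.1]
    calc x0 * |t - s| ≤ 1 * |t - s| := mul_le_mul_of_nonneg_right x01.2 (abs_nonneg _)
      _ ≤ c := by linarith
  have := step (l x0) (lm x0 x01) labs (by
    intro r hr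
    have hseg : r ∈ segment ℝ s (l x0) := by rw [segment_eq_uIcc]; exact hr
    obtain ⟨u, v, hu, hv, huv, rfl⟩ := hseg
    have : u • s + v • l x0 = l (v * x0) := by
      simp only [hl, smul_eq_mul]
      have : u = 1 - v := by linarith
      rw [this]; ring
    rw [this]
    exact low _ ⟨mul_nonneg hv x01.1, mul_le_of_le_one_left x01.1 (by linarith)⟩)
  have : g x0 ≤ 2 * M := this
  linarith

lemma wsq_bd {κ : ℝ} {w : ℝ → ℝ} (hw : Wt κ w) : ∃ B, 0 ≤ B ∧ (∀ x, |w x ^ 2| ≤ B * (1 + |x|) ^ 2) ∧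
    (∀ x, |x ^ 2 * w x ^ 2| ≤ B * (1 + |x|) ^ 2) := by
  obtain ⟨Bw, hBw⟩ := hw.bdd
  have w0 := hw.pos
  refine ⟨Bw ^ 2, by positivity, fun x => ?_, fun x => ?_⟩
  · rw [abs_of_nonneg (by positivity)]
    calc w x ^ 2 ≤ Bw ^ 2 := pow_le_pow_left₀ (w0 x).le (hBw x) 2
      _ ≤ _ := le_mul_of_one_le_right (by positivity) (one_le_pow₀ (by linarith [abs_nonneg x]))
  · rw [abs_of_nonneg (by positivity), mul_comm]
    exact mul_le_mul (pow_le_pow_left₀ (w0 x).le (hBw x) 2) (sq_th x) (by positivity) (by positivity)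

theorem propI {a : ℝ} (ha : a < 0) {M : ℝ} (hM : 0 < M) : ∃ κ0 > 0, ∃ c > 0, ∀ (α β κ : ℝ) (w : ℝ → ℝ) (p q : ℝ → ℝ → ℂ),
    FS a α β p q → Wt κ w → κ ≤ κ0 → ∀ s ∈ Icc α β, V (fun x => w x ^ 2) (p s) (q s) ≤ ENNReal.ofReal M →
    ∀ t ∈ Icc α β, κ * |t - s| ≤ c → V (fun x => w x ^ 2) (p t) (q t) ≤ ENNReal.ofReal (4 * M) := by
  obtain ⟨C, hC, hI⟩ := caseI ha
  set N := Real.sqrt (2 * (4 * M)) with hN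
  have hN0 : 0 < N := Real.sqrt_pos.2 (by positivity)
  set K := C * (N ^ 3 + N ^ 4 + N ^ 5) with hK
  have hK0 : 0 < K := by positivity
  refine ⟨M / (2 * K), by positivity, M / (2 * K), by positivity, ?_⟩
  intro α β κ w p q hF hw hκ s hs hV t ht htc
  have hκ0 := hw.k0
  obtain ⟨D, hD, hd⟩ := hF.d6
  obtain ⟨B, hB, bb, _⟩ := wsq_bd hw
  have wm := hw.meas
  have VE : ∀ r ∈ Icc α β, V (fun x => w x ^ 2) (p r) (q r) = ENNReal.ofReal ‖Ew w (p r) (q r)‖ := fun r hr =>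
    V_of_E hD (hd r hr).1 (hd r hr).2 (hF.cp r hr) (hF.cq r hr) (by fun_prop) (fun _ => by positivity) bb
  have cE := (E_deriv hF (θu := fun x => w x ^ 2) (θv := fun x => w x ^ 2) (by fun_prop) (by fun_prop)
    (fun x => by rw [hw.even]) (fun x => by rw [hw.even]) hB bb bb).1
  have key := cont_boot (f := fun r => ‖Ew w (p r) (q r)‖) cE.norm hs hM
    ((ENNReal.ofReal_le_ofReal_iff hM.le).1 (by rw [← VE s hs]; exact hV)) |t - s| (by
      intro r hr hrt hle
      have hsub : uIcc s r ⊆ Icc α β := uIcc_subset_Icc hs hr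
      have hI' := hI (min s r) (max s r) κ N w p q (hF.mono (le_min hs.1 hr.1) (max_le hs.2 hr.2)) hw hN0.le
        (fun x hx => Am_V (fun y => (hw.pos y).le) (by positivity) (by
          rw [VE x (hsub hx)]; exact ENNReal.ofReal_le_ofReal (hle x hx))) s left_mem_uIcc r right_mem_uIcc
      have h0 : ‖Ew w (p s) (q s)‖ ≤ M := (ENNReal.ofReal_le_ofReal_iff hM.le).1 (by rw [← VE s hs]; exact hV)
      have h1 : ‖Ew w (p r) (q r)‖ ≤ ‖Ew w (p s) (q s)‖ + ‖Ew w (p r) (q r) - Ew w (p s) (q s)‖ := by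
        have := norm_add_le (Ew w (p s) (q s)) (Ew w (p r) (q r) - Ew w (p s) (q s))
        simpa using this
      have h2 : κ * |r - s| ≤ M / (2 * K) := (mul_le_mul_of_nonneg_left hrt hκ0).trans htc
      have h3 : C * κ * (N ^ 3 + N ^ 4 + |r - s| * (N ^ 3 + N ^ 4 + N ^ 5)) ≤ κ * K + (κ * |r - s|) * K := by
        have : 0 ≤ C * κ * N ^ 5 := by positivity
        rw [hK]; nlinarith
      have h4 : κ * K ≤ M / 2 := by
        calc κ * K ≤ M / (2 * K) * K := mul_le_mul_of_nonneg_right hκ hK0.le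
          _ = M / 2 := by field_simp
      have h5 : (κ * |r - s|) * K ≤ M / 2 := by
        calc _ ≤ M / (2 * K) * K := mul_le_mul_of_nonneg_right h2 hK0.le
          _ = M / 2 := by field_simp
      linarith)
  rw [VE t ht]
  exact ENNReal.ofReal_le_ofReal (key t ht le_rfl)

theorem propII {a : ℝ} (ha : a = 1 ∨ 4 < a) {M : ℝ} (hM : 0 < M) : ∃ κ0 > 0, ∃ c > 0, ∃ B ≥ 0,
    ∀ (α β κ : ℝ) (w : ℝ → ℝ) (p q : ℝ → ℝ → ℂ),
    FS a α β p q → Wt κ w → w 0 = 1 → 0 < κ → κ ≤ κ0 → ∀ s ∈ Icc α β,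
    V (fun x => (1 + x ^ 2) * w x ^ 2) (p s) (q s) ≤ ENNReal.ofReal M →
    ∀ t ∈ Icc α β, κ * |t - s| ≤ c → V (fun x => w x ^ 2) (p t) (q t) ≤ ENNReal.ofReal B ∧
      V (fun x => x ^ 2 * w x ^ 2) (p t) (q t) ≤ ENNReal.ofReal (1 / κ) := by
  obtain ⟨C, hC, hI⟩ := caseII (a := a) (Or.inr ha)
  obtain ⟨B, hB, hH⟩ := H1_bound (a := a) (by rcases ha with h | h <;> linarith) hM.le
  have hkh := kh_nn
  set N0 := Real.sqrt (2 * B) with hN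
  have hN0 : 0 ≤ N0 := Real.sqrt_nonneg _
  set K := C * (1 + N0) ^ 4 with hK
  have hK0 : 0 < K := by positivity
  refine ⟨min 1 (1 / (4 * (M + K))), by positivity, 1 / (4 * K), by positivity, ((4 * kh + 4) * (1 + N0)) ^ 2, by positivity, ?_⟩
  intro α β κ w p q hF hw hw0 hκ0 hκ s hs hV t ht htc
  have hκ1 : κ ≤ 1 := hκ.trans (min_le_left _ _)
  have hκM : κ * (M + K) ≤ 1 / 4 := by
    calc _ ≤ 1 / (4 * (M + K)) * (M + K) := mul_le_mul_of_nonneg_right (hκ.trans (min_le_right _ _)) (by positivity)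
      _ = 1 / 4 := by field_simp
  obtain ⟨D, hD, hd⟩ := hF.d6
  obtain ⟨B', hB', _, bb⟩ := wsq_bd hw
  have wm := hw.meas
  have w1 := hw.one
  have VE : ∀ r ∈ Icc α β, V (fun x => x ^ 2 * w x ^ 2) (p r) (q r) = ENNReal.ofReal ‖Ex w (p r) (q r)‖ := fun r hr =>
    V_of_E hD (hd r hr).1 (hd r hr).2 (hF.cp r hr) (hF.cq r hr) (by fun_prop) (fun _ => by positivity) bb
  have cE := (E_deriv hF (θu := fun x => x ^ 2 * w x ^ 2) (θv := fun x => x ^ 2 * w x ^ 2) (by fun_prop) (by fun_prop)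
    (fun x => by rw [hw.even]; ring) (fun x => by rw [hw.even]; ring) hB' bb bb).1
  have h1 := hH α β p q hF s hs ((V_mono fun x => by
    have : 1 ≤ w x ^ 2 := one_le_pow₀ (w1 x)
    nlinarith [sq_nonneg x]).trans hV)
  have n0 : ∀ r ∈ Icc α β, n2 (Am (fun _ => 1) (p r) (q r)) ≤ ENNReal.ofReal N0 ∧
      n2 (fun x => ab x * Am (fun _ => 1) (p r) (q r) x) ≤ ENNReal.ofReal N0 := by
    intro r hr
    obtain ⟨e1, e2⟩ := h1 r hr
    refine ⟨Am_V (fun _ => zero_le_one) hB ?_, abAm_V (fun _ => zero_le_one) hB ?_⟩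
    · simpa using e1
    · simpa using e2
  have hf0 : ‖Ex w (p s) (q s)‖ ≤ M := (ENNReal.ofReal_le_ofReal_iff hM.le).1 (by
    rw [← VE s hs]
    refine le_trans (V_mono fun x => ?_) hV
    nlinarith [sq_nonneg (w x)])
  have hMκ : M ≤ 1 / (4 * κ) := by
    rw [le_div_iff₀ (by positivity)]; nlinarith
  set Φ := Real.sqrt (2 * (1 / κ)) with hΦ
  have hΦ2 : κ * Φ ^ 2 ≤ 2 := by
    rw [hΦ, Real.sq_sqrt (by positivity)]
    exact le_of_eq (by field_simp)
  have e4 : 4 * (1 / (4 * κ)) = 1 / κ := by field_simp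
  have bt : ∀ r ∈ Icc α β, ‖Ex w (p r) (q r)‖ ≤ 1 / κ → n2 (fun x => ab x * Am w (p r) (q r) x) ≤ ENNReal.ofReal Φ := by
    intro r hr hle
    refine abAm_V (fun y => (hw.pos y).le) (by positivity) ?_
    rw [VE r hr]; exact ENNReal.ofReal_le_ofReal hle
  have key := cont_boot (f := fun r => ‖Ex w (p r) (q r)‖) (M := 1 / (4 * κ)) cE.norm hs (by positivity)
    (hf0.trans hMκ) |t - s| (by
      intro r hr hrt hle
      rw [e4] at hle
      have hsub : uIcc s r ⊆ Icc α β := uIcc_subset_Icc hs hr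
      have hI' := hI (min s r) (max s r) κ N0 Φ w p q (hF.mono (le_min hs.1 hr.1) (max_le hs.2 hr.2)) hw hw0 hκ0 hκ1 hN0
        (Real.sqrt_nonneg _) hΦ2 (fun x hx => ⟨(n0 x (hsub hx)).1, (n0 x (hsub hx)).2, bt x (hsub hx) (hle x hx)⟩)
        s left_mem_uIcc r right_mem_uIcc
      have h1 : ‖Ex w (p r) (q r)‖ ≤ ‖Ex w (p s) (q s)‖ + ‖Ex w (p r) (q r) - Ex w (p s) (q s)‖ := by
        have := norm_add_le (Ex w (p s) (q s)) (Ex w (p r) (q r) - Ex w (p s) (q s))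
        simpa using this
      have h2 : κ * |r - s| ≤ 1 / (4 * K) := (mul_le_mul_of_nonneg_left hrt hκ0.le).trans htc
      have h5 : (κ * |r - s|) * K ≤ 1 / 4 := by
        calc _ ≤ 1 / (4 * K) * K := mul_le_mul_of_nonneg_right h2 hK0.le
          _ = 1 / 4 := by field_simp
      have e2 : 2 * (1 / (4 * κ)) = (1 / 2) / κ := by field_simp; norm_num
      rw [e2, le_div_iff₀ hκ0]
      have h6 : ‖Ex w (p r) (q r)‖ ≤ M + K * (1 + |r - s|) := by linarith
      nlinarith [mul_le_mul_of_nonneg_right h6 hκ0.le])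
  have kt := key t ht le_rfl
  rw [e4] at kt
  obtain ⟨s1, _, _⟩ := sizes hw hw0 hκ0 hκ1 hN0 (Real.sqrt_nonneg _) hΦ2 (hF.mp t ht) (hF.mq t ht) (n0 t ht).1 (n0 t ht).2 (bt t ht kt)
  refine ⟨?_, ?_⟩
  · rw [ENNReal.ofReal_pow (by positivity)]
    refine le_trans ?_ (pow_le_pow_left' s1 2)
    rw [n2_sq]
    unfold V V2
    refine lintegral_mono fun x => ?_
    simp only
    unfold Am
    rw [← mul_add, mul_pow, ENNReal.ofReal_pow (hw.pos x).le]
    refine mul_le_mul_right ?_ _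
    calc ‖p t x‖ₑ ^ 2 + ‖q t x‖ₑ ^ 2 ≤ ‖p t x‖ₑ ^ 2 + ‖q t x‖ₑ ^ 2 + 2 * (‖p t x‖ₑ * ‖q t x‖ₑ) := le_self_add
      _ = _ := by ring
  · rw [VE t ht]; exact ENNReal.ofReal_le_ofReal kt
end MB


namespace MB

lemma V_lim {θ : ℝ → ℝ} {θR : ℕ → ℝ → ℝ} {p q : ℝ → ℂ} {K : ℝ≥0∞}
    (h : ∀ (n : ℕ) (x : ℝ), |x| ≤ (n : ℝ) → θ x ≤ θR n x) (hK : ∀ n, V (θR n) p q ≤ K) : V θ p q ≤ K := by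
  have hu : (⋃ n : ℕ, Icc (-(n : ℝ)) n) = univ := by
    refine eq_univ_of_forall fun x => ?_
    obtain ⟨n, hn⟩ := exists_nat_ge |x|
    exact mem_iUnion.2 ⟨n, abs_le.1 hn⟩
  have hd : Directed (· ⊆ ·) (fun n : ℕ => Icc (-(n : ℝ)) n) := by
    refine (monotone_nat_of_le_succ fun n => ?_).directed_le
    refine Icc_subset_Icc ?_ ?_ <;> push_cast <;> linarith
  unfold V V2
  rw [← setLIntegral_univ, ← hu, setLIntegral_iUnion_of_directed _ hd]
  refine iSup_le fun n => ?_
  refine le_trans ?_ (hK n)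
  unfold V V2
  refine le_trans (setLIntegral_mono' measurableSet_Icc fun x hx => ?_) (setLIntegral_le_lintegral _ _)
  have := h n x (abs_le.2 hx)
  gcongr

lemma V_add {θ θ' : ℝ → ℝ} {p q : ℝ → ℂ} {C : ℝ} (h0 : ∀ x, 0 ≤ θ x) (h0' : ∀ x, 0 ≤ θ' x)
    (mθ : Measurable θ) (mp : Measurable p) (mq : Measurable q) (hC : 0 ≤ C) :
    V (fun x => θ x + C * θ' x) p q = V θ p q + ENNReal.ofReal C * V θ' p q := by
  unfold V V2
  rw [← lintegral_const_mul' _ _ ENNReal.ofReal_ne_top, ← lintegral_add_left (by fun_prop)]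
  refine lintegral_congr fun x => ?_
  rw [ENNReal.ofReal_add (h0 x) (mul_nonneg hC (h0' x)), ENNReal.ofReal_mul hC]
  ring

lemma V_smul {θ : ℝ → ℝ} {p q : ℝ → ℂ} {C : ℝ} (hC : 0 ≤ C) :
    V (fun x => C * θ x) p q = ENNReal.ofReal C * V θ p q := by
  unfold V V2
  rw [← lintegral_const_mul' _ _ ENNReal.ofReal_ne_top]
  refine lintegral_congr fun x => ?_
  rw [ENNReal.ofReal_mul hC]
  ring

theorem propA {a : ℝ} (ha : a < 0 ∨ a = 1 ∨ 4 < a) {M : ℝ} (hM : 0 < M) : ∃ κ0 > 0, ∃ c > 0, ∃ B ≥ 0,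
    ∀ (α β κ : ℝ) (w : ℝ → ℝ) (p q : ℝ → ℝ → ℂ),
    FS a α β p q → Wt κ w → w 0 = 1 → 0 < κ → κ ≤ κ0 → ∀ s ∈ Icc α β,
    V (fun x => (1 + x ^ 2) * w x ^ 2) (p s) (q s) ≤ ENNReal.ofReal M →
    ∀ t ∈ Icc α β, κ * |t - s| ≤ c →
      V (fun x => (1 + κ ^ 2 * x ^ 2) * w x ^ 2) (p t) (q t) ≤ ENNReal.ofReal B := by
  rcases ha with ha | ha
  · obtain ⟨κ0, hκ0, c, hc, H⟩ := propI ha (M := 2 * M) (by positivity)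
    refine ⟨min 1 (κ0 / 2), by positivity, c / 2, by positivity, 4 * (2 * M), by positivity, ?_⟩
    intro α β κ w p q hF hw w0 hκ hκl s hs hV t ht hts
    have hκ1 : κ ≤ 1 := hκl.trans (min_le_left _ _)
    have hκ2 : κ ≤ κ0 / 2 := hκl.trans (min_le_right _ _)
    refine V_lim (θR := fun n x => ((1 + κ * min |x| n) * w x) ^ 2) ?_ ?_
    · intro n x hx
      rw [min_eq_left hx, mul_pow]
      refine mul_le_mul_of_nonneg_right ?_ (sq_nonneg _)
      nlinarith [sq_abs x, mul_nonneg hκ.le (abs_nonneg x)]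
    · intro n
      refine H α β (κ + κ) _ p q hF ((wt_lin hκ.le (Nat.cast_nonneg n)).mul hw) (by linarith) s hs ?_ t ht (by linarith)
      have e : ENNReal.ofReal (2 * M) = ENNReal.ofReal 2 * ENNReal.ofReal M := ENNReal.ofReal_mul (by norm_num)
      rw [e]
      refine le_trans ?_ (mul_le_mul_right hV _)
      rw [← V_smul (by norm_num)]
      refine V_mono fun x => ?_
      rw [mul_pow, ← mul_assoc]
      refine mul_le_mul_of_nonneg_right ?_ (sq_nonneg _)
      have h1 : κ * min |x| n ≤ |x| := by
        calc _ ≤ 1 * |x| := mul_le_mul hκ1 (min_le_left _ _) (le_min (abs_nonneg _) (Nat.cast_nonneg n)) (by norm_num)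
          _ = |x| := one_mul _
      have h2 : 0 ≤ κ * min |x| n := mul_nonneg hκ.le (le_min (abs_nonneg _) (Nat.cast_nonneg n))
      nlinarith [sq_abs x, sq_nonneg (1 - |x|), abs_nonneg x]
  · obtain ⟨κ0, hκ0, c, hc, B, hB, H⟩ := propII ha hM
    refine ⟨min 1 κ0, by positivity, c, hc, B + 1, by positivity, ?_⟩
    intro α β κ w p q hF hw w0 hκ hκl s hs hV t ht hts
    have hκ1 : κ ≤ 1 := hκl.trans (min_le_left _ _)
    obtain ⟨h1, h2⟩ := H α β κ w p q hF hw w0 hκ (hκl.trans (min_le_right _ _)) s hs hV t ht hts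
    have e : (fun x => (1 + κ ^ 2 * x ^ 2) * w x ^ 2) = fun x => w x ^ 2 + κ ^ 2 * (x ^ 2 * w x ^ 2) := by
      funext x; ring
    have := hw.meas
    rw [e, V_add (θ := fun x => w x ^ 2) (θ' := fun x => x ^ 2 * w x ^ 2) (fun x => by positivity) (fun x => by positivity) (by fun_prop) (hF.mp t ht) (hF.mq t ht) (by positivity),
      ENNReal.ofReal_add hB zero_le_one]
    refine add_le_add h1 ((mul_le_mul_right h2 _).trans ?_)
    rw [← ENNReal.ofReal_mul (by positivity)]
    refine ENNReal.ofReal_le_ofReal ?_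
    have : κ ^ 2 * (1 / κ) = κ := by field_simp
    linarith

/-- polynomial weight -/
theorem propPoly {a : ℝ} (ha : a < 0 ∨ a = 1 ∨ 4 < a) {M : ℝ} (hM : 0 < M) (T : ℝ) (hT : 0 ≤ T) : ∃ B ≥ 0,
    ∀ (α β : ℝ) (p q : ℝ → ℝ → ℂ), FS a α β p q → ∀ s ∈ Icc α β,
    V (fun x => (1 + |x|) ^ 14) (p s) (q s) ≤ ENNReal.ofReal M →
    ∀ t ∈ Icc α β, |t - s| ≤ T →
      V (fun x => (1 + |x|) ^ 14) (p t) (q t) ≤ ENNReal.ofReal B := by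
  obtain ⟨κ0, hκ0, c, hc, B, hB, H⟩ := propA ha hM
  set κ := min 1 (min (κ0 / 6) (c / (6 * (T + 1)))) with hκ
  have hκp : 0 < κ := by positivity
  have k1 : κ ≤ 1 := min_le_left _ _
  have k2 : κ ≤ κ0 / 6 := (min_le_right _ _).trans (min_le_left _ _)
  have k3 : κ ≤ c / (6 * (T + 1)) := (min_le_right _ _).trans (min_le_right _ _)
  rw [le_div_iff₀ (by positivity)] at k3
  refine ⟨2 / κ ^ 14 * B, by positivity, ?_⟩
  intro α β p q hF s hs hV t ht hts
  have key : V (fun x => (1 + κ ^ 2 * x ^ 2) * ((1 + κ * |x|) ^ 6) ^ 2) (p t) (q t) ≤ ENNReal.ofReal B := by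
    refine V_lim (θR := fun n x => (1 + ((6:ℕ) * κ) ^ 2 * x ^ 2) * ((1 + κ * min |x| n) ^ 6) ^ 2) ?_ ?_
    · intro n x hx
      rw [min_eq_left hx]
      refine mul_le_mul_of_nonneg_right ?_ (by positivity)
      push_cast
      nlinarith [mul_nonneg (sq_nonneg κ) (sq_nonneg x)]
    · intro n
      refine H α β _ _ p q hF (wt_pow (wt_lin hκp.le (Nat.cast_nonneg n)) 6) (by simp) (by positivity) (by push_cast; linarith) s hs ?_ t ht ?_
      · refine le_trans (V_mono fun x => ?_) hV
        have h1 : κ * min |x| n ≤ |x| := by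
          calc _ ≤ 1 * |x| := mul_le_mul k1 (min_le_left _ _) (le_min (abs_nonneg _) (Nat.cast_nonneg n)) (by norm_num)
            _ = |x| := one_mul _
        have h2 : 0 ≤ κ * min |x| n := mul_nonneg hκp.le (le_min (abs_nonneg _) (Nat.cast_nonneg n))
        have h3 : 1 + x ^ 2 ≤ (1 + |x|) ^ 2 := by nlinarith [sq_abs x, abs_nonneg x]
        calc (1 + x ^ 2) * ((1 + κ * min |x| n) ^ 6) ^ 2 ≤ (1 + |x|) ^ 2 * ((1 + |x|) ^ 6) ^ 2 := by
              refine mul_le_mul h3 ?_ (by positivity) (by positivity)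
              gcongr
          _ = _ := by ring
      · push_cast
        nlinarith
  have e : ENNReal.ofReal (2 / κ ^ 14 * B) = ENNReal.ofReal (2 / κ ^ 14) * ENNReal.ofReal B := ENNReal.ofReal_mul (by positivity)
  rw [e]
  refine le_trans ?_ (mul_le_mul_right key _)
  rw [← V_smul (by positivity)]
  refine V_mono fun x => ?_
  rw [div_mul_eq_mul_div, le_div_iff₀ (by positivity)]
  have h1 : κ * (1 + |x|) ≤ 1 + κ * |x| := by linarith
  have h2 : (1 + κ * |x|) ^ 2 ≤ 2 * (1 + κ ^ 2 * x ^ 2) := by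
    nlinarith [sq_abs x, sq_nonneg (1 - κ * |x|)]
  calc (1 + |x|) ^ 14 * κ ^ 14 = (κ * (1 + |x|)) ^ 14 := by ring
    _ ≤ (1 + κ * |x|) ^ 14 := by gcongr
    _ = (1 + κ * |x|) ^ 2 * ((1 + κ * |x|) ^ 6) ^ 2 := by ring
    _ ≤ 2 * (1 + κ ^ 2 * x ^ 2) * ((1 + κ * |x|) ^ 6) ^ 2 := mul_le_mul_of_nonneg_right h2 (by positivity)
    _ = _ := by ring

theorem propExp {a : ℝ} (ha : a < 0 ∨ a = 1 ∨ 4 < a) {M : ℝ} (hM : 0 < M) : ∃ κ0 > 0, ∃ c > 0, ∃ B ≥ 0,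
    ∀ (α β κ : ℝ) (p q : ℝ → ℝ → ℂ),
    FS a α β p q → 0 < κ → κ ≤ κ0 → ∀ s ∈ Icc α β,
    V (fun x => (1 + x ^ 2) * Real.exp (κ * |x|) ^ 2) (p s) (q s) ≤ ENNReal.ofReal M →
    ∀ t ∈ Icc α β, κ * |t - s| ≤ c →
      V (fun x => Real.exp (κ * |x|) ^ 2) (p t) (q t) ≤ ENNReal.ofReal B := by
  obtain ⟨κ0, hκ0, c, hc, B, hB, H⟩ := propA ha hM
  refine ⟨κ0, hκ0, c, hc, B, hB, ?_⟩
  intro α β κ p q hF hκ hκl s hs hV t ht hts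
  refine V_lim (θR := fun n x => (1 + κ ^ 2 * x ^ 2) * Real.exp (κ * min |x| n) ^ 2) ?_ ?_
  · intro n x hx
    rw [min_eq_left hx]
    refine le_mul_of_one_le_left (by positivity) ?_
    nlinarith [mul_nonneg (sq_nonneg κ) (sq_nonneg x)]
  · intro n
    refine H α β _ _ p q hF (wt_exp hκ.le (Nat.cast_nonneg n)) (by simp) hκ hκl s hs ?_ t ht hts
    refine le_trans (V_mono fun x => ?_) hV
    have : min |x| (n:ℝ) ≤ |x| := min_le_left _ _
    gcongr

end MB


namespace MB
open scoped FourierTransform SchwartzMap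

/-- normalised Fourier transform -/
noncomputable def fh (f : ℝ → ℂ) (ξ : ℝ) : ℂ := FT1 f ξ / (2 * Real.pi)

lemma FT1_eq (f : ℝ → ℂ) (ξ : ℝ) : FT1 f ξ = 𝓕 f (ξ / (2 * Real.pi)) := by
  rw [Real.fourier_real_eq_integral_exp_smul]
  unfold FT1
  refine integral_congr_ae (Eventually.of_forall fun x => ?_)
  simp only [smul_eq_mul]
  congr 2
  have := Real.pi_ne_zero
  push_cast
  field_simp

lemma fh_eq (f : 𝓢(ℝ, ℂ)) (ξ : ℝ) : fh f ξ = (𝓕 f) (ξ / (2 * Real.pi)) / (2 * Real.pi) := by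
  unfold fh; rw [FT1_eq]; rfl

lemma fh_cont (f : 𝓢(ℝ, ℂ)) : Continuous (fh f) := by
  have : fh f = fun ξ : ℝ => (𝓕 f) (ξ / (2 * Real.pi)) / (2 * Real.pi : ℂ) := funext (fh_eq f)
  rw [this]
  have := (𝓕 f).continuous
  fun_prop

lemma sch_dec (f : 𝓢(ℝ, ℂ)) (k : ℕ) : ∃ C, 0 ≤ C ∧ ∀ x, (1 + |x|) ^ k * ‖f x‖ ≤ C := by
  have h := fun x => SchwartzMap.one_add_le_sup_seminorm_apply (𝕜 := ℝ) (m := (k, 0)) (k := k) (n := 0) le_rfl le_rfl f x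
  simp only [norm_iteratedFDeriv_zero, Real.norm_eq_abs] at h
  exact ⟨_, le_trans (by positivity) (h 0), h⟩

lemma fh_dec (f : 𝓢(ℝ, ℂ)) (k : ℕ) : ∃ C, 0 ≤ C ∧ ∀ ξ, ‖fh f ξ‖ ≤ C / (1 + |ξ|) ^ k := by
  obtain ⟨C, hC, h⟩ := sch_dec (𝓕 f) k
  have hp := Real.pi_gt_three
  refine ⟨C * (2 * Real.pi) ^ k, by positivity, fun ξ => ?_⟩
  rw [fh_eq, le_div_iff₀ (by positivity)]
  have h1 := h (ξ / (2 * Real.pi))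
  have h2 : 1 + |ξ| ≤ (2 * Real.pi) * (1 + |ξ / (2 * Real.pi)|) := by
    rw [abs_div, abs_of_pos (by positivity : (0:ℝ) < 2 * Real.pi)]
    have : 2 * Real.pi * (1 + |ξ| / (2 * Real.pi)) = 2 * Real.pi + |ξ| := by field_simp
    rw [this]; linarith
  have h3 : ‖𝓕 f (ξ / (2 * Real.pi)) / (2 * Real.pi)‖ ≤ ‖𝓕 f (ξ / (2 * Real.pi))‖ := by
    rw [norm_div]
    refine div_le_self (norm_nonneg _) ?_
    rw [norm_mul]
    simp [abs_of_pos Real.pi_pos]; linarith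
  calc _ ≤ ‖𝓕 f (ξ / (2 * Real.pi))‖ * ((2 * Real.pi) * (1 + |ξ / (2 * Real.pi)|)) ^ k := by gcongr
    _ = ((1 + |ξ / (2 * Real.pi)|) ^ k * ‖𝓕 f (ξ / (2 * Real.pi))‖) * (2 * Real.pi) ^ k := by rw [mul_pow]; ring
    _ ≤ _ := by gcongr

lemma fh_deriv (f : 𝓢(ℝ, ℂ)) (ξ : ℝ) : fh (deriv f) ξ = Complex.I * ξ * fh f ξ := by
  unfold fh
  rw [FT1_eq, FT1_eq, Real.fourier_deriv f.integrable f.differentiable (SchwartzMap.derivCLM ℂ ℂ f).integrable]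
  have : (Real.pi : ℂ) ≠ 0 := by exact_mod_cast Real.pi_ne_zero
  simp only [smul_eq_mul]
  push_cast
  field_simp

/-- iterated derivative as a Schwartz map -/
noncomputable def sD (n : ℕ) (f : 𝓢(ℝ, ℂ)) : 𝓢(ℝ, ℂ) := (SchwartzMap.derivCLM ℂ ℂ)^[n] f

lemma sD_succ (n : ℕ) (f : 𝓢(ℝ, ℂ)) (x : ℝ) : sD (n + 1) f x = deriv (sD n f) x := by
  unfold sD
  rw [Function.iterate_succ_apply']; rfl

lemma sD_eq (n : ℕ) (f : 𝓢(ℝ, ℂ)) : ⇑(sD n f) = iteratedDeriv n f := by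
  induction n with
  | zero => simp [sD]
  | succ n ih =>
    funext x
    rw [sD_succ, ih, iteratedDeriv_succ]

lemma fh_sD (n : ℕ) (f : 𝓢(ℝ, ℂ)) (ξ : ℝ) : fh (sD n f) ξ = (Complex.I * ξ) ^ n * fh f ξ := by
  induction n with
  | zero => simp [sD]
  | succ n ih =>
    have : ⇑(sD (n+1) f) = deriv (sD n f) := funext (sD_succ n f)
    rw [this, fh_deriv, ih]; ring

lemma fh_sup (f : 𝓢(ℝ, ℂ)) (x : ℝ) : ‖f x‖ ≤ ∫ ξ, ‖fh f ξ‖ := by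
  have hp := Real.pi_pos
  have h1 : f x = 𝓕⁻ (𝓕 f) x := by simp
  have h2 : ‖f x‖ ≤ ∫ ξ, ‖𝓕 f ξ‖ := by
    rw [h1, SchwartzMap.fourierInv_coe, Real.fourierInv_eq_fourier_neg, Real.fourier_real_eq_integral_exp_smul]
    refine (norm_integral_le_integral_norm _).trans (le_of_eq ?_)
    refine integral_congr_ae (Eventually.of_forall fun y => ?_)
    simp only [norm_smul, Complex.norm_exp_ofReal_mul_I, one_mul]
  refine h2.trans (le_of_eq ?_)
  have h3 := MeasureTheory.Measure.integral_comp_div (fun ξ => ‖𝓕 f ξ‖) (2 * Real.pi)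
  have h4 : (fun ξ => ‖fh f ξ‖) = fun ξ => ‖𝓕 f (ξ / (2 * Real.pi))‖ * (1 / (2 * Real.pi)) := by
    funext ξ
    rw [fh_eq, norm_div, norm_mul]
    simp [abs_of_pos hp]; ring
  rw [h4, integral_mul_const, h3, abs_of_pos (by positivity)]
  simp only [smul_eq_mul]
  field_simp

lemma fh_planch (f : 𝓢(ℝ, ℂ)) : ∫ x, ‖f x‖ ^ 2 = 2 * Real.pi * ∫ ξ, ‖fh f ξ‖ ^ 2 := by
  have hp := Real.pi_pos
  rw [← SchwartzMap.integral_norm_sq_fourier]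
  have h3 := MeasureTheory.Measure.integral_comp_div (fun ξ => ‖𝓕 f ξ‖ ^ 2) (2 * Real.pi)
  have h4 : (fun ξ => ‖fh f ξ‖ ^ 2) = fun ξ => ‖𝓕 f (ξ / (2 * Real.pi))‖ ^ 2 * (1 / (2 * Real.pi) ^ 2) := by
    funext ξ
    rw [fh_eq, norm_div, norm_mul, div_pow]
    simp [abs_of_pos hp]; ring
  rw [h4, integral_mul_const, h3, abs_of_pos (by positivity)]
  simp only [smul_eq_mul]
  field_simp

lemma four_four (f : 𝓢(ℝ, ℂ)) (x : ℝ) : 𝓕 (𝓕 f) x = f (-x) := by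
  have h1 : f (-x) = 𝓕⁻ (𝓕 f) (-x) := by simp
  rw [h1, SchwartzMap.fourierInv_coe, Real.fourierInv_eq_fourier_neg, neg_neg]
  rfl

lemma four_mul (f g h : 𝓢(ℝ, ℂ)) (hh : ∀ x, h x = f x * g x) (ξ : ℝ) :
    𝓕 h ξ = ∫ η, 𝓕 f η * 𝓕 g (ξ - η) := by
  have h1 : 𝓕 (SchwartzMap.convolution (ContinuousLinearMap.mul ℂ ℂ) (𝓕 f) (𝓕 g)) = 𝓕 (𝓕 h) := by
    ext x
    rw [SchwartzMap.fourier_convolution, SchwartzMap.pairing_apply_apply, four_four, four_four, four_four, hh]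
    rfl
  have h2 : SchwartzMap.convolution (ContinuousLinearMap.mul ℂ ℂ) (𝓕 f) (𝓕 g) = 𝓕 h := by
    have := congrArg (fun z => 𝓕⁻ z) h1
    simpa using this
  rw [← h2, SchwartzMap.convolution_apply]
  rfl

lemma fh_mul (f g h : 𝓢(ℝ, ℂ)) (hh : ∀ x, h x = f x * g x) (ξ : ℝ) :
    fh h ξ = cv (fh f) (fh g) ξ := by
  have hp := Real.pi_pos
  have hp' : (Real.pi : ℂ) ≠ 0 := by exact_mod_cast hp.ne'
  rw [fh_eq, four_mul f g h hh]
  unfold cv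
  have h3 := MeasureTheory.Measure.integral_comp_div (fun η => 𝓕 f η * 𝓕 g (ξ / (2 * Real.pi) - η)) (2 * Real.pi)
  have h4 : (fun η => fh f η * fh g (ξ - η)) = fun η => (𝓕 f (η / (2 * Real.pi)) * 𝓕 g (ξ / (2 * Real.pi) - η / (2 * Real.pi))) * (1 / (2 * Real.pi) ^ 2 : ℂ) := by
    funext η
    rw [fh_eq, fh_eq, sub_div]
    field_simp
  rw [h4, integral_mul_const, h3, abs_of_pos (by positivity)]
  simp only [Complex.real_smul]
  push_cast
  field_simp

lemma fh_real (f : ℝ → ℝ) (ξ : ℝ) : fh (fun x => (f x : ℂ)) (-ξ) = (starRingEnd ℂ) (fh (fun x => (f x : ℂ)) ξ) := by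
  unfold fh FT1
  rw [map_div₀, ← integral_conj]
  congr 1
  · refine integral_congr_ae (Eventually.of_forall fun x => ?_)
    simp only [map_mul, Complex.conj_ofReal, ← Complex.exp_conj, map_neg, Complex.conj_I]
    push_cast
    congr 2; ring
  · rw [map_mul, Complex.conj_ofReal]
    congr 1
    exact (Complex.conj_ofReal 2).symm

end MB


namespace MB
open scoped Topology

/-- space exponential -/
noncomputable def ex (ξ x : ℝ) : ℂ := Complex.exp (-Complex.I * (x * ξ))
/-- time exponential -/
noncomputable def et (a ξ t : ℝ) : ℂ := Complex.exp (-(Complex.I * a * ξ ^ 3) * t)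

lemma ex_norm (ξ x : ℝ) : ‖ex ξ x‖ = 1 := by
  unfold ex
  rw [show -Complex.I * (x * ξ) = ((-(x * ξ) : ℝ) : ℂ) * Complex.I by push_cast; ring]
  exact Complex.norm_exp_ofReal_mul_I _

lemma et_norm (a ξ x : ℝ) : ‖et a ξ x‖ = 1 := by
  unfold et
  rw [show -(Complex.I * a * ξ ^ 3) * x = ((-(a * ξ ^ 3 * x) : ℝ) : ℂ) * Complex.I by push_cast; ring]
  exact Complex.norm_exp_ofReal_mul_I _

lemma ex_deriv (ξ x : ℝ) : HasDerivAt (ex ξ) (-(Complex.I * ξ) * ex ξ x) x := by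
  have h : HasDerivAt (fun x : ℝ => -Complex.I * ((x : ℂ) * ξ)) (-(Complex.I * ξ)) x := by
    have := ((Complex.ofRealCLM.hasDerivAt (x := x)).mul_const (ξ : ℂ)).const_mul (-Complex.I)
    convert! this using 1; simp
  unfold ex
  convert! h.cexp using 1; ring

lemma et_deriv (a ξ t : ℝ) : HasDerivAt (et a ξ) (-(Complex.I * a * ξ ^ 3) * et a ξ t) t := by
  have h : HasDerivAt (fun x : ℝ => -(Complex.I * a * ξ ^ 3) * (x : ℂ)) (-(Complex.I * a * ξ ^ 3)) t := by
    have := (Complex.ofRealCLM.hasDerivAt (x := t)).const_mul (-(Complex.I * a * ξ ^ 3))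
    convert! this using 1; simp
  unfold et
  convert! h.cexp using 1; ring

@[fun_prop] lemma ex_cont (ξ : ℝ) : Continuous (ex ξ) := by unfold ex; fun_prop
@[fun_prop] lemma et_cont (a ξ : ℝ) : Continuous (et a ξ) := by unfold et; fun_prop

lemma duh_R {a ξ t1 t2 R : ℝ} {w wt w1 w2 w3 N N1 : ℝ → ℝ → ℂ}
    (cw : Continuous (Function.uncurry w)) (ct : Continuous (Function.uncurry wt))
    (c3 : ∀ t, Continuous (w3 t))
    (cN : ∀ t, Continuous (N t)) (cN1 : ∀ t, Continuous (N1 t))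
    (dt : ∀ t x, HasDerivAt (fun τ => w τ x) (wt t x) t)
    (d0 : ∀ t x, HasDerivAt (w t) (w1 t x) x) (d1 : ∀ t x, HasDerivAt (w1 t) (w2 t x) x)
    (d2 : ∀ t x, HasDerivAt (w2 t) (w3 t x) x) (dN : ∀ t x, HasDerivAt (N t) (N1 t x) x)
    (pde : ∀ t x, wt t x = -(a * w3 t x) - N1 t x) :
    et a ξ t2 * (∫ x in (-R)..R, ex ξ x * w t2 x) - et a ξ t1 * (∫ x in (-R)..R, ex ξ x * w t1 x) =
      ∫ t in t1..t2, ∫ x in (-R)..R, et a ξ t * ex ξ x * (wt t x - Complex.I * a * ξ ^ 3 * w t x) ∧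
    ∀ t, ∫ x in (-R)..R, et a ξ t * ex ξ x * (wt t x - Complex.I * a * ξ ^ 3 * w t x) =
      et a ξ t * (-(Complex.I * ξ) * (∫ x in (-R)..R, ex ξ x * N t x)
       - ((a * (ex ξ R * (w2 t R + Complex.I * ξ * w1 t R - ξ ^ 2 * w t R)) + ex ξ R * N t R) -
        (a * (ex ξ (-R) * (w2 t (-R) + Complex.I * ξ * w1 t (-R) - ξ ^ 2 * w t (-R))) + ex ξ (-R) * N t (-R)))) := by
  have cwt : ∀ t, Continuous (w t) := fun t => cw.comp (by fun_prop : Continuous fun x => (t, x))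
  have cG : Continuous (Function.uncurry fun t x => et a ξ t * ex ξ x * (wt t x - Complex.I * a * ξ ^ 3 * w t x)) := by
    have h1 : Continuous fun z : ℝ × ℝ => w z.1 z.2 := cw
    have h2 : Continuous fun z : ℝ × ℝ => wt z.1 z.2 := ct
    unfold Function.uncurry
    fun_prop
  constructor
  · rw [intervalIntegral_intervalIntegral_swap, ← intervalIntegral.integral_const_mul, ← intervalIntegral.integral_const_mul,
      ← intervalIntegral.integral_sub]
    · refine intervalIntegral.integral_congr fun x _ => ?_
      rw [intervalIntegral.integral_eq_sub_of_hasDerivAt (f := fun t => et a ξ t * (ex ξ x * w t x))]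
      · intro t _
        convert! (et_deriv a ξ t).mul ((dt t x).const_mul (ex ξ x)) using 1
        ring
      · exact Continuous.intervalIntegrable (cG.comp (by fun_prop : Continuous fun t => (t, x))) _ _
    · have := cwt t2
      exact Continuous.intervalIntegrable (by fun_prop) _ _
    · have := cwt t1
      exact Continuous.intervalIntegrable (by fun_prop) _ _
    · have : IntegrableOn (Function.uncurry fun t x => et a ξ t * ex ξ x * (wt t x - Complex.I * a * ξ ^ 3 * w t x)) (uIcc t1 t2 ×ˢ uIcc (-R) R) :=
        cG.continuousOn.integrableOn_compact (isCompact_uIcc.prod isCompact_uIcc)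
      exact this.mono_set (Set.prod_mono uIoc_subset_uIcc uIoc_subset_uIcc)
  · intro t
    have e1 : ∀ x, HasDerivAt (fun x => a * (ex ξ x * (w2 t x + Complex.I * ξ * w1 t x - ξ ^ 2 * w t x)) + ex ξ x * N t x)
        (ex ξ x * (a * (w3 t x + Complex.I * ξ ^ 3 * w t x) + N1 t x - Complex.I * ξ * N t x)) x := by
      intro x
      have h1 := ((((ex_deriv ξ x).mul (((d2 t x).add ((d1 t x).const_mul (Complex.I * ξ))).sub ((d0 t x).const_mul ((ξ:ℂ)^2))))).const_mul (a:ℂ)).add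
        ((ex_deriv ξ x).mul (dN t x))
      convert! h1 using 1
      simp only [Pi.add_apply, Pi.sub_apply]
      ring_nf
      rw [Complex.I_sq]; ring
    have h3 := c3 t
    have h4 := cwt t
    have h5 := cN t
    have h6 := cN1 t
    have e2 := intervalIntegral.integral_eq_sub_of_hasDerivAt (a := -R) (b := R) (fun x _ => e1 x) (Continuous.intervalIntegrable (by fun_prop) _ _)
    rw [← e2, ← intervalIntegral.integral_const_mul, ← intervalIntegral.integral_sub, ← intervalIntegral.integral_const_mul]
    · refine intervalIntegral.integral_congr fun x _ => ?_
      rw [pde]; ring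
    · exact Continuous.intervalIntegrable (by fun_prop) _ _
    · exact Continuous.intervalIntegrable (by fun_prop) _ _

lemma duh {a ξ K t1 t2 : ℝ} (h12 : t1 ≤ t2) {w wt w1 w2 w3 N N1 : ℝ → ℝ → ℂ}
    (cw : Continuous (Function.uncurry w)) (ct : Continuous (Function.uncurry wt))
    (c3 : ∀ t, Continuous (w3 t))
    (cN : ∀ t, Continuous (N t)) (cN1 : ∀ t, Continuous (N1 t))
    (dt : ∀ t x, HasDerivAt (fun τ => w τ x) (wt t x) t)
    (d0 : ∀ t x, HasDerivAt (w t) (w1 t x) x) (d1 : ∀ t x, HasDerivAt (w1 t) (w2 t x) x)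
    (d2 : ∀ t x, HasDerivAt (w2 t) (w3 t x) x) (dN : ∀ t x, HasDerivAt (N t) (N1 t x) x)
    (pde : ∀ t x, wt t x = -(a * w3 t x) - N1 t x)
    (bd : ∀ t ∈ Icc t1 t2, ∀ x, ‖w t x‖ ≤ K ∧ ‖w1 t x‖ ≤ K ∧ ‖w2 t x‖ ≤ K ∧ ‖N t x‖ ≤ K)
    (iw : ∀ t, Integrable (w t)) (iN : ∀ t, Integrable (N t)) (bN : ∀ t ∈ Icc t1 t2, ∫ x, ‖N t x‖ ≤ K)
    (lim : ∀ t, Tendsto (w t) (cocompact ℝ) (𝓝 0) ∧ Tendsto (w1 t) (cocompact ℝ) (𝓝 0) ∧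
      Tendsto (w2 t) (cocompact ℝ) (𝓝 0) ∧ Tendsto (N t) (cocompact ℝ) (𝓝 0)) :
    et a ξ t2 * FT1 (w t2) ξ - et a ξ t1 * FT1 (w t1) ξ =
      ∫ t in t1..t2, et a ξ t * (-(Complex.I * ξ) * FT1 (N t) ξ) := by
  have H := fun R => duh_R (a := a) (ξ := ξ) (t1 := t1) (t2 := t2) (R := R) cw ct c3 cN cN1 dt d0 d1 d2 dN pde
  have atop : Tendsto (fun n : ℕ => (n : ℝ)) atTop atTop := tendsto_natCast_atTop_atTop
  have abot : Tendsto (fun n : ℕ => -(n : ℝ)) atTop atBot := tendsto_neg_atTop_atBot.comp atop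
  have iex : ∀ f : ℝ → ℂ, Integrable f → Integrable (fun x => ex ξ x * f x) := fun f hf =>
    hf.bdd_mul (c := 1) (ex_cont ξ).aestronglyMeasurable (Eventually.of_forall fun x => (ex_norm ξ x).le)
  have tI : ∀ f : ℝ → ℂ, Integrable f → Tendsto (fun n : ℕ => ∫ x in (-(n:ℝ))..n, ex ξ x * f x) atTop (𝓝 (FT1 f ξ)) := fun f hf =>
    intervalIntegral_tendsto_integral (iex f hf) abot atop
  have tL : Tendsto (fun n : ℕ => et a ξ t2 * (∫ x in (-(n:ℝ))..n, ex ξ x * w t2 x) - et a ξ t1 * (∫ x in (-(n:ℝ))..n, ex ξ x * w t1 x)) atTop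
      (𝓝 (et a ξ t2 * FT1 (w t2) ξ - et a ξ t1 * FT1 (w t1) ξ)) :=
    ((tI _ (iw t2)).const_mul _).sub ((tI _ (iw t1)).const_mul _)
  refine tendsto_nhds_unique tL ?_
  simp_rw [fun n : ℕ => (H n).1]
  have cG : Continuous (Function.uncurry fun t x => et a ξ t * ex ξ x * (wt t x - Complex.I * a * ξ ^ 3 * w t x)) := by
    have h1 : Continuous fun z : ℝ × ℝ => w z.1 z.2 := cw
    have h2 : Continuous fun z : ℝ × ℝ => wt z.1 z.2 := ct
    unfold Function.uncurry
    fun_prop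
  set BB : ℝ := |ξ| * K + 2 * (|a| * (K + |ξ| * K + ξ ^ 2 * K) + K) with hBB
  refine intervalIntegral.tendsto_integral_filter_of_dominated_convergence (fun _ => BB) ?_ ?_ (by simp) ?_
  · refine Eventually.of_forall fun n => ?_
    exact (intervalIntegral.continuous_parametric_intervalIntegral_of_continuous' cG _ _).aestronglyMeasurable
  · refine Eventually.of_forall fun n => Eventually.of_forall fun t ht => ?_
    have ht' : t ∈ Icc t1 t2 := by
      rw [uIoc_of_le h12] at ht; exact ⟨ht.1.le, ht.2⟩
    rw [(H n).2 t, norm_mul, et_norm, one_mul]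
    have hin : ‖∫ x in (-(n:ℝ))..n, ex ξ x * N t x‖ ≤ K := by
      refine (intervalIntegral.norm_integral_le_integral_norm (by linarith [(Nat.cast_nonneg n : (0:ℝ) ≤ n)])).trans (le_trans ?_ (bN t ht'))
      simp only [norm_mul, ex_norm, one_mul]
      rw [intervalIntegral.integral_of_le (by linarith [(Nat.cast_nonneg n : (0:ℝ) ≤ n)])]
      exact setIntegral_le_integral (iN t).norm (Eventually.of_forall fun x => norm_nonneg _)
    have hbd : ∀ R, ‖(a * (ex ξ R * (w2 t R + Complex.I * ξ * w1 t R - ξ ^ 2 * w t R)) + ex ξ R * N t R)‖ ≤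
        |a| * (K + |ξ| * K + ξ ^ 2 * K) + K := by
      intro R
      obtain ⟨b0, b1, b2, b3⟩ := bd t ht' R
      refine (norm_add_le _ _).trans (add_le_add ?_ ?_)
      · rw [norm_mul, norm_mul, ex_norm, one_mul, Complex.norm_real, Real.norm_eq_abs]
        refine mul_le_mul_of_nonneg_left ?_ (abs_nonneg _)
        refine (norm_sub_le _ _).trans (add_le_add ((norm_add_le _ _).trans (add_le_add b2 ?_)) ?_)
        · rw [norm_mul, norm_mul, Complex.norm_I, one_mul, Complex.norm_real, Real.norm_eq_abs]
          exact mul_le_mul_of_nonneg_left b1 (abs_nonneg _)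
        · rw [norm_mul, norm_pow, Complex.norm_real, Real.norm_eq_abs, sq_abs]
          exact mul_le_mul_of_nonneg_left b0 (sq_nonneg _)
      · rw [norm_mul, ex_norm, one_mul]; exact b3
    refine (norm_sub_le _ _).trans ?_
    have h1 : ‖-(Complex.I * ξ) * (∫ x in (-(n:ℝ))..n, ex ξ x * N t x)‖ ≤ |ξ| * K := by
      rw [norm_mul, norm_neg, norm_mul, Complex.norm_I, one_mul, Complex.norm_real, Real.norm_eq_abs]
      exact mul_le_mul_of_nonneg_left hin (abs_nonneg _)
    have h2 := (norm_sub_le _ _).trans (add_le_add (hbd n) (hbd (-n)))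
    linarith
  · refine Eventually.of_forall fun t ht => ?_
    simp_rw [fun n : ℕ => (H n).2 t]
    refine Tendsto.const_mul _ ?_
    have ht' : t ∈ Icc t1 t2 := by
      rw [uIoc_of_le h12] at ht; exact ⟨ht.1.le, ht.2⟩
    obtain ⟨l0, l1, l2, l3⟩ := lim t
    have bdry : Tendsto (fun R => (a * (ex ξ R * (w2 t R + Complex.I * ξ * w1 t R - ξ ^ 2 * w t R)) + ex ξ R * N t R)) (cocompact ℝ) (𝓝 0) := by
      have z : ∀ f : ℝ → ℂ, Tendsto f (cocompact ℝ) (𝓝 0) → Tendsto (fun R => ex ξ R * f R) (cocompact ℝ) (𝓝 0) := by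
        intro f hf
        rw [tendsto_zero_iff_norm_tendsto_zero] at hf ⊢
        simpa [norm_mul, ex_norm] using hf
      have l4 := (l2.add (l1.const_mul (Complex.I * ξ))).sub (l0.const_mul ((ξ:ℂ)^2))
      simp only [mul_zero, add_zero, sub_zero] at l4
      have := ((z _ l4).const_mul (a:ℂ)).add (z _ l3)
      simpa using this
    have c1 : Tendsto (fun n : ℕ => (n : ℝ)) atTop (cocompact ℝ) := atop.mono_right atTop_le_cocompact
    have c2 : Tendsto (fun n : ℕ => -(n : ℝ)) atTop (cocompact ℝ) := abot.mono_right atBot_le_cocompact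
    have := ((tI _ (iN t)).const_mul (-(Complex.I * ξ))).sub ((bdry.comp c1).sub (bdry.comp c2))
    simpa using this

end MB


namespace MB
open scoped Topology FourierTransform SchwartzMap

/-- pointwise product of Schwartz functions -/
noncomputable def sM (f g : 𝓢(ℝ, ℂ)) : 𝓢(ℝ, ℂ) := SchwartzMap.pairing (ContinuousLinearMap.mul ℂ ℂ) f g
lemma sM_apply (f g : 𝓢(ℝ, ℂ)) (x : ℝ) : sM f g x = f x * g x := rfl

/-- Schwartz solution of the system -/
structure Sol (a : ℝ) (U W : ℝ → 𝓢(ℝ, ℂ)) : Prop where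
  cU : ∀ n, Continuous (fun z : ℝ × ℝ => sD n (U z.1) z.2)
  cW : ∀ n, Continuous (fun z : ℝ × ℝ => sD n (W z.1) z.2)
  rU : ∀ t ξ, fh (U t) (-ξ) = (starRingEnd ℂ) (fh (U t) ξ)
  rW : ∀ t ξ, fh (W t) (-ξ) = (starRingEnd ℂ) (fh (W t) ξ)
  dU : ∀ t x, HasDerivAt (fun τ => U τ x) (-(((1:ℝ):ℂ) * sD 3 (U t) x) - W t x * sD 1 (W t) x) t
  dW : ∀ t x, HasDerivAt (fun τ => W τ x) (-((a:ℂ) * sD 3 (W t) x) - (sD 1 (U t) x * W t x + U t x * sD 1 (W t) x)) t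

/-- the regularity functional -/
noncomputable def Y (p q : ℝ → ℂ) : ℝ≥0∞ := V (fun x => (1 + |x|) ^ 14) p q

lemma Y_n2 {p q : ℝ → ℂ} {K : ℝ} (hK : 0 ≤ K) (h : Y p q ≤ ENNReal.ofReal K) :
    n2 (fun ξ => ENNReal.ofReal ((1 + |ξ|) ^ 7) * (‖p ξ‖ₑ + ‖q ξ‖ₑ)) ≤ ENNReal.ofReal (Real.sqrt (2 * K)) := by
  refine n2_V (φ := fun x => (1 + |x|) ^ 7) (fun x => by positivity) hK ?_
  refine le_trans (V_mono fun x => le_of_eq ?_) h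
  ring

lemma sup_bd {K : ℝ} (hK : 0 ≤ K) : ∃ K1, 0 ≤ K1 ∧ ∀ f g : 𝓢(ℝ, ℂ), Y (fh f) (fh g) ≤ ENNReal.ofReal K →
    ∀ j ≤ 2, ∀ x, ‖sD j f x‖ ≤ K1 ∧ ‖sD j g x‖ ≤ K1 := by
  refine ⟨(cJ 2 ^ (1/2 : ℝ)).toReal * Real.sqrt (2 * K), by positivity, fun f g h j hj x => ?_⟩
  have hc : cJ 2 ^ (1/2 : ℝ) ≠ ⊤ := (ENNReal.rpow_lt_top_of_nonneg (by norm_num) (J_fin (by norm_num)).ne).ne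
  have mA : Measurable (fun ξ => ENNReal.ofReal ((1 + |ξ|) ^ 7) * (‖fh f ξ‖ₑ + ‖fh g ξ‖ₑ)) := by
    have h1 := (fh_cont f).measurable
    have h2 := (fh_cont g).measurable
    fun_prop
  have key := (AJ mA 1).trans (mul_le_mul_right (Y_n2 hK h) _)
  rw [show (2 * 1 : ℝ) = 2 by norm_num] at key
  have e : cJ 2 ^ (1/2 : ℝ) * ENNReal.ofReal (Real.sqrt (2 * K)) = ENNReal.ofReal ((cJ 2 ^ (1/2 : ℝ)).toReal * Real.sqrt (2 * K)) := by
    rw [ENNReal.ofReal_mul (by positivity), ENNReal.ofReal_toReal hc]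
  rw [e] at key
  have gen : ∀ k : 𝓢(ℝ, ℂ), (∀ ξ, ‖fh k ξ‖ₑ ≤ ‖fh f ξ‖ₑ + ‖fh g ξ‖ₑ) → ‖sD j k x‖ ≤ (cJ 2 ^ (1/2 : ℝ)).toReal * Real.sqrt (2 * K) := by
    intro k hk
    refine (fh_sup (sD j k) x).trans ?_
    rw [integral_norm_eq_lintegral_enorm (fh_cont _).aestronglyMeasurable]
    refine ENNReal.toReal_le_of_le_ofReal (by positivity) (le_trans (lintegral_mono fun ξ => ?_) key)
    rw [fh_sD, enorm_mul, mul_right_comm]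
    refine mul_le_mul ?_ (hk ξ) zero_le zero_le
    have : ‖(Complex.I * ξ) ^ j‖ₑ = ENNReal.ofReal (|ξ| ^ j) := by
      rw [← ofReal_norm]; simp
    rw [this]
    unfold J
    rw [← ENNReal.ofReal_mul (by positivity)]
    refine ENNReal.ofReal_le_ofReal ?_
    rw [Real.rpow_neg_one]
    have h0 : (0:ℝ) ≤ |ξ| := abs_nonneg _
    calc |ξ| ^ j ≤ (1 + |ξ|) ^ j := by gcongr; linarith
      _ ≤ (1 + |ξ|) ^ 6 := pow_le_pow_right₀ (by linarith) (by omega)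
      _ = (1 + |ξ|) ^ 7 * (1 + |ξ|)⁻¹ := by field_simp
  exact ⟨gen f fun ξ => le_self_add, gen g fun ξ => le_add_self⟩

lemma fh_int_sq (f : 𝓢(ℝ, ℂ)) : Integrable (fun ξ => ‖fh f ξ‖ ^ 2) := by
  obtain ⟨C, hC, h⟩ := fh_dec f 1
  refine (int1.const_mul (C ^ 2)).mono' ((fh_cont f).norm.pow 2).aestronglyMeasurable (Eventually.of_forall fun ξ => ?_)
  rw [Real.norm_of_nonneg (by positivity)]
  calc _ ≤ (C / (1 + |ξ|) ^ 1) ^ 2 := by gcongr; exact h ξ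
    _ = _ := by field_simp

lemma sch_int_sq (f : 𝓢(ℝ, ℂ)) : Integrable (fun ξ => ‖f ξ‖ ^ 2) := by
  obtain ⟨C, hC, h⟩ := sch_dec f 1
  refine (int1.const_mul (C ^ 2)).mono' (f.continuous.norm.pow 2).aestronglyMeasurable (Eventually.of_forall fun ξ => ?_)
  rw [Real.norm_of_nonneg (by positivity)]
  have h1 := h ξ
  rw [← mul_div_assoc, le_div_iff₀ (by positivity), mul_one, ← mul_pow]
  rw [pow_one] at h1
  have : 0 ≤ ‖f ξ‖ * (1 + |ξ|) := by positivity
  gcongr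
  linarith

lemma fh_planch_l (f : 𝓢(ℝ, ℂ)) : ∫⁻ x, ‖f x‖ₑ ^ 2 = ENNReal.ofReal (2 * Real.pi) * ∫⁻ ξ, ‖fh f ξ‖ₑ ^ 2 := by
  have e : ∀ g : ℝ → ℂ, Integrable (fun ξ => ‖g ξ‖ ^ 2) → ∫⁻ ξ, ‖g ξ‖ₑ ^ 2 = ENNReal.ofReal (∫ ξ, ‖g ξ‖ ^ 2) := by
    intro g hg
    rw [ofReal_integral_eq_lintegral_ofReal hg (Eventually.of_forall fun ξ => by positivity)]
    refine lintegral_congr fun ξ => ?_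
    rw [ENNReal.ofReal_pow (norm_nonneg _), ofReal_norm]
  rw [e _ (sch_int_sq f), e _ (fh_int_sq f), ← ENNReal.ofReal_mul Real.two_pi_pos.le, fh_planch]

lemma L2_bd {K : ℝ} (hK : 0 ≤ K) (f g : 𝓢(ℝ, ℂ)) (h : Y (fh f) (fh g) ≤ ENNReal.ofReal K) :
    ∫ x, ‖f x‖ ^ 2 ≤ 2 * Real.pi * K ∧ ∫ x, ‖g x‖ ^ 2 ≤ 2 * Real.pi * K := by
  have gen : ∀ k : 𝓢(ℝ, ℂ), (∀ ξ, ‖fh k ξ‖ₑ ^ 2 ≤ ‖fh f ξ‖ₑ ^ 2 + ‖fh g ξ‖ₑ ^ 2) → ∫ x, ‖k x‖ ^ 2 ≤ 2 * Real.pi * K := by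
    intro k hk
    rw [fh_planch]
    refine mul_le_mul_of_nonneg_left ?_ Real.two_pi_pos.le
    refine (ENNReal.ofReal_le_ofReal_iff hK).1 ?_
    rw [ofReal_integral_eq_lintegral_ofReal (fh_int_sq k) (Eventually.of_forall fun ξ => by positivity)]
    refine le_trans ?_ h
    unfold Y V V2
    refine lintegral_mono fun ξ => ?_
    rw [ENNReal.ofReal_pow (norm_nonneg _), ofReal_norm, ← mul_add]
    refine (hk ξ).trans (le_mul_of_one_le_left zero_le ?_)
    rw [ENNReal.one_le_ofReal]
    exact one_le_pow₀ (by linarith [abs_nonneg ξ])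
  exact ⟨gen f fun ξ => le_self_add, gen g fun ξ => le_add_self⟩

lemma L1_bd {K : ℝ} (hK : 0 ≤ K) (f g : 𝓢(ℝ, ℂ)) (hf : ∫ x, ‖f x‖ ^ 2 ≤ K) (hg : ∫ x, ‖g x‖ ^ 2 ≤ K) :
    ∫ x, ‖sM f g x‖ ≤ K := by
  have : ∫ x, ‖sM f g x‖ ≤ ∫ x, (1/2) * (‖f x‖ ^ 2 + ‖g x‖ ^ 2) := by
    refine integral_mono (sM f g).integrable.norm (((sch_int_sq f).add (sch_int_sq g)).const_mul _) fun x => ?_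
    simp only [sM_apply, norm_mul]
    nlinarith [sq_nonneg (‖f x‖ - ‖g x‖)]
  rw [integral_const_mul, integral_add (sch_int_sq f) (sch_int_sq g)] at this
  linarith

lemma cv_bd {K : ℝ} (hK : 0 ≤ K) {p q f g : ℝ → ℂ} (mp : Measurable p) (mq : Measurable q) (h : Y p q ≤ ENNReal.ofReal K)
    (hf : ∀ ξ, ‖f ξ‖ₑ ≤ ‖p ξ‖ₑ + ‖q ξ‖ₑ) (hg : ∀ ξ, ‖g ξ‖ₑ ≤ ‖p ξ‖ₑ + ‖q ξ‖ₑ) (ξ : ℝ) :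
    ‖cv f g ξ‖ ≤ 2 * K / (1 + |ξ|) ^ 7 := by
  rw [le_div_iff₀ (by positivity)]
  set A : ℝ → ℝ≥0∞ := fun ξ => ENNReal.ofReal ((1 + |ξ|) ^ 7) * (‖p ξ‖ₑ + ‖q ξ‖ₑ) with hA
  have mA : Measurable A := by rw [hA]; fun_prop
  have h1 := Y_n2 hK h
  rw [← hA] at h1
  have h2 : ∫⁻ η, A η * A (ξ - η) ≤ ENNReal.ofReal (2 * K) := by
    refine (cs mA (by fun_prop : Measurable fun η => A (ξ - η))).trans ?_
    rw [n2_sub_left]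
    refine (mul_le_mul h1 h1 zero_le zero_le).trans (le_of_eq ?_)
    rw [← ENNReal.ofReal_mul (by positivity), Real.mul_self_sqrt (by positivity)]
  refine (ENNReal.ofReal_le_ofReal_iff (by positivity)).1 (le_trans ?_ h2)
  rw [ENNReal.ofReal_mul (norm_nonneg _), ofReal_norm, mul_comm]
  unfold cv
  refine (mul_le_mul_right (enorm_integral_le_lintegral_enorm _) _).trans ?_
  rw [← lintegral_const_mul' _ _ ENNReal.ofReal_ne_top]
  refine lintegral_mono fun η => ?_
  rw [enorm_mul]
  calc ENNReal.ofReal ((1 + |ξ|) ^ 7) * (‖f η‖ₑ * ‖g (ξ - η)‖ₑ)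
      ≤ (ENNReal.ofReal ((1 + |η|) ^ 7) * ENNReal.ofReal ((1 + |ξ - η|) ^ 7)) * ((‖p η‖ₑ + ‖q η‖ₑ) * (‖p (ξ - η)‖ₑ + ‖q (ξ - η)‖ₑ)) := by
        refine mul_le_mul ?_ (mul_le_mul (hf _) (hg _) zero_le zero_le) zero_le zero_le
        rw [← ENNReal.ofReal_mul (by positivity)]
        refine ENNReal.ofReal_le_ofReal ?_
        rw [← mul_pow]
        exact pow_le_pow_left₀ (by positivity) (br_tri ξ η) 7
    _ = _ := by rw [hA]; ring

end MB


namespace MB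
open scoped Topology FourierTransform SchwartzMap

lemma et_inv (a ξ t : ℝ) : et (-a) ξ t * et a ξ t = 1 := by
  unfold et; rw [← Complex.exp_add]
  convert Complex.exp_zero using 2
  push_cast; ring

lemma gen_sol {a ξ B α β : ℝ} {f n : ℝ → ℂ} (hαβ : α ≤ β)
    (hi : ∀ t1 ∈ Icc α β, ∀ t2 ∈ Icc α β, t1 ≤ t2 →
      et a ξ t2 * f t2 - et a ξ t1 * f t1 = ∫ t in t1..t2, et a ξ t * n t)
    (hB : ∀ t ∈ Icc α β, ‖n t‖ ≤ B) :
    (∀ t ∈ Icc α β, ‖f t‖ ≤ ‖f α‖ + (β - α) * B) ∧ ContinuousOn f (Icc α β) ∧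
      (ContinuousOn n (Icc α β) → ∀ t ∈ Ioo α β, HasDerivAt f (Complex.I * a * ξ ^ 3 * f t + n t) t) := by
  have hα : α ∈ Icc α β := ⟨le_rfl, hαβ⟩
  have hB0 : 0 ≤ B := (norm_nonneg _).trans (hB α hα)
  have bd : ∀ t1 ∈ Icc α β, ∀ t2 ∈ Icc α β, t1 ≤ t2 → ‖et a ξ t2 * f t2 - et a ξ t1 * f t1‖ ≤ B * |t2 - t1| := by
    intro t1 h1 t2 h2 h
    rw [hi t1 h1 t2 h2 h]
    refine intervalIntegral.norm_integral_le_of_norm_le_const fun t ht => ?_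
    rw [uIoc_of_le h] at ht
    rw [norm_mul, et_norm, one_mul]
    exact hB t ⟨h1.1.trans ht.1.le, ht.2.trans h2.2⟩
  have bd' : ∀ t1 ∈ Icc α β, ∀ t2 ∈ Icc α β, ‖et a ξ t1 * f t1 - et a ξ t2 * f t2‖ ≤ B * |t1 - t2| := by
    intro t1 h1 t2 h2
    rcases le_total t1 t2 with h | h
    · rw [norm_sub_rev, abs_sub_comm]; exact bd t1 h1 t2 h2 h
    · exact bd t2 h2 t1 h1 h
  have fe : f = fun t => et (-a) ξ t * (et a ξ t * f t) := by
    funext t; rw [← mul_assoc, et_inv, one_mul]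
  refine ⟨fun t ht => ?_, ?_, fun cn t ht => ?_⟩
  · have h := bd' t ht α hα
    have h2 := norm_le_norm_add_norm_sub' (et a ξ t * f t) (et a ξ α * f α)
    rw [norm_mul, norm_mul, et_norm, et_norm, one_mul, one_mul] at h2
    have : B * |t - α| ≤ (β - α) * B := by
      rw [abs_of_nonneg (by linarith [ht.1]), mul_comm]
      exact mul_le_mul_of_nonneg_right (by linarith [ht.2]) hB0
    linarith
  · rw [fe]
    refine (et_cont (-a) ξ).continuousOn.mul ?_
    have : LipschitzOnWith (Real.toNNReal B) (fun t => et a ξ t * f t) (Icc α β) := by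
      refine LipschitzOnWith.of_dist_le_mul fun x hx y hy => ?_
      rw [dist_eq_norm, Real.dist_eq, Real.coe_toNNReal _ hB0]
      exact bd' x hx y hy
    exact this.continuousOn
  · have tI : t ∈ Icc α β := ⟨ht.1.le, ht.2.le⟩
    have cm : ContinuousOn (fun t => et a ξ t * n t) (Icc α β) := (et_cont a ξ).continuousOn.mul cn
    have nb : Icc α β ∈ 𝓝 t := Icc_mem_nhds ht.1 ht.2
    have h1 : HasDerivAt (fun τ => ∫ t in α..τ, et a ξ t * n t) (et a ξ t * n t) t := by
      refine intervalIntegral.integral_hasDerivAt_right ?_ ?_ (cm.continuousAt nb)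
      · refine (cm.mono ?_).intervalIntegrable
        rw [uIcc_of_le ht.1.le]; exact Icc_subset_Icc_right ht.2.le
      · exact (cm.mono Ioo_subset_Icc_self).stronglyMeasurableAtFilter isOpen_Ioo t ht
    have h2 : HasDerivAt (fun τ => et a ξ τ * f τ) (et a ξ t * n t) t := by
      refine (h1.const_add (et a ξ α * f α)).congr_of_eventuallyEq ?_
      filter_upwards [nb] with τ hτ
      rw [← hi α hα τ hτ hτ.1]; ring
    have h3 := (et_deriv (-a) ξ t).mul h2
    rw [fe]
    convert! h3 using 1
    have e := et_inv a ξ t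
    push_cast
    linear_combination (Complex.I * a * ξ ^ 3 * f t) * e - (Complex.I * a * ξ ^ 3 * f t + n t) * e +  (Complex.I * a * ξ ^ 3 * f t) * e - (Complex.I * a * ξ ^ 3 * f t) * e

lemma sD_has (n : ℕ) (f : 𝓢(ℝ, ℂ)) (x : ℝ) : HasDerivAt (sD n f) (sD (n + 1) f x) x := by
  rw [sD_succ]; exact (sD n f).differentiableAt.hasDerivAt

lemma sch_lim (f : 𝓢(ℝ, ℂ)) : Tendsto f (cocompact ℝ) (𝓝 0) := zero_at_infty f

lemma int_bd {n K A : ℝ} {ξ : ℝ} (hn : n ≤ 2 * K / (1 + |ξ|) ^ 7) (hn0 : 0 ≤ n) (hK : 0 ≤ K) (hA : A ≤ |ξ| * n) :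
    A ≤ 2 * K / (1 + |ξ|) ^ 6 := by
  have h0 := abs_nonneg ξ
  calc A ≤ |ξ| * n := hA
    _ ≤ (1 + |ξ|) * (2 * K / (1 + |ξ|) ^ 7) := mul_le_mul (by linarith) hn hn0 (by positivity)
    _ = _ := by field_simp

lemma cv_ct {α β C : ℝ} {f g : ℝ → ℝ → ℂ} (hC : 0 ≤ C)
    (mf : ∀ t ∈ Icc α β, Measurable (f t)) (mg : ∀ t ∈ Icc α β, Measurable (g t))
    (hf : ∀ t ∈ Icc α β, ∀ ξ, ‖f t ξ‖ ≤ C / (1 + |ξ|) ^ 6) (hg : ∀ t ∈ Icc α β, ∀ ξ, ‖g t ξ‖ ≤ C / (1 + |ξ|) ^ 6)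
    (cf : ∀ ξ, ContinuousOn (fun t => f t ξ) (Icc α β)) (cg : ∀ ξ, ContinuousOn (fun t => g t ξ) (Icc α β)) (ξ : ℝ) :
    ContinuousOn (fun t => cv (f t) (g t) ξ) (Icc α β) := by
  unfold cv
  refine continuousOn_of_dominated (bound := fun η => C ^ 2 * (1 / (1 + |η|) ^ 2)) ?_ ?_ (int1.const_mul _) ?_
  · intro t ht
    have h1 := mf t ht
    have h2 := mg t ht
    exact (by fun_prop : Measurable fun η => f t η * g t (ξ - η)).aestronglyMeasurable
  · intro t ht
    refine Eventually.of_forall fun η => ?_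
    rw [norm_mul]
    have h0 := abs_nonneg η
    have h1 := abs_nonneg (ξ - η)
    calc ‖f t η‖ * ‖g t (ξ - η)‖ ≤ (C / (1 + |η|) ^ 6) * (C / (1 + |ξ - η|) ^ 6) :=
          mul_le_mul (hf t ht η) (hg t ht _) (norm_nonneg _) (by positivity)
      _ ≤ (C / (1 + |η|) ^ 2) * C := by
          refine mul_le_mul ?_ ?_ (by positivity) (by positivity)
          · exact div_le_div_of_nonneg_left hC (by positivity) (pow_le_pow_right₀ (by linarith) (by norm_num))
          · exact div_le_self hC (one_le_pow₀ (by linarith))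
      _ = _ := by ring
  · refine Eventually.of_forall fun η => ?_
    exact (cf η).mul (cg (ξ - η))

section
variable {a : ℝ} {U W : ℝ → 𝓢(ℝ, ℂ)}

lemma Sol.duhU (S : Sol a U W) {K t1 t2 : ℝ} (hK : 0 ≤ K) (h12 : t1 ≤ t2)
    (hY : ∀ t ∈ Icc t1 t2, Y (fh (U t)) (fh (W t)) ≤ ENNReal.ofReal K) (ξ : ℝ) :
    et 1 ξ t2 * fh (U t2) ξ - et 1 ξ t1 * fh (U t1) ξ = ∫ t in t1..t2, et 1 ξ t * nP (fh (W t)) ξ := by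
  obtain ⟨K1, hK1, hs⟩ := sup_bd hK
  have cU := S.cU; have cW := S.cW
  have dW : ∀ t x, HasDerivAt (W t) (sD 1 (W t) x) x := fun t x => sD_has 0 (W t) x
  have dU : ∀ t x, HasDerivAt (U t) (sD 1 (U t) x) x := fun t x => sD_has 0 (U t) x
  have H := duh (a := 1) (ξ := ξ) (K := K1 + K1 ^ 2 + 2 * Real.pi * K) h12 (w := fun t x => U t x)
    (wt := fun t x => -(((1:ℝ):ℂ) * sD 3 (U t) x) - W t x * sD 1 (W t) x)
    (w1 := fun t x => sD 1 (U t) x) (w2 := fun t x => sD 2 (U t) x) (w3 := fun t x => sD 3 (U t) x)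
    (N := fun t x => (1/2 : ℂ) * sM (W t) (W t) x) (N1 := fun t x => W t x * sD 1 (W t) x)
    (cU 0) (by
      have h0 : Continuous fun z : ℝ × ℝ => W z.1 z.2 := cW 0
      have h1 := cW 1
      have h3 := cU 3
      unfold Function.uncurry; fun_prop)
    (fun t => (sD 3 (U t)).continuous) (fun t => (sM (W t) (W t)).continuous.const_mul _)
    (fun t => (W t).continuous.mul (sD 1 (W t)).continuous) S.dU
    dU (fun t x => sD_has 1 (U t) x) (fun t x => sD_has 2 (U t) x)
    (fun t x => by
      have h := ((dW t x).mul (dW t x)).const_mul (1/2 : ℂ)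
      convert! h using 1
      ring)
    (fun t x => rfl)
    (fun t ht x => by
      have h0 := hs _ _ (hY t ht) 0 (by norm_num) x
      have h1 := hs _ _ (hY t ht) 1 (by norm_num) x
      have h2 := hs _ _ (hY t ht) 2 (by norm_num) x
      have hp : 0 ≤ 2 * Real.pi * K := by positivity
      have hq : 0 ≤ K1 ^ 2 := by positivity
      refine ⟨h0.1.trans (by linarith), h1.1.trans (by linarith), h2.1.trans (by linarith), ?_⟩
      have h0' : ‖W t x‖ ≤ K1 := h0.2
      rw [sM_apply, norm_mul, norm_mul]
      have : ‖W t x‖ * ‖W t x‖ ≤ K1 ^ 2 := by rw [sq]; exact mul_le_mul h0' h0' (norm_nonneg _) hK1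
      have h4 : ‖(1/2:ℂ)‖ = 1/2 := by norm_num
      rw [h4]; linarith)
    (fun t => (U t).integrable) (fun t => (sM (W t) (W t)).integrable.const_mul _)
    (fun t ht => by
      have h := L2_bd hK _ _ (hY t ht)
      have h2 := L1_bd (by positivity) _ _ h.2 h.2
      have h4 : ‖(1/2:ℂ)‖ = 1/2 := by norm_num
      simp_rw [norm_mul (1/2 : ℂ)]
      rw [integral_const_mul, h4]
      have hp : 0 ≤ 2 * Real.pi * K := by positivity
      have hq : 0 ≤ K1 ^ 2 := by positivity
      linarith)
    (fun t => ⟨sch_lim _, sch_lim _, sch_lim _, by simpa using (sch_lim (sM (W t) (W t))).const_mul (1/2 : ℂ)⟩)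
  have e : ∀ t, et 1 ξ t * nP (fh (W t)) ξ =
      (et 1 ξ t * (-(Complex.I * ξ) * FT1 (fun x => (1/2 : ℂ) * sM (W t) (W t) x) ξ)) * (1 / (2 * Real.pi)) := by
    intro t
    unfold nP
    rw [← fh_mul (W t) (W t) (sM (W t) (W t)) (fun x => rfl)]
    have : FT1 (fun x => (1/2 : ℂ) * sM (W t) (W t) x) ξ = (1/2) * FT1 (sM (W t) (W t)) ξ := by
      unfold FT1
      rw [← integral_const_mul]
      congr 1; funext x; ring
    rw [this]; unfold fh; ring
  simp_rw [e]
  rw [intervalIntegral.integral_mul_const, ← H]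
  unfold fh; ring

lemma Sol.duhW (S : Sol a U W) {K t1 t2 : ℝ} (hK : 0 ≤ K) (h12 : t1 ≤ t2)
    (hY : ∀ t ∈ Icc t1 t2, Y (fh (U t)) (fh (W t)) ≤ ENNReal.ofReal K) (ξ : ℝ) :
    et a ξ t2 * fh (W t2) ξ - et a ξ t1 * fh (W t1) ξ = ∫ t in t1..t2, et a ξ t * nQ (fh (U t)) (fh (W t)) ξ := by
  obtain ⟨K1, hK1, hs⟩ := sup_bd hK
  have cU := S.cU; have cW := S.cW
  have dW : ∀ t x, HasDerivAt (W t) (sD 1 (W t) x) x := fun t x => sD_has 0 (W t) x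
  have dU : ∀ t x, HasDerivAt (U t) (sD 1 (U t) x) x := fun t x => sD_has 0 (U t) x
  have H := duh (a := a) (ξ := ξ) (K := K1 + K1 ^ 2 + 2 * Real.pi * K) h12 (w := fun t x => W t x)
    (wt := fun t x => -((a:ℂ) * sD 3 (W t) x) - (sD 1 (U t) x * W t x + U t x * sD 1 (W t) x))
    (w1 := fun t x => sD 1 (W t) x) (w2 := fun t x => sD 2 (W t) x) (w3 := fun t x => sD 3 (W t) x)
    (N := fun t x => sM (U t) (W t) x) (N1 := fun t x => sD 1 (U t) x * W t x + U t x * sD 1 (W t) x)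
    (cW 0) (by
      have h0 : Continuous fun z : ℝ × ℝ => W z.1 z.2 := cW 0
      have h1 := cW 1
      have h2 : Continuous fun z : ℝ × ℝ => U z.1 z.2 := cU 0
      have h4 := cU 1
      have h3 := cW 3
      unfold Function.uncurry; fun_prop)
    (fun t => (sD 3 (W t)).continuous) (fun t => (sM (U t) (W t)).continuous)
    (fun t => ((sD 1 (U t)).continuous.mul (W t).continuous).add ((U t).continuous.mul (sD 1 (W t)).continuous)) S.dW
    dW (fun t x => sD_has 1 (W t) x) (fun t x => sD_has 2 (W t) x)
    (fun t x => (dU t x).mul (dW t x))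
    (fun t x => rfl)
    (fun t ht x => by
      have h0 := hs _ _ (hY t ht) 0 (by norm_num) x
      have h1 := hs _ _ (hY t ht) 1 (by norm_num) x
      have h2 := hs _ _ (hY t ht) 2 (by norm_num) x
      have hp : 0 ≤ 2 * Real.pi * K := by positivity
      have hq : 0 ≤ K1 ^ 2 := by positivity
      refine ⟨h0.2.trans (by linarith), h1.2.trans (by linarith), h2.2.trans (by linarith), ?_⟩
      have h0' : ‖W t x‖ ≤ K1 := h0.2
      have h0'' : ‖U t x‖ ≤ K1 := h0.1
      rw [sM_apply, norm_mul]
      have : ‖U t x‖ * ‖W t x‖ ≤ K1 ^ 2 := by rw [sq]; exact mul_le_mul h0'' h0' (norm_nonneg _) hK1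
      linarith)
    (fun t => (W t).integrable) (fun t => (sM (U t) (W t)).integrable)
    (fun t ht => by
      have h := L2_bd hK _ _ (hY t ht)
      have h2 := L1_bd (by positivity) _ _ h.1 h.2
      have hq : 0 ≤ K1 ^ 2 := by positivity
      linarith)
    (fun t => ⟨sch_lim _, sch_lim _, sch_lim _, sch_lim _⟩)
  have e : ∀ t, et a ξ t * nQ (fh (U t)) (fh (W t)) ξ =
      (et a ξ t * (-(Complex.I * ξ) * FT1 (fun x => sM (U t) (W t) x) ξ)) * (1 / (2 * Real.pi)) := by
    intro t
    unfold nQ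
    rw [← fh_mul (U t) (W t) (sM (U t) (W t)) (fun x => rfl)]
    unfold fh; ring
  simp_rw [e]
  rw [intervalIntegral.integral_mul_const, ← H]
  unfold fh; ring

lemma FS_of_bdd (S : Sol a U W) {K α β : ℝ} (hK : 0 ≤ K) (hαβ : α ≤ β)
    (hY : ∀ t ∈ Icc α β, Y (fh (U t)) (fh (W t)) ≤ ENNReal.ofReal K) :
    FS a α β (fun t => fh (U t)) (fun t => fh (W t)) := by
  have m : ∀ f : 𝓢(ℝ, ℂ), Measurable (fh f) := fun f => (fh_cont f).measurable
  have nPb : ∀ t ∈ Icc α β, ∀ ξ, ‖nP (fh (W t)) ξ‖ ≤ 2 * K / (1 + |ξ|) ^ 6 := by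
    intro t ht ξ
    refine int_bd (cv_bd hK (m (U t)) (m (W t)) (hY t ht) (fun _ => le_add_self) (fun _ => le_add_self) ξ) (norm_nonneg _) hK ?_
    unfold nP
    rw [norm_mul, norm_neg]
    refine mul_le_mul_of_nonneg_right ?_ (norm_nonneg _)
    have := abs_nonneg ξ
    simp
  have nQb : ∀ t ∈ Icc α β, ∀ ξ, ‖nQ (fh (U t)) (fh (W t)) ξ‖ ≤ 2 * K / (1 + |ξ|) ^ 6 := by
    intro t ht ξ
    refine int_bd (cv_bd hK (m (U t)) (m (W t)) (hY t ht) (fun _ => le_self_add) (fun _ => le_add_self) ξ) (norm_nonneg _) hK ?_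
    unfold nQ
    rw [norm_mul, norm_neg]
    refine mul_le_mul_of_nonneg_right ?_ (norm_nonneg _)
    simp
  have gU := fun ξ => gen_sol (a := 1) (ξ := ξ) (f := fun t => fh (U t) ξ) (n := fun t => nP (fh (W t)) ξ) hαβ
    (fun t1 h1 t2 h2 h12 => S.duhU hK h12 (fun t ht => hY t (Icc_subset_Icc h1.1 h2.2 ht)) ξ) (fun t ht => nPb t ht ξ)
  have gW := fun ξ => gen_sol (a := a) (ξ := ξ) (f := fun t => fh (W t) ξ) (n := fun t => nQ (fh (U t)) (fh (W t)) ξ) hαβ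
    (fun t1 h1 t2 h2 h12 => S.duhW hK h12 (fun t ht => hY t (Icc_subset_Icc h1.1 h2.2 ht)) ξ) (fun t ht => nQb t ht ξ)
  obtain ⟨C1, hC1, hd1⟩ := fh_dec (U α) 6
  obtain ⟨C2, hC2, hd2⟩ := fh_dec (W α) 6
  have hβα : 0 ≤ β - α := by linarith
  have hCn : 0 ≤ C1 + C2 + (β - α) * (2 * K) := by positivity
  have dec : ∀ t ∈ Icc α β, ∀ ξ, ‖fh (U t) ξ‖ ≤ (C1 + C2 + (β - α) * (2 * K)) / (1 + |ξ|) ^ 6 ∧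
      ‖fh (W t) ξ‖ ≤ (C1 + C2 + (β - α) * (2 * K)) / (1 + |ξ|) ^ 6 := by
    intro t ht ξ
    have h1 := (gU ξ).1 t ht
    have h2 := (gW ξ).1 t ht
    have h3 := hd1 ξ
    have h4 := hd2 ξ
    rw [add_div, add_div, mul_div_assoc]
    have h5 : 0 ≤ C1 / (1 + |ξ|) ^ 6 := by positivity
    have h6 : 0 ≤ C2 / (1 + |ξ|) ^ 6 := by positivity
    constructor <;> linarith
  have cP : ∀ ξ, ContinuousOn (fun t => nP (fh (W t)) ξ) (Icc α β) := fun ξ =>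
    (cv_ct hCn (fun t _ => m (W t)) (fun t _ => m (W t)) (fun t ht ξ => (dec t ht ξ).2) (fun t ht ξ => (dec t ht ξ).2)
      (fun ξ => (gW ξ).2.1) (fun ξ => (gW ξ).2.1) ξ).const_smul (-(Complex.I * ξ / 2))
  have cQ : ∀ ξ, ContinuousOn (fun t => nQ (fh (U t)) (fh (W t)) ξ) (Icc α β) := fun ξ =>
    (cv_ct hCn (fun t _ => m (U t)) (fun t _ => m (W t)) (fun t ht ξ => (dec t ht ξ).1) (fun t ht ξ => (dec t ht ξ).2)
      (fun ξ => (gU ξ).2.1) (fun ξ => (gW ξ).2.1) ξ).const_smul (-(Complex.I * ξ))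
  exact ⟨fun t _ => m _, fun t _ => m _, fun t _ => S.rU t, fun t _ => S.rW t, ⟨_, hCn, dec⟩,
    fun ξ => (gU ξ).2.1, fun ξ => (gW ξ).2.1, fun ξ => (gU ξ).2.2 (cP ξ), fun ξ => (gW ξ).2.2 (cQ ξ)⟩
end
end MB


namespace MB
open scoped Topology FourierTransform SchwartzMap

section
variable {a : ℝ} {U W : ℝ → 𝓢(ℝ, ℂ)}

/-- physical-space energy -/
noncomputable def Zf (f g : 𝓢(ℝ, ℂ)) : ℝ≥0∞ :=
  ∫⁻ x, (‖f x‖ₑ ^ 2 + ‖sD 7 f x‖ₑ ^ 2 + ‖g x‖ₑ ^ 2 + ‖sD 7 g x‖ₑ ^ 2)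

lemma Zf_eq (f g : 𝓢(ℝ, ℂ)) : Zf f g =
    (∫⁻ x, ‖f x‖ₑ ^ 2) + (∫⁻ x, ‖sD 7 f x‖ₑ ^ 2) + (∫⁻ x, ‖g x‖ₑ ^ 2) + (∫⁻ x, ‖sD 7 g x‖ₑ ^ 2) := by
  have m : ∀ h : 𝓢(ℝ, ℂ), Measurable (fun x => ‖h x‖ₑ ^ 2) := fun h => by
    have := h.continuous.measurable
    fun_prop
  unfold Zf
  rw [lintegral_add_right _ (m _), lintegral_add_right _ (m _), lintegral_add_right _ (m _)]

lemma sq_fin (f : 𝓢(ℝ, ℂ)) : ∫⁻ x, ‖f x‖ₑ ^ 2 ≠ ⊤ := by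
  have h := (sch_int_sq f).hasFiniteIntegral
  unfold HasFiniteIntegral at h
  refine ne_of_lt (lt_of_le_of_lt (lintegral_mono fun x => ?_) h)
  rw [enorm_pow, enorm_norm]

lemma Zf_fin (f g : 𝓢(ℝ, ℂ)) : Zf f g ≠ ⊤ := by
  rw [Zf_eq]
  simp [sq_fin]

lemma w14 (x : ℝ) : (1 + |x|) ^ 14 ≤ 2 ^ 14 * (1 + (|x| ^ 7) ^ 2) := by
  have h0 := abs_nonneg x
  rcases le_total |x| 1 with h | h
  · calc (1 + |x|) ^ 14 ≤ 2 ^ 14 := by gcongr; linarith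
      _ ≤ _ := by nlinarith [sq_nonneg (|x| ^ 7)]
  · calc (1 + |x|) ^ 14 ≤ (2 * |x|) ^ 14 := by gcongr; linarith
      _ = 2 ^ 14 * (|x| ^ 7) ^ 2 := by ring
      _ ≤ _ := by nlinarith [sq_nonneg (|x| ^ 7)]

lemma Y_le_Z (f g : 𝓢(ℝ, ℂ)) : Y (fh f) (fh g) ≤ ENNReal.ofReal (2 ^ 14) * Zf f g := by
  have m : ∀ h : 𝓢(ℝ, ℂ), Measurable (fun x => ‖fh h x‖ₑ ^ 2) := fun h => by
    have := (fh_cont h).measurable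
    fun_prop
  have h1 : ∫⁻ ξ, (‖fh f ξ‖ₑ ^ 2 + ‖fh (sD 7 f) ξ‖ₑ ^ 2 + ‖fh g ξ‖ₑ ^ 2 + ‖fh (sD 7 g) ξ‖ₑ ^ 2) ≤ Zf f g := by
    rw [lintegral_add_right _ (m _), lintegral_add_right _ (m _), lintegral_add_right _ (m _), Zf_eq,
      fh_planch_l f, fh_planch_l g, fh_planch_l (sD 7 f), fh_planch_l (sD 7 g)]
    have hp : 1 ≤ ENNReal.ofReal (2 * Real.pi) := by
      rw [ENNReal.one_le_ofReal]; linarith [Real.pi_gt_three]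
    have hx : ∀ x : ℝ≥0∞, x ≤ ENNReal.ofReal (2 * Real.pi) * x := fun x => le_mul_of_one_le_left zero_le hp
    gcongr <;> exact hx _
  refine le_trans ?_ (mul_le_mul_right h1 _)
  rw [← lintegral_const_mul' _ _ ENNReal.ofReal_ne_top]
  unfold Y V V2
  refine lintegral_mono fun ξ => ?_
  have e : ∀ h : 𝓢(ℝ, ℂ), ‖fh (sD 7 h) ξ‖ₑ ^ 2 = ENNReal.ofReal ((|ξ| ^ 7) ^ 2) * ‖fh h ξ‖ₑ ^ 2 := by
    intro h
    rw [fh_sD, enorm_mul, mul_pow]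
    congr 1
    rw [← ofReal_norm, ENNReal.ofReal_pow (by positivity)]
    simp
  have k : ENNReal.ofReal ((1 + |ξ|) ^ 14) ≤ ENNReal.ofReal (2 ^ 14) * (1 + ENNReal.ofReal ((|ξ| ^ 7) ^ 2)) := by
    rw [← ENNReal.ofReal_one, ← ENNReal.ofReal_add (by norm_num) (by positivity), ← ENNReal.ofReal_mul (by norm_num)]
    exact ENNReal.ofReal_le_ofReal (w14 ξ)
  rw [e, e]
  calc _ = ENNReal.ofReal ((1 + |ξ|) ^ 14) * (‖fh f ξ‖ₑ ^ 2 + ‖fh g ξ‖ₑ ^ 2) := by ring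
    _ ≤ ENNReal.ofReal (2 ^ 14) * (1 + ENNReal.ofReal ((|ξ| ^ 7) ^ 2)) * (‖fh f ξ‖ₑ ^ 2 + ‖fh g ξ‖ₑ ^ 2) := mul_le_mul_left k _
    _ = _ := by ring

lemma Z_closed (S : Sol a U W) (n : ℝ≥0∞) : IsClosed {t | Zf (U t) (W t) ≤ n} := by
  refine IsSeqClosed.isClosed fun t s ht hs => ?_
  have ev : ∀ k : ℝ → 𝓢(ℝ, ℂ), (∀ x, Continuous fun τ => k τ x) → ∀ x, Tendsto (fun i => ‖k (t i) x‖ₑ ^ 2) atTop (𝓝 (‖k s x‖ₑ ^ 2)) := by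
    intro k hk x
    exact (((ENNReal.continuous_pow 2).comp (hk x).enorm).tendsto s).comp hs
  have cU : ∀ n x, Continuous fun τ => sD n (U τ) x := fun n x => (S.cU n).comp (by fun_prop : Continuous fun τ : ℝ => (τ, x))
  have cW : ∀ n x, Continuous fun τ => sD n (W τ) x := fun n x => (S.cW n).comp (by fun_prop : Continuous fun τ : ℝ => (τ, x))
  have m : ∀ h : 𝓢(ℝ, ℂ), Measurable (fun x => ‖h x‖ₑ ^ 2) := fun h => by
    have := h.continuous.measurable
    fun_prop
  have T : ∀ x, Tendsto (fun i => ‖U (t i) x‖ₑ ^ 2 + ‖sD 7 (U (t i)) x‖ₑ ^ 2 + ‖W (t i) x‖ₑ ^ 2 + ‖sD 7 (W (t i)) x‖ₑ ^ 2) atTop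
      (𝓝 (‖U s x‖ₑ ^ 2 + ‖sD 7 (U s) x‖ₑ ^ 2 + ‖W s x‖ₑ ^ 2 + ‖sD 7 (W s) x‖ₑ ^ 2)) := fun x =>
    (((ev U (cU 0) x).add (ev (fun t => sD 7 (U t)) (cU 7) x)).add (ev W (cW 0) x)).add (ev (fun t => sD 7 (W t)) (cW 7) x)
  change Zf (U s) (W s) ≤ n
  unfold Zf
  simp_rw [fun x => (T x).liminf_eq.symm]
  refine (lintegral_liminf_le fun i => ?_).trans ?_
  · exact (((m _).add (m _)).add (m _)).add (m _)
  · refine liminf_le_of_le (by isBoundedDefault) fun b hb => ?_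
    obtain ⟨i, hi⟩ := hb.exists
    exact hi.trans (ht i)

/-- local boundedness of the regularity functional -/
def LB (U W : ℝ → 𝓢(ℝ, ℂ)) (s : ℝ) : Prop :=
  ∃ K : ℝ, 0 ≤ K ∧ ∀ᶠ r in 𝓝 s, Y (fh (U r)) (fh (W r)) ≤ ENNReal.ofReal K

lemma LB_cpt {k : Set ℝ} (hk : IsCompact k) (h : ∀ s ∈ k, LB U W s) :
    ∃ K : ℝ, 0 ≤ K ∧ ∀ s ∈ k, Y (fh (U s)) (fh (W s)) ≤ ENNReal.ofReal K := by
  refine hk.induction_on (p := fun k => ∃ K : ℝ, 0 ≤ K ∧ ∀ s ∈ k, Y (fh (U s)) (fh (W s)) ≤ ENNReal.ofReal K) ?_ ?_ ?_ ?_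
  · exact ⟨0, le_rfl, by simp⟩
  · rintro s t hst ⟨K, hK, h⟩
    exact ⟨K, hK, fun x hx => h x (hst hx)⟩
  · rintro s t ⟨K, hK, h⟩ ⟨K', hK', h'⟩
    refine ⟨max K K', le_max_of_le_left hK, fun x hx => ?_⟩
    rcases hx with hx | hx
    · exact (h x hx).trans (ENNReal.ofReal_le_ofReal (le_max_left _ _))
    · exact (h' x hx).trans (ENNReal.ofReal_le_ofReal (le_max_right _ _))
  · intro x hx
    obtain ⟨K, hK, h⟩ := h x hx
    exact ⟨_, mem_nhdsWithin_of_mem_nhds h, K, hK, fun s hs => hs⟩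

lemma gap (ha : a < 0 ∨ a = 1 ∨ 4 < a) (S : Sol a U W) {M : ℝ} (hM : 0 < M) (T : ℝ) (hT : 0 ≤ T) :
    ∃ B : ℝ, 0 ≤ B ∧ ∀ α t, Y (fh (U α)) (fh (W α)) ≤ ENNReal.ofReal M → |t - α| ≤ T →
      (∀ s ∈ uIcc α t, s ≠ α → LB U W s) → Y (fh (U t)) (fh (W t)) ≤ ENNReal.ofReal B := by
  obtain ⟨B, hB, hP⟩ := propPoly ha hM T hT
  refine ⟨max B M, le_max_of_le_left hB, fun α t hα hd loc => ?_⟩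
  rcases eq_or_ne t α with rfl | hne
  · exact hα.trans (ENNReal.ofReal_le_ofReal (le_max_right _ _))
  obtain ⟨K, hK, hKt⟩ := LB_cpt (k := {t}) isCompact_singleton (by
    rintro s rfl; exact loc s right_mem_uIcc hne)
  obtain ⟨B', hB', hP'⟩ := propPoly ha (by linarith : 0 < K + 1) T hT
  have b1 : ∀ s ∈ uIcc α t, s ≠ α → Y (fh (U s)) (fh (W s)) ≤ ENNReal.ofReal B' := by
    intro s hs hsα
    obtain ⟨L, hL, hLs⟩ := LB_cpt (U := U) (W := W) (k := uIcc s t) isCompact_uIcc (by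
      intro r hr
      refine loc r (uIcc_subset_uIcc hs right_mem_uIcc hr) ?_
      rintro rfl
      apply hsα
      rw [mem_uIcc] at hs hr
      rcases hs with hs | hs <;> rcases hr with hr | hr
      · linarith [hs.1, hr.1]
      · exact absurd (le_antisymm hr.1 (hs.1.trans hs.2)) hne
      · exact absurd (le_antisymm (hs.1.trans hs.2) hr.2) hne
      · linarith [hs.2, hr.2])
    have F := FS_of_bdd S hL min_le_max hLs
    refine hP' _ _ _ _ F t ⟨min_le_right _ _, le_max_right _ _⟩ ((hKt t rfl).trans (ENNReal.ofReal_le_ofReal (by linarith))) s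
      ⟨min_le_left _ _, le_max_left _ _⟩ ?_
    refine le_trans ?_ hd
    have := abs_sub_left_of_mem_uIcc hs
    rw [abs_sub_comm]
    exact abs_sub_right_of_mem_uIcc hs
  have F := FS_of_bdd S (K := max B' M) (le_max_of_le_left hB') (min_le_max (a := α) (b := t)) (fun s hs => by
    rcases eq_or_ne s α with rfl | h
    · exact hα.trans (ENNReal.ofReal_le_ofReal (le_max_right _ _))
    · exact (b1 s hs h).trans (ENNReal.ofReal_le_ofReal (le_max_left _ _)))
  exact (hP _ _ _ _ F α ⟨min_le_left _ _, le_max_left _ _⟩ hα t ⟨min_le_right _ _, le_max_right _ _⟩ hd).trans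
    (ENNReal.ofReal_le_ofReal (le_max_left _ _))

lemma all_LB (ha : a < 0 ∨ a = 1 ∨ 4 < a) (S : Sol a U W) (s : ℝ) : LB U W s := by
  by_contra hs
  set P : Set ℝ := {s | ¬ LB U W s} with hPd
  have Pc : IsClosed P := by
    rw [← isOpen_compl_iff, isOpen_iff_mem_nhds]
    intro t ht
    have ht' : LB U W t := not_not.1 ht
    obtain ⟨K, hK, h⟩ := ht'
    filter_upwards [h.eventually_nhds] with r hr
    exact not_not.2 ⟨K, hK, hr⟩
  have : CompleteSpace P := Pc.completeSpace_coe
  have : Nonempty P := ⟨⟨s, hs⟩⟩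
  obtain ⟨n, ⟨ts, hts⟩⟩ := nonempty_interior_of_iUnion_of_closed (X := P)
    (f := fun n : ℕ => {t : P | Zf (U t) (W t) ≤ n})
    (fun n => (Z_closed S n).preimage continuous_subtype_val) (by
      refine eq_univ_of_forall fun t => mem_iUnion.2 ?_
      obtain ⟨n, hn⟩ := ENNReal.exists_nat_gt (Zf_fin (U t) (W t))
      exact ⟨n, hn.le⟩)
  rw [mem_interior_iff_mem_nhds, Metric.mem_nhds_iff] at hts
  obtain ⟨δ, hδ, hb⟩ := hts
  have hPb : ∀ r ∈ P, |r - ts| < δ → Y (fh (U r)) (fh (W r)) ≤ ENNReal.ofReal (2 ^ 14 * n + 1) := by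
    intro r hr hd
    have h0 : (⟨r, hr⟩ : P) ∈ Metric.ball ts δ := by
      rw [Metric.mem_ball, Subtype.dist_eq, Real.dist_eq]; exact hd
    have h1 : Zf (U r) (W r) ≤ n := by
      have h2 := hb h0
      exact h2
    refine (Y_le_Z _ _).trans ((mul_le_mul_right h1 _).trans ?_)
    rw [← ENNReal.ofReal_natCast, ← ENNReal.ofReal_mul (by norm_num)]
    exact ENNReal.ofReal_le_ofReal (by linarith)
  obtain ⟨B, hB, hg⟩ := gap ha S (by positivity : (0:ℝ) < 2 ^ 14 * n + 1) δ hδ.le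
  refine ts.2 ⟨B, hB, ?_⟩
  filter_upwards [Metric.ball_mem_nhds (ts : ℝ) hδ] with t ht
  rw [Metric.mem_ball, Real.dist_eq] at ht
  obtain ⟨α, hα, hmin⟩ := ((isCompact_uIcc (a := (ts:ℝ)) (b := t)).inter_left Pc).exists_isMinOn ⟨ts, ts.2, left_mem_uIcc⟩
    (f := fun r => |t - r|) (by fun_prop)
  have hαd : |α - ts| ≤ |t - ts| := abs_sub_left_of_mem_uIcc hα.2
  have htα : |t - α| ≤ |t - ts| := abs_sub_right_of_mem_uIcc hα.2
  refine hg α t (hPb α hα.1 (by linarith)) (by linarith) fun r hr hne => ?_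
  by_contra hrP
  have h1 : |t - α| ≤ |t - r| := hmin (show r ∈ P ∩ uIcc (ts:ℝ) t from ⟨hrP, uIcc_subset_uIcc hα.2 right_mem_uIcc hr⟩)
  apply hne
  rw [mem_uIcc] at hr
  rcases hr with hr | hr
  · rw [abs_of_nonneg (by linarith), abs_of_nonneg (by linarith)] at h1; linarith
  · rw [abs_of_nonpos (by linarith), abs_of_nonpos (by linarith)] at h1; linarith

theorem FS_all (ha : a < 0 ∨ a = 1 ∨ 4 < a) (S : Sol a U W) (α β : ℝ) (h : α ≤ β) :
    FS a α β (fun t => fh (U t)) (fun t => fh (W t)) := by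
  obtain ⟨K, hK, hb⟩ := LB_cpt (U := U) (W := W) (k := Icc α β) isCompact_Icc (fun s _ => all_LB ha S s)
  exact FS_of_bdd S hK h hb
end
end MB


namespace MB
open scoped Topology FourierTransform SchwartzMap

lemma pow_exp (r σ : ℝ) (hσ : 0 < σ) : ∃ C : ℝ, 0 ≤ C ∧ ∀ x : ℝ, (1 + |x|) ^ r ≤ C * Real.exp (σ * |x|) := by
  obtain ⟨n, hn⟩ := exists_nat_ge r
  refine ⟨n.factorial * Real.exp σ / σ ^ n, by positivity, fun x => ?_⟩
  have h0 := abs_nonneg x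
  have h1 : (1 + |x|) ^ r ≤ (1 + |x|) ^ n := by
    rw [← Real.rpow_natCast]
    exact Real.rpow_le_rpow_of_exponent_le (by linarith) hn
  have h2 := Real.pow_div_factorial_le_exp (σ * (1 + |x|)) (by positivity) n
  rw [mul_pow, div_le_iff₀ (by positivity), mul_add, mul_one, Real.exp_add] at h2
  refine h1.trans ?_
  rw [div_mul_eq_mul_div, le_div_iff₀ (by positivity)]
  linarith

/-- the spatial derivatives are jointly smooth -/
lemma joint_smooth {u : ℝ → ℝ → ℝ} (hu : ContDiff ℝ (⊤ : ℕ∞) (fun p : ℝ × ℝ => u p.1 p.2)) (n : ℕ) :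
    ContDiff ℝ (⊤ : ℕ∞) (fun p : ℝ × ℝ => iteratedDeriv n (u p.1) p.2) := by
  induction n with
  | zero => simpa using hu
  | succ n ih =>
    have h : (fun p : ℝ × ℝ => iteratedDeriv (n + 1) (u p.1) p.2) =
        fun p => fderiv ℝ (fun p : ℝ × ℝ => iteratedDeriv n (u p.1) p.2) p (0, 1) := by
      funext p
      rw [iteratedDeriv_succ]
      have h1 := (ih.differentiable (by simp) p).hasFDerivAt
      have h2 : HasDerivAt (fun y : ℝ => (p.1, y)) ((0:ℝ), (1:ℝ)) p.2 := (hasDerivAt_const _ _).prodMk (hasDerivAt_id _)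
      exact (h1.comp_hasDerivAt (x := p.2) (f := fun y : ℝ => (p.1, y)) h2).deriv
    rw [h]
    exact (ih.fderiv_right (m := (⊤ : ℕ∞)) (by simp)).clm_apply contDiff_const

lemma sD_real {f : 𝓢(ℝ, ℂ)} {u : ℝ → ℝ} (hu : ContDiff ℝ (⊤ : ℕ∞) u) (h : ∀ x, f x = (u x : ℂ)) (n : ℕ) (x : ℝ) :
    sD n f x = ((iteratedDeriv n u x : ℝ) : ℂ) := by
  induction n generalizing x with
  | zero => rw [iteratedDeriv_zero]; exact h x
  | succ n ih =>
    rw [sD_succ, iteratedDeriv_succ]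
    have e : ⇑(sD n f) = fun x => ((iteratedDeriv n u x : ℝ) : ℂ) := funext ih
    rw [e]
    have hd : DifferentiableAt ℝ (iteratedDeriv n u) x := (hu.differentiable_iteratedDeriv n (by exact_mod_cast ENat.natCast_lt_top n)) x
    exact hd.hasDerivAt.ofReal_comp.deriv

lemma FT1_fh (f : ℝ → ℂ) (ξ : ℝ) : ‖FT1 f ξ‖ = 2 * Real.pi * ‖fh f ξ‖ := by
  unfold fh
  have := Real.pi_pos
  rw [norm_div]
  have e : ‖(2 * Real.pi : ℂ)‖ = 2 * Real.pi := by
    rw [norm_mul, Complex.norm_real, Real.norm_eq_abs, abs_of_pos this]; norm_num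
  rw [e]; field_simp

lemma gev_int {σ s : ℝ} {f : ℝ → ℂ} : gevreyNorm σ s f ≠ ⊤ ↔
    ∫⁻ ξ : ℝ, ENNReal.ofReal (Real.exp (2 * σ * |ξ|) * (1 + |ξ|) ^ (2 * s)) * ‖fh f ξ‖ₑ ^ 2 ≠ ⊤ := by
  unfold gevreyNorm
  have e : ∀ ξ, ENNReal.ofReal (Real.exp (2 * σ * |ξ|) * (1 + |ξ|) ^ (2 * s) * ‖FT1 f ξ‖ ^ 2) =
      ENNReal.ofReal ((2 * Real.pi) ^ 2) * (ENNReal.ofReal (Real.exp (2 * σ * |ξ|) * (1 + |ξ|) ^ (2 * s)) * ‖fh f ξ‖ₑ ^ 2) := by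
    intro ξ
    rw [FT1_fh, ← ofReal_norm, ← ENNReal.ofReal_pow (norm_nonneg _), ← ENNReal.ofReal_mul (by positivity), ← ENNReal.ofReal_mul (by positivity)]
    congr 1; ring
  simp_rw [e]
  rw [lintegral_const_mul' _ _ ENNReal.ofReal_ne_top]
  have hp := Real.pi_pos
  have h0 : ENNReal.ofReal ((2 * Real.pi) ^ 2) ≠ 0 := by
    rw [Ne, ENNReal.ofReal_eq_zero, not_le]; positivity
  rw [Ne, Ne, ENNReal.rpow_eq_top_iff_of_pos (by norm_num), ENNReal.mul_eq_top]
  simp [h0]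

lemma int_cmp {θ θ' : ℝ → ℝ} {C : ℝ} {f : ℝ → ℂ} (hC : 0 ≤ C) (h : ∀ x, θ x ≤ C * θ' x)
    (hf : ∫⁻ ξ, ENNReal.ofReal (θ' ξ) * ‖f ξ‖ₑ ^ 2 ≠ ⊤) : ∫⁻ ξ, ENNReal.ofReal (θ ξ) * ‖f ξ‖ₑ ^ 2 ≠ ⊤ := by
  refine ne_of_lt (lt_of_le_of_lt (b := ENNReal.ofReal C * ∫⁻ ξ, ENNReal.ofReal (θ' ξ) * ‖f ξ‖ₑ ^ 2) ?_
    (ENNReal.mul_lt_top ENNReal.ofReal_lt_top hf.lt_top))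
  rw [← lintegral_const_mul' _ _ ENNReal.ofReal_ne_top]
  refine lintegral_mono fun ξ => ?_
  rw [← mul_assoc, ← ENNReal.ofReal_mul hC]
  exact mul_le_mul_left (ENNReal.ofReal_le_ofReal (h ξ)) _

lemma final {a : ℝ} (ha : a < 0 ∨ a = 1 ∨ 4 < a) {U W : ℝ → 𝓢(ℝ, ℂ)} (S : Sol a U W) {σ₀ s : ℝ} (hσ₀ : 0 < σ₀)
    (hu0 : gevreyNorm σ₀ s (U 0) ≠ ⊤) (hv0 : gevreyNorm σ₀ s (W 0) ≠ ⊤) :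
    ∀ ε : ℝ, 0 < ε → ∃ c : ℝ, 0 < c ∧
      ∀ t : ℝ,
        gevreyNorm (c * (1 + |t|) ^ (-(4/3 : ℝ) - ε)) s (U t) ≠ ⊤ ∧
        gevreyNorm (c * (1 + |t|) ^ (-(4/3 : ℝ) - ε)) s (W t) ≠ ⊤ := by
  intro ε hε
  obtain ⟨C0, hC0, hw0⟩ := pow_exp (2 - 2 * s) σ₀ hσ₀
  have hθ : ∀ x : ℝ, (1 + x ^ 2) * Real.exp (σ₀ / 2 * |x|) ^ 2 ≤ C0 * (Real.exp (2 * σ₀ * |x|) * (1 + |x|) ^ (2 * s)) := by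
    intro x
    have h0 := abs_nonneg x
    have hp : 0 < 1 + |x| := by linarith
    have h1 : 1 + x ^ 2 ≤ (1 + |x|) ^ (2:ℝ) := by
      rw [Real.rpow_two]; nlinarith [sq_abs x]
    have h2 : (1 + |x|) ^ (2:ℝ) = (1 + |x|) ^ (2 - 2 * s) * (1 + |x|) ^ (2 * s) := by
      rw [← Real.rpow_add hp]; congr 1; ring
    have h3 : Real.exp (σ₀ / 2 * |x|) ^ 2 = Real.exp (σ₀ * |x|) := by
      rw [← Real.exp_nat_mul]; congr 1; push_cast; ring
    have h4 : Real.exp (2 * σ₀ * |x|) = Real.exp (σ₀ * |x|) * Real.exp (σ₀ * |x|) := by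
      rw [← Real.exp_add]; congr 1; ring
    rw [h3, h4]
    calc (1 + x ^ 2) * Real.exp (σ₀ * |x|) ≤ ((C0 * Real.exp (σ₀ * |x|)) * (1 + |x|) ^ (2 * s)) * Real.exp (σ₀ * |x|) := by
          refine mul_le_mul_of_nonneg_right (h1.trans ?_) (Real.exp_pos _).le
          rw [h2]
          exact mul_le_mul_of_nonneg_right (hw0 x) (Real.rpow_nonneg hp.le _)
      _ = _ := by ring
  have m : ∀ (θ : ℝ → ℝ) (_ : Continuous θ) (h : 𝓢(ℝ, ℂ)), Measurable (fun x => ENNReal.ofReal (θ x) * ‖fh h x‖ₑ ^ 2) := fun θ hθ h => by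
    have := (fh_cont h).measurable
    have := hθ.measurable
    fun_prop
  have hV : V (fun x => (1 + x ^ 2) * Real.exp (σ₀ / 2 * |x|) ^ 2) (fh (U 0)) (fh (W 0)) ≠ ⊤ := by
    unfold V V2
    rw [lintegral_add_right _ (m _ (by fun_prop) _)]
    exact ENNReal.add_ne_top.2 ⟨int_cmp hC0 hθ (gev_int.1 hu0), int_cmp hC0 hθ (gev_int.1 hv0)⟩
  set M : ℝ := (V (fun x => (1 + x ^ 2) * Real.exp (σ₀ / 2 * |x|) ^ 2) (fh (U 0)) (fh (W 0))).toReal + 1 with hM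
  have hMp : 0 < M := by positivity
  have hVM : V (fun x => (1 + x ^ 2) * Real.exp (σ₀ / 2 * |x|) ^ 2) (fh (U 0)) (fh (W 0)) ≤ ENNReal.ofReal M := by
    rw [← ENNReal.ofReal_toReal hV]
    exact ENNReal.ofReal_le_ofReal (by rw [hM]; linarith)
  obtain ⟨κ0, hκ0, c, hc, B, hB, H⟩ := propExp ha hMp
  set μ : ℝ := min κ0 (min (σ₀ / 2) c) with hμ
  have hμp : 0 < μ := lt_min hκ0 (lt_min (by linarith) hc)
  have hμ1 : μ ≤ κ0 := min_le_left _ _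
  have hμ2 : μ ≤ σ₀ / 2 := (min_le_right _ _).trans (min_le_left _ _)
  have hμ3 : μ ≤ c := (min_le_right _ _).trans (min_le_right _ _)
  refine ⟨μ / 2, by linarith, fun t => ?_⟩
  have ht0 := abs_nonneg t
  have htp : 0 < 1 + |t| := by linarith
  set κ : ℝ := μ / (1 + |t|) with hκ
  have hκp : 0 < κ := by positivity
  have hκμ : κ ≤ μ := div_le_self hμp.le (by linarith)
  have hκt : κ * |t| ≤ μ := by
    rw [hκ, div_mul_eq_mul_div, div_le_iff₀ htp]; nlinarith
  have F := FS_all ha S (-|t|) |t| (by linarith)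
  have h0m : (0:ℝ) ∈ Icc (-|t|) |t| := ⟨by linarith, ht0⟩
  have htm : t ∈ Icc (-|t|) |t| := ⟨neg_abs_le t, le_abs_self t⟩
  have hVt := H _ _ κ _ _ F hκp (hκμ.trans hμ1) 0 h0m (by
    refine le_trans (V_mono fun x => ?_) hVM
    have h1 : κ * |x| ≤ σ₀ / 2 * |x| := mul_le_mul_of_nonneg_right (hκμ.trans hμ2) (abs_nonneg x)
    have := Real.exp_le_exp.2 h1
    gcongr) t htm (by rw [sub_zero]; exact hκt.trans hμ3)
  have hVt' := ne_of_lt (lt_of_le_of_lt hVt ENNReal.ofReal_lt_top)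
  unfold V V2 at hVt'
  rw [lintegral_add_right _ (m _ (by fun_prop) _), ENNReal.add_ne_top] at hVt'
  obtain ⟨C1, hC1, hw1⟩ := pow_exp (2 * s) κ hκp
  have hσ : μ / 2 * (1 + |t|) ^ (-(4/3 : ℝ) - ε) ≤ κ / 2 := by
    have h1 : (1 + |t|) ^ (-(4/3 : ℝ) - ε) ≤ (1 + |t|) ^ (-1 : ℝ) :=
      Real.rpow_le_rpow_of_exponent_le (by linarith) (by linarith)
    rw [Real.rpow_neg_one] at h1
    calc _ ≤ μ / 2 * (1 + |t|)⁻¹ := mul_le_mul_of_nonneg_left h1 (by linarith)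
      _ = _ := by rw [hκ]; ring
  have hθ1 : ∀ x : ℝ, Real.exp (2 * (μ / 2 * (1 + |t|) ^ (-(4/3 : ℝ) - ε)) * |x|) * (1 + |x|) ^ (2 * s) ≤ C1 * Real.exp (κ * |x|) ^ 2 := by
    intro x
    have h0 := abs_nonneg x
    calc _ ≤ Real.exp (κ * |x|) * (C1 * Real.exp (κ * |x|)) := by
          refine mul_le_mul ?_ (hw1 x) (by positivity) (by positivity)
          refine Real.exp_le_exp.2 (mul_le_mul_of_nonneg_right ?_ h0)
          linarith
      _ = _ := by ring
  exact ⟨gev_int.2 (int_cmp hC1 hθ1 hVt'.1), gev_int.2 (int_cmp hC1 hθ1 hVt'.2)⟩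

end MB

/-- Persistence of spatial analyticity for the Majda–Biello system
`u_t + u_{xxx} = −v v_x`, `v_t + a₂ v_{xxx} = −(uv)_x` with `a₂ < 0`, `a₂ = 1`
or `a₂ > 4`: if `(u,v)` is a real-valued smooth solution, Schwartz in space,
with `‖u(0)‖_{G^{σ₀,s}}, ‖v(0)‖_{G^{σ₀,s}}` finite for some `σ₀ > 0`, then for
every `ε > 0` there is `c > 0` such that `‖u(t)‖_{G^{σ(t),s}}` and
`‖v(t)‖_{G^{σ(t),s}}` are finite for all `t ∈ ℝ`, where
`σ(t) = c(1+|t|)^{−4/3−ε}`. -/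
theorem persistence_of_analyticity_majda_biello
    (a₂ : ℝ) (ha₂ : a₂ < 0 ∨ a₂ = 1 ∨ 4 < a₂)
    (σ₀ s : ℝ) (hσ₀ : 0 < σ₀)
    (u v : ℝ → ℝ → ℝ)
    (hu : ContDiff ℝ (⊤ : ℕ∞) (fun p : ℝ × ℝ => u p.1 p.2))
    (hv : ContDiff ℝ (⊤ : ℕ∞) (fun p : ℝ × ℝ => v p.1 p.2))
    (huS : ∀ t : ℝ, ∃ φ : SchwartzMap ℝ ℝ, ∀ x : ℝ, φ x = u t x)
    (hvS : ∀ t : ℝ, ∃ ψ : SchwartzMap ℝ ℝ, ∀ x : ℝ, ψ x = v t x)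
    (hPDEu : ∀ t x : ℝ,
      deriv (fun τ => u τ x) t + iteratedDeriv 3 (u t) x =
        -(v t x * deriv (v t) x))
    (hPDEv : ∀ t x : ℝ,
      deriv (fun τ => v τ x) t + a₂ * iteratedDeriv 3 (v t) x =
        -deriv (fun y => u t y * v t y) x)
    (hu0 : gevreyNorm σ₀ s (fun x => (u 0 x : ℂ)) ≠ ⊤)
    (hv0 : gevreyNorm σ₀ s (fun x => (v 0 x : ℂ)) ≠ ⊤) :
    ∀ ε : ℝ, 0 < ε → ∃ c : ℝ, 0 < c ∧
      ∀ t : ℝ,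
        gevreyNorm (c * (1 + |t|) ^ (-(4/3 : ℝ) - ε)) s (fun x => (u t x : ℂ)) ≠ ⊤ ∧
        gevreyNorm (c * (1 + |t|) ^ (-(4/3 : ℝ) - ε)) s (fun x => (v t x : ℂ)) ≠ ⊤ := by
  choose φ hφ using huS
  choose ψ hψ using hvS
  obtain ⟨U, hU⟩ : ∃ U : ℝ → SchwartzMap ℝ ℂ, ∀ t x, U t x = (u t x : ℂ) :=
    ⟨fun t => SchwartzMap.postcompCLM Complex.ofRealCLM (φ t), fun t x => by simp [hφ]⟩
  obtain ⟨W, hW⟩ : ∃ W : ℝ → SchwartzMap ℝ ℂ, ∀ t x, W t x = (v t x : ℂ) :=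
    ⟨fun t => SchwartzMap.postcompCLM Complex.ofRealCLM (ψ t), fun t x => by simp [hψ]⟩
  have eU : ∀ t, (fun x => (u t x : ℂ)) = U t := fun t => funext fun x => (hU t x).symm
  have eW : ∀ t, (fun x => (v t x : ℂ)) = W t := fun t => funext fun x => (hW t x).symm
  have su : ∀ t, ContDiff ℝ (⊤ : ℕ∞) (u t) := fun t => hu.comp (contDiff_const.prodMk contDiff_id : ContDiff ℝ (⊤ : ℕ∞) (fun x : ℝ => (t, x)))
  have sv : ∀ t, ContDiff ℝ (⊤ : ℕ∞) (v t) := fun t => hv.comp (contDiff_const.prodMk contDiff_id : ContDiff ℝ (⊤ : ℕ∞) (fun x : ℝ => (t, x)))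
  have tu : ∀ x, ContDiff ℝ (⊤ : ℕ∞) (fun t => u t x) := fun x => hu.comp (contDiff_id.prodMk contDiff_const : ContDiff ℝ (⊤ : ℕ∞) (fun t : ℝ => (t, x)))
  have tv : ∀ x, ContDiff ℝ (⊤ : ℕ∞) (fun t => v t x) := fun x => hv.comp (contDiff_id.prodMk contDiff_const : ContDiff ℝ (⊤ : ℕ∞) (fun t : ℝ => (t, x)))
  have dU : ∀ n t x, MB.sD n (U t) x = ((iteratedDeriv n (u t) x : ℝ) : ℂ) := fun n t x => MB.sD_real (su t) (hU t) n x
  have dW : ∀ n t x, MB.sD n (W t) x = ((iteratedDeriv n (v t) x : ℝ) : ℂ) := fun n t x => MB.sD_real (sv t) (hW t) n x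
  have S : MB.Sol a₂ U W := by
    refine ⟨fun n => ?_, fun n => ?_, fun t ξ => ?_, fun t ξ => ?_, fun t x => ?_, fun t x => ?_⟩
    · simp_rw [dU]
      exact Complex.continuous_ofReal.comp (MB.joint_smooth hu n).continuous
    · simp_rw [dW]
      exact Complex.continuous_ofReal.comp (MB.joint_smooth hv n).continuous
    · rw [← eU]; exact MB.fh_real _ _
    · rw [← eW]; exact MB.fh_real _ _
    · simp_rw [hU, dU, dW, hW]
      have h1 := ((tu x).differentiable (by simp) t).hasDerivAt.ofReal_comp
      convert! h1 using 1
      have := hPDEu t x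
      rw [iteratedDeriv_one]
      have h2 : deriv (fun τ => u τ x) t = -(1 * iteratedDeriv 3 (u t) x) - v t x * deriv (v t) x := by linarith
      rw [h2]; push_cast; ring
    · simp_rw [hW, dU, dW, hU]
      have h1 := ((tv x).differentiable (by simp) t).hasDerivAt.ofReal_comp
      convert! h1 using 1
      have := hPDEv t x
      rw [deriv_fun_mul ((su t).differentiable (by simp) x) ((sv t).differentiable (by simp) x)] at this
      rw [iteratedDeriv_one, iteratedDeriv_one]
      have h2 : deriv (fun τ => v τ x) t = -(a₂ * iteratedDeriv 3 (v t) x) - (deriv (u t) x * v t x + u t x * deriv (v t) x) := by linarith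
      rw [h2]; push_cast; ring
  rw [eU] at hu0
  rw [eW] at hv0
  simp_rw [eU, eW]
  exact MB.final ha₂ S hσ₀ hu0 hv0
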